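/- Let $K$ be a field and let $v$ be a nontrivial equicharacteristic henselian valuation on $K$ whose valuation ring $\mathcal{O}_v$ is definable by an existential ring formula without parameters. Then the residue field $Kv$ is not separably closed and $Kv$ admits no nontrivial henselian valuation; consequently $v$ is the canonical henselian valuation of $K$ and no proper henselian coarsening of $v$ has existentially $\emptyset$-definable valuation ring. -/

import Mathlib

open FirstOrder

/-- The set `S ⊆ K` is definable by an existential ring formula without parameters. -/
def ExistentiallyDef0 (K : Type*) [Field K] (S : Set K) : Prop :=
  letI := Ring.compatibleRingOfRing K
  ∃ (n : ℕ) (φ : Language.ring.BoundedFormula (Fin 1) n), φ.IsQF ∧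
    ∀ x : K, x ∈ S ↔ ∃ w : Fin n → K, φ.Realize (fun _ => x) w

open IntermediateField (adjoin adjoin_induction adjoin_le_iff adjoin_map adjoin_toSubalgebra
  essFiniteType_iff fg_adjoin_of_finite inclusion mem_adjoin_simple_iff mem_adjoin_simple_self
  normal_iff_forall_map_le' subset_adjoin)
open Finset (add_sum_erase card_pos card_univ le_sup mem_Icc mem_biUnion mem_erase mem_filter
  mem_image mem_image_of_mem mem_insert mem_map mem_of_mem_erase mem_product mem_range
  mem_range_succ_iff mem_singleton mem_union mem_univ mul_sum prod_nbij' range sum_add_distrib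
  sum_congr sum_const sum_insert sum_mul sum_range_succ sum_range_succ' sum_sub_distrib sup_lt_iff
  univ)
open IsLocalRing (ResidueField mem_maximalIdeal residue residue_surjective)
open IsAlgClosed (exists_aeval_eq_zero exists_pow_nat_eq of_exists_root)
open UniformSpace (Completion)

universe u

namespace Ultra

open Polynomial

section

variable {E : Type*} [NormedField E] [IsUltrametricDist E]

theorem norm_sum_lt {ι : Type*} (s : Finset ι) (f : ι → E) {r : ℝ} (hr : 0 < r)
    (h : ∀ i ∈ s, ‖f i‖ < r) : ‖∑ i ∈ s, f i‖ < r := by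
  classical
  induction s using Finset.induction_on with
  | empty => simpa using hr
  | insert a s ha ih =>
    rw [sum_insert ha]
    refine (IsUltrametricDist.norm_add_le_max _ _).trans_lt (max_lt (h a (by simp)) ?_)
    exact ih fun i hi => h i (by simp [hi])

theorem norm_sum_le {ι : Type*} (s : Finset ι) (f : ι → E) {r : ℝ} (hr : 0 ≤ r)
    (h : ∀ i ∈ s, ‖f i‖ ≤ r) : ‖∑ i ∈ s, f i‖ ≤ r :=
  IsUltrametricDist.norm_sum_le_of_forall_le_of_nonneg hr h

theorem norm_eq_of_sub_lt {x y : E} (h : ‖x - y‖ < ‖x‖) : ‖y‖ = ‖x‖ := by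
  by_contra hne
  rw [norm_sub_rev] at h
  have h3 := IsUltrametricDist.norm_add_eq_max_of_norm_ne_norm (x := x) (y := y - x) h.ne'
  rw [add_sub_cancel, max_eq_left h.le] at h3
  exact hne h3

theorem norm_add_lt {x y : E} {r : ℝ} (hx : ‖x‖ < r) (hy : ‖y‖ < r) : ‖x + y‖ < r :=
  (IsUltrametricDist.norm_add_le_max _ _).trans_lt (max_lt hx hy)

theorem norm_add_le {x y : E} {r : ℝ} (hx : ‖x‖ ≤ r) (hy : ‖y‖ ≤ r) : ‖x + y‖ ≤ r :=
  (IsUltrametricDist.norm_add_le_max _ _).trans (max_le hx hy)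

theorem norm_sub_lt {x y : E} {r : ℝ} (hx : ‖x‖ < r) (hy : ‖y‖ < r) : ‖x - y‖ < r := by
  rw [sub_eq_add_neg]; exact norm_add_lt hx (by rwa [norm_neg])

theorem norm_sub_le {x y : E} {r : ℝ} (hx : ‖x‖ ≤ r) (hy : ‖y‖ ≤ r) : ‖x - y‖ ≤ r := by
  rw [sub_eq_add_neg]; exact norm_add_le hx (by rwa [norm_neg])

theorem norm_add_eq_left {x y : E} (h : ‖y‖ < ‖x‖) : ‖x + y‖ = ‖x‖ := by
  rw [IsUltrametricDist.norm_add_eq_max_of_norm_ne_norm h.ne', max_eq_left h.le]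

theorem norm_sub_eq_left {x y : E} (h : ‖y‖ < ‖x‖) : ‖x - y‖ = ‖x‖ := by
  rw [sub_eq_add_neg]; exact norm_add_eq_left (by rwa [norm_neg])

/-- The norm of a sum with a strictly dominating term. -/
theorem norm_sum_eq_of_dominant {ι : Type*} [DecidableEq ι] {s : Finset ι} {f : ι → E} {j : ι}
    (hj : j ∈ s) (h0 : f j ≠ 0) (h : ∀ i ∈ s, i ≠ j → ‖f i‖ < ‖f j‖) :
    ‖∑ i ∈ s, f i‖ = ‖f j‖ ∧ ‖∑ i ∈ s, f i - f j‖ < ‖f j‖ := by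
  have hlt : ‖∑ i ∈ s.erase j, f i‖ < ‖f j‖ :=
    norm_sum_lt _ _ (norm_pos_iff.mpr h0) fun i hi =>
      h i (mem_of_mem_erase hi) (Finset.ne_of_mem_erase hi)
  rw [← add_sum_erase s f hj]
  exact ⟨norm_add_eq_left hlt, by rwa [add_sub_cancel_left]⟩

end

/-- A nontrivial finite `p`-group has a nontrivial additive character with values in `ZMod p`. -/
theorem exists_nontrivial_hom_zmod {H : Type*} [Group H] [Finite H] {p : ℕ} [Fact p.Prime]
    (hH : IsPGroup p H) [Nontrivial H] :
    ∃ χ : H →* Multiplicative (ZMod p), ∃ h, χ h ≠ 1 := by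
  obtain ⟨n, hn⟩ := IsPGroup.iff_card.mp hH
  have hp := Fact.out (p := p.Prime)
  have hn0 : n ≠ 0 := by
    rintro rfl
    rw [pow_zero] at hn
    exact absurd hn (Finite.one_lt_card).ne'
  obtain ⟨m, rfl⟩ := Nat.exists_eq_succ_of_ne_zero hn0
  obtain ⟨N, hN⟩ := Sylow.exists_subgroup_card_pow_prime (G := H) (n := m) p
    (by rw [hn]; exact pow_dvd_pow _ (Nat.le_succ m))
  have hidx : N.index = p := by
    have h1 := N.card_mul_index
    rw [hN, hn, pow_succ] at h1
    exact Nat.eq_of_mul_eq_mul_left (pow_pos hp.pos m) h1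
  have hnorm : N.Normal := by
    apply Subgroup.normal_of_index_eq_minFac_card
    rw [hidx, hn, hp.pow_minFac (Nat.succ_ne_zero m)]
  have hc : Nat.card (H ⧸ N) = p := hidx
  have : IsCyclic (H ⧸ N) := isCyclic_of_prime_card hc
  have e : H ⧸ N ≃* Multiplicative (ZMod p) :=
    mulEquivOfCyclicCardEq (by rw [hc, Nat.card_eq_fintype_card]; simp [ZMod.card])
  refine ⟨e.toMonoidHom.comp (QuotientGroup.mk' N), ?_⟩
  by_contra! hall
  have : N = ⊤ := by
    rw [eq_top_iff]
    intro h _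
    have := hall h
    simp at this
    exact this
  rw [this, Subgroup.index_top] at hidx
  exact hp.one_lt.ne hidx

/-- Artin-Schreier elements for a Galois extension whose group is a nontrivial `p`-group. -/
theorem exists_artinSchreier {D L : Type*} [Field D] [Field L] [Algebra D L]
    [FiniteDimensional D L] [IsGalois D L] {p : ℕ} [Fact p.Prime] [CharP L p]
    (hH : IsPGroup p (L ≃ₐ[D] L)) [Nontrivial (L ≃ₐ[D] L)] :
    ∃ a : L, a ∉ Set.range (algebraMap D L) ∧ a ^ p - a ∈ Set.range (algebraMap D L) := by
  classical
  obtain ⟨χ, h, hχ⟩ := exists_nontrivial_hom_zmod hH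
  obtain ⟨θ, hθ⟩ := Algebra.trace_surjective D L 1
  have hθ1 : ∑ σ : L ≃ₐ[D] L, σ θ = 1 := by
    rw [← trace_eq_sum_automorphisms, hθ, map_one]
  let c : (L ≃ₐ[D] L) → ZMod p := fun σ => Multiplicative.toAdd (χ σ)
  have hc : ∀ σ τ, c (σ * τ) = c σ + c τ := fun σ τ => by simp [c]
  let j : ZMod p →+* L := ZMod.castHom (dvd_refl p) L
  have hj : ∀ (τ : L ≃ₐ[D] L) x, τ (j x) = j x := fun τ x => by
    have : (τ : L →+* L).comp j = j := Subsingleton.elim _ _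
    exact congrArg (fun f : ZMod p →+* L => f x) this
  set a : L := - ∑ σ : L ≃ₐ[D] L, j (c σ) * σ θ with ha
  have key : ∀ τ : L ≃ₐ[D] L, τ a = a + j (c τ) := by
    intro τ
    have h1 : τ a = - ∑ σ : L ≃ₐ[D] L, j (c σ) * (τ * σ) θ := by
      simp [ha, hj]
    have h2 : ∑ σ : L ≃ₐ[D] L, j (c σ) * (τ * σ) θ
        = ∑ σ : L ≃ₐ[D] L, (j (c σ) * σ θ - j (c τ) * σ θ) := by
      rw [← Equiv.sum_comp (Equiv.mulLeft τ)
        (fun σ : L ≃ₐ[D] L => (j (c σ) * σ θ - j (c τ) * σ θ))]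
      refine sum_congr rfl fun σ _ => ?_
      simp only [Equiv.coe_mulLeft, hc, map_add]
      ring
    rw [h1, h2, sum_sub_distrib, ← mul_sum, hθ1, ha]
    ring
  refine ⟨a, ?_, ?_⟩
  · rintro ⟨d, hd⟩
    have := key h
    rw [← hd, AlgEquiv.commutes, left_eq_add] at this
    have h0 : c h = 0 := by
      apply j.injective; rw [this, map_zero]
    exact hχ h0
  · refine (IsGalois.mem_range_algebraMap_iff_fixed _).mpr ?_
    intro τ
    have hf : j (c τ) ^ p = j (c τ) := by rw [← map_pow, ZMod.pow_card]
    rw [map_sub, map_pow, key, add_pow_char, hf]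
    ring

/-- A finite Galois extension without residual or prime-to-`p` ramified part is either trivial or
contains an Artin-Schreier element. -/
theorem exists_artinSchreier_of_normed {D L : Type*} [Field D] [NormedField L]
    [IsUltrametricDist L] [Algebra D L] [FiniteDimensional D L] [IsGalois D L] (p : ℕ)
    [ExpChar L p] (hσ : ∀ (σ : L ≃ₐ[D] L) x, ‖σ x‖ = ‖x‖)
    (hres : ∀ a : L, ‖a‖ ≤ 1 → ∃ c : D, ‖a - algebraMap D L c‖ < 1)
    (hval : ∀ n : ℕ, p.Coprime n → n ≠ 0 → ∀ d : D, ∃ e : D,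
      ‖algebraMap D L d‖ = ‖algebraMap D L e‖ ^ n)
    (hn : ∀ n : ℕ, p.Coprime n → n ≠ 0 → ‖(n : L)‖ = 1)
    (hne : ∃ x : L, x ∉ Set.range (algebraMap D L)) :
    p.Prime ∧ ∃ a : L, a ∉ Set.range (algebraMap D L) ∧ a ^ p - a ∈ Set.range (algebraMap D L) := by
  classical
  -- a `p`-subgroup of index prime to `p`
  obtain ⟨P, hP, hcop⟩ : ∃ P : Subgroup (L ≃ₐ[D] L), (p.Prime → IsPGroup p P) ∧
      (p = 1 → P = ⊥) ∧ p.Coprime P.index := by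
    rcases expChar_is_prime_or_one L p with hp | rfl
    · have := Fact.mk hp
      let S : Sylow p (L ≃ₐ[D] L) := default
      refine ⟨S, fun _ => S.isPGroup', fun h => absurd h hp.one_lt.ne', ?_⟩
      rw [hp.coprime_iff_not_dvd]
      exact S.not_dvd_index
    · exact ⟨⊥, fun h => absurd h (by decide), fun _ => rfl, by simp⟩
  have hidx0 : P.index ≠ 0 := Subgroup.index_ne_zero_of_finite
  -- elements fixed by P lie in D
  let R : (L ≃ₐ[D] L) ⧸ P → (L ≃ₐ[D] L) := Quotient.out
  have hR : ∀ (b : L), (∀ σ ∈ P, σ b = b) → ∀ (τ : L ≃ₐ[D] L) (q : (L ≃ₐ[D] L) ⧸ P),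
      τ (R q b) = R (τ • q) b := by
    intro b hb τ q
    have h1 : (QuotientGroup.mk (R (τ • q)) : (L ≃ₐ[D] L) ⧸ P) = QuotientGroup.mk (τ * R q) := by
      have e1 : (QuotientGroup.mk (R (τ • q)) : (L ≃ₐ[D] L) ⧸ P) = τ • q := Quotient.out_eq _
      have e2 : (QuotientGroup.mk (R q) : (L ≃ₐ[D] L) ⧸ P) = q := Quotient.out_eq _
      rw [e1]
      conv_lhs => rw [← e2]
      rfl
    have h2 := QuotientGroup.eq.mp h1
    have h3 := hb _ h2
    have h4 := congrArg (R (τ • q)) h3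
    rw [← AlgEquiv.mul_apply, mul_inv_cancel_left] at h4
    simpa using h4
  have hcard : Fintype.card ((L ≃ₐ[D] L) ⧸ P) = P.index := by
    rw [Subgroup.index, Nat.card_eq_fintype_card]
  have hfix : ∀ b : L, (∀ σ ∈ P, σ b = b) → b ∈ Set.range (algebraMap D L) := by
    have htr : ∀ b : L, (∀ σ ∈ P, σ b = b) → (∑ q, R q b) ∈ Set.range (algebraMap D L) := by
      intro b hb
      refine (IsGalois.mem_range_algebraMap_iff_fixed _).mpr ?_
      intro τ
      rw [map_sum]
      simp_rw [hR b hb τ]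
      exact Equiv.sum_comp (MulAction.toPerm τ) (fun q => R q b)
    have hnm : ∀ b : L, (∀ σ ∈ P, σ b = b) → (∏ q, R q b) ∈ Set.range (algebraMap D L) := by
      intro b hb
      refine (IsGalois.mem_range_algebraMap_iff_fixed _).mpr ?_
      intro τ
      rw [map_prod]
      simp_rw [hR b hb τ]
      exact Equiv.prod_comp (MulAction.toPerm τ) (fun q => R q b)
    have h0 : ∀ b : L, (∀ σ ∈ P, σ b = b) → (∑ q, R q b) = 0 → b = 0 := by
      intro b hb hs
      by_contra hb0
      obtain ⟨d, hd⟩ := hnm b hb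
      obtain ⟨e, he⟩ := hval _ hcop.2 hidx0 d
      have hbe : ‖b‖ = ‖algebraMap D L e‖ := by
        have : ‖b‖ ^ P.index = ‖algebraMap D L e‖ ^ P.index := by
          rw [← he, hd, norm_prod]
          simp [hσ, hcard]
        exact (pow_left_inj₀ (norm_nonneg _) (norm_nonneg _) hidx0).mp this
      have hbp : 0 < ‖b‖ := norm_pos_iff.mpr hb0
      have he0 : algebraMap D L e ≠ 0 := by
        rw [← norm_pos_iff, ← hbe]; exact hbp
      obtain ⟨c, hc⟩ := hres (b / algebraMap D L e) (by rw [norm_div, ← hbe, div_self hbp.ne'])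
      have hc1 : ‖b - algebraMap D L (c * e)‖ < ‖b‖ := by
        have : b - algebraMap D L (c * e) = (b / algebraMap D L e - algebraMap D L c)
            * algebraMap D L e := by
          rw [map_mul]; field_simp
        rw [this, norm_mul, ← hbe]
        exact mul_lt_of_lt_one_left hbp hc
      have hc2 : ‖algebraMap D L (c * e)‖ = ‖b‖ := by
        exact norm_eq_of_sub_lt hc1
      have hsum : ∑ q, R q b = ∑ q, R q (b - algebraMap D L (c * e))
          + (P.index : L) * algebraMap D L (c * e) := by
        simp only [map_sub, AlgEquiv.commutes, sum_sub_distrib, sum_const,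
          card_univ, hcard, nsmul_eq_mul, sub_add_cancel]
      have hlt : ‖∑ q, R q (b - algebraMap D L (c * e))‖ < ‖b‖ := by
        apply norm_sum_lt _ _ hbp
        intro q _
        rw [hσ]; exact hc1
      rw [hsum, add_eq_zero_iff_eq_neg] at hs
      rw [hs, norm_neg, norm_mul, hn _ hcop.2 hidx0, one_mul, hc2] at hlt
      exact lt_irrefl _ hlt
    intro b hb
    obtain ⟨d, hd⟩ := htr b hb
    have hnz : (P.index : L) ≠ 0 := by
      rw [← norm_pos_iff, hn _ hcop.2 hidx0]; exact one_pos
    have hnzD : (P.index : D) ≠ 0 := by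
      intro h; apply hnz; have := congrArg (algebraMap D L) h; simpa using this
    refine ⟨d / P.index, ?_⟩
    have := h0 (b - algebraMap D L (d / P.index)) (by
      intro σ hσ'
      rw [map_sub, hb σ hσ', AlgEquiv.commutes]) (by
      simp only [map_sub, AlgEquiv.commutes, sum_sub_distrib, sum_const,
        card_univ, hcard, nsmul_eq_mul, ← hd, map_div₀, map_natCast]
      rw [mul_div_cancel₀ _ hnz, sub_self])
    exact (sub_eq_zero.mp this).symm
  have hPtop : P = ⊤ := by
    rw [eq_top_iff]
    rw [← IntermediateField.fixingSubgroup_fixedField P]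
    intro σ _
    rw [IntermediateField.mem_fixingSubgroup_iff]
    intro x hx
    obtain ⟨d, rfl⟩ := hfix x (fun τ hτ => hx ⟨τ, hτ⟩)
    exact AlgEquiv.commutes _ _
  obtain ⟨x, hx⟩ := hne
  have hnt : Nontrivial (L ≃ₐ[D] L) := by
    by_contra h
    rw [not_nontrivial_iff_subsingleton] at h
    apply hx
    refine (IsGalois.mem_range_algebraMap_iff_fixed _).mpr ?_
    intro σ
    rw [Subsingleton.elim σ 1]; rfl
  rcases expChar_is_prime_or_one L p with hp | rfl
  · have := Fact.mk hp
    have : CharP L p := by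
      rcases ‹ExpChar L p› with _ | h
      · exact absurd hp (by decide)
      · assumption
    refine ⟨hp, exists_artinSchreier ?_⟩
    have := hP hp
    rw [hPtop] at this
    exact this.of_equiv Subgroup.topEquiv
  · exfalso
    have := hcop.1 rfl
    rw [hPtop] at this
    exact absurd this top_ne_bot

section

variable {C : Type*} [NormedField C] [IsUltrametricDist C]

/-- Approximate fixed points of contractions preserving a set are close to that set. -/
theorem exists_near_of_approx_fixed {E : Set C} {Φ : C → C} {q ε : ℝ} (hq0 : 0 ≤ q) (hq : q < 1)
    (hΦ : ∀ y ∈ E, ‖y‖ ≤ q → Φ y ∈ E ∧ ‖Φ y‖ ≤ q)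
    (hlip : ∀ y y', ‖y‖ ≤ q → ‖y'‖ ≤ q → ‖Φ y - Φ y'‖ ≤ q * ‖y - y'‖)
    (h0 : (0 : C) ∈ E) {w : C} (hw : ‖w‖ ≤ q) (hε : 0 < ε) (hfix : ‖Φ w - w‖ ≤ ε) :
    ∃ y ∈ E, ‖w - y‖ ≤ ε := by
  have key : ∀ n : ℕ, ∃ y ∈ E, ‖y‖ ≤ q ∧ ‖w - y‖ ≤ max (q ^ n) ε := by
    intro n
    induction n with
    | zero =>
      refine ⟨0, h0, by simpa using hq0, le_max_of_le_left ?_⟩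
      simpa using hw.trans hq.le
    | succ n ih =>
      obtain ⟨y, hyE, hyq, hy⟩ := ih
      refine ⟨Φ y, (hΦ y hyE hyq).1, (hΦ y hyE hyq).2, ?_⟩
      have h1 : w - Φ y = -(Φ w - w) + (Φ w - Φ y) := by ring
      rw [h1]
      refine norm_add_le (by rw [norm_neg]; exact le_max_of_le_right hfix) ?_
      refine (hlip w y hw hyq).trans ?_
      refine (mul_le_mul_of_nonneg_left hy hq0).trans ?_
      rw [mul_max_of_nonneg _ _ hq0, ← pow_succ']
      exact max_le_max le_rfl (mul_le_of_le_one_left hε.le hq.le)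
  obtain ⟨n, hn⟩ := exists_pow_lt_of_lt_one hε hq
  obtain ⟨y, hyE, -, hy⟩ := key n
  exact ⟨y, hyE, hy.trans (max_le hn.le le_rfl)⟩

theorem norm_one_add {w : C} (h : ‖w‖ < 1) : ‖1 + w‖ = 1 := by
  rw [norm_add_eq_left (by simpa using h), norm_one]

theorem norm_intCast_le_one (n : ℤ) : ‖(n : C)‖ ≤ 1 := by
  have hnat : ∀ m : ℕ, ‖(m : C)‖ ≤ 1 := fun m => by
    induction m with
    | zero => simp
    | succ m ih => rw [Nat.cast_succ]; exact norm_add_le ih (by simp)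
  obtain ⟨m, rfl | rfl⟩ := n.eq_nat_or_neg
  · simpa using hnat m
  · simpa using hnat m

theorem norm_pow_sub_pow_le {a b : C} (ha : ‖a‖ ≤ 1) (hb : ‖b‖ ≤ 1) (n : ℕ) :
    ‖a ^ n - b ^ n‖ ≤ ‖a - b‖ := by
  induction n with
  | zero => simp
  | succ n ih =>
    have h : a ^ (n + 1) - b ^ (n + 1) = a * (a ^ n - b ^ n) + (a - b) * b ^ n := by ring
    rw [h]
    refine norm_add_le ?_ ?_
    · rw [norm_mul]
      exact (mul_le_of_le_one_left (norm_nonneg _) ha).trans ih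
    · rw [norm_mul, norm_pow]
      exact mul_le_of_le_one_right (norm_nonneg _) (pow_le_one₀ (norm_nonneg _) hb)

theorem norm_pow_sub_pow_sub_le {a b : C} {q : ℝ} (hq : q < 1) (ha : ‖a - 1‖ ≤ q)
    (hb : ‖b - 1‖ ≤ q) (n : ℕ) :
    ‖a ^ n - b ^ n - n * (a - b)‖ ≤ q * ‖a - b‖ := by
  have hq0 : 0 ≤ q := (norm_nonneg _).trans ha
  have ha1 : ‖a‖ = 1 := by
    have := norm_one_add (ha.trans_lt hq); rwa [add_sub_cancel] at this
  have hb1 : ‖b‖ = 1 := by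
    have := norm_one_add (hb.trans_lt hq); rwa [add_sub_cancel] at this
  induction n with
  | zero => simpa using mul_nonneg hq0 (norm_nonneg _)
  | succ n ih =>
    have h : a ^ (n + 1) - b ^ (n + 1) - (n + 1 : ℕ) * (a - b)
        = a * (a ^ n - b ^ n - n * (a - b)) + (((n : ℤ) : C) * (a - 1) * (a - b)
          + (b ^ n - 1 ^ n) * (a - b)) := by
      push_cast; ring
    rw [h]
    refine norm_add_le ?_ (norm_add_le ?_ ?_)
    · rwa [norm_mul, ha1, one_mul]
    · rw [norm_mul, norm_mul]
      exact mul_le_mul_of_nonneg_right ((mul_le_of_le_one_left (norm_nonneg _)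
        (norm_intCast_le_one _)).trans ha) (norm_nonneg _)
    · rw [norm_mul]
      exact mul_le_mul_of_nonneg_right ((norm_pow_sub_pow_le hb1.le (by simp) n).trans hb)
        (norm_nonneg _)

theorem norm_zpow_sub_zpow_sub_le {a b : C} {q : ℝ} (hq : q < 1) (ha : ‖a - 1‖ ≤ q)
    (hb : ‖b - 1‖ ≤ q) (n : ℤ) :
    ‖a ^ n - b ^ n - n * (a - b)‖ ≤ q * ‖a - b‖ := by
  have hq0 : 0 ≤ q := (norm_nonneg _).trans ha
  have ha1 : ‖a‖ = 1 := by
    have := norm_one_add (ha.trans_lt hq); rwa [add_sub_cancel] at this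
  have hb1 : ‖b‖ = 1 := by
    have := norm_one_add (hb.trans_lt hq); rwa [add_sub_cancel] at this
  have ha0 : a ≠ 0 := by rw [← norm_pos_iff, ha1]; exact one_pos
  have hb0 : b ≠ 0 := by rw [← norm_pos_iff, hb1]; exact one_pos
  obtain ⟨m, rfl | rfl⟩ := n.eq_nat_or_neg
  · simpa using norm_pow_sub_pow_sub_le hq ha hb m
  · have h : a ^ (-(m : ℤ)) - b ^ (-(m : ℤ)) - ((-(m : ℤ) : ℤ) : C) * (a - b)
        = -((a ^ m - b ^ m - m * (a - b)) * ((a * b) ^ m)⁻¹)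
          + (((m : ℤ) : C) * (a - b)) * ((((a * b) ^ m - 1 ^ m)) * ((a * b) ^ m)⁻¹) := by
      rw [zpow_neg, zpow_neg, zpow_natCast, zpow_natCast, mul_pow]
      push_cast
      field_simp
      ring
    have hab : ‖a * b - 1‖ ≤ q := by
      have : a * b - 1 = a * (b - 1) + (a - 1) := by ring
      rw [this]
      exact norm_add_le (by rwa [norm_mul, ha1, one_mul]) ha
    rw [h]
    refine norm_add_le ?_ ?_
    · rw [norm_neg, norm_mul, norm_inv, norm_pow, norm_mul, ha1, hb1]
      simpa using norm_pow_sub_pow_sub_le hq ha hb m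
    · rw [norm_mul, norm_mul, norm_mul, norm_inv, norm_pow (a * b), norm_mul a b, ha1, hb1, mul_comm]
      simp only [mul_one, one_pow, inv_one]
      refine mul_le_mul ?_ (mul_le_of_le_one_left (norm_nonneg _) (norm_intCast_le_one _))
        (by positivity) hq0
      have := (norm_pow_sub_pow_le (a := a * b) (b := 1) (by simp [ha1, hb1]) (by simp) m).trans hab
      simpa using this

theorem norm_zpow_sub_zpow_le {a b : C} {q : ℝ} (hq : q < 1) (ha : ‖a - 1‖ ≤ q)
    (hb : ‖b - 1‖ ≤ q) (n : ℤ) : ‖a ^ n - b ^ n‖ ≤ ‖a - b‖ := by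
  have h : a ^ n - b ^ n = (a ^ n - b ^ n - n * (a - b)) + n * (a - b) := by ring
  rw [h]
  refine norm_add_le ((norm_zpow_sub_zpow_sub_le hq ha hb n).trans
    (mul_le_of_le_one_left (norm_nonneg _) hq.le)) ?_
  rw [norm_mul]
  exact mul_le_of_le_one_left (norm_nonneg _) (norm_intCast_le_one _)

/-- If a Laurent polynomial in `X` with a dominating term of tame exponent is approximated by
elements of a subfield, then so is `X`. -/
theorem exists_near_of_dominant {E : Subfield C} {s : Finset ℤ} {d : ℤ → C} {X : C}
    (hd : ∀ i ∈ s, d i ∈ E) {j : ℤ} (hjs : j ∈ s) (hj : ‖(j : C)‖ = 1)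
    (hX : X ≠ 0) (hdj : d j ≠ 0) (hdom : ∀ i ∈ s, i ≠ j → ‖d i * X ^ i‖ < ‖d j * X ^ j‖)
    {r : C} (hrE : r ∈ E) (hr : ‖X - r‖ < ‖X‖) {e : C} (heE : e ∈ E) {ε : ℝ} (hε : 0 < ε)
    (hε1 : ε < 1) (he : ‖∑ i ∈ s, d i * X ^ i - e‖ ≤ ε * ‖d j * X ^ j‖) :
    ∃ x ∈ E, ‖X - x‖ ≤ ε * ‖X‖ := by
  classical
  have hrX : ‖r‖ = ‖X‖ := norm_eq_of_sub_lt hr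
  have hXp : 0 < ‖X‖ := norm_pos_iff.mpr hX
  have hr0 : r ≠ 0 := by rw [← norm_pos_iff, hrX]; exact hXp
  have hj0 : (j : C) ≠ 0 := by rw [← norm_pos_iff, hj]; exact one_pos
  set A := d j * r ^ j with hA
  have hA0 : A ≠ 0 := mul_ne_zero hdj (zpow_ne_zero _ hr0)
  have hAX : ‖A‖ = ‖d j * X ^ j‖ := by rw [hA, norm_mul, norm_zpow, hrX, norm_mul, norm_zpow]
  have hAp : 0 < ‖A‖ := norm_pos_iff.mpr hA0
  have hAE : A ∈ E := E.mul_mem (hd j hjs) (zpow_mem hrE _)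
  set w := X / r - 1 with hw
  have hXw : X = r * (1 + w) := by rw [hw]; field_simp; ring
  have hw1 : ‖w‖ < 1 := by
    have : w = (X - r) / r := by rw [hw]; field_simp
    rw [this, norm_div, hrX, div_lt_one hXp]; exact hr
  set u : ℤ → C := fun i => d i * r ^ i / A with hu
  have hu1 : ∀ i ∈ s.erase j, ‖u i‖ < 1 := fun i hi => by
    have := hdom i (mem_of_mem_erase hi) (Finset.ne_of_mem_erase hi)
    rw [hu]
    simp only [norm_div]
    rw [div_lt_one hAp, hAX]
    rwa [norm_mul, norm_zpow, hrX, ← norm_zpow, ← norm_mul]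
  have huE : ∀ i ∈ s.erase j, u i ∈ E := fun i hi =>
    E.div_mem (E.mul_mem (hd i (mem_of_mem_erase hi)) (zpow_mem hrE _)) hAE
  have hsum : (∑ i ∈ s, d i * X ^ i) / A = (1 + w) ^ j + ∑ i ∈ s.erase j, u i * (1 + w) ^ i := by
    rw [← add_sum_erase s _ hjs, add_div, Finset.sum_div]
    congr 1
    · rw [hXw, hA, mul_zpow]; field_simp
    · refine sum_congr rfl fun i _ => ?_
      rw [hXw, hu, mul_zpow]; ring
  set e' := e / A - 1 with he'
  have he'E : e' ∈ E := E.sub_mem (E.div_mem heE hAE) E.one_mem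
  have hdiff : ‖(∑ i ∈ s, d i * X ^ i) / A - e / A‖ ≤ ε := by
    rw [← sub_div, norm_div, div_le_iff₀ hAp, hAX]; exact he
  obtain ⟨q0, hq01, hq0w, hq0u⟩ : ∃ q0 < 1, ‖w‖ ≤ q0 ∧ ∀ i ∈ s.erase j, ‖u i‖ ≤ q0 := by
    obtain ⟨m, hm1, hm2⟩ : ∃ m < 1, ∀ i ∈ s.erase j, ‖u i‖ ≤ m := by
      rcases (s.erase j).eq_empty_or_nonempty with h | h
      · exact ⟨0, one_pos, by simp [h]⟩
      · refine ⟨(s.erase j).sup' h (fun i => ‖u i‖), ?_, fun i hi =>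
          Finset.le_sup' (fun i => ‖u i‖) hi⟩
        rw [Finset.sup'_lt_iff]; exact hu1
    exact ⟨max ‖w‖ m, max_lt hw1 hm1, le_max_left _ _, fun i hi => (hm2 i hi).trans (le_max_right _ _)⟩
  set q := max q0 ε with hqdef
  have hq1 : q < 1 := max_lt hq01 hε1
  have hq0 : 0 ≤ q := hε.le.trans (le_max_right _ _)
  have hwq : ‖w‖ ≤ q := hq0w.trans (le_max_left _ _)
  have huq : ∀ i ∈ s.erase j, ‖u i‖ ≤ q := fun i hi => (hq0u i hi).trans (le_max_left _ _)
  have hpow1 : ∀ y : C, ‖y‖ ≤ q → ∀ i : ℤ, ‖(1 + y) ^ i‖ = 1 := fun y hy i => by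
    rw [norm_zpow, norm_one_add (hy.trans_lt hq1), one_zpow]
  have he'q : ‖e'‖ ≤ q := by
    have : e' = -((∑ i ∈ s, d i * X ^ i) / A - e / A)
        + (((1 + w) ^ j - 1 ^ j) + ∑ i ∈ s.erase j, u i * (1 + w) ^ i) := by
      rw [hsum, one_zpow]; ring
    rw [this]
    refine norm_add_le (by rw [norm_neg]; exact hdiff.trans (le_max_right _ _))
      (norm_add_le ?_ ?_)
    · refine (norm_zpow_sub_zpow_le hq1 (a := 1 + w) (b := 1) (by simpa using hwq)
        (by simpa using hq0) j).trans ?_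
      simpa using hwq
    · refine norm_sum_le _ _ hq0 fun i hi => ?_
      rw [norm_mul, hpow1 w hwq, mul_one]; exact huq i hi
  set Φ : C → C := fun y => (j : C)⁻¹ * (e' - ((1 + y) ^ j - 1 - j * y)
    - ∑ i ∈ s.erase j, u i * (1 + y) ^ i) with hΦ
  obtain ⟨y, hyE, hy⟩ := exists_near_of_approx_fixed (E := (E : Set C)) (Φ := Φ) hq0 hq1
    (fun y hyE hy => by
      constructor
      · have h1y : 1 + y ∈ E := E.add_mem E.one_mem hyE
        have hjE : (j : C) ∈ E := E.intCast_mem j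
        refine E.mul_mem (E.inv_mem hjE) (E.sub_mem (E.sub_mem he'E (E.sub_mem (E.sub_mem
          (zpow_mem h1y _) E.one_mem) (E.mul_mem hjE hyE))) (E.sum_mem fun i hi => ?_))
        exact E.mul_mem (huE i hi) (zpow_mem h1y _)
      · simp only [hΦ]
        rw [norm_mul, norm_inv, hj, inv_one, one_mul]
        refine norm_sub_le (norm_sub_le he'q ?_) ?_
        · have h := norm_zpow_sub_zpow_sub_le hq1 (a := 1 + y) (b := 1) (by simpa using hy)
            (by simpa using hq0) j
          simp only [one_zpow, add_sub_cancel_left] at h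
          exact h.trans ((mul_le_of_le_one_left (norm_nonneg _) hq1.le).trans hy)
        · refine norm_sum_le _ _ hq0 fun i hi => ?_
          rw [norm_mul, hpow1 y hy, mul_one]; exact huq i hi)
    (fun y y' hy hy' => by
      have h : Φ y - Φ y' = (j : C)⁻¹ * (-(((1 + y) ^ j - (1 + y') ^ j - j * ((1 + y) - (1 + y'))))
          - ∑ i ∈ s.erase j, u i * ((1 + y) ^ i - (1 + y') ^ i)) := by
        simp only [hΦ, mul_sub, sum_sub_distrib]
        ring
      have hyy : (1 + y) - (1 + y') = y - y' := by ring
      rw [h, norm_mul, norm_inv, hj, inv_one, one_mul]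
      refine norm_sub_le ?_ ?_
      · rw [norm_neg]
        have := norm_zpow_sub_zpow_sub_le hq1 (a := 1 + y) (b := 1 + y') (by simpa using hy)
            (by simpa using hy') j
        rwa [hyy] at this ⊢
      · refine norm_sum_le _ _ (mul_nonneg hq0 (norm_nonneg _)) fun i hi => ?_
        rw [norm_mul]
        have := norm_zpow_sub_zpow_le hq1 (a := 1 + y) (b := 1 + y') (by simpa using hy)
            (by simpa using hy') i
        rw [hyy] at this
        exact mul_le_mul (huq i hi) this (norm_nonneg _) hq0)
    E.zero_mem hwq hε (by
      have h : Φ w - w = (j : C)⁻¹ * -((∑ i ∈ s, d i * X ^ i) / A - e / A) := by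
        rw [hsum]
        simp only [hΦ, he']
        field_simp
        ring
      rw [h, norm_mul, norm_inv, hj, inv_one, one_mul, norm_neg]
      exact hdiff)
  refine ⟨r * (1 + y), E.mul_mem hrE (E.add_mem E.one_mem hyE), ?_⟩
  have : X - r * (1 + y) = r * (w - y) := by
    conv_lhs => rw [hXw]
    ring
  rw [this, norm_mul, hrX, mul_comm]
  exact mul_le_mul_of_nonneg_right hy hXp.le

end

section

variable {C : Type*} [NormedField C]

/-- A trivially valued subfield representing all residue classes. -/
structure IsResidueSection (κ : Subfield C) : Prop where
  norm_eq_one : ∀ c ∈ κ, c ≠ 0 → ‖c‖ = 1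
  exists_norm_sub_lt : ∀ a : C, ‖a‖ ≤ 1 → ∃ c ∈ κ, ‖a - c‖ < 1

/-- Closed under roots whose order is not divisible by the characteristic. -/
def TamelyClosed (E : Subfield C) : Prop :=
  ∀ n : ℕ, (n : C) ≠ 0 → ∀ c : C, c ^ n ∈ E → c ∈ E

/-- Topologically closed, tamely closed subfields containing `B`. -/
structure IsGood (B E : Subfield C) : Prop where
  isClosed : IsClosed (E : Set C)
  le : B ≤ E
  tame : TamelyClosed E

/-- The smallest good subfield containing `B` and `T`. -/
def hull (B : Subfield C) (T : C) : Subfield C := sInf {E | IsGood B E ∧ T ∈ E}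

theorem hull_le {B E : Subfield C} {T : C} (hE : IsGood B E) (hT : T ∈ E) : hull B T ≤ E :=
  sInf_le ⟨hE, hT⟩

theorem mem_hull (B : Subfield C) (T : C) : T ∈ hull B T :=
  Subfield.mem_sInf.mpr fun _ h => h.2

theorem isGood_hull (B : Subfield C) (T : C) : IsGood B (hull B T) where
  isClosed := by
    have : (hull B T : Set C) = ⋂ E ∈ {E : Subfield C | IsGood B E ∧ T ∈ E}, (E : Set C) := by
      ext x
      simp only [hull, SetLike.mem_coe, Subfield.mem_sInf, Set.mem_iInter]
    rw [this]
    exact isClosed_biInter fun E hE => hE.1.isClosed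
  le := le_sInf fun E hE => hE.1.le
  tame := fun n hn c hc => Subfield.mem_sInf.mpr fun E hE =>
    hE.1.tame n hn c (Subfield.mem_sInf.mp hc E hE)

theorem IsResidueSection.norm_natCast {κ : Subfield C} (h : IsResidueSection κ) {n : ℕ}
    (hn : (n : C) ≠ 0) : ‖(n : C)‖ = 1 := h.norm_eq_one _ (natCast_mem κ n) hn

theorem IsResidueSection.norm_intCast {κ : Subfield C} (h : IsResidueSection κ) {n : ℤ}
    (hn : (n : C) ≠ 0) : ‖(n : C)‖ = 1 := h.norm_eq_one _ (intCast_mem κ n) hn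

theorem mem_of_forall_near {E : Subfield C} (hE : IsClosed (E : Set C)) {X : C}
    (h : ∀ ε : ℝ, 0 < ε → ε < 1 → ∃ x ∈ E, ‖X - x‖ ≤ ε * ‖X‖) : X ∈ E := by
  rcases eq_or_ne X 0 with rfl | hX
  · exact E.zero_mem
  have hXp := norm_pos_iff.mpr hX
  refine hE.closure_subset (Metric.mem_closure_iff.mpr fun ε hε => ?_)
  have h2 : 0 < min (ε / ‖X‖ / 2) (1 / 2) := by positivity
  obtain ⟨x, hx, hxX⟩ := h _ h2 ((min_le_right _ _).trans_lt (by norm_num))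
  refine ⟨x, hx, ?_⟩
  rw [dist_eq_norm]
  have h3 : min (ε / ‖X‖ / 2) (1 / 2) * ‖X‖ ≤ ε / ‖X‖ / 2 * ‖X‖ :=
    mul_le_mul_of_nonneg_right (min_le_left _ _) hXp.le
  have h4 : ε / ‖X‖ / 2 * ‖X‖ = ε / 2 := by field_simp
  linarith

variable [IsUltrametricDist C]

omit [IsUltrametricDist C] in
theorem IsResidueSection.exists_ratio {κ : Subfield C} (h : IsResidueSection κ) {x y : C}
    (hx : x ≠ 0) (hxy : ‖x‖ = ‖y‖) : ∃ c ∈ κ, c ≠ 0 ∧ ‖x - c * y‖ < ‖x‖ := by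
  have hxp := norm_pos_iff.mpr hx
  have hy : y ≠ 0 := norm_pos_iff.mp (hxy ▸ hxp)
  have h1 : ‖x / y‖ = 1 := by rw [norm_div, hxy, div_self]; exact (norm_pos_iff.mpr hy).ne'
  obtain ⟨c, hc, hlt⟩ := h.exists_norm_sub_lt (x / y) h1.le
  refine ⟨c, hc, ?_, ?_⟩
  · rintro rfl
    rw [sub_zero, h1] at hlt; exact lt_irrefl _ hlt
  · have : x - c * y = (x / y - c) * y := by field_simp
    rw [this, norm_mul, hxy]
    exact mul_lt_of_lt_one_left (norm_pos_iff.mpr hy) hlt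

omit [IsUltrametricDist C] in
theorem TamelyClosed.exists_zpow_eq [IsAlgClosed C] {E : Subfield C} (hE : TamelyClosed E) {j : ℤ}
    (hj : (j : C) ≠ 0) {g : C} (hg : g ∈ E) : ∃ c ∈ E, c ^ j = g := by
  obtain ⟨n, rfl | rfl⟩ := j.eq_nat_or_neg
  · have hn : (n : C) ≠ 0 := by simpa using hj
    have hn0 : 0 < n := Nat.pos_of_ne_zero (by rintro rfl; simp at hn)
    obtain ⟨c, hc⟩ := exists_pow_nat_eq g hn0
    exact ⟨c, hE n hn c (hc ▸ hg), by rw [zpow_natCast, hc]⟩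
  · have hn : (n : C) ≠ 0 := by simpa using hj
    have hn0 : 0 < n := Nat.pos_of_ne_zero (by rintro rfl; simp at hn)
    obtain ⟨c, hc⟩ := exists_pow_nat_eq g⁻¹ hn0
    exact ⟨c, hE n hn c (hc ▸ E.inv_mem hg), by rw [zpow_neg, zpow_natCast, hc, inv_inv]⟩

/-- A form of Hensel's lemma: if `X` is a root of a Laurent polynomial over a good field
dominated by a term of tame exponent, then `X` lies in that field. -/
theorem IsGood.mem_of_dominant [IsAlgClosed C] [CompleteSpace C] {κ B E : Subfield C} (hκ : IsResidueSection κ)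
    (hκB : κ ≤ B) (hE : IsGood B E) {s : Finset ℤ} {d : ℤ → C} {X : C}
    (hd : ∀ i ∈ s, d i ∈ E) {j : ℤ} (hjs : j ∈ s) (hj : (j : C) ≠ 0)
    (hX : X ≠ 0) (hdj : d j ≠ 0) (hdom : ∀ i ∈ s, i ≠ j → ‖d i * X ^ i‖ < ‖d j * X ^ j‖)
    (hsum : ∀ ε : ℝ, 0 < ε → ε < 1 → ∃ e ∈ E, ‖∑ i ∈ s, d i * X ^ i - e‖ ≤ ε * ‖d j * X ^ j‖) :
    X ∈ E := by
  classical
  have h0 : d j * X ^ j ≠ 0 := mul_ne_zero hdj (zpow_ne_zero _ hX)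
  have hp := norm_pos_iff.mpr h0
  obtain ⟨hs1, hs2⟩ := norm_sum_eq_of_dominant (f := fun i => d i * X ^ i) hjs h0 hdom
  obtain ⟨e, he, hee⟩ := hsum (1 / 2) (by norm_num) (by norm_num)
  have hlt : ‖d j * X ^ j - e‖ < ‖d j * X ^ j‖ := by
    have : d j * X ^ j - e = (∑ i ∈ s, d i * X ^ i - e) - (∑ i ∈ s, d i * X ^ i - d j * X ^ j) := by
      ring
    rw [this]
    refine norm_sub_lt (hee.trans_lt ?_) hs2
    linarith
  have hen := norm_eq_of_sub_lt hlt
  have he0 : e ≠ 0 := norm_pos_iff.mp (hen ▸ hp)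
  have hroot := hE.tame.exists_zpow_eq hj (E.div_mem he (hd j hjs))
  obtain ⟨c, hcE, hc⟩ := hroot
  have hc0 : c ≠ 0 := by
    rintro rfl
    have hj0 : j ≠ 0 := by rintro rfl; simp at hj
    rw [zero_zpow _ hj0] at hc
    exact (div_ne_zero he0 hdj) hc.symm
  have hXc : ‖X‖ = ‖c‖ := by
    have h1 : ‖X‖ ^ j = ‖c‖ ^ j := by
      rw [← norm_zpow, ← norm_zpow, hc, norm_div, hen, norm_mul, mul_div_cancel_left₀]
      exact (norm_pos_iff.mpr hdj).ne'
    have hj0 : j ≠ 0 := by rintro rfl; simp at hj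
    exact (zpow_left_inj₀ (norm_nonneg _) (norm_nonneg _) hj0).mp h1
  obtain ⟨b, hb, hb0, hbX⟩ := hκ.exists_ratio hX hXc
  refine mem_of_forall_near hE.isClosed fun ε hε hε1 => ?_
  obtain ⟨e', he', hee'⟩ := hsum ε hε hε1
  exact exists_near_of_dominant hd hjs (hκ.norm_intCast hj) hX hdj hdom
    (E.mul_mem (hE.le (hκB hb)) hcE) hbX he' hε hε1 hee'

/-- Sufficient condition for the topological closure of a subring to be a good subfield. -/
theorem exists_isGood_closure [IsAlgClosed C] [CompleteSpace C] {κ B : Subfield C} (hκ : IsResidueSection κ)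
    (hκB : κ ≤ B) (R : Subring C) (hBR : ∀ b ∈ B, b ∈ R)
    (hR : ∀ x ∈ R, x ≠ 0 → ∃ m ∈ R, m ≠ 0 ∧ ‖x - m‖ < ‖m‖ ∧ m⁻¹ ∈ R ∧
      ∀ n : ℕ, (n : C) ≠ 0 → ∃ r ∈ R, r ^ n = m) :
    ∃ E : Subfield C, IsGood B E ∧ (E : Set C) = closure (R : Set C) := by
  have hinvR : ∀ x ∈ R, x ≠ 0 → x⁻¹ ∈ closure (R : Set C) := by
    intro x hx hx0
    obtain ⟨m, hm, hm0, hlt, hmi, -⟩ := hR x hx hx0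
    set u := 1 - x * m⁻¹ with hu
    have hu1 : ‖u‖ < 1 := by
      have : u = -((x - m) / m) := by rw [hu]; field_simp; ring
      rw [this, norm_neg, norm_div]
      exact (div_lt_one (norm_pos_iff.mpr hm0)).mpr hlt
    have huR : u ∈ R := R.sub_mem R.one_mem (R.mul_mem hx hmi)
    have hxinv : x⁻¹ = m⁻¹ * ∑' n : ℕ, u ^ n := by
      rw [tsum_geometric_of_norm_lt_one hu1, hu, sub_sub_cancel, mul_inv, inv_inv]
      field_simp
    have hs := (summable_geometric_of_norm_lt_one hu1).hasSum.tendsto_sum_nat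
    rw [hxinv]
    refine mem_closure_of_tendsto (hs.const_mul m⁻¹) (Filter.Eventually.of_forall fun n => ?_)
    exact R.mul_mem hmi (R.sum_mem fun i _ => R.pow_mem huR i)
  let E : Subfield C :=
    { R.topologicalClosure with
      inv_mem' := by
        intro x hx
        change x⁻¹ ∈ closure (R : Set C)
        have hx : x ∈ closure (R : Set C) := hx
        rcases eq_or_ne x 0 with rfl | hx0
        · rw [inv_zero]; exact subset_closure R.zero_mem
        · obtain ⟨f, hf, hfx⟩ := mem_closure_iff_seq_limit.mp hx
          have h1 : Filter.Tendsto (fun n => (f n)⁻¹) Filter.atTop (nhds x⁻¹) := hfx.inv₀ hx0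
          have h2 : ∀ᶠ n in Filter.atTop, f n ≠ 0 := hfx.eventually_ne hx0
          have h3 := mem_closure_of_tendsto h1 (s := closure (R : Set C))
            (h2.mono fun n hn => hinvR _ (hf n) hn)
          rwa [closure_closure] at h3 }
  have hE : (E : Set C) = closure (R : Set C) := rfl
  have hRE : ∀ x ∈ R, x ∈ E := fun x hx => subset_closure hx
  refine ⟨E, ⟨hE ▸ isClosed_closure, fun b hb => hRE b (hBR b hb), ?_⟩, hE⟩
  intro n hn c hc
  rcases eq_or_ne c 0 with rfl | hc0
  · exact E.zero_mem
  have hcn : c ^ n ≠ 0 := pow_ne_zero _ hc0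
  have hn0 : n ≠ 0 := by rintro rfl; simp at hn
  have hcl : c ^ n ∈ closure (R : Set C) := hc
  obtain ⟨x, hx, hxc⟩ := Metric.mem_closure_iff.mp hcl ‖c ^ n‖ (norm_pos_iff.mpr hcn)
  rw [dist_eq_norm] at hxc
  have hxn := norm_eq_of_sub_lt hxc
  have hx0 : x ≠ 0 := norm_pos_iff.mp (hxn ▸ norm_pos_iff.mpr hcn)
  obtain ⟨m, hm, hm0, hlt, -, hmr⟩ := hR x hx hx0
  obtain ⟨r, hr, hrm⟩ := hmr n hn
  have hmx : ‖x‖ = ‖m‖ := norm_eq_of_sub_lt (by rwa [norm_sub_rev])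
  have hcr : ‖c‖ = ‖r‖ := by
    have : ‖c‖ ^ n = ‖r‖ ^ n := by rw [← norm_pow, ← norm_pow, hrm, ← hxn, hmx]
    exact (pow_left_inj₀ (norm_nonneg _) (norm_nonneg _) hn0).mp this
  obtain ⟨b, hb, hb0, hbc⟩ := hκ.exists_ratio hc0 hcr
  refine mem_of_forall_near (hE ▸ isClosed_closure) fun ε hε hε1 => ?_
  refine exists_near_of_dominant (E := E) (s := {(n : ℤ)}) (d := fun _ => 1) (j := n)
    (r := b * r) (e := c ^ n)
    (fun _ _ => E.one_mem) (by simp) (hκ.norm_intCast (by exact_mod_cast hn)) hc0 one_ne_zero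
    (fun i hi hne => absurd (mem_singleton.mp hi) hne) (hRE _ (R.mul_mem (hBR b (hκB hb)) hr)) hbc hc hε hε1 ?_
  simp only [Finset.sum_singleton, one_mul, zpow_natCast, sub_self, norm_zero]
  positivity

end

section

variable {C : Type*} [NormedField C]

/-- `T` is a limit point of `B` without a best approximation. -/
def TypeI (B : Subfield C) (T : C) : Prop := ∀ α : B, ∃ β : B, ‖T - β‖ < ‖T - α‖

/-- The norm of `T` is not attained on `B`. -/
def TypeII (B : Subfield C) (T : C) : Prop := ∀ b : B, ‖T‖ ≠ ‖(b : C)‖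

/-- The constant coefficient dominates on the disc of radius `δ`. -/
def ConstDominant (δ : ℝ) (P : C[X]) : Prop := ∀ l, l ≠ 0 → ‖P.coeff l‖ * δ ^ l < ‖P.coeff 0‖

theorem TypeI.sub_ne_zero {B : Subfield C} {T : C} (h : TypeI B T) (α : B) : T - α ≠ 0 := by
  obtain ⟨β, hβ⟩ := h α
  exact norm_pos_iff.mp ((norm_nonneg _).trans_lt hβ)

theorem TypeI.exists_forall_lt {B : Subfield C} {T : C} (h : TypeI B T) (s : Finset B) :
    ∃ α : B, ∀ r ∈ s, ‖T - α‖ < ‖T - r‖ := by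
  classical
  induction s using Finset.induction_on with
  | empty => exact ⟨0, by simp⟩
  | insert a s _ ih =>
    obtain ⟨α, hα⟩ := ih
    obtain ⟨β, hβ⟩ := h a
    rcases le_total ‖T - α‖ ‖T - β‖ with hle | hle
    · exact ⟨α, fun r hr => (mem_insert.mp hr).elim (fun h => h ▸ hle.trans_lt hβ) (hα r)⟩
    · exact ⟨β, fun r hr => (mem_insert.mp hr).elim (fun h => h ▸ hβ)
        fun hr => hle.trans_lt (hα r hr)⟩

theorem TypeII.ne_zero {B : Subfield C} {T : C} (h : TypeII B T) : T ≠ 0 := by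
  rintro rfl; exact h 0 (by simp)

theorem TypeII.zpow {B : Subfield C} [IsAlgClosed B] {T : C} (h : TypeII B T) {i : ℤ} (hi : i ≠ 0)
    (b : B) : ‖T ^ i‖ ≠ ‖(b : C)‖ := by
  intro hb
  have key : ∀ n : ℕ, n ≠ 0 → ∀ b : B, ‖T ^ n‖ ≠ ‖(b : C)‖ := by
    intro n hn b hb
    obtain ⟨c, hc⟩ := exists_pow_nat_eq b (Nat.pos_of_ne_zero hn)
    refine h c ((pow_left_inj₀ (norm_nonneg _) (norm_nonneg _) hn).mp ?_)
    rw [← norm_pow, hb, ← hc]; push_cast; rw [norm_pow]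
  obtain ⟨n, rfl | rfl⟩ := i.eq_nat_or_neg
  · exact key n (by simpa using hi) b (by simpa using hb)
  · refine key n (by simpa using hi) b⁻¹ ?_
    rw [zpow_neg, norm_inv, zpow_natCast] at hb
    push_cast
    rw [norm_inv, ← hb, inv_inv]

theorem TypeII.of_pow {B : Subfield C} {t : C} {n : ℕ} (h : TypeII B (t ^ n)) : TypeII B t := by
  intro b hb
  refine h (b ^ n) ?_
  push_cast; rw [norm_pow, norm_pow, hb]

theorem TypeII.exists_dominant {B : Subfield C} [IsAlgClosed B] {T : C} (h : TypeII B T)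
    {f : ℤ →₀ B} (hf : f ≠ 0) :
    ∃ j ∈ f.support, ∀ i ∈ f.support, i ≠ j → ‖(f i : C) * T ^ i‖ < ‖(f j : C) * T ^ j‖ := by
  obtain ⟨j, hj, hmax⟩ := Finset.exists_max_image f.support (fun i => ‖(f i : C) * T ^ i‖)
    (Finsupp.support_nonempty_iff.mpr hf)
  refine ⟨j, hj, fun i hi hij => lt_of_le_of_ne (hmax i hi) fun heq => ?_⟩
  have hfi : (f i : C) ≠ 0 := by simpa using hi
  have hT := zpow_ne_zero j h.ne_zero
  refine h.zpow (sub_ne_zero.mpr hij) (f j / f i) ?_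
  push_cast
  rw [zpow_sub₀ h.ne_zero, norm_div, norm_div, div_eq_div_iff (norm_ne_zero_iff.mpr hT)
    (norm_ne_zero_iff.mpr hfi), ← norm_mul, ← norm_mul, mul_comm, heq]

variable [IsUltrametricDist C]

theorem ConstDominant.mul {δ : ℝ} (hδ : 0 < δ) {P Q : C[X]} (hP : ConstDominant δ P)
    (hQ : ConstDominant δ Q) : ConstDominant δ (P * Q) := by
  intro l hl
  have hP0 : 0 < ‖P.coeff 0‖ := by
    have := hP 1 one_ne_zero
    exact lt_of_le_of_lt (by positivity) this
  have hQ0 : 0 < ‖Q.coeff 0‖ := by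
    have := hQ 1 one_ne_zero
    exact lt_of_le_of_lt (by positivity) this
  have hPle : ∀ l, ‖P.coeff l‖ * δ ^ l ≤ ‖P.coeff 0‖ := fun l => by
    rcases eq_or_ne l 0 with rfl | h
    · simp
    · exact (hP l h).le
  rw [mul_coeff_zero, norm_mul, ← lt_div_iff₀ (by positivity), coeff_mul]
  refine norm_sum_lt _ _ (by positivity) fun x hx => ?_
  replace hx := Finset.HasAntidiagonal.mem_antidiagonal.mp hx
  rw [lt_div_iff₀ (by positivity), norm_mul, ← hx, pow_add, mul_mul_mul_comm]
  rcases eq_or_ne x.2 0 with h2 | h2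
  · have h1 : x.1 ≠ 0 := by rintro h; apply hl; rw [← hx, h, h2]
    rw [h2, pow_zero, mul_one]
    exact mul_lt_mul_of_pos_right (hP _ h1) hQ0
  · exact mul_lt_mul_of_le_of_lt_of_nonneg_of_pos (hPle _) (hQ _ h2) (by positivity) hP0

theorem ConstDominant.eval {δ : ℝ} (hδ : 0 < δ) {P : C[X]} (hP : ConstDominant δ P) {x : C}
    (hx : ‖x‖ ≤ δ) : ‖P.eval x - P.coeff 0‖ < ‖P.coeff 0‖ := by
  have hP0 : 0 < ‖P.coeff 0‖ := by
    have := hP 1 one_ne_zero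
    exact lt_of_le_of_lt (by positivity) this
  rw [eval_eq_sum_range, sum_range_succ', pow_zero, mul_one, add_sub_cancel_right]
  refine norm_sum_lt _ _ hP0 fun i _ => ?_
  rw [norm_mul, norm_pow]
  exact (mul_le_mul_of_nonneg_left (pow_le_pow_left₀ (norm_nonneg _) hx _) (norm_nonneg _)).trans_lt
    (hP _ i.succ_ne_zero)

theorem constDominant_of_roots {B : Subfield C} [IsAlgClosed B] {q : B[X]} (hq : q ≠ 0) {α : B}
    {δ : ℝ} (hδ : 0 < δ) (hlin : ∀ r ∈ q.roots, δ < ‖(α - r : C)‖) :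
    ConstDominant δ ((taylor α q).map (algebraMap B C)) := by
  classical
  have hprod : ∀ s : Multiset B, (∀ r ∈ s, δ < ‖(α - r : C)‖) →
      ConstDominant δ ((taylor α (s.map fun r => X - Polynomial.C r).prod).map
        (algebraMap B C)) := by
    intro s
    induction s using Multiset.induction_on with
    | empty =>
      intro _ l hl
      simp [coeff_one, hl]
    | cons a s ih =>
      intro hs
      rw [Multiset.map_cons, Multiset.prod_cons, taylor_mul, Polynomial.map_mul]
      refine ConstDominant.mul hδ ?_ (ih fun r hr => hs r (Multiset.mem_cons_of_mem hr))
      intro l hl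
      have h1 := hs a (Multiset.mem_cons_self _ _)
      have h3 : (taylor α (X - Polynomial.C a)).map (algebraMap B C)
          = X + Polynomial.C ((α : C) - a) := by
        simp only [map_sub, taylor_X, taylor_C, Polynomial.map_sub, Polynomial.map_add, map_X,
          Polynomial.map_C]
        rw [add_sub_assoc]; rfl
      rw [h3]
      rcases Nat.exists_eq_succ_of_ne_zero hl with ⟨m, rfl⟩
      rcases m with _ | m
      · simpa [coeff_C] using h1
      · have : (α : C) - a ≠ 0 := norm_pos_iff.mp (hδ.trans h1)
        simp [coeff_X, coeff_C, this]
  have hfac : q = Polynomial.C q.leadingCoeff * (q.roots.map fun r => X - Polynomial.C r).prod :=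
    ((IsAlgClosed.splits q).eq_prod_roots)
  rw [hfac, taylor_mul, Polynomial.map_mul, taylor_C, Polynomial.map_C]
  refine ConstDominant.mul hδ ?_ (hprod _ hlin)
  intro l hl
  have : (algebraMap B C q.leadingCoeff) ≠ 0 := by simpa using hq
  simpa [coeff_C, hl] using this

/-- Close to a type I point, a nonzero polynomial is dominated by its constant term. -/
theorem TypeI.exists_constDominant {B : Subfield C} [IsAlgClosed B] {T : C} (h : TypeI B T)
    {q : B[X]} (hq : q ≠ 0) : ∃ α₀ : B, ∀ α : B, ‖T - α‖ ≤ ‖T - α₀‖ →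
      ConstDominant ‖T - α‖ ((taylor α q).map (algebraMap B C)) := by
  classical
  obtain ⟨α₀, hα₀⟩ := h.exists_forall_lt q.roots.toFinset
  refine ⟨α₀, fun α hα => ?_⟩
  have hδ : 0 < ‖T - α‖ := norm_pos_iff.mpr (h.sub_ne_zero α)
  have hlin : ∀ r ∈ q.roots, ‖T - α‖ < ‖(α - r : C)‖ := by
    intro r hr
    have h1 := hα.trans_lt (hα₀ r (by simpa using hr))
    have h2 : (α : C) - r = (T - r) - (T - α) := by ring
    rwa [h2, norm_sub_eq_left h1]
  exact constDominant_of_roots hq hδ hlin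

theorem TypeI.exists_norm_sub_eval_lt {B : Subfield C} [IsAlgClosed B] {T : C} (h : TypeI B T)
    {q : B[X]} (hq : q ≠ 0) : ∃ α₀ : B, ∀ α : B, ‖T - α‖ ≤ ‖T - α₀‖ →
      ‖aeval T q - q.eval α‖ < ‖((q.eval α : B) : C)‖ := by
  obtain ⟨α₀, hα₀⟩ := h.exists_constDominant hq
  refine ⟨α₀, fun α hα => ?_⟩
  have h1 := (hα₀ α hα).eval (norm_pos_iff.mpr (h.sub_ne_zero α)) le_rfl
  have h2 : eval (T - α) ((taylor α q).map (algebraMap B C)) = aeval T q := by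
    rw [eval_map, taylor_apply, eval₂_comp, aeval_def]
    simp only [eval₂_add, eval₂_X, eval₂_C]
    rw [show T - (α : C) + algebraMap B C α = T from sub_add_cancel _ _]
  rw [h2, coeff_map, taylor_coeff_zero] at h1
  exact h1

end

section

section

variable {C : Type*} [Field C]

theorem mem_of_isIntegral {B : Subfield C} [IsAlgClosed B] {x : C} (hx : IsIntegral B x) :
    x ∈ B := by
  have h := IsAlgClosed.degree_eq_one_of_irreducible B (minpoly.irreducible hx)
  obtain ⟨b, rfl⟩ := minpoly.mem_range_of_degree_eq_one B x h
  exact b.2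

theorem mem_of_pow_mem {B : Subfield C} [IsAlgClosed B] {x : C} {n : ℕ} (hn : 0 < n)
    (hx : x ^ n ∈ B) : x ∈ B :=
  mem_of_isIntegral (IsIntegral.of_pow hn (isIntegral_algebraMap (x := (⟨_, hx⟩ : B))))

/-- Laurent polynomials in `t` with coefficients in `B`. -/
def laurent (B : Subfield C) (t : C) : Submodule B C := Submodule.span B (Set.range fun i : ℤ => t ^ i)

theorem zpow_mem_laurent (B : Subfield C) (t : C) (i : ℤ) : t ^ i ∈ laurent B t :=
  Submodule.subset_span ⟨i, rfl⟩

theorem laurent_mul_mem {B : Subfield C} {t : C} (ht : t ≠ 0) {x y : C} (hx : x ∈ laurent B t)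
    (hy : y ∈ laurent B t) : x * y ∈ laurent B t := by
  have h := Submodule.mul_mem_mul hx hy
  rw [laurent, Submodule.span_mul_span] at h
  refine Submodule.span_mono ?_ h
  rintro _ ⟨_, ⟨i, rfl⟩, _, ⟨j, rfl⟩, rfl⟩
  exact ⟨i + j, zpow_add₀ ht i j⟩

theorem coe_mem_laurent {B : Subfield C} (t : C) {b : C} (hb : b ∈ B) : b ∈ laurent B t := by
  have h := (laurent B t).smul_mem ⟨b, hb⟩ (zpow_mem_laurent B t 0)
  rwa [zpow_zero, Subfield.smul_def, smul_eq_mul, mul_one] at h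

theorem mul_zpow_mem_laurent {B : Subfield C} (t : C) {b : C} (hb : b ∈ B) (i : ℤ) :
    b * t ^ i ∈ laurent B t := (laurent B t).smul_mem ⟨b, hb⟩ (zpow_mem_laurent B t i)

theorem laurent_le_of {B : Subfield C} {t t' ζ : C} (hζ : ζ ∈ B) {n : ℤ} (h : t = ζ * t' ^ n) :
    laurent B t ≤ laurent B t' := by
  refine Submodule.span_le.mpr ?_
  rintro _ ⟨i, rfl⟩
  simp only [h, mul_zpow, ← zpow_mul]
  exact mul_zpow_mem_laurent t' (zpow_mem hζ i) (n * i)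

/-- Two tame roots of the same element are dominated by a third. -/
theorem exists_common_root [IsAlgClosed C] {B : Subfield C} [IsAlgClosed B] {T t₁ t₂ : C} {n₁ n₂ : ℕ}
    (hT : T ≠ 0) (hn₁ : (n₁ : C) ≠ 0) (hn₂ : (n₂ : C) ≠ 0) (h₁ : t₁ ^ n₁ = T) (h₂ : t₂ ^ n₂ = T) :
    ∃ t : C, t ^ (n₁ * n₂) = T ∧ laurent B t₁ ≤ laurent B t ∧ laurent B t₂ ≤ laurent B t := by
  have hp₂ : 0 < n₂ := Nat.pos_of_ne_zero (by rintro rfl; simp at hn₂)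
  obtain ⟨t, ht⟩ := exists_pow_nat_eq t₁ hp₂
  have htT : t ^ (n₁ * n₂) = T := by rw [mul_comm, pow_mul, ht, h₁]
  have ht0 : t ≠ 0 := by
    rintro rfl
    rw [zero_pow hp₂.ne'] at ht
    have hn : n₁ ≠ 0 := by rintro rfl; simp at hn₁
    rw [← ht, zero_pow hn] at h₁
    exact hT h₁.symm
  refine ⟨t, htT, laurent_le_of B.one_mem (n := n₂) (by rw [one_mul, zpow_natCast, ht]),
    laurent_le_of (ζ := t₂ / t ^ n₁) (n := n₁) ?_ ?_⟩
  · refine mem_of_pow_mem hp₂ ?_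
    rw [div_pow, ← pow_mul, htT, h₂, div_self hT]
    exact B.one_mem
  · rw [zpow_natCast, div_mul_cancel₀ _ (pow_ne_zero _ ht0)]

end

variable {C : Type*} [NormedField C] [IsUltrametricDist C] [IsAlgClosed C] [CompleteSpace C]
  {κ B : Subfield C} [IsAlgClosed B]

theorem TypeI.hull_approx (hκ : IsResidueSection κ) (hκB : κ ≤ B) {T : C} (hT : TypeI B T) {x : C}
    (hx : x ∈ hull B T) {ε : ℝ} (hε : 0 < ε) : ∃ q : B[X], ‖x - aeval T q‖ < ε := by
  obtain ⟨E, hE, hEc⟩ := exists_isGood_closure hκ hκB (aeval T : B[X] →ₐ[B] C).range.toSubring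
    (fun b hb => ⟨Polynomial.C ⟨b, hb⟩, aeval_C T _⟩) (by
      rintro x ⟨q, rfl⟩ hx0
      have hq : q ≠ 0 := by rintro rfl; simp at hx0
      obtain ⟨α, hα⟩ := hT.exists_norm_sub_eval_lt hq
      have h := hα α le_rfl
      have hmem : ∀ b : B, (b : C) ∈ (aeval T : B[X] →ₐ[B] C).range.toSubring :=
        fun b => ⟨Polynomial.C b, aeval_C T b⟩
      refine ⟨(q.eval α : B), hmem _, norm_pos_iff.mp ((norm_nonneg _).trans_lt h), h, ?_, ?_⟩
      · exact_mod_cast hmem (q.eval α)⁻¹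
      · intro n hn
        obtain ⟨c, hc⟩ := exists_pow_nat_eq (q.eval α)
          (Nat.pos_of_ne_zero (by rintro rfl; simp at hn) : 0 < n)
        exact ⟨c, hmem c, by rw [← hc]; push_cast; rfl⟩)
  have hTE : T ∈ E := by
    rw [← SetLike.mem_coe, hEc]
    exact subset_closure ⟨X, aeval_X T⟩
  have := hull_le hE hTE hx
  rw [← SetLike.mem_coe, hEc] at this
  obtain ⟨_, ⟨q, rfl⟩, hq⟩ := Metric.mem_closure_iff.mp this ε hε
  exact ⟨q, by rwa [dist_eq_norm] at hq⟩

theorem TypeII.hull_approx (hκ : IsResidueSection κ) (hκB : κ ≤ B) {T : C} (hT : TypeII B T) {x : C}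
    (hx : x ∈ hull B T) {ε : ℝ} (hε : 0 < ε) :
    ∃ (t : C) (n : ℕ), (n : C) ≠ 0 ∧ t ^ n = T ∧ ∃ y ∈ laurent B t, ‖x - y‖ < ε := by
  have hT0 := hT.ne_zero
  have ht0 : ∀ {t : C} {n : ℕ}, (n : C) ≠ 0 → t ^ n = T → t ≠ 0 := by
    rintro t n hn ht rfl
    rw [zero_pow (by rintro rfl; simp at hn)] at ht
    exact hT0 ht.symm
  let R : Subring C :=
    { carrier := {x | ∃ (t : C) (n : ℕ), (n : C) ≠ 0 ∧ t ^ n = T ∧ x ∈ laurent B t}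
      zero_mem' := ⟨T, 1, by simp, pow_one T, Submodule.zero_mem _⟩
      one_mem' := ⟨T, 1, by simp, pow_one T, coe_mem_laurent T B.one_mem⟩
      neg_mem' := by
        rintro x ⟨t, n, hn, ht, hx⟩
        exact ⟨t, n, hn, ht, Submodule.neg_mem _ hx⟩
      add_mem' := by
        rintro x y ⟨t, n, hn, ht, hx⟩ ⟨t', n', hn', ht', hy⟩
        obtain ⟨u, hu, h1, h2⟩ := exists_common_root (B := B) hT0 hn hn' ht ht'
        exact ⟨u, n * n', by push_cast; exact mul_ne_zero hn hn', hu,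
          Submodule.add_mem _ (h1 hx) (h2 hy)⟩
      mul_mem' := by
        rintro x y ⟨t, n, hn, ht, hx⟩ ⟨t', n', hn', ht', hy⟩
        obtain ⟨u, hu, h1, h2⟩ := exists_common_root (B := B) hT0 hn hn' ht ht'
        have h3 : ((n * n' : ℕ) : C) ≠ 0 := by push_cast; exact mul_ne_zero hn hn'
        exact ⟨u, n * n', h3, hu, laurent_mul_mem (ht0 h3 hu) (h1 hx) (h2 hy)⟩ }
  obtain ⟨E, hE, hEc⟩ := exists_isGood_closure hκ hκB R
    (fun b hb => ⟨T, 1, by simp, pow_one T, coe_mem_laurent T hb⟩) (by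
      rintro x ⟨t, n, hn, ht, hx⟩ hx0
      obtain ⟨f, rfl⟩ := Finsupp.mem_span_range_iff_exists_finsupp.mp hx
      have hf : f ≠ 0 := by rintro rfl; simp at hx0
      have htII : TypeII B t := TypeII.of_pow (n := n) (ht ▸ hT)
      obtain ⟨j, hj, hdom⟩ := htII.exists_dominant hf
      have hfj : (f j : C) ≠ 0 := by simpa using hj
      have h := (norm_sum_eq_of_dominant (f := fun i => (f i : C) * t ^ i) hj
        (mul_ne_zero hfj (zpow_ne_zero _ (ht0 hn ht))) hdom).2
      refine ⟨f j * t ^ j, ⟨t, n, hn, ht, mul_zpow_mem_laurent t (f j).2 j⟩,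
        mul_ne_zero hfj (zpow_ne_zero _ (ht0 hn ht)), h, ?_, ?_⟩
      · rw [mul_inv, ← zpow_neg]
        exact ⟨t, n, hn, ht, mul_zpow_mem_laurent t (B.inv_mem (f j).2) _⟩
      · intro m hm
        have hm0 : 0 < m := Nat.pos_of_ne_zero (by rintro rfl; simp at hm)
        obtain ⟨c, hc⟩ := exists_pow_nat_eq (f j) hm0
        obtain ⟨u, hu⟩ := exists_pow_nat_eq t hm0
        refine ⟨c * u ^ j, ⟨u, m * n, ?_, by rw [pow_mul, hu, ht],
          mul_zpow_mem_laurent u c.2 _⟩, ?_⟩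
        · push_cast; exact mul_ne_zero hm hn
        · rw [mul_pow, ← hu, ← hc, ← zpow_natCast (u ^ j), ← zpow_mul, mul_comm j, zpow_mul,
            zpow_natCast]
          push_cast; rfl)
  have hTE : T ∈ E := by
    rw [← SetLike.mem_coe, hEc]
    exact subset_closure ⟨T, 1, by simp, pow_one T, by simpa using zpow_mem_laurent B T 1⟩
  have := hull_le hE hTE hx
  rw [← SetLike.mem_coe, hEc] at this
  obtain ⟨y, ⟨t, n, hn, ht, hy⟩, hxy⟩ := Metric.mem_closure_iff.mp this ε hε
  exact ⟨t, n, hn, ht, y, hy, by rwa [dist_eq_norm] at hxy⟩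

end

section

variable {C : Type*} [NormedField C] [IsUltrametricDist C] [IsAlgClosed C] [CompleteSpace C]
  {κ B : Subfield C}

theorem IsGood.mem_of_dominant_nat {E : Subfield C} (hκ : IsResidueSection κ)
    (hκB : κ ≤ B) (hE : IsGood B E) {s : Finset ℕ} {d : ℕ → C} {X : C}
    (hd : ∀ i ∈ s, d i ∈ E) {j : ℕ} (hjs : j ∈ s) (hj : (j : C) ≠ 0)
    (hX : X ≠ 0) (hdj : d j ≠ 0) (hdom : ∀ i ∈ s, i ≠ j → ‖d i * X ^ i‖ < ‖d j * X ^ j‖)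
    (hsum : ∀ ε : ℝ, 0 < ε → ε < 1 → ∃ e ∈ E, ‖∑ i ∈ s, d i * X ^ i - e‖ ≤ ε * ‖d j * X ^ j‖) :
    X ∈ E := by
  refine hE.mem_of_dominant hκ hκB (s := s.map Nat.castEmbedding) (d := fun i => d i.toNat)
    (j := j) ?_ ?_ (by simpa using hj) hX (by simpa using hdj) ?_ ?_
  · simpa using hd
  · simpa using hjs
  · simpa using hdom
  · simpa using hsum

omit [IsUltrametricDist C] [IsAlgClosed C] [CompleteSpace C] in
theorem mem_of_pow_eq_self [IsAlgClosed B] {p : ℕ} (hp : p.Prime) {x : C} (hx : x ^ p = x) :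
    x ∈ B := by
  refine mem_of_isIntegral ⟨X ^ p - X, monic_X_pow_sub (by
    rw [degree_X]; exact_mod_cast hp.one_lt), ?_⟩
  simp [hx]

variable {p : ℕ} [Fact p.Prime] [CharP C p]

omit [IsUltrametricDist C] [IsAlgClosed C] [CompleteSpace C] in
theorem artinSchreier_sub (x y : C) : (x - y) ^ p - (x - y) = (x ^ p - x) - (y ^ p - y) := by
  rw [sub_pow_char]; ring

theorem IsGood.exists_artinSchreier_root [IsAlgClosed B] {E : Subfield C} (hκ : IsResidueSection κ)
    (hκB : κ ≤ B) (hE : IsGood B E) {h : C} (hh : h ∈ E) (hh1 : ‖h‖ ≤ 1) :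
    ∃ w ∈ E, w ^ p - w = h := by
  have hp : p.Prime := Fact.out
  obtain ⟨w, hw⟩ : ∃ w : C, w ^ p - w = h := by
    obtain ⟨w, hw⟩ := IsAlgClosed.exists_root (X ^ p - X - Polynomial.C h) (by
      have : (X ^ p - X - Polynomial.C h : C[X]).degree = p := by
        have h1 : (X + Polynomial.C h : C[X]).degree < (X ^ p : C[X]).degree := by
          rw [degree_X_add_C, degree_X_pow]; exact_mod_cast hp.one_lt
        rw [sub_sub, degree_sub_eq_left_of_degree_lt h1, degree_X_pow]
      rw [this]; exact_mod_cast hp.ne_zero)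
    refine ⟨w, ?_⟩
    simpa [sub_eq_zero] using hw
  have hw1 : ‖w‖ ≤ 1 := by
    by_contra hlt
    push Not at hlt
    have h1 : ‖w‖ < ‖w ^ p‖ := by
      rw [norm_pow]; exact lt_self_pow₀ hlt hp.one_lt
    rw [← norm_sub_eq_left h1, hw] at h1
    linarith
  obtain ⟨c, hc, hcw⟩ := hκ.exists_norm_sub_lt w hw1
  have hcE : c ∈ E := hE.le (hκB hc)
  refine ⟨w, ?_, hw⟩
  suffices w - c ∈ E by simpa using E.add_mem this hcE
  rcases eq_or_ne (w - c) 0 with h0 | h0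
  · rw [h0]; exact E.zero_mem
  have hsum : (w - c) ^ p - (w - c) ∈ E := by
    rw [artinSchreier_sub, hw]
    exact E.sub_mem hh (E.sub_mem (E.pow_mem hcE p) hcE)
  refine hE.mem_of_dominant_nat hκ hκB (s := {1, p}) (d := fun i => if i = 1 then -1 else 1)
    (j := 1) ?_ (by simp) (by simp) h0 (by simp) ?_ ?_
  · intro i _
    split_ifs
    · exact E.neg_mem E.one_mem
    · exact E.one_mem
  · intro i hi hi1
    simp only [hi1, if_false, if_true, one_mul, pow_one, norm_mul, norm_neg, norm_one, norm_pow]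
    have : i = p := by simpa [hi1] using hi
    rw [this]
    exact pow_lt_self_of_lt_one₀ (norm_pos_iff.mpr h0) hcw hp.one_lt
  · intro ε hε _
    refine ⟨_, hsum, ?_⟩
    rw [Finset.sum_pair hp.one_lt.ne]
    simp only [if_true, hp.one_lt.ne', if_false]
    rw [show -1 * (w - c) ^ 1 + 1 * (w - c) ^ p - ((w - c) ^ p - (w - c)) = 0 by ring, norm_zero]
    positivity

/-- If `a` is not in the good field `E` but `a ^ p - a` is, then `a` has norm larger than one. -/
theorem IsGood.one_lt_norm [IsAlgClosed B] {E : Subfield C} (hκ : IsResidueSection κ)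
    (hκB : κ ≤ B) (hE : IsGood B E) {a : C} (ha : a ∉ E) (haE : a ^ p - a ∈ E) :
    1 < ‖a ^ p - a‖ ∧ 1 < ‖a‖ ∧ ‖a ^ p - a‖ = ‖a‖ ^ p := by
  have hp : p.Prime := Fact.out
  have h1 : 1 < ‖a ^ p - a‖ := by
    by_contra hle
    push Not at hle
    obtain ⟨w, hw, hwa⟩ := hE.exists_artinSchreier_root (p := p) hκ hκB haE hle
    have h : (a - w) ^ p = a - w := by
      rw [← sub_eq_zero, artinSchreier_sub, hwa, sub_self]
    have := E.add_mem (hE.le (mem_of_pow_eq_self (B := B) hp h)) hw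
    rw [sub_add_cancel] at this
    exact ha this
  have h2 : 1 < ‖a‖ := by
    by_contra hle
    push Not at hle
    refine absurd h1 (not_lt.mpr (norm_sub_le ?_ hle))
    rw [norm_pow]; exact pow_le_one₀ (norm_nonneg _) hle
  refine ⟨h1, h2, ?_⟩
  rw [norm_sub_eq_left, norm_pow]
  rw [norm_pow]; exact lt_self_pow₀ h2 hp.one_lt

/-- `T'` is a parameter whose hull contains `T` and `a`. -/
structure IsStep (B : Subfield C) (T a T' : C) : Prop where
  sub_mem : T' - a ∈ hull B T
  mem_of_isAlgClosed : ∀ Ω : Subfield C, IsAlgClosed Ω → B ≤ Ω → T ∈ Ω → T' ∈ Ω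
  mem_of_mem : ∀ E : Subfield C, IsGood B E → T' ∈ E → T ∈ E

omit [IsUltrametricDist C] [IsAlgClosed C] [CompleteSpace C] in
theorem laurent_reduction [IsAlgClosed B] {t : C} {y : C} (hy : y ∈ laurent B t) :
    ∃ f ∈ Submodule.span B ((fun i : ℤ => t ^ i) '' {i | ¬ (p : ℤ) ∣ i}), ∃ u ∈ laurent B t,
      y - f = u ^ p - u := by
  have hp : p.Prime := Fact.out
  obtain ⟨g, rfl⟩ := Finsupp.mem_span_range_iff_exists_finsupp.mp hy
  clear hy
  induction g using Finsupp.induction_linear with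
  | zero => exact ⟨0, Submodule.zero_mem _, 0, Submodule.zero_mem _, by simp [hp.ne_zero]⟩
  | add g₁ g₂ h₁ h₂ =>
    obtain ⟨f₁, hf₁, u₁, hu₁, h₁⟩ := h₁
    obtain ⟨f₂, hf₂, u₂, hu₂, h₂⟩ := h₂
    refine ⟨f₁ + f₂, Submodule.add_mem _ hf₁ hf₂, u₁ + u₂, Submodule.add_mem _ hu₁ hu₂, ?_⟩
    rw [Finsupp.sum_add_index' (by simp) (by intros; rw [add_smul]), add_pow_char]
    linear_combination h₁ + h₂
  | single i b =>
    rw [Finsupp.sum_single_index (by simp)]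
    induction hn : i.natAbs using Nat.strong_induction_on generalizing i b with
    | _ n ih =>
      rcases eq_or_ne i 0 with rfl | hi
      · obtain ⟨c, hc⟩ := IsAlgClosed.exists_root (X ^ p - X - Polynomial.C b) (by
          have : (X ^ p - X - Polynomial.C b : B[X]).degree = p := by
            have h1 : (X + Polynomial.C b : B[X]).degree < (X ^ p : B[X]).degree := by
              rw [degree_X_add_C, degree_X_pow]; exact_mod_cast hp.one_lt
            rw [sub_sub, degree_sub_eq_left_of_degree_lt h1, degree_X_pow]
          rw [this]; exact_mod_cast hp.ne_zero)
        refine ⟨0, Submodule.zero_mem _, c, coe_mem_laurent t c.2, ?_⟩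
        have hc' : c ^ p - c = b := by simpa [sub_eq_zero] using hc
        rw [← hc']
        simp [Subfield.smul_def]
      · by_cases hpi : (p : ℤ) ∣ i
        · obtain ⟨k, rfl⟩ := hpi
          obtain ⟨c, hc⟩ := exists_pow_nat_eq b hp.pos
          have hk : k ≠ 0 := by rintro rfl; simp at hi
          obtain ⟨f, hf, u, hu, h⟩ := ih k.natAbs (by
            rw [← hn, Int.natAbs_mul, Int.natAbs_natCast]
            have := Int.natAbs_pos.mpr hk
            nlinarith [hp.one_lt]) k c rfl
          refine ⟨f, hf, u + c • t ^ k, Submodule.add_mem _ hu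
            (Submodule.smul_mem _ _ (zpow_mem_laurent B t k)), ?_⟩
          have hpow : (c • t ^ k) ^ p = b • t ^ ((p : ℤ) * k) := by
            rw [_root_.smul_pow, hc, mul_comm (p : ℤ) k, zpow_mul, zpow_natCast]
          rw [add_pow_char, hpow]
          linear_combination h
        · exact ⟨b • t ^ i, Submodule.smul_mem _ _ (Submodule.subset_span ⟨i, hpi, rfl⟩), 0,
            Submodule.zero_mem _, by simp [hp.ne_zero]⟩

theorem TypeII.exists_step [IsAlgClosed B] (hκ : IsResidueSection κ) (hκB : κ ≤ B) {T : C}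
    (hT : TypeII B T) {a : C} (ha : a ∉ hull B T) (haT : a ^ p - a ∈ hull B T) :
    ∃ T', TypeII B T' ∧ IsStep B T a T' := by
  have hp : p.Prime := Fact.out
  have hD := isGood_hull B T
  obtain ⟨t, n, hn, ht, y, hy, hay⟩ := hT.hull_approx hκ hκB haT one_pos
  have htII : TypeII B t := TypeII.of_pow (n := n) (ht ▸ hT)
  have ht0 := htII.ne_zero
  have htD : t ∈ hull B T := hD.tame n hn t (ht ▸ mem_hull B T)
  have hlD : ∀ x ∈ laurent B t, x ∈ hull B T := by
    intro x hx
    have : laurent B t ≤ { (hull B T).toAddSubgroup with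
        smul_mem' := fun b x hx => (hull B T).mul_mem (hD.le b.2) hx } := by
      refine Submodule.span_le.mpr ?_
      rintro _ ⟨i, rfl⟩
      exact zpow_mem htD i
    exact this hx
  obtain ⟨f, hf, u, hu, hyf⟩ := laurent_reduction (p := p) hy
  have hfl : f ∈ laurent B t := Submodule.span_mono (Set.image_subset_range _ _) hf
  obtain ⟨w, hw, hwa⟩ := hD.exists_artinSchreier_root (p := p) hκ hκB
    ((hull B T).sub_mem haT (hlD y hy)) hay.le
  have hT'f : (a - (w + u)) ^ p - (a - (w + u)) = f := by
    rw [sub_pow_char, add_pow_char]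
    linear_combination -hwa + hyf
  have hwu : w + u ∈ hull B T := (hull B T).add_mem hw (hlD u hu)
  have hT'D : a - (w + u) ∉ hull B T := fun h => ha (by
    simpa using (hull B T).add_mem h hwu)
  obtain ⟨h1, h2, h3⟩ := hD.one_lt_norm (p := p) hκ hκB hT'D (hT'f ▸ hlD f hfl)
  rw [hT'f] at h1 h3
  obtain ⟨g, hgs, rfl⟩ := (Finsupp.mem_span_image_iff_linearCombination B).mp hf
  have hg0 : g ≠ 0 := by rintro rfl; simp at h1; linarith
  obtain ⟨j, hj, hdom⟩ := htII.exists_dominant hg0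
  have hgj : (g j : C) ≠ 0 := by simpa using hj
  have hpj : ¬ (p : ℤ) ∣ j := hgs hj
  have hj0 : (j : C) ≠ 0 := by rwa [Ne, CharP.intCast_eq_zero_iff C p]
  have hsum : Finsupp.linearCombination B (fun i : ℤ => t ^ i) g
      = ∑ i ∈ g.support, (g i : C) * t ^ i := rfl
  have hnorm := (norm_sum_eq_of_dominant (f := fun i => (g i : C) * t ^ i) hj
        (mul_ne_zero hgj (zpow_ne_zero _ ht0)) hdom).1
  refine ⟨a - (w + u), ?_, ⟨?_, ?_, ?_⟩⟩
  · intro b hb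
    have hj00 : j ≠ 0 := by rintro rfl; simp at hpj
    refine htII.zpow hj00 (b ^ p / g j) ?_
    rw [hsum, hnorm, hb, norm_mul] at h3
    push_cast
    rw [norm_div, norm_pow, ← h3, mul_div_cancel_left₀ _ (norm_ne_zero_iff.mpr hgj)]
  · rw [show a - (w + u) - a = -(w + u) by ring]
    exact (hull B T).neg_mem hwu
  · intro Ω hΩ hBΩ hTΩ
    have htΩ : t ∈ Ω := mem_of_pow_mem (Nat.pos_of_ne_zero (by rintro rfl; simp at hn)) (ht ▸ hTΩ)
    have hfΩ : Finsupp.linearCombination B (fun i : ℤ => t ^ i) g ∈ Ω := by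
      rw [hsum]
      exact Ω.sum_mem fun i _ => Ω.mul_mem (hBΩ (g i).2) (zpow_mem htΩ i)
    rw [← hT'f] at hfΩ
    refine mem_of_isIntegral ⟨X ^ p - X - Polynomial.C ⟨_, hfΩ⟩, ?_, ?_⟩
    · rw [sub_sub]
      refine monic_X_pow_sub ?_
      rw [degree_X_add_C]; exact_mod_cast hp.one_lt
    · simp only [eval₂_sub, eval₂_X_pow, eval₂_X, eval₂_C]
      exact sub_self _
  · intro E hE hT'E
    have hfE : Finsupp.linearCombination B (fun i : ℤ => t ^ i) g ∈ E := by
      rw [← hT'f]; exact E.sub_mem (E.pow_mem hT'E p) hT'E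
    have htE : t ∈ E := by
      refine hE.mem_of_dominant hκ hκB (s := g.support) (d := fun i => g i)
        (fun i _ => hE.le (g i).2) hj hj0 ht0 hgj hdom fun ε hε _ => ⟨_, hfE, ?_⟩
      rw [hsum, sub_self, norm_zero]; positivity
    rw [← ht]; exact E.pow_mem htE n

end

section

section

variable {F : Type*} [Field F] {p : ℕ} [Fact p.Prime] [CharP F p]

theorem coeff_pow_char_pow (g : F[X]) (k n : ℕ) :
    (g ^ p ^ k).coeff n = if p ^ k ∣ n then g.coeff (n / p ^ k) ^ p ^ k else 0 := by
  rw [← map_iterateFrobenius_expand p, coeff_map, coeff_expand (pow_pos (Fact.out : p.Prime).pos k)]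
  split_ifs
  · rw [iterateFrobenius_def]
  · simp

/-- An invariant of polynomials modulo the image of the Artin-Schreier operator. -/
noncomputable def asDeriv (p R : ℕ) (f : F[X]) : F[X] :=
  ∑ m ∈ range (R + 1), hasseDeriv (p ^ m) f ^ p ^ (R - m)

omit [Fact p.Prime] [CharP F p] in
theorem eval_asDeriv (R : ℕ) (f : F[X]) (β : F) : (asDeriv p R f).eval β =
    ∑ m ∈ range (R + 1), (taylor β f).coeff (p ^ m) ^ p ^ (R - m) := by
  simp only [asDeriv, eval_finsetSum, eval_pow, taylor_coeff]

theorem sum_coeff_add_artinSchreier {R : ℕ} {u : F[X]} (hu : u.natDegree < p ^ R) (f : F[X]) :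
    ∑ m ∈ range (R + 1), (f + (u ^ p - u)).coeff (p ^ m) ^ p ^ (R - m) =
      ∑ m ∈ range (R + 1), f.coeff (p ^ m) ^ p ^ (R - m) := by
  have hp : p.Prime := Fact.out
  have h1 : ∀ m ∈ range (R + 1), (f + (u ^ p - u)).coeff (p ^ m) ^ p ^ (R - m) =
      f.coeff (p ^ m) ^ p ^ (R - m) + ((u ^ p).coeff (p ^ m) ^ p ^ (R - m)
        - u.coeff (p ^ m) ^ p ^ (R - m)) := by
    intro m _
    rw [coeff_add, coeff_sub, add_pow_char_pow, sub_pow_char_pow]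
  rw [sum_congr rfl h1, sum_add_distrib, sum_sub_distrib,
    sum_range_succ' (fun m => (u ^ p).coeff (p ^ m) ^ p ^ (R - m)),
    sum_range_succ (fun m => u.coeff (p ^ m) ^ p ^ (R - m)),
    coeff_eq_zero_of_natDegree_lt hu]
  have h2 := coeff_pow_char_pow (p := p) u 1
  simp only [pow_one] at h2
  have h3 : (u ^ p).coeff (p ^ 0) = 0 := by
    rw [h2, if_neg]; simpa using hp.ne_one
  have h4 : ∀ m ∈ range R, (u ^ p).coeff (p ^ (m + 1)) ^ p ^ (R - (m + 1))
      = u.coeff (p ^ m) ^ p ^ (R - m) := by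
    intro m hm
    have hm := mem_range.mp hm
    rw [h2, if_pos (dvd_pow_self p m.succ_ne_zero), pow_succ, Nat.mul_div_cancel _ hp.pos,
      ← pow_mul, ← pow_succ']
    congr 2; omega
  rw [sum_congr rfl h4, h3]
  simp [hp.ne_zero]

theorem coeff_asDeriv {f : F[X]} (hf : ∀ i, p ∣ i → f.coeff i = 0) (R j : ℕ) :
    (asDeriv p R f).coeff (j * p ^ R) = ((j + 1 : ℕ) : F) * f.coeff (j + 1) ^ p ^ R := by
  have hp : p.Prime := Fact.out
  rw [asDeriv, finsetSum_coeff, Finset.sum_eq_single 0]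
  · rw [Nat.sub_zero, coeff_pow_char_pow, if_pos (dvd_mul_left _ _),
      Nat.mul_div_cancel _ (pow_pos hp.pos _), pow_zero, hasseDeriv_coeff, Nat.choose_one_right,
      mul_pow, ← Nat.cast_pow]
    congr 1
    have := map_natCast (iterateFrobenius F p R) (j + 1)
    rw [iterateFrobenius_def] at this
    push_cast at this ⊢
    exact this
  · intro m hm hm0
    have hmR : m ≤ R := Nat.lt_succ_iff.mp (mem_range.mp hm)
    rw [coeff_pow_char_pow, if_pos (dvd_mul_of_dvd_right (pow_dvd_pow p (Nat.sub_le R m)) j)]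
    have h1 : j * p ^ R = j * p ^ m * p ^ (R - m) := by
      rw [mul_assoc, ← pow_add]; congr 2; omega
    rw [h1, Nat.mul_div_cancel _ (pow_pos hp.pos _), hasseDeriv_coeff, hf, mul_zero,
      zero_pow (pow_pos hp.pos _).ne']
    exact dvd_add (dvd_mul_of_dvd_right (dvd_pow_self p hm0) j) (dvd_pow_self p hm0)
  · simp

theorem exists_artinSchreier_reduction [IsAlgClosed F] (N : ℕ) (q : F[X]) (hq : q.natDegree ≤ N) :
    ∃ f u : F[X], f.natDegree ≤ N ∧ u.natDegree ≤ N ∧ (∀ i, p ∣ i → f.coeff i = 0) ∧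
      q = f + (u ^ p - u) := by
  have hp : p.Prime := Fact.out
  have hmono : ∀ i, i ≤ N → ∀ b : F, ∃ f u : F[X], f.natDegree ≤ N ∧ u.natDegree ≤ N ∧
      (∀ i, p ∣ i → f.coeff i = 0) ∧ monomial i b = f + (u ^ p - u) := by
    intro i
    induction i using Nat.strong_induction_on with
    | _ i ih =>
    intro hi b
    rcases eq_or_ne i 0 with rfl | hi0
    · obtain ⟨c, hc⟩ := IsAlgClosed.exists_root (X ^ p - X - Polynomial.C b) (by
          have : (X ^ p - X - Polynomial.C b : F[X]).degree = p := by
            have h1 : (X + Polynomial.C b : F[X]).degree < (X ^ p : F[X]).degree := by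
              rw [degree_X_add_C, degree_X_pow]; exact_mod_cast hp.one_lt
            rw [sub_sub, degree_sub_eq_left_of_degree_lt h1, degree_X_pow]
          rw [this]; exact_mod_cast hp.ne_zero)
      have hc' : c ^ p - c = b := by simpa [sub_eq_zero] using hc
      refine ⟨0, Polynomial.C c, by simp, by simp, by simp, ?_⟩
      rw [← hc', ← C_pow, ← C_sub, zero_add, monomial_zero_left]
    by_cases hpi : p ∣ i
    · obtain ⟨k, rfl⟩ := hpi
      obtain ⟨c, hc⟩ := exists_pow_nat_eq b hp.pos
      have hk : 0 < k := Nat.pos_of_ne_zero (by rintro rfl; simp at hi0)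
      have hkp : k < p * k := by nlinarith [hp.one_lt]
      obtain ⟨f, u, hf, hu, hfc, h⟩ := ih k hkp (hkp.le.trans hi) c
      refine ⟨f, u + monomial k c, hf, (natDegree_add_le _ _).trans (max_le hu
        ((natDegree_monomial_le c).trans (hkp.le.trans hi))), hfc, ?_⟩
      rw [add_pow_char, monomial_pow, hc, mul_comm k p]
      linear_combination h
    · refine ⟨monomial i b, 0, (natDegree_monomial_le b).trans hi, by simp, ?_, by
        simp [hp.ne_zero]⟩
      intro l hl
      rw [coeff_monomial, if_neg]
      rintro rfl; exact hpi hl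
  rw [q.as_sum_range_C_mul_X_pow' (Nat.lt_succ_of_le hq)]
  have hs : ∀ s : Finset ℕ, (∀ i ∈ s, i ≤ N) → ∃ f u : F[X], f.natDegree ≤ N ∧ u.natDegree ≤ N ∧
      (∀ i, p ∣ i → f.coeff i = 0) ∧
        ∑ i ∈ s, Polynomial.C (q.coeff i) * X ^ i = f + (u ^ p - u) := by
    intro s
    induction s using Finset.induction_on with
    | empty => intro _; exact ⟨0, 0, by simp, by simp, by simp, by simp [hp.ne_zero]⟩
    | insert a s ha ih =>
      intro hsN
      obtain ⟨f, u, hf, hu, hfc, h⟩ := ih fun i hi => hsN i (Finset.mem_insert_of_mem hi)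
      obtain ⟨f', u', hf', hu', hfc', h'⟩ := hmono a (hsN a (Finset.mem_insert_self _ _)) (q.coeff a)
      refine ⟨f' + f, u' + u, (natDegree_add_le _ _).trans (max_le hf' hf),
        (natDegree_add_le _ _).trans (max_le hu' hu), ?_, ?_⟩
      · intro i hi; rw [coeff_add, hfc i hi, hfc' i hi, add_zero]
      · rw [sum_insert ha, C_mul_X_pow_eq_monomial, h, h', add_pow_char]; ring
  exact hs _ fun i hi => Nat.lt_succ_iff.mp (mem_range.mp hi)

theorem taylor_asDeriv {R : ℕ} {q f u : F[X]} [Infinite F] {α : F} (hu : u.natDegree < p ^ R)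
    (h : taylor α q = f + (u ^ p - u)) : taylor α (asDeriv p R q) = asDeriv p R f := by
  refine Polynomial.funext fun β => ?_
  rw [taylor_eval, eval_asDeriv, eval_asDeriv, ← taylor_taylor, h, map_add, map_sub, taylor_pow,
    sum_coeff_add_artinSchreier]
  rwa [natDegree_taylor]

end

variable {C : Type*} [NormedField C] [IsUltrametricDist C] [IsAlgClosed C] [CompleteSpace C]
  {κ B : Subfield C} {p : ℕ} [Fact p.Prime] [CharP C p]

theorem TypeI.exists_step [IsAlgClosed B] (hκ : IsResidueSection κ) (hκB : κ ≤ B) {T : C}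
    (hT : TypeI B T) {a : C} (ha : a ∉ hull B T) (haT : a ^ p - a ∈ hull B T) :
    ∃ T', TypeI B T' ∧ IsStep B T a T' := by
  have hp : p.Prime := Fact.out
  have : Infinite B := IsAlgClosed.instInfinite
  have hD := isGood_hull B T
  have hTD := mem_hull B T
  have hpoly : ∀ (q : B[X]) (x : C) (E : Subfield C), B ≤ E → x ∈ E → aeval x q ∈ E := by
    intro q x E hBE hx
    rw [aeval_eq_sum_range]
    exact E.sum_mem fun i _ => E.mul_mem (hBE (q.coeff i).2) (E.pow_mem hx i)
  obtain ⟨q, hq⟩ := hT.hull_approx hκ hκB haT one_pos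
  obtain ⟨w, hw, hwa⟩ := hD.exists_artinSchreier_root (p := p) hκ hκB
    ((hull B T).sub_mem haT (hpoly q T _ hD.le hTD)) hq.le
  obtain ⟨q₁, u₁, hq₁, hu₁, hq₁c, rfl⟩ := exists_artinSchreier_reduction (p := p) _ q le_rfl
  set N := (q₁ + (u₁ ^ p - u₁)).natDegree
  have hN : N < p ^ N := Nat.lt_pow_self hp.one_lt
  have ha1 : (a - w - aeval T u₁) ^ p - (a - w - aeval T u₁) = aeval T q₁ := by
    rw [sub_pow_char, sub_pow_char]
    simp only [map_add, map_sub, map_pow] at hwa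
    linear_combination -hwa
  have hq₁0 : q₁ ≠ 0 := by
    rintro rfl
    rw [map_zero, sub_eq_zero] at ha1
    have h := (hull B T).add_mem ((hull B T).add_mem (hD.le (mem_of_pow_eq_self (B := B) hp ha1))
      (hpoly u₁ T _ hD.le hTD)) hw
    rw [sub_add_cancel, sub_add_cancel] at h
    exact ha h
  have hG0 : asDeriv p N q₁ ≠ 0 := by
    intro h0
    have hd : q₁.natDegree ≠ 0 := by
      intro hd
      have := hq₁c _ (hd ▸ dvd_zero p)
      exact hq₁0 (leadingCoeff_eq_zero.mp this)
    obtain ⟨j, hj⟩ := Nat.exists_eq_succ_of_ne_zero hd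
    have h := coeff_asDeriv hq₁c N j
    rw [h0, coeff_zero, ← Nat.succ_eq_add_one, ← hj] at h
    rcases mul_eq_zero.mp h.symm with h | h
    · rw [CharP.cast_eq_zero_iff B p] at h
      exact hq₁0 (leadingCoeff_eq_zero.mp (hq₁c _ h))
    · exact hq₁0 (leadingCoeff_eq_zero.mp (pow_eq_zero_iff (pow_pos hp.pos _).ne' |>.mp h))
  obtain ⟨α, hα⟩ := hT.exists_constDominant hG0
  have hα := hα α le_rfl
  obtain ⟨f, u₂, hf, hu₂, hfc, hfu⟩ := exists_artinSchreier_reduction (p := p) N (taylor α q₁)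
    ((natDegree_taylor q₁ α).le.trans hq₁)
  rw [taylor_asDeriv (hu₂.trans_lt hN) hfu] at hα
  have hX0 := hT.sub_ne_zero α
  set Y : C := T - α with hY
  have hYpos : 0 < ‖Y‖ := norm_pos_iff.mpr hX0
  have hYD : Y ∈ hull B T := (hull B T).sub_mem hTD (hD.le α.2)
  have hfY : ∀ g : B[X], aeval Y (taylor α g) = aeval T g := by
    intro g
    rw [taylor_apply, aeval_comp]
    simp only [map_add, aeval_X, aeval_C]
    congr 2
    exact sub_add_cancel _ _
  have hdom0 : ∀ i, i ≠ 1 → f.coeff i ≠ 0 → f.coeff 1 ≠ 0 ∧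
      ‖(f.coeff i : C) * Y ^ i‖ < ‖(f.coeff 1 : C) * Y ^ 1‖ := by
    intro i hi1 hi
    have hpi : ¬ p ∣ i := fun h => hi (hfc i h)
    have hi0 : i ≠ 0 := by rintro rfl; simp at hpi
    obtain ⟨j, rfl⟩ := Nat.exists_eq_succ_of_ne_zero hi0
    have hj0 : j ≠ 0 := by rintro rfl; simp at hi1
    have h := hα (j * p ^ N) (mul_ne_zero hj0 (pow_pos hp.pos _).ne')
    have h0 := coeff_asDeriv hfc N 0
    rw [zero_mul] at h0
    rw [coeff_map, coeff_map, coeff_asDeriv hfc, h0] at h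
    have hjn : ‖((j + 1 : ℕ) : C)‖ = 1 := hκ.norm_natCast (by
      rwa [Ne, CharP.cast_eq_zero_iff C p])
    simp only [map_mul, map_pow, map_natCast, norm_mul, norm_pow, hjn, one_mul, zero_add,
      Nat.cast_one, pow_mul, ← mul_pow] at h
    have h' := lt_of_pow_lt_pow_left₀ _ (norm_nonneg _) h
    refine ⟨?_, ?_⟩
    · intro h1
      rw [h1, map_zero, norm_zero] at h'
      exact absurd h' (not_lt.mpr (by positivity))
    · rw [norm_mul, norm_mul, norm_pow, pow_one, Nat.succ_eq_add_one, pow_succ, ← mul_assoc]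
      exact mul_lt_mul_of_pos_right h' hYpos
  set T' := a - w - aeval T u₁ - aeval Y u₂ with hT'
  have hT'f : T' ^ p - T' = aeval Y f := by
    rw [hT', sub_pow_char]
    have : aeval T q₁ = aeval Y f + ((aeval Y u₂) ^ p - aeval Y u₂) := by
      rw [← hfY, hfu]; simp
    linear_combination ha1 + this
  have hT'a : T' - a ∈ hull B T := by
    rw [show T' - a = -(w + aeval T u₁ + aeval Y u₂) by rw [hT']; ring]
    exact (hull B T).neg_mem ((hull B T).add_mem ((hull B T).add_mem hw (hpoly _ _ _ hD.le hTD))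
      (hpoly _ _ _ hD.le hYD))
  have hT'D : T' ∉ hull B T := by
    intro h
    have := (hull B T).sub_mem h hT'a
    rw [sub_sub_cancel] at this
    exact ha this
  have hfD : aeval Y f ∈ hull B T := hpoly _ _ _ hD.le hYD
  have hf1 : f.coeff 1 ≠ 0 := by
    have hf0 : f ≠ 0 := by
      rintro rfl
      have h1 := (hD.one_lt_norm (p := p) hκ hκB hT'D (hT'f ▸ hfD)).1
      rw [hT'f, map_zero, norm_zero] at h1
      linarith
    rcases eq_or_ne f.natDegree 1 with h | h
    · rw [← h]; exact leadingCoeff_ne_zero.mpr hf0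
    · exact (hdom0 _ h (leadingCoeff_ne_zero.mpr hf0)).1
  have hf1C : (f.coeff 1 : C) ≠ 0 := by simpa using hf1
  have hsum : aeval Y f = ∑ i ∈ f.support, (f.coeff i : C) * Y ^ i := by
    rw [aeval_def, eval₂_eq_sum, Polynomial.sum_def]; rfl
  refine ⟨T', ?_, ⟨hT'a, ?_, ?_⟩⟩
  · intro β
    have hβD : (β : C) ∈ hull B T := hD.le β.2
    have hxD : T' - β ∉ hull B T := fun h => hT'D (by
      have := (hull B T).add_mem h hβD
      rwa [sub_add_cancel] at this)
    have hh : (T' - β) ^ p - (T' - β) = aeval T (f.comp (X - Polynomial.C α) -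
        Polynomial.C (β ^ p - β)) := by
      rw [artinSchreier_sub, hT'f, map_sub, aeval_comp, map_sub, aeval_X, aeval_C, aeval_C,
        map_sub, map_pow]
      rfl
    set Q : B[X] := f.comp (X - Polynomial.C α) - Polynomial.C (β ^ p - β)
    obtain ⟨h1, h2, h3⟩ := hD.one_lt_norm (p := p) hκ hκB hxD (hh ▸ hpoly _ _ _ hD.le hTD)
    have hQ0 : Q ≠ 0 := by
      intro h0
      rw [hh, h0, map_zero, norm_zero] at h1
      linarith
    obtain ⟨α', hα'⟩ := hT.exists_norm_sub_eval_lt hQ0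
    have hb := hα' α' le_rfl
    obtain ⟨c, hc⟩ := exists_pow_nat_eq (Q.eval α') hp.pos
    refine ⟨β + c, ?_⟩
    have hcp : (T' - (β + c : B)) ^ p = (aeval T Q - (Q.eval α' : B)) + (T' - β) := by
      rw [← hc]
      push_cast
      rw [← sub_sub, sub_pow_char, ← hh]; ring
    refine lt_of_pow_lt_pow_left₀ p (norm_nonneg _) ?_
    rw [← norm_pow, hcp]
    have hn := norm_eq_of_sub_lt (x := ((Q.eval α' : B) : C)) (y := aeval T Q) (by
      rwa [norm_sub_rev])
    rw [← h3, hh]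
    refine norm_add_lt (by rwa [hn]) ?_
    rw [← hh, h3]
    exact lt_self_pow₀ h2 hp.one_lt
  · intro Ω hΩ hBΩ hTΩ
    have hfΩ : aeval Y f ∈ Ω := hpoly _ _ _ hBΩ (Ω.sub_mem hTΩ (hBΩ α.2))
    rw [← hT'f] at hfΩ
    refine mem_of_isIntegral ⟨X ^ p - X - Polynomial.C ⟨_, hfΩ⟩, ?_, ?_⟩
    · rw [sub_sub]
      refine monic_X_pow_sub ?_
      rw [degree_X_add_C]; exact_mod_cast hp.one_lt
    · simp only [eval₂_sub, eval₂_X_pow, eval₂_X, eval₂_C]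
      exact sub_self _
  · intro E hE hT'E
    have hfE : aeval Y f ∈ E := by
      rw [← hT'f]; exact E.sub_mem (E.pow_mem hT'E p) hT'E
    have hYE : Y ∈ E := by
      refine hE.mem_of_dominant_nat hκ hκB (s := f.support) (d := fun i => f.coeff i) (j := 1)
        (fun i _ => hE.le (f.coeff i).2) (by simpa using hf1) (by simp) hX0 hf1C
        (fun i hi hi1 => (hdom0 i hi1 (by simpa using hi)).2) fun ε hε _ => ⟨_, hfE, ?_⟩
      rw [hsum, sub_self, norm_zero]; positivity
    have := E.add_mem hYE (hE.le α.2)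
    rwa [hY, sub_add_cancel] at this

end

section

section

variable {E L : Type*} [NontriviallyNormedField E] [CompleteSpace E] [NormedField L]
  [NormedAlgebra E L]

theorem norm_algEquiv [FiniteDimensional E L] (σ : L ≃ₐ[E] L) (x : L) : ‖σ x‖ = ‖x‖ := by
  have key : ∀ (σ : L ≃ₐ[E] L) (x : L), ‖σ x‖ ≤ ‖x‖ := by
    intro σ x
    have hcont : Continuous σ.toLinearMap := LinearMap.continuous_of_finiteDimensional _
    let f : L →L[E] L := ⟨σ.toLinearMap, hcont⟩
    by_contra hlt
    push Not at hlt
    have hx : x ≠ 0 := by rintro rfl; simp at hlt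
    have hxp := norm_pos_iff.mpr hx
    have hr : 1 < ‖σ x‖ / ‖x‖ := (one_lt_div hxp).mpr hlt
    obtain ⟨n, hn⟩ := pow_unbounded_of_one_lt ‖f‖ hr
    have h1 : ‖σ (x ^ n)‖ ≤ ‖f‖ * ‖x ^ n‖ := f.le_opNorm (x ^ n)
    rw [map_pow, norm_pow, norm_pow] at h1
    rw [div_pow, lt_div_iff₀ (pow_pos hxp n)] at hn
    linarith
  refine le_antisymm (key σ x) ?_
  have := key σ.symm (σ x)
  rwa [AlgEquiv.symm_apply_apply] at this

theorem isClosed_intermediateField (W : IntermediateField E L) [FiniteDimensional E W] :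
    IsClosed (W : Set L) := by
  have : FiniteDimensional E W.toSubmodule := ‹FiniteDimensional E W›
  exact Submodule.closed_of_finiteDimensional (𝕜 := E) W.toSubmodule

end

def Param {C : Type*} [NormedField C] (B : Subfield C) (T : C) : Prop := TypeI B T ∨ TypeII B T

variable {C : Type*} [NormedField C] [IsUltrametricDist C] [IsAlgClosed C] [CompleteSpace C]
  {κ B : Subfield C}

omit [IsUltrametricDist C] [IsAlgClosed C] [CompleteSpace C] in
theorem Param.exists_one_lt_norm {T : C} (h : Param B T) {E : Subfield C} (hE : B ≤ E)
    (hT : T ∈ E) : ∃ x ∈ E, 1 < ‖x‖ := by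
  rcases h with h | h
  · obtain ⟨β, hβ⟩ := h 0
    have h0 := norm_pos_iff.mpr (h.sub_ne_zero β)
    exact ⟨(T - (0 : B)) / (T - β), E.div_mem (E.sub_mem hT (hE (0 : B).2))
      (E.sub_mem hT (hE β.2)), by rw [norm_div]; exact (one_lt_div h0).mpr hβ⟩
  · have h0 := h.ne_zero
    have h1 : ‖T‖ ≠ 1 := by simpa using h 1
    rcases lt_or_gt_of_ne h1 with h1 | h1
    · exact ⟨T⁻¹, E.inv_mem hT, by
        rw [norm_inv]; exact (one_lt_inv₀ (norm_pos_iff.mpr h0)).mpr h1⟩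
    · exact ⟨T, hT, h1⟩

theorem Param.exists_step [IsAlgClosed B] {p : ℕ} [Fact p.Prime] [CharP C p]
    (hκ : IsResidueSection κ) (hκB : κ ≤ B) {T : C}
    (hT : Param B T) {a : C} (ha : a ∉ hull B T) (haT : a ^ p - a ∈ hull B T) :
    ∃ T', Param B T' ∧ IsStep B T a T' := by
  rcases hT with hT | hT
  · obtain ⟨T', h, h'⟩ := hT.exists_step hκ hκB ha haT
    exact ⟨T', Or.inl h, h'⟩
  · obtain ⟨T', h, h'⟩ := hT.exists_step hκ hκB ha haT
    exact ⟨T', Or.inr h, h'⟩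

omit [IsAlgClosed C] [CompleteSpace C] in
theorem exists_near_root {E : Subfield C} (hE : IsClosed (E : Set C)) (hκ : IsResidueSection κ)
    (hκE : κ ≤ E) {n : ℕ} (hn : (n : C) ≠ 0) {c e : C} (hc : c ^ n ∈ E) (he : e ∈ E)
    (hce : ‖c‖ = ‖e‖) : c ∈ E := by
  rcases eq_or_ne c 0 with rfl | hc0
  · exact E.zero_mem
  obtain ⟨b, hb, -, hbe⟩ := hκ.exists_ratio hc0 hce
  refine mem_of_forall_near hE fun ε hε hε1 => ?_
  refine exists_near_of_dominant (s := {(n : ℤ)}) (d := fun _ => 1) (j := n) (e := c ^ n)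
    (fun _ _ => E.one_mem) (by simp) (by simpa using hκ.norm_natCast hn) hc0 one_ne_zero ?_
    (E.mul_mem (hκE hb) he) hbe hc hε hε1 ?_
  · intro i hi hi'; simp at hi; exact absurd hi hi'
  · simp; positivity

section

variable {z : C} (hz : Param B z) {W : IntermediateField (hull B z) C}
  [FiniteDimensional (hull B z) W]

include hz

/-- The hull of a parameter as a nontrivially normed field. -/
noncomputable abbrev Param.nontriviallyNormedField : NontriviallyNormedField (hull B z) :=
  { (inferInstance : NormedField (hull B z)) with
    non_trivial := by
      obtain ⟨x, hx, h⟩ := hz.exists_one_lt_norm (isGood_hull B z).le (mem_hull B z)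
      exact ⟨⟨x, hx⟩, h⟩ }

omit hz [IsUltrametricDist C] [IsAlgClosed C] in
theorem completeSpace_hull : CompleteSpace (hull B z) :=
  (isGood_hull B z).isClosed.completeSpace_coe

omit [IsUltrametricDist C] [IsAlgClosed C] in
theorem Param.norm_algEquiv (σ : W ≃ₐ[hull B z] W) (x : W) : ‖σ x‖ = ‖x‖ := by
  let := hz.nontriviallyNormedField
  have : CompleteSpace (hull B z) := completeSpace_hull
  let : NormedAlgebra (hull B z) W :=
    { (inferInstance : Algebra (hull B z) W) with
      norm_smul_le := fun r x => by
        rw [Algebra.smul_def]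
        exact (norm_mul (algebraMap (hull B z) W r : C) (x : C)).le }
  exact Ultra.norm_algEquiv σ x

omit [IsUltrametricDist C] [IsAlgClosed C] in
theorem Param.isClosed : IsClosed (W : Set C) := by
  let := hz.nontriviallyNormedField
  have : CompleteSpace (hull B z) := completeSpace_hull
  let : NormedAlgebra (hull B z) C :=
    { (inferInstance : Algebra (hull B z) C) with
      norm_smul_le := fun r x => by
        rw [Algebra.smul_def]
        exact (norm_mul (r : C) (x : C)).le }
  exact isClosed_intermediateField W

theorem Param.isGood_of_isGalois [IsGalois (hull B z) W] (hκ : IsResidueSection κ) (hκB : κ ≤ B)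
    (p : ℕ) [ExpChar C p] : IsGood B W.toSubfield where
  isClosed := hz.isClosed (W := W)
  le := (isGood_hull B z).le.trans fun x hx => W.algebraMap_mem ⟨x, hx⟩
  tame := by
    classical
    have hD : ∀ x ∈ hull B z, x ∈ W.toSubfield := fun x hx => W.algebraMap_mem ⟨x, hx⟩
    have hB := (isGood_hull B z).le
    intro n hn c hc
    rcases eq_or_ne c 0 with rfl | hc0
    · exact W.zero_mem
    set d := Module.finrank (hull B z) W with hd
    have hd0 : d ≠ 0 := Module.finrank_pos.ne'
    set x : W := ⟨c ^ n, hc⟩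
    have hx0 : (x : C) ≠ 0 := pow_ne_zero n hc0
    set N := Algebra.norm (hull B z) x
    have hN : ‖(N : C)‖ = ‖c ^ n‖ ^ d := by
      have h1 : ((algebraMap (hull B z) W N : W) : C) = ((∏ σ : W ≃ₐ[hull B z] W, σ x : W) : C) := by
        rw [Algebra.norm_eq_prod_automorphisms]
      have h2 : ((algebraMap (hull B z) W N : W) : C) = N := rfl
      rw [← h2, h1]
      push_cast
      rw [norm_prod, Finset.prod_congr rfl (fun σ _ => (hz.norm_algEquiv σ x : ‖((σ x : W) : C)‖ = ‖(x : C)‖)), Finset.prod_const,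
        card_univ, ← Nat.card_eq_fintype_card, IsGalois.card_aut_eq_finrank]
    have hncop : p.Coprime n ∧ ∃ r m', d = p ^ r * m' ∧ (m' : C) ≠ 0 := by
      rcases ‹ExpChar C p› with _ | ⟨hp⟩
      · exact ⟨Nat.coprime_one_left n, 0, d, by simp, by exact_mod_cast hd0⟩
      · have : Fact p.Prime := ⟨hp⟩
        refine ⟨(Nat.Prime.coprime_iff_not_dvd hp).mpr fun h => hn ?_, ?_⟩
        · exact (CharP.cast_eq_zero_iff C p n).mpr h
        · obtain ⟨r, m', h1, h2⟩ := Nat.exists_eq_pow_mul_and_not_dvd hd0 p hp.ne_one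
          exact ⟨r, m', h2, fun h => h1 ((CharP.cast_eq_zero_iff C p m').mp h)⟩
    obtain ⟨hcop, r, m', hdm, hm'⟩ := hncop
    have hnm0 : ((n * m' : ℕ) : C) ≠ 0 := by push_cast; exact mul_ne_zero hn hm'
    have hnm00 : n * m' ≠ 0 := by rintro h; rw [h] at hnm0; simp at hnm0
    obtain ⟨N', hN'⟩ := exists_pow_nat_eq (N : C) (Nat.pos_of_ne_zero hnm00)
    have hN'D : N' ∈ hull B z := (isGood_hull B z).tame _ hnm0 _ (hN' ▸ N.2)
    have hN'n : ‖N'‖ = ‖c‖ ^ p ^ r := by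
      refine (pow_left_inj₀ (norm_nonneg _) (by positivity) hnm00).mp ?_
      rw [← norm_pow, hN', hN, norm_pow, ← pow_mul, ← pow_mul, hdm]
      congr 1; ring
    have hcop' : IsCoprime (n : ℤ) ((p ^ r : ℕ) : ℤ) :=
      Nat.isCoprime_iff_coprime.mpr (hcop.symm.pow_right r)
    obtain ⟨u, v, huv⟩ := hcop'
    have hcpos := norm_pos_iff.mpr hc0
    refine exists_near_root (E := W.toSubfield) (hz.isClosed (W := W)) hκ (hκB.trans (hB.trans hD)) hn hc
      (e := (c ^ n) ^ u * N' ^ v) (W.mul_mem (zpow_mem hc u) (zpow_mem (hD _ hN'D) v)) ?_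
    rw [norm_mul, norm_zpow, norm_zpow, norm_pow, hN'n, ← zpow_natCast, ← zpow_natCast ‖c‖ (p ^ r),
      ← zpow_mul, ← zpow_mul, ← zpow_add₀ hcpos.ne', mul_comm (n : ℤ), mul_comm _ v, huv, zpow_one]

/-- A finite Galois extension of the hull of a parameter is again the hull of a parameter. -/
theorem Param.exists_hull_eq [IsAlgClosed B] [IsGalois (hull B z) W] (hκ : IsResidueSection κ)
    (hκB : κ ≤ B) (p : ℕ) [ExpChar C p] {Ω : Subfield C} (hΩ : IsAlgClosed Ω) (hBΩ : B ≤ Ω)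
    (hzΩ : z ∈ Ω) : ∃ T, Param B T ∧ T ∈ Ω ∧ z ∈ hull B T ∧ hull B T = W.toSubfield := by
  have hW := hz.isGood_of_isGalois (W := W) hκ hκB p
  have hD : ∀ x ∈ hull B z, x ∈ W.toSubfield := fun x hx => W.algebraMap_mem ⟨x, hx⟩
  let P : C → Prop := fun T => Param B T ∧ T ∈ Ω ∧ z ∈ hull B T ∧ T ∈ W
  have hsub : ∀ T, P T → ∀ x : hull B z, (x : C) ∈ hull B T := fun T hT x =>
    hull_le (isGood_hull B T) hT.2.2.1 x.2
  let F : ∀ T, P T → IntermediateField (hull B z) W := fun T hT =>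
    { carrier := {w | (w : C) ∈ hull B T}
      mul_mem' := fun ha hb => (hull B T).mul_mem ha hb
      add_mem' := fun ha hb => (hull B T).add_mem ha hb
      algebraMap_mem' := hsub T hT
      inv_mem' := fun _ ha => (hull B T).inv_mem ha }
  have hmax := (wellFounded_gt (α := Submodule (hull B z) W)).has_min
    {V | ∃ T, ∃ hT : P T, V = (F T hT).toSubmodule}
    ⟨_, z, ⟨hz, hzΩ, mem_hull B z, hD z (mem_hull B z)⟩, rfl⟩
  obtain ⟨_, ⟨T, hT, rfl⟩, hmax⟩ := hmax
  have hgood := isGood_hull B T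
  have hle : hull B T ≤ W.toSubfield := hull_le hW hT.2.2.2
  refine ⟨T, hT.1, hT.2.1, hT.2.2.1, le_antisymm hle ?_⟩
  by_contra hne
  obtain ⟨x, hxW, hxT⟩ := Set.not_subset.mp hne
  have hcopn : ∀ n : ℕ, p.Coprime n → n ≠ 0 → (n : C) ≠ 0 := by
    intro n hpn hn0
    rcases ‹ExpChar C p› with _ | ⟨hp⟩
    · exact_mod_cast hn0
    · rw [Ne, CharP.cast_eq_zero_iff C p]
      exact (Nat.Prime.coprime_iff_not_dvd hp).mp hpn
  have : ExpChar W p := ((algebraMap W C).expChar_iff (algebraMap W C).injective p).mpr ‹_›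
  obtain ⟨hp, a, ha, haT⟩ := exists_artinSchreier_of_normed (D := F T hT) (L := W) p
    (fun σ x => hz.norm_algEquiv (σ.restrictScalars (hull B z)) x)
    (by
      intro a ha
      obtain ⟨c, hc, hca⟩ := hκ.exists_norm_sub_lt (a : C) ha
      exact ⟨⟨⟨c, hle (hgood.le (hκB hc))⟩, hgood.le (hκB hc)⟩, hca⟩)
    (by
      intro n hpn hn0 d
      obtain ⟨e, he⟩ := exists_pow_nat_eq ((d : W) : C) (Nat.pos_of_ne_zero hn0)
      have heT : e ∈ hull B T := hgood.tame n (hcopn n hpn hn0) e (he ▸ d.2)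
      refine ⟨⟨⟨e, hle heT⟩, heT⟩, ?_⟩
      rw [← norm_pow]
      exact (congrArg norm he).symm)
    (fun n hpn hn0 => hκ.norm_natCast (hcopn n hpn hn0))
    ⟨⟨x, hxW⟩, by rintro ⟨y, hy⟩; exact hxT (by rw [← show ((y : W) : C) = x from congrArg _ hy]; exact y.2)⟩
  have : Fact p.Prime := ⟨hp⟩
  have : CharP C p := by
    rcases ‹ExpChar C p› with _ | ⟨_⟩
    · exact absurd hp Nat.not_prime_one
    · assumption
  have ha' : (a : C) ∉ hull B T := fun h => ha ⟨⟨a, h⟩, rfl⟩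
  have haT' : (a : C) ^ p - a ∈ hull B T := by
    obtain ⟨y, hy⟩ := haT
    rw [← show ((y : W) : C) = (a : C) ^ p - a from congrArg _ hy]; exact y.2
  obtain ⟨T', hT', hstep⟩ := hT.1.exists_step hκ hκB ha' haT'
  have hTT' : hull B T ≤ hull B T' :=
    hull_le (isGood_hull B T') (hstep.mem_of_mem _ (isGood_hull B T') (mem_hull B T'))
  have hT'W : T' ∈ W := by
    have := W.add_mem (hle hstep.sub_mem) a.2
    rwa [sub_add_cancel] at this
  have hPT' : P T' := ⟨hT', hstep.mem_of_isAlgClosed Ω hΩ hBΩ hT.2.1, hTT' hT.2.2.1, hT'W⟩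
  refine hmax _ ⟨T', hPT', rfl⟩ ?_
  refine lt_of_le_of_ne (fun w hw => hTT' hw) fun heq => ha' ?_
  have haT'2 : (a : C) ∈ hull B T' := by
    have := (hull B T').sub_mem (mem_hull B T') (hTT' hstep.sub_mem)
    rwa [sub_sub_cancel] at this
  have : a ∈ (F T' hPT').toSubmodule := haT'2
  rw [← heq] at this
  exact this

end

end

section

variable {C : Type*} [NormedField C] [IsUltrametricDist C]
  {κ B : Subfield C}

theorem TypeII.exists_dominant_of_norm_eq [IsAlgClosed B] {t T S : C} {n : ℕ} (hn : n ≠ 0)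
    (ht : t ^ n = T) (hT : TypeII B T) (hS : ‖S‖ = ‖T‖) {y : C} (hy : y ∈ laurent B t)
    (hSy : ‖S - y‖ < ‖S‖) : ∃ f : ℤ →₀ B, y = ∑ i ∈ f.support, (f i : C) * t ^ i ∧
      (n : ℤ) ∈ f.support ∧ (∀ i ∈ f.support, i ≠ n → ‖(f i : C) * t ^ i‖ < ‖(f n : C) * t ^ (n : ℤ)‖) ∧
      ‖(f n : C)‖ = 1 := by
  have htII : TypeII B t := TypeII.of_pow (n := n) (ht ▸ hT)
  obtain ⟨f, rfl⟩ := Finsupp.mem_span_range_iff_exists_finsupp.mp hy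
  have hyS := norm_eq_of_sub_lt hSy
  have hf : f ≠ 0 := by
    rintro rfl
    rw [Finsupp.sum_zero_index, norm_zero, hS] at hyS
    exact hT.ne_zero (norm_eq_zero.mp hyS.symm)
  obtain ⟨j, hj, hdom⟩ := htII.exists_dominant hf
  have hfj : (f j : C) ≠ 0 := by simpa using hj
  have h1 := (norm_sum_eq_of_dominant (f := fun i => (f i : C) * t ^ i) hj
    (mul_ne_zero hfj (zpow_ne_zero _ htII.ne_zero)) hdom).1
  have h2 : ‖(f j : C) * t ^ j‖ = ‖t ^ (n : ℤ)‖ := by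
    rw [← h1, zpow_natCast, ht, ← hS, ← hyS]; rfl
  have hjn : j = n := by
    by_contra hne
    refine htII.zpow (i := n - j) (sub_ne_zero.mpr (Ne.symm hne)) (f j) ?_
    rw [zpow_sub₀ htII.ne_zero, norm_div, ← h2, norm_mul,
      mul_div_cancel_right₀ _ (norm_ne_zero_iff.mpr (zpow_ne_zero _ htII.ne_zero))]
  subst hjn
  refine ⟨f, rfl, hj, hdom, ?_⟩
  rw [norm_mul] at h2
  exact mul_eq_right₀ (norm_ne_zero_iff.mpr (zpow_ne_zero _ htII.ne_zero)) |>.mp h2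

variable [IsAlgClosed C] [CompleteSpace C]

theorem TypeII.exists_residue_ratio [IsAlgClosed B] (hκ : IsResidueSection κ) (hκB : κ ≤ B)
    {T S : C} (hT : TypeII B T) (hS : S ∈ hull B T) (hST : ‖S‖ = ‖T‖) :
    ∃ c ∈ κ, c ≠ 0 ∧ ‖S - c * T‖ < ‖T‖ := by
  have hT0 := norm_pos_iff.mpr hT.ne_zero
  obtain ⟨t, n, hn, ht, y, hy, hSy⟩ := hT.hull_approx hκ hκB hS (hST ▸ hT0 : 0 < ‖S‖)
  obtain ⟨f, rfl, hnf, hdom, hfn⟩ := hT.exists_dominant_of_norm_eq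
    (by rintro rfl; simp at hn) ht hST hy hSy
  have hf0 : (f n : C) ≠ 0 := norm_pos_iff.mp (hfn ▸ one_pos)
  have ht0 : t ≠ 0 := (TypeII.of_pow (n := n) (ht ▸ hT)).ne_zero
  have h1 := (norm_sum_eq_of_dominant (f := fun i => (f i : C) * t ^ i) hnf
    (mul_ne_zero hf0 (zpow_ne_zero _ ht0)) hdom).2
  obtain ⟨c, hc, hcf⟩ := hκ.exists_norm_sub_lt (f n : C) hfn.le
  have hc1 : ‖c‖ = 1 := hfn ▸ norm_eq_of_sub_lt (hfn ▸ hcf)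
  refine ⟨c, hc, norm_pos_iff.mp (hc1 ▸ one_pos), ?_⟩
  rw [zpow_natCast, ht, norm_mul, hfn, one_mul] at h1
  have h2 : S - c * T = (S - ∑ i ∈ f.support, (f i : C) * t ^ i)
    + ((∑ i ∈ f.support, (f i : C) * t ^ i - f n * T) + (f n - c) * T) := by ring
  rw [h2]
  refine norm_add_lt (hST ▸ hSy) (norm_add_lt h1 ?_)
  rw [norm_mul]
  exact mul_lt_of_lt_one_left hT0 hcf

theorem TypeII.mem_hull_of_norm_sub_lt [IsAlgClosed B] (hκ : IsResidueSection κ) (hκB : κ ≤ B)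
    {T S : C} (hT : TypeII B T) (hS : S ∈ hull B T) (hST : ‖S‖ = ‖T‖) : T ∈ hull B S := by
  have hT0 := norm_pos_iff.mpr hT.ne_zero
  have hE := isGood_hull B S
  refine mem_of_forall_near hE.isClosed fun ε hε hε1 => ?_
  obtain ⟨t, n, hn, ht, y, hy, hSy⟩ := hT.hull_approx hκ hκB hS (mul_pos hε hT0)
  have hn0 : n ≠ 0 := by rintro rfl; simp at hn
  obtain ⟨f, rfl, hnf, hdom, hfn⟩ := hT.exists_dominant_of_norm_eq hn0 ht hST hy
    (hSy.trans_le (by rw [hST]; exact mul_le_of_le_one_left hT0.le hε1.le))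
  have ht0 : t ≠ 0 := (TypeII.of_pow (n := n) (ht ▸ hT)).ne_zero
  obtain ⟨e, he⟩ := exists_pow_nat_eq S (Nat.pos_of_ne_zero hn0)
  have heE : e ∈ hull B S := hE.tame n hn e (he ▸ mem_hull B S)
  have hte : ‖t‖ = ‖e‖ := by
    refine (pow_left_inj₀ (norm_nonneg _) (norm_nonneg _) hn0).mp ?_
    rw [← norm_pow, ← norm_pow, ht, he, hST]
  obtain ⟨b, hb, -, hbe⟩ := hκ.exists_ratio ht0 hte
  obtain ⟨x, hx, htx⟩ := exists_near_of_dominant (E := hull B S) (s := f.support)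
    (d := fun i => f i) (j := n) (X := t) (e := S) (fun i _ => hE.le (f i).2) hnf
    (by simpa using hκ.norm_natCast hn) ht0 (norm_pos_iff.mp (hfn ▸ one_pos)) hdom
    ((hull B S).mul_mem (hE.le (hκB hb)) heE) hbe (mem_hull B S) hε hε1 (by
      rw [norm_mul, hfn, one_mul, zpow_natCast, ht, norm_sub_rev]; exact hSy.le)
  refine ⟨x ^ n, (hull B S).pow_mem hx n, ?_⟩
  have htp := norm_pos_iff.mpr ht0
  have h1 : ‖x / t - 1‖ ≤ ε := by
    rw [div_sub_one ht0, norm_div, div_le_iff₀ htp, norm_sub_rev]; exact htx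
  have h2 := norm_zpow_sub_zpow_le (a := x / t) (b := 1) hε1 h1 (by simpa using hε.le) n
  rw [one_zpow, zpow_natCast, div_pow, div_sub_one (pow_ne_zero n ht0), norm_div,
    div_le_iff₀ (norm_pos_iff.mpr (pow_ne_zero n ht0)), ht] at h2
  rw [norm_sub_rev]
  exact h2.trans (mul_le_mul_of_nonneg_right h1 hT0.le)

/-- A linear combination of conjugates of a type II parameter generating the same hull. -/
theorem TypeII.exists_pull_down [IsAlgClosed B] (hκ : IsResidueSection κ) (hκB : κ ≤ B)
    {T : C} (hT : TypeII B T) {ι : Type*} [Fintype ι] [Nonempty ι] {S : ι → C}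
    (hS : ∀ i, S i ∈ hull B T) (hST : ∀ i, ‖S i‖ = ‖T‖) {𝒮 : Set (ι → C)}
    (h𝒮κ : ∀ b ∈ 𝒮, ∀ i, b i ∈ κ)
    (h𝒮 : ∀ c : ι → C, (∀ i, c i ∈ κ) → c ≠ 0 → ∃ b ∈ 𝒮, ∑ i, b i * c i ≠ 0) :
    ∃ b ∈ 𝒮, T ∈ hull B (∑ i, b i * S i) := by
  have hT0 := norm_pos_iff.mpr hT.ne_zero
  choose c hcκ hc0 hcS using fun i => hT.exists_residue_ratio hκ hκB (hS i) (hST i)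
  obtain ⟨b, hb, hbc⟩ := h𝒮 c hcκ (fun h => hc0 (Classical.arbitrary ι) (congrFun h _))
  have hE := isGood_hull B T
  refine ⟨b, hb, hT.mem_hull_of_norm_sub_lt hκ hκB ((hull B T).sum_mem fun i _ =>
    (hull B T).mul_mem (hE.le (hκB (h𝒮κ b hb i))) (hS i)) ?_⟩
  have h1 : ‖(∑ i, b i * c i) * T‖ = ‖T‖ := by
    rw [norm_mul, hκ.norm_eq_one _ (κ.sum_mem fun i _ => κ.mul_mem (h𝒮κ b hb i) (hcκ i)) hbc, one_mul]
  rw [← h1]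
  refine norm_eq_of_sub_lt ?_
  rw [h1, norm_sub_rev, sum_mul, ← sum_sub_distrib]
  refine norm_sum_lt _ _ hT0 fun i _ => ?_
  rw [mul_assoc, ← mul_sub, norm_mul]
  refine (mul_le_of_le_one_left (norm_nonneg _) ?_).trans_lt (hcS i)
  rcases eq_or_ne (b i) 0 with h | h
  · simp [h]
  · exact (hκ.norm_eq_one _ (h𝒮κ b hb i) h).le

end

section

variable {C : Type*} [NormedField C]

/-- The filter of elements of `B` close to `T`. -/
def nearby (B : Subfield C) (T : C) : Filter B where
  sets := {s | ∃ α₀ : B, ∀ α : B, ‖T - α‖ ≤ ‖T - α₀‖ → α ∈ s}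
  univ_sets := ⟨0, fun _ _ => trivial⟩
  sets_of_superset := fun ⟨α₀, h⟩ hst => ⟨α₀, fun α hα => hst (h α hα)⟩
  inter_sets := by
    rintro s t ⟨α₀, h⟩ ⟨α₁, h'⟩
    rcases le_total ‖T - α₀‖ ‖T - α₁‖ with hle | hle
    · exact ⟨α₀, fun α hα => ⟨h α hα, h' α (hα.trans hle)⟩⟩
    · exact ⟨α₁, fun α hα => ⟨h α (hα.trans hle), h' α hα⟩⟩

theorem eventually_nearby {B : Subfield C} {T : C} {P : B → Prop} :
    (∀ᶠ α in nearby B T, P α) ↔ ∃ α₀ : B, ∀ α : B, ‖T - α‖ ≤ ‖T - α₀‖ → P α := Iff.rfl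

instance (B : Subfield C) (T : C) : (nearby B T).NeBot :=
  ⟨fun h => by
    obtain ⟨α₀, h⟩ := Filter.empty_mem_iff_bot.mpr h
    exact h α₀ le_rfl⟩

variable [IsUltrametricDist C]

omit [IsUltrametricDist C] in
theorem aeval_eq_sum_taylor {B : Subfield C} (T : C) (q : B[X]) (α : B) {N : ℕ}
    (hN : q.natDegree < N) :
    aeval T q = ∑ i ∈ range N, ((taylor α q).coeff i : C) * (T - α) ^ i := by
  have h2 : eval (T - α) ((taylor α q).map (algebraMap B C)) = aeval T q := by
    rw [eval_map, taylor_apply, eval₂_comp, aeval_def]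
    simp only [eval₂_add, eval₂_X, eval₂_C]
    rw [show T - (α : C) + algebraMap B C α = T from sub_add_cancel _ _]
  rw [← h2, eval_map, eval₂_eq_sum_range' _ (by rwa [natDegree_taylor])]
  rfl

theorem TypeI.eventually_coeff_lt {B : Subfield C} [IsAlgClosed B] {T : C} (h : TypeI B T)
    (q : B[X]) {ρ : ℝ} (hq : ‖aeval T q‖ < ρ) :
    ∀ᶠ α in nearby B T, ∀ l, ‖((taylor α q).coeff l : C)‖ * ‖T - α‖ ^ l < ρ := by
  have hρ := (norm_nonneg _).trans_lt hq
  rcases eq_or_ne q 0 with rfl | hq0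
  · exact Filter.Eventually.of_forall fun α l => by simpa using hρ
  filter_upwards [eventually_nearby.mpr (h.exists_constDominant hq0),
    eventually_nearby.mpr (h.exists_norm_sub_eval_lt hq0)] with α h1 h2 l
  have h3 : ‖((taylor α q).coeff 0 : C)‖ < ρ := by
    rw [taylor_coeff_zero]
    exact (norm_eq_of_sub_lt (by rwa [norm_sub_rev])).ge.trans_lt hq
  rcases eq_or_ne l 0 with rfl | hl
  · simpa using h3
  · have := h1 l hl
    simp only [coeff_map] at this
    exact this.trans h3

variable {B : Subfield C} [IsAlgClosed B]

/-- If `q(T)` is close to a generator of the hull of `T`, then the linear term of `q` dominates. -/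
theorem TypeI.eventually_linear_dominant {T : C} (h : TypeI B T) {ρ : ℝ}
    (hρT : ∀ α : B, ρ ≤ ‖T - α‖) {g q : B[X]} (hu : ‖aeval T (g.comp q - X)‖ < ρ) :
    ∀ᶠ α in nearby B T, (taylor α q).coeff 1 ≠ 0 ∧ ∀ l, 2 ≤ l →
      ‖((taylor α q).coeff l : C)‖ * ‖T - α‖ ^ (l - 1) < ‖((taylor α q).coeff 1 : C)‖ := by
  filter_upwards [h.eventually_coeff_lt _ hu] with α hα
  set r := ‖T - α‖ with hr
  have hr0 : 0 < r := norm_pos_iff.mpr (h.sub_ne_zero α)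
  set u := g.comp q - X with hudef
  have hul : ∀ l, 1 ≤ l → ‖((taylor α u).coeff l : C)‖ * r ^ (l - 1) < 1 := by
    intro l hl
    have h1 := (hα l).trans_le (hρT α)
    obtain ⟨m, rfl⟩ := Nat.exists_eq_add_of_le' hl
    rw [pow_succ, ← mul_assoc] at h1
    simpa using (mul_lt_iff_lt_one_left hr0).mp h1
  -- injectivity of `g ∘ q`
  have hinj : ∀ β : B, ‖(β - α : C)‖ ≤ r → q.eval β = q.eval α → β = α := by
    intro β hβ heq
    by_contra hne
    have hne' : (β - α : C) ≠ 0 := 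
      _root_.sub_ne_zero.mpr fun h => hne (Subtype.ext h)
    have h0 := norm_pos_iff.mpr hne'
    have e1 : aeval (β : C) u - aeval (α : C) u = -(β - α : C) := by
      have hev : ∀ x : B, aeval (x : C) u = (g.eval (q.eval x) : B) - (x : C) := by
        intro x
        have : aeval (x : C) u = ((u.eval x : B) : C) :=
          aeval_algebraMap_apply_eq_algebraMap_eval x u
        rw [this, hudef]; simp
      rw [hev, hev, heq]; ring
    have e2 := aeval_eq_sum_taylor (β : C) u α (Nat.lt_succ_self _)
    have e3 := aeval_eq_sum_taylor (α : C) u α (Nat.lt_succ_self _)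
    rw [sum_range_succ'] at e2 e3
    rw [e2, e3] at e1
    have : ‖(β - α : C)‖ < ‖(β - α : C)‖ := by
      conv_lhs => rw [← norm_neg, ← e1]
      simp only [sub_self, pow_zero, mul_one, zero_pow (Nat.succ_ne_zero _), mul_zero,
        Finset.sum_const_zero, zero_add, add_sub_cancel_right]
      refine norm_sum_lt _ _ h0 fun l _ => ?_
      rw [norm_mul, norm_pow, pow_succ, ← mul_assoc]
      refine mul_lt_of_lt_one_left h0 (lt_of_le_of_lt ?_ (hul (l + 1) (by omega)))
      exact mul_le_mul_of_nonneg_left (pow_le_pow_left₀ h0.le hβ _) (norm_nonneg _)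
    exact lt_irrefl _ this
  have hq1 : (taylor α q).coeff 1 ≠ 0 := by
    intro h0
    have h1 := hul 1 le_rfl
    rw [taylor_coeff_one] at h0 h1
    rw [hudef, derivative_sub, derivative_comp, eval_sub, eval_mul, h0] at h1
    simp at h1
  refine ⟨hq1, fun l hl => ?_⟩
  obtain ⟨m, hm⟩ : X - Polynomial.C α ∣ q - Polynomial.C (q.eval α) := by
    rw [dvd_iff_isRoot]; simp
  have hcoef : ∀ l, (taylor α q).coeff (l + 1) = (taylor α m).coeff l := by
    intro l
    have h1 := congrArg (fun p => (taylor α p).coeff (l + 1)) hm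
    simp only [map_sub, taylor_mul, taylor_X, taylor_C, coeff_sub, coeff_C_succ, sub_zero,
      add_sub_cancel_right, coeff_X_mul] at h1
    exact h1
  have hm0 : m ≠ 0 := by
    rintro rfl
    rw [hcoef 0] at hq1; simp at hq1
  have hdom := constDominant_of_roots hm0 (α := α) hr0 (by
    intro β hβ
    by_contra! hle
    have hβ0 : m.eval β = 0 := (mem_roots hm0).mp hβ
    have h2 := hinj β (by rw [norm_sub_rev]; exact hle) (by
      have := congrArg (eval β) hm
      simp [hβ0, sub_eq_zero] at this
      exact this)
    rw [hcoef 0, taylor_coeff_zero, ← h2] at hq1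
    exact hq1 hβ0)
  obtain ⟨n, rfl⟩ := Nat.exists_eq_add_of_le' hl
  have := hdom (n + 1) (by omega)
  rw [coeff_map, coeff_map, ← hcoef, ← hcoef] at this
  exact this

omit [IsUltrametricDist C] [IsAlgClosed B] in
theorem aeval_sub_eval_eq_sum (T : C) (q : B[X]) (α : B) {N : ℕ} (hN : q.natDegree ≤ N) :
    aeval T q - (q.eval α : B) =
      ∑ i ∈ range N, ((taylor α q).coeff (i + 1) : C) * (T - α) ^ (i + 1) := by
  rw [aeval_eq_sum_taylor T q α (Nat.lt_succ_of_le hN), sum_range_succ', taylor_coeff_zero]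
  ring

/-- A polynomial whose linear term dominates has large derivative if its values stay away from
a point close to its value at `T`. -/
theorem TypeI.one_le_norm_derivative {T : C} (h : TypeI B T) {ρ : ℝ} (hρ : 0 < ρ)
    (hρT' : ∀ η > ρ, ∃ α : B, ‖T - α‖ < η) {T' : C}
    (hT' : ∀ β : B, ρ ≤ ‖T' - β‖) {q : B[X]} (hq : ‖T' - aeval T q‖ < ρ)
    (hdom : ∀ᶠ α in nearby B T, (taylor α q).coeff 1 ≠ 0 ∧ ∀ l, 2 ≤ l →
      ‖((taylor α q).coeff l : C)‖ * ‖T - α‖ ^ (l - 1) < ‖((taylor α q).coeff 1 : C)‖) :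
    1 ≤ ‖aeval T (derivative q)‖ ∧ ∀ᶠ α in nearby B T,
      ‖((taylor α q).coeff 1 : C) - aeval T (derivative q)‖ < ‖aeval T (derivative q)‖ := by
  have hd0 : derivative q ≠ 0 := by
    intro h0
    obtain ⟨α, hα⟩ := hdom.exists
    rw [taylor_coeff_one, h0] at hα
    simp at hα
  have hd : ∀ᶠ α in nearby B T,
      ‖((taylor α q).coeff 1 : C) - aeval T (derivative q)‖ < ‖aeval T (derivative q)‖ := by
    filter_upwards [eventually_nearby.mpr (h.exists_norm_sub_eval_lt hd0)] with α hα
    rw [taylor_coeff_one, norm_sub_rev]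
    have := norm_eq_of_sub_lt (x := ((eval α (derivative q) : B) : C)) (by rwa [norm_sub_rev])
    rwa [this]
  refine ⟨?_, hd⟩
  set m := ‖aeval T (derivative q)‖ with hm
  by_contra! hm1
  obtain ⟨α₀, hα₀⟩ := eventually_nearby.mp (hdom.and hd)
  have hm0 : 0 < m := (norm_nonneg _).trans_lt (hα₀ α₀ le_rfl).2
  obtain ⟨α₁, hα₁⟩ := hρT' (ρ / m) ((lt_div_iff₀ hm0).mpr (mul_lt_of_lt_one_right hρ hm1))
  obtain ⟨α, hα, hα'⟩ : ∃ α : B, ‖T - α‖ ≤ ‖T - α₀‖ ∧ ‖T - α‖ < ρ / m := by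
    rcases le_total ‖T - α₀‖ ‖T - α₁‖ with hle | hle
    · exact ⟨α₀, le_rfl, hle.trans_lt hα₁⟩
    · exact ⟨α₁, hle, hα₁⟩
  obtain ⟨⟨h1, h2⟩, h3⟩ := hα₀ α hα
  have hr0 : 0 < ‖T - α‖ := norm_pos_iff.mpr (h.sub_ne_zero α)
  have h4 : ‖((taylor α q).coeff 1 : C)‖ = m :=
    norm_eq_of_sub_lt (x := aeval T (derivative q)) (by rwa [norm_sub_rev])
  have h5 : ‖aeval T q - (q.eval α : B)‖ ≤ m * ‖T - α‖ := by
    rw [aeval_sub_eval_eq_sum T q α le_rfl]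
    refine norm_sum_le _ _ (by positivity) fun i _ => ?_
    rw [norm_mul, norm_pow, pow_succ, ← mul_assoc]
    refine mul_le_mul_of_nonneg_right ?_ hr0.le
    rcases Nat.eq_zero_or_pos i with rfl | hi
    · simpa using h4.le
    · rw [← h4]; exact (h2 (i + 1) (by omega)).le
  have h6 : ‖T' - (q.eval α : B)‖ < ρ := by
    rw [← sub_add_sub_cancel _ (aeval T q)]
    exact norm_add_lt hq (h5.trans_lt (by rwa [mul_comm, ← lt_div_iff₀ hm0]))
  exact absurd (hT' _) h6.not_ge

variable [IsAlgClosed C] [CompleteSpace C] {κ : Subfield C}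

/-- A linear combination of conjugates of a type I parameter generating the same hull. -/
theorem TypeI.exists_pull_down (hκ : IsResidueSection κ) (hκB : κ ≤ B)
    {T : C} (hT : TypeI B T) {ρ : ℝ} (hρ : 0 < ρ)
    (hρT : ∀ α : B, ρ ≤ ‖T - α‖) (hρT' : ∀ η > ρ, ∃ α : B, ‖T - α‖ < η)
    {ι : Type*} [Fintype ι] [Nonempty ι] {S : ι → C}
    (hS : ∀ i, S i ∈ hull B T) (hTS : ∀ i, T ∈ hull B (S i)) (hSI : ∀ i, TypeI B (S i))
    (hSρ : ∀ i, ∀ α : B, ρ ≤ ‖S i - α‖) {𝒮 : Set (ι → C)}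
    (h𝒮κ : ∀ b ∈ 𝒮, ∀ i, b i ∈ κ)
    (h𝒮 : ∀ c : ι → C, (∀ i, c i ∈ κ) → c ≠ 0 → ∃ b ∈ 𝒮, ∑ i, b i * c i ≠ 0) :
    ∃ b ∈ 𝒮, T ∈ hull B (∑ i, b i * S i) := by
  have hδ : ∀ i, ∃ δ > 0, δ ≤ ρ ∧ ∀ q : B[X], ‖S i - aeval T q‖ < δ →
      ∀ᶠ α in nearby B T, (taylor α q).coeff 1 ≠ 0 ∧ ∀ l, 2 ≤ l →
        ‖((taylor α q).coeff l : C)‖ * ‖T - α‖ ^ (l - 1) < ‖((taylor α q).coeff 1 : C)‖ := by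
    intro i
    obtain ⟨g, hg⟩ := (hSI i).hull_approx hκ hκB (hTS i) hρ
    obtain ⟨δ, hδ, hδg⟩ := Metric.continuous_iff.mp (Polynomial.continuous_aeval g) (S i) ρ hρ
    refine ⟨min δ ρ, lt_min hδ hρ, min_le_right _ _, fun q hq => ?_⟩
    refine hT.eventually_linear_dominant hρT (g := g) ?_
    have h1 := hδg (aeval T q) (by rw [dist_eq_norm, norm_sub_rev]; exact hq.trans_le (min_le_left _ _))
    rw [map_sub, aeval_comp, aeval_X, ← sub_add_sub_cancel _ (aeval (S i) g)]
    refine norm_add_lt (by rwa [dist_eq_norm] at h1) (by rwa [norm_sub_rev])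
  choose δ hδ hδρ hdom using hδ
  choose q₀ hq₀ using fun i => hT.hull_approx hκ hκB (hS i) (hδ i)
  have hc := fun i => hT.one_le_norm_derivative hρ hρT' (hSρ i)
    ((hq₀ i).trans_le (hδρ i)) (hdom i _ (hq₀ i))
  set c : ι → C := fun i => aeval T (derivative (q₀ i)) with hcdef
  obtain ⟨i₀, -, hi₀⟩ := Finset.exists_max_image univ (fun i => ‖c i‖) Finset.univ_nonempty
  have hm1 : 1 ≤ ‖c i₀‖ := (hc i₀).1
  have hm0 : 0 < ‖c i₀‖ := one_pos.trans_le hm1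
  have hci0 := norm_pos_iff.mp hm0
  choose k hkκ hk using fun i => hκ.exists_norm_sub_lt (c i / c i₀) (by
    rw [norm_div]; exact div_le_one_of_le₀ (hi₀ i (mem_univ _)) hm0.le)
  obtain ⟨b, hb, hbk⟩ := h𝒮 k hkκ (fun h => by
    have h1 := hk i₀
    rw [h, div_self hci0] at h1
    simp at h1)
  have hb1 : ∀ i, ‖b i‖ ≤ 1 := by
    intro i
    rcases eq_or_ne (b i) 0 with h | h
    · simp [h]
    · exact (hκ.norm_eq_one _ (h𝒮κ b hb i) h).le
  have hsum : ‖∑ i, b i * c i‖ = ‖c i₀‖ := by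
    have h1 : ‖(∑ i, b i * k i) * c i₀‖ = ‖c i₀‖ := by
      rw [norm_mul, hκ.norm_eq_one _ (κ.sum_mem fun i _ => κ.mul_mem (h𝒮κ b hb i) (hkκ i)) hbk,
        one_mul]
    rw [← h1]
    refine norm_eq_of_sub_lt ?_
    rw [h1, norm_sub_rev, sum_mul, ← sum_sub_distrib]
    refine norm_sum_lt _ _ hm0 fun i _ => ?_
    rw [mul_assoc, ← mul_sub, norm_mul]
    refine (mul_le_of_le_one_left (norm_nonneg _) (hb1 i)).trans_lt ?_
    have h2 : c i - k i * c i₀ = (c i / c i₀ - k i) * c i₀ := by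
      rw [sub_mul, div_mul_cancel₀ _ hci0]
    rw [h2, norm_mul]
    exact mul_lt_of_lt_one_left hm0 (hk i)
  refine ⟨b, hb, mem_of_forall_near (isGood_hull B _).isClosed fun ε hε hε1 => ?_⟩
  choose q hq using fun i => hT.hull_approx hκ hκB (hS i) (lt_min (hδ i) (mul_pos hε hρ))
  have hqδ := fun i => (hq i).trans_le (min_le_left _ _)
  have hcoeff : ∀ᶠ α in nearby B T, ∀ i,
      (‖((taylor α (q i)).coeff 1 : C) - c i‖ < ‖c i‖) ∧ ∀ l, 2 ≤ l →
        ‖((taylor α (q i)).coeff l : C)‖ * ‖T - α‖ ^ (l - 1) < ‖c i₀‖ := by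
    refine Filter.eventually_all.mpr fun i => ?_
    have hv : ‖aeval T (q i - q₀ i)‖ < ρ := by
      rw [map_sub, ← sub_sub_sub_cancel_left _ _ (S i)]
      exact norm_sub_lt ((hq₀ i).trans_le (hδρ i)) ((hqδ i).trans_le (hδρ i))
    filter_upwards [hT.eventually_coeff_lt _ hv, hdom i _ (hqδ i), (hc i).2] with α h1 h2 h3
    have hr0 : 0 < ‖T - α‖ := norm_pos_iff.mpr (hT.sub_ne_zero α)
    have h4 : ‖((taylor α (q i)).coeff 1 : C) - c i‖ < ‖c i‖ := by
      have h5 := (h1 1).trans_le (hρT α)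
      rw [pow_one, mul_lt_iff_lt_one_left hr0, map_sub, coeff_sub] at h5
      push_cast at h5
      rw [← sub_add_sub_cancel _ ((taylor α (q₀ i)).coeff 1 : C)]
      exact norm_add_lt (h5.trans_le (hc i).1) h3
    refine ⟨h4, fun l hl => (h2.2 l hl).trans_le ?_⟩
    rw [norm_eq_of_sub_lt (x := c i) (by rwa [norm_sub_rev])]
    exact hi₀ i (mem_univ _)
  obtain ⟨α, hα, hαT⟩ := (hcoeff.and (eventually_nearby.mpr ⟨0, fun α h => h⟩)).exists
  rw [ZeroMemClass.coe_zero, sub_zero] at hαT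
  set X := T - (α : C) with hX
  have hX0 : X ≠ 0 := hT.sub_ne_zero α
  have hXn := norm_pos_iff.mpr hX0
  set Q : B[X] := ∑ i, Polynomial.C ⟨b i, hκB (h𝒮κ b hb i)⟩ * q i with hQ
  have hQcoeff : ∀ l, ((taylor α Q).coeff l : C) = ∑ i, b i * ((taylor α (q i)).coeff l : C) := by
    intro l
    rw [hQ, map_sum, finsetSum_coeff]
    push_cast
    refine sum_congr rfl fun i _ => ?_
    rw [taylor_mul, taylor_C, coeff_C_mul]
    rfl
  have hQ1 : ‖((taylor α Q).coeff 1 : C)‖ = ‖c i₀‖ := by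
    rw [← hsum]
    refine norm_eq_of_sub_lt ?_
    rw [hsum, hQcoeff, ← sum_sub_distrib]
    refine norm_sum_lt _ _ hm0 fun i _ => ?_
    rw [← mul_sub, norm_mul, norm_sub_rev]
    exact (mul_le_of_le_one_left (norm_nonneg _) (hb1 i)).trans_lt
      ((hα i).1.trans_le (hi₀ i (mem_univ _)))
  have hQl : ∀ l, 2 ≤ l → ‖((taylor α Q).coeff l : C)‖ * ‖X‖ ^ (l - 1) < ‖c i₀‖ := by
    intro l hl
    rw [← lt_div_iff₀ (by positivity), hQcoeff]
    refine norm_sum_lt _ _ (by positivity) fun i _ => ?_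
    rw [norm_mul, lt_div_iff₀ (by positivity), mul_assoc]
    exact (mul_le_of_le_one_left (by positivity) (hb1 i)).trans_lt ((hα i).2 l hl)
  set Tc := ∑ i, b i * S i with hTc
  have hE := isGood_hull B Tc
  have hTcQ : ‖aeval T Q - Tc‖ ≤ ε * ρ := by
    have : aeval T Q - Tc = ∑ i, b i * (aeval T (q i) - S i) := by
      rw [hQ, map_sum, hTc, ← sum_sub_distrib]
      refine sum_congr rfl fun i _ => ?_
      rw [map_mul, aeval_C, mul_sub]; rfl
    rw [this]
    refine norm_sum_le _ _ (by positivity) fun i _ => ?_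
    rw [norm_mul, norm_sub_rev]
    exact (mul_le_of_le_one_left (norm_nonneg _) (hb1 i)).trans
      ((hq i).trans_le (min_le_right _ _)).le
  have hdiff : ‖aeval T Q - Tc‖ ≤ ε * (‖c i₀‖ * ‖X‖) := by
    refine hTcQ.trans (mul_le_mul_of_nonneg_left ?_ hε.le)
    exact (hρT α).trans (le_mul_of_one_le_left hXn.le hm1)
  set N := Q.natDegree + 1 with hN
  have hsumX := aeval_sub_eval_eq_sum T Q α (N := N) (Nat.le_succ _)
  have hQ0 : ((taylor α Q).coeff 1 : C) ≠ 0 := norm_pos_iff.mp (hQ1 ▸ hm0)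
  have hdomQ : ∀ i, i ≠ 0 → ‖((taylor α Q).coeff (i + 1) : C) * X ^ (i + 1)‖ <
      ‖((taylor α Q).coeff 1 : C) * X‖ := by
    intro i hi
    rw [norm_mul, norm_mul, norm_pow, hQ1, pow_succ, ← mul_assoc]
    exact mul_lt_mul_of_pos_right (hQl (i + 1) (by omega)) hXn
  have hQX : 0 < ‖((taylor α Q).coeff 1 : C) * X‖ := norm_pos_iff.mpr (mul_ne_zero hQ0 hX0)
  have heE : Tc - (Q.eval α : B) ∈ hull B Tc := sub_mem (mem_hull B Tc) (hE.le (Q.eval α).2)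
  have hsum_e : ‖∑ i ∈ range N, ((taylor α Q).coeff (i + 1) : C) * X ^ (i + 1)
      - (Tc - (Q.eval α : B))‖ ≤ ε * ‖((taylor α Q).coeff 1 : C) * X‖ := by
    rw [← hsumX, sub_sub_sub_cancel_right, norm_mul, hQ1]
    exact hdiff
  obtain ⟨x, hx, hxX⟩ := exists_near_of_dominant (E := hull B Tc)
    (s := (range N).map ⟨fun i : ℕ => ((i + 1 : ℕ) : ℤ), fun a b h => by simpa using h⟩)
    (d := fun i => ((taylor α Q).coeff i.toNat : C)) (j := 1) (X := X)
    (r := (Tc - (Q.eval α : B)) / ((taylor α Q).coeff 1 : C)) (e := Tc - (Q.eval α : B))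
    (fun i _ => hE.le (Subtype.mem _))
    (mem_map.mpr ⟨0, by simp [hN], by simp⟩) (by simp) hX0 hQ0 (by
      intro i hi hi1
      obtain ⟨l, -, rfl⟩ := mem_map.mp hi
      have hl : l ≠ 0 := by rintro rfl; exact hi1 (by simp)
      have := hdomQ l hl
      change ‖(((taylor α Q).coeff ((l + 1 : ℕ) : ℤ).toNat : B) : C) * X ^ ((l + 1 : ℕ) : ℤ)‖ < _
      rwa [Int.toNat_natCast, zpow_natCast, zpow_one])
    (div_mem heE (hE.le (Subtype.mem _))) (by
      refine lt_of_mul_lt_mul_left ?_ (norm_nonneg ((taylor α Q).coeff 1 : C))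
      rw [← norm_mul, ← norm_mul, mul_sub, mul_div_cancel₀ _ hQ0]
      rw [← sub_add_sub_cancel _ (∑ i ∈ range N,
        ((taylor α Q).coeff (i + 1) : C) * X ^ (i + 1))]
      refine norm_add_lt ?_ (hsum_e.trans_lt (mul_lt_of_lt_one_left hQX hε1))
      rw [norm_sub_rev]
      have := (norm_sum_eq_of_dominant (s := range N) (j := 0)
        (f := fun i => ((taylor α Q).coeff (i + 1) : C) * X ^ (i + 1)) (by simp [hN])
        (norm_pos_iff.mp (by simpa only [zero_add, pow_one] using hQX)) (fun i _ hi => by simpa using hdomQ i hi)).2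
      simpa using this)
    heE hε hε1 (by
      rw [Finset.sum_map]
      change ‖∑ l ∈ range N, (((taylor α Q).coeff ((l + 1 : ℕ) : ℤ).toNat : B) : C) *
        X ^ ((l + 1 : ℕ) : ℤ) - _‖ ≤ _
      simp only [Int.toNat_natCast, zpow_natCast, zpow_one]
      exact hsum_e)
  refine ⟨x + α, add_mem hx (hE.le α.2), ?_⟩
  rw [← sub_sub, sub_right_comm]
  exact hxX.trans (mul_le_mul_of_nonneg_left hαT hε.le)

end

section

variable {Ω : Type*} [NormedField Ω]

/-- A henselian field `F₀`, with a subfield `k` and the relative algebraic closure `κ` of `k` in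
an algebraic closure of `F₀` representing its residue classes. -/
structure IsFrame (p : ℕ) (F₀ k κ : Subfield Ω) : Prop where
  isAlgebraic : ∀ x : Ω, IsAlgebraic F₀ x
  norm_ringEquiv : ∀ σ : Ω ≃+* Ω, (∀ x ∈ F₀, σ x = x) → ∀ x, ‖σ x‖ = ‖x‖
  section_κ : IsResidueSection κ
  mem_iff : ∀ x, x ∈ κ ↔ IsAlgebraic k x
  le : k ≤ F₀
  inter_le : ∀ x ∈ F₀, x ∈ κ → x ∈ k
  perfect : ∀ x ∈ k, ∃ y ∈ k, y ^ p = x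

/-- A maximal extension of `F₀` meeting `κ` in `k`. -/
structure IsComplement (F₀ k κ K : Subfield Ω) : Prop where
  le : F₀ ≤ K
  inter_le : ∀ x ∈ K, x ∈ κ → x ∈ k
  maximal : ∀ K' : Subfield Ω, K ≤ K' → (∀ x ∈ K', x ∈ κ → x ∈ K) → K' ≤ K

variable {p : ℕ} {F₀ k κ K : Subfield Ω}

theorem IsFrame.exists_isComplement (h : IsFrame p F₀ k κ) : ∃ K, IsComplement F₀ k κ K := by
  obtain ⟨K, hFK, hK⟩ := zorn_le_nonempty₀ {K : Subfield Ω | F₀ ≤ K ∧ ∀ x ∈ K, x ∈ κ → x ∈ k} (by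
    intro c hc hchain y hy
    refine ⟨sSup c, ⟨(hc hy).1.trans (le_sSup hy), fun x hx hxκ => ?_⟩, fun z hz => le_sSup hz⟩
    obtain ⟨s, hs, hxs⟩ := (Subfield.mem_sSup_of_directedOn ⟨y, hy⟩ hchain.directedOn).mp hx
    exact (hc hs).2 x hxs hxκ) F₀ ⟨le_rfl, h.inter_le⟩
  exact ⟨K, hFK, hK.prop.2, fun K' hK' h' => hK.le_of_ge
    ⟨hFK.trans hK', fun x hx hxκ => hK.prop.2 x (h' x hx hxκ) hxκ⟩ hK'⟩

theorem IsFrame.le_κ (h : IsFrame p F₀ k κ) : k ≤ κ := fun x hx =>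
  (h.mem_iff x).mpr (isAlgebraic_algebraMap (⟨x, hx⟩ : k))

theorem IsFrame.map_mem (h : IsFrame p F₀ k κ) (σ : Ω ≃+* Ω) (hσ : ∀ x ∈ k, σ x = x) {x : Ω}
    (hx : x ∈ κ) : σ x ∈ κ := by
  rw [h.mem_iff] at hx ⊢
  let f : Ω →ₐ[k] Ω := { (σ : Ω →+* Ω) with commutes' := fun r => hσ r r.2 }
  exact hx.algHom f

theorem IsFrame.isAlgebraic' (h : IsFrame p F₀ k κ) (hK : IsComplement F₀ k κ K) :
    Algebra.IsAlgebraic K Ω := by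
  let := (Subfield.inclusion hK.le).toAlgebra
  have : IsScalarTower F₀ K Ω := IsScalarTower.of_algebraMap_eq fun _ => rfl
  exact ⟨fun x => (h.isAlgebraic x).tower_top K⟩

theorem IsFrame.root_mem (h : IsFrame p F₀ k κ) [ExpChar Ω p] (hK : IsComplement F₀ k κ K) {x : Ω}
    (hx : x ^ p ∈ K) : x ∈ K := by
  refine hK.maximal (K.comap (frobenius Ω p)) (fun y hy => pow_mem hy p) (fun y hy hyκ => ?_) hx
  obtain ⟨z, hz, hzy⟩ := h.perfect _ (hK.inter_le _ hy (pow_mem hyκ p))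
  have : z = y := frobenius_inj Ω p hzy
  exact this ▸ hK.le (h.le hz)

theorem IsFrame.isGalois (h : IsFrame p F₀ k κ) [ExpChar Ω p] [IsAlgClosed Ω]
    (hK : IsComplement F₀ k κ K) : IsGalois K Ω := by
  have : ExpChar K p := ((algebraMap K Ω).expChar_iff (algebraMap K Ω).injective p).mpr ‹_›
  have : PerfectRing K p := PerfectRing.ofSurjective K p fun x => by
    obtain ⟨y, hy⟩ := exists_pow_nat_eq (x : Ω) (expChar_pos Ω p)
    exact ⟨⟨y, h.root_mem hK (hy ▸ x.2)⟩, Subtype.ext hy⟩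
  have := PerfectRing.toPerfectField K p
  have := h.isAlgebraic' hK
  have : IsAlgClosure K Ω := ⟨‹_›, ‹_›⟩
  exact { to_isSeparable := Algebra.IsAlgebraic.isSeparable_of_perfectField
          to_normal := IsAlgClosure.normal K Ω }

theorem IsFrame.mem_of_forall_fixed (h : IsFrame p F₀ k κ) [ExpChar Ω p] [IsAlgClosed Ω]
    (hK : IsComplement F₀ k κ K) {x : Ω} (hx : ∀ σ : Ω ≃ₐ[K] Ω, σ x = x) : x ∈ K := by
  have := h.isGalois hK
  obtain ⟨y, rfl⟩ := (InfiniteGalois.mem_range_algebraMap_iff_fixed (k := K) x).mpr hx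
  exact y.2

theorem IsFrame.norm_map (h : IsFrame p F₀ k κ) (hK : IsComplement F₀ k κ K) (σ : Ω ≃ₐ[K] Ω)
    (x : Ω) : ‖σ x‖ = ‖x‖ :=
  h.norm_ringEquiv σ.toRingEquiv (fun x hx => σ.commutes ⟨x, hK.le hx⟩) x

theorem IsFrame.map_mem' (h : IsFrame p F₀ k κ) (hK : IsComplement F₀ k κ K) (σ : Ω ≃ₐ[K] Ω)
    {x : Ω} (hx : x ∈ κ) : σ x ∈ κ :=
  h.map_mem σ.toRingEquiv (fun x hx => σ.commutes ⟨x, hK.le (h.le hx)⟩) hx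

theorem IsResidueSection.eq_of_norm_sub_lt (h : IsResidueSection κ) {c d : Ω} (hc : c ∈ κ)
    (hd : d ∈ κ) (hcd : ‖c - d‖ < 1) : c = d := by
  by_contra hne
  exact hcd.ne (h.norm_eq_one _ (sub_mem hc hd) (sub_ne_zero.mpr hne))

variable [IsUltrametricDist Ω]

theorem IsFrame.mem_of_norm_sub_lt (h : IsFrame p F₀ k κ) [ExpChar Ω p] [IsAlgClosed Ω]
    (hK : IsComplement F₀ k κ K) {c a : Ω} (hc : c ∈ κ) (ha : a ∈ K) (hca : ‖c - a‖ < 1) :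
    c ∈ k := by
  refine hK.inter_le c (h.mem_of_forall_fixed hK fun σ => ?_) hc
  refine h.section_κ.eq_of_norm_sub_lt (h.map_mem' hK σ hc) hc ?_
  rw [← sub_add_sub_cancel _ a]
  refine norm_add_lt ?_ (by rwa [norm_sub_rev])
  have h1 : σ c - a = σ (c - a) := by
    rw [map_sub, show σ a = a from σ.commutes ⟨a, ha⟩]
  rwa [h1, h.norm_map hK]

end

/-- Averaging over conjugates, with coefficients in a stable subfield. -/
theorem exists_averaging {K Ω : Type*} [Field K] [Field Ω] [Algebra K Ω] [IsGalois K Ω]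
    (κ : Subfield Ω) (hκ : ∀ σ : Ω ≃ₐ[K] Ω, ∀ x ∈ κ, σ x ∈ κ) {ℓ : Set Ω} (hℓ : ℓ.Finite)
    (hℓκ : ℓ ⊆ κ) :
    ∃ (n : ℕ) (s : Fin (n + 1) → Ω ≃ₐ[K] Ω) (E : Subfield Ω), E ≤ κ ∧ ℓ ⊆ E ∧
      (∀ b ∈ E, ∑ i, s i b ∈ Set.range (algebraMap K Ω)) ∧
      ∀ c : Fin (n + 1) → Ω, c ≠ 0 → ∃ b ∈ E, ∑ i, s i b * c i ≠ 0 := by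
  have : Finite ℓ := hℓ
  let N : IntermediateField K Ω := (FiniteGaloisIntermediateField.adjoin K ℓ).toIntermediateField
  have hN : ℓ ⊆ N := FiniteGaloisIntermediateField.subset_adjoin K ℓ
  let N' : IntermediateField K Ω := adjoin K (κ ∩ N)
  have hN' : N' ≤ N := adjoin_le_iff.mpr Set.inter_subset_right
  have : FiniteDimensional K N' :=
    FiniteDimensional.of_injective (inclusion hN').toLinearMap
      (inclusion hN').injective
  have hNn := normal_iff_forall_map_le'.mp (inferInstance : Normal K N)
  have : Normal K N' := normal_iff_forall_map_le'.mpr fun σ => by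
    rw [adjoin_map]
    refine adjoin.mono _ _ _ ?_
    rintro _ ⟨x, ⟨hx, hxN⟩, rfl⟩
    exact ⟨hκ σ x hx, hNn σ ⟨x, hxN, rfl⟩⟩
  have : IsGalois K N' := ⟨⟩
  let e := Fintype.equivFin (N' ≃ₐ[K] N')
  obtain ⟨n, hn⟩ : ∃ n, Fintype.card (N' ≃ₐ[K] N') = n + 1 :=
    Nat.exists_eq_succ_of_ne_zero Fintype.card_ne_zero
  let e : Fin (n + 1) ≃ (N' ≃ₐ[K] N') := (finCongr hn.symm).trans e.symm
  let s : Fin (n + 1) → Ω ≃ₐ[K] Ω := fun i => AlgEquiv.liftNormal (e i) Ω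
  have hs : ∀ i (x : N'), s i x = (e i x : Ω) := fun i x => AlgEquiv.liftNormal_commutes (e i) Ω x
  let E : Subfield Ω := κ ⊓ N'.toSubfield
  have hEN : ∀ {b}, b ∈ E → b ∈ N' := fun hb => hb.2
  refine ⟨n, s, E, inf_le_left, fun x hx => ⟨hℓκ hx, subset_adjoin _ _
    ⟨hℓκ hx, hN hx⟩⟩, fun b hb => ?_, fun c hc => ?_⟩
  · refine ⟨Algebra.trace K N' ⟨b, hEN hb⟩, ?_⟩
    rw [IsScalarTower.algebraMap_apply K N' Ω, trace_eq_sum_automorphisms, map_sum]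
    exact (Fintype.sum_equiv e _ _ fun i => hs i ⟨b, hEN hb⟩).symm
  · by_contra! hcon
    let f : Fin (n + 1) → E →* Ω := fun i => ((s i : Ω →+* Ω).comp E.subtype : E →* Ω)
    have hf : Function.Injective f := by
      intro i j hij
      refine e.injective (AlgEquiv.coe_toAlgHom_injective ?_)
      refine IntermediateField.algHom_ext_of_eq_adjoin _ rfl fun x hx => Subtype.ext ?_
      have hxN' := subset_adjoin K _ hx
      have : s i x = s j x := DFunLike.congr_fun hij (⟨x, hx.1, hxN'⟩ : E)
      exact (hs i ⟨x, hxN'⟩).symm.trans (this.trans (hs j ⟨x, hxN'⟩))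
    have := (linearIndependent_monoidHom E Ω).comp f hf
    refine hc (funext fun i => Fintype.linearIndependent_iff.mp this c (funext fun b => ?_) i)
    simpa [f, mul_comm] using hcon b b.2

section

variable {Ω : Type*} [NormedField Ω] {p : ℕ} {F₀ k κ K : Subfield Ω}

theorem IsFrame.exists_averaging (h : IsFrame p F₀ k κ) [ExpChar Ω p] [IsAlgClosed Ω]
    (hK : IsComplement F₀ k κ K) {W : Set Ω} (hW : W.Finite)
    (hWD : ∀ w ∈ W, w ∈ adjoin K (κ : Set Ω)) :
    ∃ (n : ℕ) (s : Fin (n + 1) → Ω ≃ₐ[K] Ω) (E : Subfield Ω), E ≤ κ ∧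
      (∀ b ∈ E, ∀ w ∈ W, ∑ i, s i (b * w) ∈ K) ∧
      ∀ c : Fin (n + 1) → Ω, c ≠ 0 → ∃ b ∈ E, ∑ i, s i b * c i ≠ 0 := by
  have := h.isGalois hK
  have := h.isAlgebraic' hK
  have hspan : ∀ w ∈ W, ∃ ℓ : Finset Ω, (ℓ : Set Ω) ⊆ κ ∧ w ∈ Submodule.span K (ℓ : Set Ω) := by
    intro w hw
    have h1 : w ∈ Algebra.adjoin K (κ : Set Ω) := by
      rw [← adjoin_toSubalgebra]; exact hWD w hw
    have h2 := Algebra.adjoin_eq_span K (κ : Set Ω) ▸ (show w ∈ Subalgebra.toSubmodule _ from h1)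
    have h3 : (Submonoid.closure (κ : Set Ω) : Set Ω) ⊆ κ :=
      Submonoid.closure_le (S := κ.toSubmonoid).mpr le_rfl
    obtain ⟨ℓ, hℓ, hwℓ⟩ := Submodule.mem_span_finite_of_mem_span h2
    exact ⟨ℓ, hℓ.trans h3, hwℓ⟩
  choose! ℓ hℓκ hwℓ using hspan
  obtain ⟨n, s, E, hEκ, hℓE, hsE, hE⟩ := Ultra.exists_averaging (K := K) κ
    (fun σ x hx => h.map_mem' hK σ hx) (hW.biUnion fun w _ => (ℓ w).finite_toSet)
    (Set.iUnion₂_subset hℓκ)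
  refine ⟨n, s, E, hEκ, fun b hb w hw => ?_, hE⟩
  have key : ∀ u ∈ Submodule.span K (ℓ w : Set Ω), ∑ i, s i (b * u) ∈ K := by
    intro u hu
    induction hu using Submodule.span_induction with
    | mem x hx =>
      obtain ⟨y, hy⟩ := hsE (b * x) (mul_mem hb (hℓE (Set.mem_biUnion hw hx)))
      exact hy ▸ y.2
    | zero => simp
    | add x y _ _ hx hy => simpa [mul_add, sum_add_distrib] using add_mem hx hy
    | smul a x _ hx =>
      have : ∑ i, s i (b * a • x) = a * ∑ i, s i (b * x) := by
        rw [mul_sum]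
        refine sum_congr rfl fun i _ => ?_
        rw [mul_smul_comm, map_smul, Algebra.smul_def]; rfl
      rw [this]
      exact mul_mem a.2 hx
  exact key w (hwℓ w hw)

variable [IsUltrametricDist Ω]

theorem IsFrame.exists_norm_eq_of_mem_adjoin (h : IsFrame p F₀ k κ) [ExpChar Ω p] [IsAlgClosed Ω]
    (hK : IsComplement F₀ k κ K) {d : Ω} (hd : d ∈ adjoin K (κ : Set Ω)) :
    ∃ g ∈ K, ‖d‖ = ‖g‖ := by
  rcases eq_or_ne d 0 with rfl | hd0
  · exact ⟨0, zero_mem _, rfl⟩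
  obtain ⟨n, s, E, hEκ, hsE, hE⟩ := h.exists_averaging hK (Set.finite_singleton d) (by simpa)
  have hsd : ∀ i, ‖s i d‖ = ‖d‖ := fun i => h.norm_map hK _ _
  choose c hcκ hc0 hc using fun i => h.section_κ.exists_ratio (x := s i d) (y := d)
    (by simpa using hd0) (hsd i)
  obtain ⟨b, hb, hbc⟩ := hE c fun h0 => hc0 0 (congr_fun h0 0)
  refine ⟨_, hsE b hb d rfl, ?_⟩
  have hdp := norm_pos_iff.mpr hd0
  have h1 : ‖∑ i, s i b * c i‖ = 1 := h.section_κ.norm_eq_one _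
    (sum_mem fun i _ => mul_mem (h.map_mem' hK _ (hEκ hb)) (hcκ i)) hbc
  have hb1 : ‖b‖ ≤ 1 := by
    rcases eq_or_ne b 0 with rfl | hb0
    · simp
    · exact (h.section_κ.norm_eq_one _ (hEκ hb) hb0).le
  have h2 : ‖(∑ i, s i b * c i) * d - ∑ i, s i (b * d)‖ < ‖d‖ := by
    rw [sum_mul, ← sum_sub_distrib]
    refine norm_sum_lt _ _ hdp fun i _ => ?_
    rw [map_mul, mul_assoc, ← mul_sub, norm_mul, h.norm_map hK, norm_sub_rev]
    exact (mul_le_of_le_one_left (norm_nonneg _) hb1).trans_lt ((hc i).trans_eq (hsd i))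
  rw [norm_eq_of_sub_lt (x := (∑ i, s i b * c i) * d) (y := ∑ i, s i (b * d))
    (by rwa [norm_mul, h1, one_mul]), norm_mul, h1, one_mul]

theorem IsFrame.exists_prime_root_norm (h : IsFrame p F₀ k κ) [ExpChar Ω p] [IsAlgClosed Ω]
    (hK : IsComplement F₀ k κ K) {q : ℕ} (hq : q.Prime) {g : Ω} (hg : g ∈ K) :
    ∃ e ∈ K, ‖g‖ = ‖e‖ ^ q := by
  have := h.isAlgebraic' hK
  rcases eq_or_ne g 0 with rfl | hg0
  · exact ⟨0, zero_mem _, by simp [hq.ne_zero]⟩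
  by_contra! hcon
  obtain ⟨e, rfl⟩ := exists_pow_nat_eq g hq.pos
  have he0 : e ≠ 0 := fun h0 => hg0 (by simp [h0, hq.ne_zero])
  have hep := norm_pos_iff.mpr he0
  have hbez : ∀ m : ℕ, m.Coprime q → ∀ a ∈ K, ‖e‖ ^ m ≠ ‖a‖ := by
    intro m hm a ha hma
    have hb := Nat.gcd_eq_gcd_ab m q
    rw [hm.gcd_eq_one] at hb
    refine hcon (a ^ (Nat.gcdA m q) * (e ^ q) ^ (Nat.gcdB m q))
      (mul_mem (zpow_mem ha _) (zpow_mem hg _)) ?_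
    have h1 : ‖e‖ = (‖e‖ ^ m) ^ Nat.gcdA m q * (‖e‖ ^ q) ^ Nat.gcdB m q := by
      rw [← zpow_natCast ‖e‖ m, ← zpow_natCast ‖e‖ q, ← zpow_mul, ← zpow_mul,
        ← zpow_add₀ hep.ne', ← hb]
      simp
    rw [norm_mul, norm_zpow, norm_zpow, ← hma, norm_pow, ← h1]
  have hbez' : ∀ i j : ℕ, i < j → j < q → ∀ a ∈ K, ∀ b ∈ K, a ≠ 0 → b ≠ 0 →
      ‖a * e ^ i‖ ≠ ‖b * e ^ j‖ := by
    intro i j hij hjq a ha b hb ha0 hb0 heq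
    refine hbez (j - i) ?_ (a / b) (div_mem ha hb) ?_
    · exact (Nat.coprime_of_lt_prime (by omega) (by omega) hq).symm
    · rw [norm_mul, norm_mul, norm_pow, norm_pow, ← Nat.sub_add_cancel hij.le, pow_add] at heq
      rw [norm_div, eq_div_iff (norm_ne_zero_iff.mpr hb0)]
      refine mul_right_cancel₀ (pow_ne_zero i hep.ne') ?_
      rw [heq]; ring_nf
  let L := adjoin K {e}
  have hKL : K ≤ L.toSubfield := fun x hx => L.algebraMap_mem ⟨x, hx⟩
  have heL : e ∈ L.toSubfield := mem_adjoin_simple_self K e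
  refine hcon e (hK.maximal L.toSubfield hKL (fun c hc hcκ => ?_) heL) (norm_pow _ _)
  rcases eq_or_ne c 0 with rfl | hc0
  · exact zero_mem _
  obtain ⟨P, hPq, rfl⟩ : ∃ P : K[X], P.natDegree < q ∧ aeval e P = c := by
    have h1 : c ∈ Algebra.adjoin K {e} := by
      rw [← adjoin_toSubalgebra]; exact hc
    rw [Algebra.adjoin_singleton_eq_range_aeval] at h1
    obtain ⟨P, rfl⟩ := h1
    have hmon : (X ^ q - C (⟨e ^ q, hg⟩ : K)).Monic := monic_X_pow_sub_C _ hq.ne_zero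
    refine ⟨P %ₘ (X ^ q - C (⟨e ^ q, hg⟩ : K)), ?_, aeval_modByMonic_eq_self_of_root ?_⟩
    · have := natDegree_modByMonic_lt P hmon (fun h1 => by
        have := congr_arg natDegree h1
        rw [natDegree_X_pow_sub_C, natDegree_one] at this
        exact hq.ne_zero this)
      rwa [natDegree_X_pow_sub_C] at this
    · simp only [map_sub, map_pow, aeval_X, aeval_C]
      exact sub_self _
  have hsum : aeval e P = ∑ i ∈ P.support, (P.coeff i : Ω) * e ^ i := by
    rw [aeval_def, eval₂_eq_sum, Polynomial.sum_def]; rfl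
  have hne : P.support.Nonempty := by
    rw [nonempty_support_iff]; rintro rfl; simp at hc0
  obtain ⟨j, hj, hjmax⟩ := P.support.exists_max_image (fun i => ‖(P.coeff i : Ω) * e ^ i‖) hne
  have hcoeff : ∀ i ∈ P.support, (P.coeff i : Ω) ≠ 0 := fun i hi => by
    simpa using mem_support_iff.mp hi
  have hlt : ∀ i ∈ P.support, i < q := fun i hi => (le_natDegree_of_mem_supp i hi).trans_lt hPq
  obtain ⟨h1, h2⟩ := norm_sum_eq_of_dominant hj
    (f := fun i => (P.coeff i : Ω) * e ^ i) (mul_ne_zero (hcoeff j hj) (pow_ne_zero _ he0))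
    fun i hi hij => lt_of_le_of_ne (hjmax i hi) (by
      rcases lt_or_gt_of_ne hij with hlt' | hlt'
      · exact hbez' i j hlt' (hlt j hj) _ (P.coeff i).2 _ (P.coeff j).2 (hcoeff i hi) (hcoeff j hj)
      · exact (hbez' j i hlt' (hlt i hi) _ (P.coeff j).2 _ (P.coeff i).2 (hcoeff j hj)
          (hcoeff i hi)).symm)
  rw [← hsum] at h1 h2
  have hc1 := h.section_κ.norm_eq_one _ hcκ hc0
  have hj0 : j = 0 := by
    by_contra hj0
    refine hbez' 0 j (Nat.pos_of_ne_zero hj0) (hlt j hj) 1 (one_mem _) _ (P.coeff j).2 one_ne_zero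
      (hcoeff j hj) ?_
    rw [← h1, hc1]; simp
  subst hj0
  rw [← h1, hc1, pow_zero, mul_one] at h2
  exact hK.le (h.le (h.mem_of_norm_sub_lt hK hcκ (P.coeff 0).2 h2))

theorem IsFrame.exists_root_norm (h : IsFrame p F₀ k κ) [ExpChar Ω p] [IsAlgClosed Ω]
    (hK : IsComplement F₀ k κ K) {n : ℕ} (hn : n ≠ 0) {g : Ω} (hg : g ∈ K) :
    ∃ e ∈ K, ‖g‖ = ‖e‖ ^ n := by
  induction n using induction_on_primes generalizing g with
  | zero => exact absurd rfl hn
  | one => exact ⟨g, hg, by simp⟩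
  | prime_mul q a hq ih =>
    obtain ⟨e, he, h1⟩ := h.exists_prime_root_norm hK hq hg
    obtain ⟨f, hf, h2⟩ := ih (right_ne_zero_of_mul hn) he
    exact ⟨f, hf, by rw [h1, h2, ← pow_mul, mul_comm]⟩

end

section

section

variable {Ω : Type*} [Field Ω] {A : Finset Ω}

theorem add_mem_of_sub_mem (hA : ∀ a ∈ A, ∀ b ∈ A, a - b ∈ A) {a b : Ω} (ha : a ∈ A)
    (hb : b ∈ A) : a + b ∈ A := by
  have := hA a ha (0 - b) (hA 0 (by simpa using hA b hb b hb) b hb)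
  simpa using this

theorem prod_sub_add (hA : ∀ a ∈ A, ∀ b ∈ A, a - b ∈ A) {ω : Ω} (hω : ω ∈ A) (x : Ω) :
    ∏ a ∈ A, (x + ω - a) = ∏ a ∈ A, (x - a) :=
  prod_nbij' (· - ω) (· + ω) (fun a ha => hA a ha ω hω)
    (fun a ha => add_mem_of_sub_mem hA ha hω) (by simp) (by simp) (fun a _ => by ring)

/-- The monic polynomial vanishing on a finite additive subgroup is additive. -/
theorem eval_prod_add (hA0 : (0 : Ω) ∈ A) (hA : ∀ a ∈ A, ∀ b ∈ A, a - b ∈ A) (x y : Ω) :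
    ∏ a ∈ A, (x + y - a) = ∏ a ∈ A, (x - a) + ∏ a ∈ A, (y - a) := by
  classical
  set V : Polynomial Ω := ∏ a ∈ A, (X - C a) with hV
  have hVe : ∀ z, V.eval z = ∏ a ∈ A, (z - a) := fun z => by simp [hV, eval_prod]
  have hVm : V.Monic := monic_prod_of_monic _ _ fun a _ => monic_X_sub_C a
  have hVd : V.natDegree = A.card := natDegree_finsetProd_X_sub_C_eq_card A _
  have h0 : V.comp (X + C y) - V - C (V.eval y) = 0 := by
    refine eq_zero_of_degree_lt_of_eval_finset_eq_zero A ?_ fun a ha => ?_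
    · have hm : (V.comp (X + C y)).Monic := hVm.comp_X_add_C y
      have hd : (V.comp (X + C y)).degree = V.degree := by
        rw [degree_eq_natDegree hm.ne_zero, degree_eq_natDegree hVm.ne_zero, natDegree_comp,
          natDegree_X_add_C, mul_one]
      have hV : V.degree = A.card := by rw [degree_eq_natDegree hVm.ne_zero, hVd]
      refine (degree_sub_le _ _).trans_lt (max_lt ?_ (degree_C_le.trans_lt ?_))
      · rw [← hV, ← hd]
        exact degree_sub_lt_left hd hm.ne_zero (by rw [hm.leadingCoeff, hVm.leadingCoeff])
      · exact_mod_cast card_pos.mpr ⟨0, hA0⟩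
    · have := prod_sub_add hA ha y
      simp only [eval_sub, eval_comp, eval_add, eval_X, eval_C, hVe]
      rw [add_comm a y, this, Finset.prod_eq_zero ha (sub_self a)]
      ring
  have := congr_arg (eval x) h0
  simp only [eval_sub, eval_comp, eval_add, eval_X, eval_C, hVe, eval_zero] at this
  linear_combination this

end

variable {Ω : Type*} [NormedField Ω] {p : ℕ} {F₀ k κ K : Subfield Ω}

theorem IsFrame.mem_κ_of_isAlgebraic (h : IsFrame p F₀ k κ) {x : Ω} (hx : IsAlgebraic κ x) :
    x ∈ κ := by
  rw [h.mem_iff]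
  let := (Subfield.inclusion h.le_κ).toAlgebra
  have : IsScalarTower k κ Ω := IsScalarTower.of_algebraMap_eq fun _ => rfl
  have : Algebra.IsAlgebraic k κ := ⟨fun x => by
    have h1 := (h.mem_iff x).mp x.2
    exact (isAlgebraic_algebraMap_iff (A := Ω) (algebraMap κ Ω).injective).mp h1⟩
  exact hx.restrictScalars k

theorem IsFrame.mem_adjoin_of_forall_sub_mem (h : IsFrame p F₀ k κ) [ExpChar Ω p] [IsAlgClosed Ω]
    (hK : IsComplement F₀ k κ K) {y : Ω} (hy : ∀ σ : Ω ≃ₐ[K] Ω, σ y - y ∈ κ) :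
    y ∈ adjoin K (κ : Set Ω) := by
  classical
  have := h.isGalois hK
  have := h.isAlgebraic' hK
  set D := adjoin K (κ : Set Ω) with hD
  have : IsGalois D Ω := IsGalois.tower_top_of_isGalois K D Ω
  have hκD : ∀ x ∈ κ, x ∈ D := fun x hx => subset_adjoin K _ hx
  have hKD : ∀ x ∈ K, x ∈ D := fun x hx => D.algebraMap_mem ⟨x, hx⟩
  have hfix : ∀ (τ : Ω ≃ₐ[D] Ω) (x : Ω), x ∈ D → τ x = x := fun τ x hx => τ.commutes ⟨x, hx⟩
  have hfixK : ∀ (τ : Ω ≃ₐ[K] Ω) (x : Ω), x ∈ K → τ x = x := fun τ x hx => τ.commutes ⟨x, hx⟩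
  have hDσ : ∀ (σ : Ω ≃ₐ[K] Ω) (x : Ω), x ∈ D → σ x ∈ D := by
    intro σ x hx
    have h1 : D.map (σ : Ω →ₐ[K] Ω) ≤ D := by
      rw [hD, adjoin_map]
      refine adjoin.mono _ _ _ ?_
      rintro _ ⟨x, hx, rfl⟩
      exact h.map_mem' hK σ hx
    exact h1 ⟨x, hx, rfl⟩
  have hfin : {ω : Ω | ∃ τ : Ω ≃ₐ[D] Ω, τ y = y + ω}.Finite := by
    refine ((minpoly D y).rootSet_finite Ω).preimage (f := (y + ·)) (add_right_injective y).injOn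
      |>.subset ?_
    rintro ω ⟨τ, hτ⟩
    rw [Set.mem_preimage, mem_rootSet]
    refine ⟨minpoly.ne_zero (IsGalois.integral D y), ?_⟩
    rw [← hτ, show τ y = (τ : Ω →ₐ[D] Ω) y from rfl, aeval_algHom_apply, minpoly.aeval, map_zero]
  set A := hfin.toFinset with hA
  have hmem : ∀ ω, ω ∈ A ↔ ∃ τ : Ω ≃ₐ[D] Ω, τ y = y + ω := fun ω => by simp [hA]
  have hAκ : ∀ ω ∈ A, ω ∈ κ := by
    intro ω hω
    obtain ⟨τ, hτ⟩ := (hmem ω).mp hω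
    have := hy (τ.restrictScalars K)
    rwa [show τ.restrictScalars K y = y + ω from hτ, add_sub_cancel_left] at this
  have hA0 : 0 ∈ A := (hmem 0).mpr ⟨AlgEquiv.refl, by simp⟩
  have hAsub : ∀ a ∈ A, ∀ b ∈ A, a - b ∈ A := by
    intro a ha b hb
    obtain ⟨τ, hτ⟩ := (hmem a).mp ha
    obtain ⟨τ', hτ'⟩ := (hmem b).mp hb
    refine (hmem _).mpr ⟨τ * τ'.symm, ?_⟩
    have h1 : τ'.symm y = y - b := by
      rw [AlgEquiv.symm_apply_eq, map_sub, hτ', hfix τ' b (hκD b (hAκ b hb))]; ring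
    rw [AlgEquiv.mul_apply, h1, map_sub, hτ, hfix τ b (hκD b (hAκ b hb))]; ring
  have hAσ : ∀ (σ : Ω ≃ₐ[K] Ω), ∀ ω ∈ A, σ ω ∈ A := by
    intro σ ω hω
    obtain ⟨τ, hτ⟩ := (hmem ω).mp hω
    let τ' : Ω ≃ₐ[D] Ω := AlgEquiv.ofRingEquiv
      (f := (σ.symm.toRingEquiv.trans (τ.toRingEquiv.trans σ.toRingEquiv))) (by
        intro x
        change σ (τ (σ.symm x)) = x
        rw [hfix τ _ (hDσ σ.symm x x.2), AlgEquiv.apply_symm_apply])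
    refine (hmem _).mpr ⟨τ', ?_⟩
    have h1 : τ' (σ y) = σ y + σ ω := by
      change σ (τ (σ.symm (σ y))) = _
      rw [AlgEquiv.symm_apply_apply, hτ, map_add]
    have h2 := hfix τ' (σ y - y) (hκD _ (hy σ))
    rw [map_sub, h1] at h2
    linear_combination -h2
  set V : Ω → Ω := fun x => ∏ a ∈ A, (x - a) with hV
  have hVadd : ∀ x z, V (x + z) = V x + V z := eval_prod_add hA0 hAsub
  have hVσ : ∀ (σ : Ω ≃ₐ[K] Ω) x, σ (V x) = V (σ x) := by
    intro σ x
    simp only [hV, map_prod, map_sub]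
    exact prod_nbij' σ σ.symm (hAσ σ) (hAσ σ.symm) (by simp) (by simp) (by simp)
  have hVκ : ∀ x ∈ κ, V x ∈ κ := fun x hx => prod_mem fun a ha => sub_mem hx (hAκ a ha)
  have hVyD : V y ∈ D := by
    have : ∀ τ : Ω ≃ₐ[D] Ω, τ (V y) = V y := by
      intro τ
      have h1 := hVσ (τ.restrictScalars K) y
      have hτA : τ y - y ∈ A := (hmem _).mpr ⟨τ, by ring⟩
      have h2 := prod_sub_add hAsub hτA y
      rw [add_sub_cancel] at h2
      exact h1.trans h2
    obtain ⟨d, hd⟩ := (InfiniteGalois.mem_range_algebraMap_iff_fixed (k := D) (V y)).mpr this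
    exact hd ▸ d.2
  have hVsub : ∀ x z, V (x - z) = V x - V z := fun x z => by
    have := hVadd (x - z) z
    rw [sub_add_cancel] at this
    linear_combination -this
  obtain ⟨c, hcκ, hc⟩ : ∃ c ∈ κ, V y - c ∈ K := by
    obtain ⟨n, s, E, hEκ, hsE, hE⟩ := h.exists_averaging hK (W := {V y, 1}) (by simp) (by
      rintro w (rfl | rfl)
      · exact hVyD
      · exact one_mem _)
    obtain ⟨b, hb, hbt⟩ := hE (fun _ => 1) fun h0 => one_ne_zero (congr_fun h0 0)
    simp only [mul_one] at hbt
    have h1 := hsE b hb (V y) (by simp)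
    have h2 := hsE b hb 1 (by simp)
    simp only [mul_one] at h2
    have h3 : ∑ i, s i (b * V y) = (∑ i, s i b) * V y + ∑ i, s i b * V (s i y - y) := by
      rw [sum_mul, ← sum_add_distrib]
      refine sum_congr rfl fun i _ => ?_
      rw [map_mul, hVσ, hVsub]; ring
    refine ⟨-(∑ i, s i b * V (s i y - y)) / ∑ i, s i b, div_mem (neg_mem (sum_mem fun i _ =>
      mul_mem (h.map_mem' hK _ (hEκ hb)) (hVκ _ (hy _)))) (sum_mem fun i _ =>
      h.map_mem' hK _ (hEκ hb)), ?_⟩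
    have h4 : V y - -(∑ i, s i b * V (s i y - y)) / ∑ i, s i b =
        (∑ i, s i (b * V y)) / ∑ i, s i b := by
      rw [h3]; field_simp; ring
    rw [h4]
    exact div_mem h1 h2
  have hVp : ∀ x, (∏ a ∈ A, (X - C a)).eval x = V x := fun x => by simp [hV, eval_prod]
  have hVm : (∏ a ∈ A, (X - C a)).Monic := monic_prod_of_monic _ _ fun a _ => monic_X_sub_C a
  have hVd : (∏ a ∈ A, (X - C a)).natDegree = A.card := natDegree_finsetProd_X_sub_C_eq_card A _
  have hApos : 0 < A.card := card_pos.mpr ⟨0, hA0⟩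
  obtain ⟨c', hc'κ, hc'⟩ : ∃ c' ∈ κ, V c' = c := by
    let q : Polynomial κ := (∏ a ∈ A.attach, (X - C (⟨a, hAκ a a.2⟩ : κ))) - C ⟨c, hcκ⟩
    have hq : q.degree = A.card := by
      have h1 := natDegree_finsetProd_X_sub_C_eq_card A.attach fun a => (⟨a, hAκ a a.2⟩ : κ)
      rw [Finset.card_attach] at h1
      rw [degree_eq_iff_natDegree_eq_of_pos hApos, natDegree_sub_C, h1]
    have hqe : ∀ x : Ω, aeval x q = V x - c := by
      intro x
      simp only [q, map_sub, map_prod, aeval_X, aeval_C]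
      congr 1
      exact Finset.prod_attach A fun a => x - a
    obtain ⟨c', hc'⟩ := exists_aeval_eq_zero Ω q (by
      rw [hq]; exact_mod_cast hApos.ne')
    refine ⟨c', h.mem_κ_of_isAlgebraic ⟨q, ?_, hc'⟩, ?_⟩
    · rintro h0
      rw [h0, degree_zero] at hq
      exact absurd hq.symm (by simp)
    · rw [hqe] at hc'; exact sub_eq_zero.mp hc'
  obtain ⟨v, hvV, hvd, hvm⟩ : ∃ v : Polynomial K, (∀ x : Ω, aeval x v = V x) ∧
      v.natDegree = A.card ∧ v.Monic := by
    have hl : (∏ a ∈ A, (X - C a)) ∈ lifts (algebraMap K Ω) := by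
      rw [lifts_iff_coeff_lifts]
      intro i
      refine ⟨⟨(∏ a ∈ A, (X - C a)).coeff i, h.mem_of_forall_fixed hK fun σ => ?_⟩, rfl⟩
      have h1 : (∏ a ∈ A, (X - C a)).map (σ : Ω →+* Ω) = ∏ a ∈ A, (X - C a) := by
        simp only [Polynomial.map_prod, Polynomial.map_sub, map_X, map_C]
        exact prod_nbij' σ σ.symm (hAσ σ) (hAσ σ.symm) (by simp) (by simp) (by simp)
      have h2 := congr_arg (fun q => coeff q i) h1
      simp only [coeff_map] at h2
      exact h2
    obtain ⟨v, h1, h2, h3⟩ := lifts_and_natDegree_eq_and_monic hl hVm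
    exact ⟨v, fun x => by rw [← hVp, ← h1, eval_map_algebraMap], h2.trans hVd, h3⟩
  set z := y - c' with hz
  have hVz : V z ∈ K := by rw [hz, hVsub, hc']; exact hc
  let L := adjoin K {z}
  have hKL : K ≤ L.toSubfield := fun x hx => L.algebraMap_mem ⟨x, hx⟩
  have hzL : z ∈ L.toSubfield := mem_adjoin_simple_self K z
  have hzK : z ∈ K := by
    refine hK.maximal L.toSubfield hKL (fun c hc hcκ => ?_) hzL
    have hdeg : (v - C (⟨V z, hVz⟩ : K)).natDegree = A.card := by rw [natDegree_sub_C, hvd]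
    have hmon : (v - C (⟨V z, hVz⟩ : K)).Monic := by
      refine hvm.sub_of_left (degree_C_le.trans_lt ?_)
      rw [degree_eq_natDegree hvm.ne_zero, hvd]; exact_mod_cast hApos
    obtain ⟨P, hPd, hP⟩ : ∃ P : Polynomial K, P.natDegree < A.card ∧ aeval z P = c := by
      have h1 : c ∈ Algebra.adjoin K {z} := by
        rw [← adjoin_toSubalgebra]; exact hc
      rw [Algebra.adjoin_singleton_eq_range_aeval] at h1
      obtain ⟨P, hP⟩ := h1
      refine ⟨P %ₘ (v - C (⟨V z, hVz⟩ : K)), ?_, ?_⟩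
      · rw [← hdeg]
        refine natDegree_modByMonic_lt P hmon fun h1 => ?_
        rw [h1, natDegree_one] at hdeg
        exact hApos.ne hdeg
      · refine (aeval_modByMonic_eq_self_of_root ?_).trans hP
        rw [map_sub, hvV, aeval_C]
        exact sub_self _
    have hroot : ∀ ω ∈ A, aeval (z + ω) P = c := by
      intro ω hω
      obtain ⟨τ, hτ⟩ := (hmem ω).mp hω
      have h1 : τ z = z + ω := by
        rw [hz, map_sub, hτ, hfix τ c' (hκD c' hc'κ)]; ring
      have h2 := aeval_algHom_apply ((τ.restrictScalars K : Ω ≃ₐ[K] Ω) : Ω →ₐ[K] Ω) z P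
      rw [hP] at h2
      rw [← h1]
      exact h2.trans (hfix τ c (hκD c hcκ))
    have hPc : P.map (algebraMap K Ω) - C c = 0 := by
      refine eq_zero_of_degree_lt_of_eval_finset_eq_zero (A.map ⟨(z + ·), add_right_injective z⟩)
        ?_ ?_
      · rw [Finset.card_map]
        refine (degree_sub_le _ _).trans_lt (max_lt ?_ (degree_C_le.trans_lt ?_))
        · exact (degree_map_le).trans_lt (degree_le_natDegree.trans_lt (by exact_mod_cast hPd))
        · exact_mod_cast hApos
      · intro x hx
        obtain ⟨ω, hω, rfl⟩ := mem_map.mp hx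
        change eval (z + ω) _ = 0
        rw [eval_sub, eval_map_algebraMap, hroot ω hω, eval_C, sub_self]
    have := congr_arg (fun q => coeff q 0) hPc
    simp only [coeff_sub, coeff_map, coeff_C_zero, coeff_zero] at this
    rw [← sub_eq_zero.mp this]
    exact (P.coeff 0).2
  have := add_mem (hKD z hzK) (hκD c' hc'κ)
  rwa [hz, sub_add_cancel] at this

end

section

variable {Ω : Type*} [NormedField Ω] {p : ℕ} {F₀ k κ K : Subfield Ω}

theorem IsFrame.exists_pow_pow_eq (h : IsFrame p F₀ k κ) (j : ℕ) {x : Ω} (hx : x ∈ k) :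
    ∃ r ∈ k, r ^ p ^ j = x := by
  induction j generalizing x with
  | zero => exact ⟨x, hx, by simp⟩
  | succ j ih =>
    obtain ⟨y, hy, rfl⟩ := h.perfect x hx
    obtain ⟨r, hr, rfl⟩ := ih hy
    exact ⟨r, hr, by rw [pow_succ, pow_mul]⟩

/-- An algebraic element satisfies an additive polynomial equation. -/
theorem exists_additive_relation {k Ω : Type*} [Field k] [Field Ω] [Algebra k Ω] {b : Ω}
    (hb : IsAlgebraic k b) (p : ℕ) :
    ∃ (m : ℕ) (q : ℕ → k), (∃ j ≤ m, q j ≠ 0) ∧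
      ∑ j ∈ range (m + 1), algebraMap k Ω (q j) * b ^ p ^ j = 0 := by
  classical
  let E := adjoin k {b}
  have : FiniteDimensional k E := adjoin.finiteDimensional hb.isIntegral
  let v : ℕ → E := fun j => ⟨b, mem_adjoin_simple_self k b⟩ ^ p ^ j
  have hv : ¬ LinearIndependent k v := fun hv => by
    have := hv.finite_of_isNoetherian
    exact not_finite ℕ
  obtain ⟨s, q, hsum, i, his, hi⟩ := not_linearIndependent_iff.mp hv
  refine ⟨s.sup id, fun j => if j ∈ s then q j else 0, ⟨i, le_sup (f := id) his, by
    simpa [his]⟩, ?_⟩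
  have h1 := congr_arg (algebraMap E Ω) hsum
  rw [map_sum, map_zero] at h1
  rw [← h1]
  symm
  refine Finset.sum_subset_zero_on_sdiff (fun j hj => ?_) (fun j hj => ?_) fun j hj => ?_
  · exact mem_range_succ_iff.mpr (le_sup (f := id) hj)
  · beta_reduce
    rw [if_neg (Finset.mem_sdiff.mp hj).2, map_zero, zero_mul]
  · beta_reduce
    rw [if_pos hj, Algebra.smul_def, map_mul, ← IsScalarTower.algebraMap_apply]
    rfl

variable [Fact p.Prime] [CharP Ω p]

theorem artinSchreier_sum {b y : Ω} (a β : ℕ → Ω) (h0 : β 0 = -(b * a 0))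
    (hs : ∀ i, β (i + 1) = β i ^ p - b * a (i + 1)) (M : ℕ) :
    (∑ i ∈ range M, β i * y ^ p ^ i) ^ p - ∑ i ∈ range M, β i * y ^ p ^ i =
      b * ∑ i ∈ range (M + 1), a i * y ^ p ^ i + β M * y ^ p ^ M := by
  have hp : p.Prime := Fact.out
  induction M with
  | zero => simp [h0, hp.ne_zero]; ring
  | succ M ih =>
    rw [sum_range_succ, add_pow_char, sum_range_succ _ (M + 1), hs]
    have : (β M * y ^ p ^ M) ^ p = β M ^ p * y ^ p ^ (M + 1) := by
      rw [mul_pow, ← pow_mul, ← pow_succ]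
    rw [this]
    linear_combination ih

theorem IsFrame.mem_adjoin_of_artinSchreier (h : IsFrame p F₀ k κ) [IsAlgClosed Ω]
    (hK : IsComplement F₀ k κ K) {b g x : Ω} (hb : b ∈ κ) (hg : g ∈ K) (hx : x ^ p - x = b * g) :
    x ∈ adjoin K (κ : Set Ω) := by
  have hp : p.Prime := Fact.out
  set D := adjoin K (κ : Set Ω) with hD
  have hκD : ∀ x ∈ κ, x ∈ D := fun x hx => subset_adjoin K _ hx
  obtain ⟨m, q, ⟨j, hjm, hj⟩, hq⟩ := exists_additive_relation ((h.mem_iff b).mp hb) p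
  choose r hr hrq using fun j => h.exists_pow_pow_eq j (q j).2
  let a : ℕ → Ω := fun i => r (m - i)
  have ha : ∀ i, a i ∈ k := fun i => hr _
  let β : ℕ → Ω := fun i => -∑ l ∈ range (i + 1), (b * a l) ^ p ^ (i - l)
  have hβκ : ∀ i, β i ∈ κ := fun i => neg_mem (sum_mem fun l _ =>
    pow_mem (mul_mem hb (h.le_κ (ha l))) _)
  have hβ0 : β 0 = -(b * a 0) := by simp [β]
  have hβs : ∀ i, β (i + 1) = β i ^ p - b * a (i + 1) := by
    intro i
    have h1 : β i ^ p = -∑ l ∈ range (i + 1), (b * a l) ^ p ^ (i + 1 - l) := by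
      change frobenius Ω p (β i) = _
      rw [map_neg, map_sum]
      congr 1
      refine sum_congr rfl fun l hl => ?_
      rw [frobenius_def, ← pow_mul, ← pow_succ, Nat.succ_sub (mem_range_succ_iff.mp hl)]
    rw [h1]
    simp only [β]
    rw [sum_range_succ _ (i + 1)]
    simp; ring
  have hβm : β m = 0 := by
    simp only [β, neg_eq_zero]
    rw [← hq, ← Finset.sum_range_reflect]
    refine sum_congr rfl fun l hl => ?_
    have hl' := mem_range_succ_iff.mp hl
    have h1 : m - (m + 1 - 1 - l) = l := by omega
    simp only [a]
    rw [h1, mul_pow, hrq, mul_comm]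
    rfl
  let P : Polynomial k := ∑ i ∈ range (m + 1), C (⟨a i, ha i⟩ : k) * X ^ p ^ i
  have hPe : ∀ y : Ω, aeval y P = ∑ i ∈ range (m + 1), a i * y ^ p ^ i := by
    intro y
    simp only [P, map_sum, map_mul, aeval_C, map_pow, aeval_X]
    rfl
  have hPc : P.coeff (p ^ (m - j)) ≠ 0 := by
    have h1 : P.coeff (p ^ (m - j)) = ⟨a (m - j), ha _⟩ := by
      simp only [P, finsetSum_coeff, coeff_C_mul_X_pow]
      rw [Finset.sum_eq_single (m - j)]
      · simp
      · intro i _ hi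
        rw [if_neg fun h => hi (Nat.pow_right_injective hp.two_le h.symm)]
      · intro h; exact absurd (mem_range.mpr (by omega)) h
    rw [h1]
    intro h0
    have h2 : r j = 0 := by
      have := congr_arg Subtype.val h0
      simp only [a, Nat.sub_sub_self hjm] at this
      exact this
    refine hj (Subtype.ext ?_)
    rw [← hrq, h2, zero_pow (pow_ne_zero _ hp.ne_zero)]; rfl
  have hP0 : P ≠ 0 := fun h0 => hPc (by rw [h0, coeff_zero])
  obtain ⟨y, hy⟩ : ∃ y : Ω, aeval y P = g := by
    obtain ⟨y, hy⟩ := IsAlgClosed.exists_root (P.map (algebraMap k Ω) - C g) (fun h0 => by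
      have h1 := eq_C_of_degree_eq_zero h0
      have h2 := congr_arg (fun q => coeff q (p ^ (m - j))) h1
      simp only [coeff_sub, coeff_map, coeff_C_of_ne_zero (pow_ne_zero _ hp.ne_zero), sub_zero] at h2
      exact hPc ((map_eq_zero _).mp h2))
    refine ⟨y, ?_⟩
    rw [IsRoot.def, eval_sub, eval_map_algebraMap, eval_C] at hy
    exact sub_eq_zero.mp hy
  have hyD : y ∈ D := h.mem_adjoin_of_forall_sub_mem hK fun σ => by
    rw [h.mem_iff]
    refine ⟨P, hP0, ?_⟩
    have h1 : ∀ u v : Ω, aeval (u - v) P = aeval u P - aeval v P := by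
      intro u v
      simp only [hPe, ← sum_sub_distrib, ← mul_sub]
      simp only [sub_pow_char_pow]
    have h2 : aeval (σ y) P = g := by
      have h3 : σ (aeval y P) = aeval (σ y) P := by
        simp only [hPe, map_sum, map_mul, map_pow]
        refine sum_congr rfl fun i _ => ?_
        rw [show σ (a i) = a i from σ.commutes ⟨a i, hK.le (h.le (ha i))⟩]
      rw [← h3, hy]
      exact σ.commutes ⟨g, hg⟩
    rw [h1, h2, hy, sub_self]
  have hsum := artinSchreier_sum (y := y) a β hβ0 hβs m
  rw [hβm, zero_mul, add_zero, ← hPe, hy] at hsum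
  set z := ∑ i ∈ range m, β i * y ^ p ^ i
  have hzD : z ∈ D := sum_mem fun i _ => mul_mem (hκD _ (hβκ i)) (pow_mem hyD _)
  have hxz : (x - z) ^ p = x - z := by
    rw [← sub_eq_zero, artinSchreier_sub, hsum, hx, sub_self]
  have : x - z ∈ κ := by
    rw [h.mem_iff]
    refine ⟨X ^ p - X, ?_, by simp [hxz]⟩
    exact (monic_X_pow_sub (by rw [degree_X]; exact_mod_cast hp.one_lt)).ne_zero
  have := add_mem (hκD _ this) hzD
  rwa [sub_add_cancel] at this

omit [CharP Ω p] in
theorem exists_artinSchreier_root [IsAlgClosed Ω] (f : Ω) : ∃ x : Ω, x ^ p - x = f := by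
  have hp : p.Prime := Fact.out
  obtain ⟨w, hw⟩ := IsAlgClosed.exists_root (X ^ p - (X + C f)) (by
    have h1 : (X + C f : Polynomial Ω).degree < (X ^ p : Polynomial Ω).degree := by
      rw [degree_X_add_C, degree_X_pow]; exact_mod_cast hp.one_lt
    rw [degree_sub_eq_left_of_degree_lt h1, degree_X_pow]
    exact_mod_cast hp.ne_zero)
  refine ⟨w, ?_⟩
  simp only [IsRoot.def, eval_sub, eval_pow, eval_X, eval_add, eval_C] at hw
  linear_combination hw

theorem IsFrame.mem_adjoin_of_artinSchreier' (h : IsFrame p F₀ k κ) [IsAlgClosed Ω]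
    (hK : IsComplement F₀ k κ K) {x : Ω}
    (hx : x ^ p - x ∈ adjoin K (κ : Set Ω)) :
    x ∈ adjoin K (κ : Set Ω) := by
  have := h.isAlgebraic' hK
  have hspan : x ^ p - x ∈ Submodule.span K (κ : Set Ω) := by
    have h1 : x ^ p - x ∈ Algebra.adjoin K (κ : Set Ω) := by
      rw [← adjoin_toSubalgebra]; exact hx
    have h2 := Algebra.adjoin_eq_span K (κ : Set Ω) ▸
      (show x ^ p - x ∈ Subalgebra.toSubmodule _ from h1)
    exact Submodule.span_mono (Submonoid.closure_le (S := κ.toSubmonoid).mpr le_rfl) h2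
  have key : ∀ f ∈ Submodule.span K (κ : Set Ω), ∀ g : K, ∀ a : Ω, a ^ p - a = f * g →
      a ∈ adjoin K (κ : Set Ω) := by
    intro f hf
    induction hf using Submodule.span_induction with
    | mem b hb => exact fun g a ha => h.mem_adjoin_of_artinSchreier hK hb g.2 ha
    | zero => exact fun g a ha => h.mem_adjoin_of_artinSchreier hK (zero_mem κ) g.2 ha
    | add f₁ f₂ _ _ h₁ h₂ =>
      intro g a ha
      obtain ⟨b, hb⟩ := exists_artinSchreier_root (p := p) (f₁ * g)
      have := add_mem (h₁ g b hb) (h₂ g (a - b) (by rw [artinSchreier_sub, ha, hb]; ring))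
      rwa [add_sub_cancel] at this
    | smul r f _ hf =>
      intro g a ha
      refine hf (r * g) a ?_
      rw [ha, Algebra.smul_def]
      push_cast
      change (r : Ω) * f * g = _
      ring
  exact key _ hspan 1 x (by simp)

theorem IsFrame.adjoin_eq_top {p : ℕ} (h : IsFrame p F₀ k κ) [ExpChar Ω p] [IsAlgClosed Ω]
    [IsUltrametricDist Ω] (hK : IsComplement F₀ k κ K) :
    adjoin K (κ : Set Ω) = ⊤ := by
  by_contra hne
  obtain ⟨x, hx⟩ : ∃ x, x ∉ adjoin K (κ : Set Ω) := by
    by_contra! hall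
    exact hne (top_unique fun x _ => hall x)
  have := h.isGalois hK
  set D := adjoin K (κ : Set Ω) with hD
  have : IsGalois D Ω := IsGalois.tower_top_of_isGalois K D Ω
  have hκD : ∀ x ∈ κ, x ∈ D := fun x hx => subset_adjoin K _ hx
  let L : IntermediateField D Ω :=
    (FiniteGaloisIntermediateField.adjoin D {x}).toIntermediateField
  have hxL : x ∈ L := FiniteGaloisIntermediateField.subset_adjoin D {x} rfl
  have : ExpChar L p := ((algebraMap L Ω).expChar_iff (algebraMap L Ω).injective p).mpr ‹_›
  obtain ⟨hp, a, ha, d, hd⟩ := exists_artinSchreier_of_normed (D := D) (L := L) p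
    (fun σ y => by
      have h1 := h.norm_map hK ((AlgEquiv.liftNormal σ Ω).restrictScalars K) (y : Ω)
      rw [show (AlgEquiv.liftNormal σ Ω).restrictScalars K (y : Ω) = (σ y : Ω) from
        AlgEquiv.liftNormal_commutes σ Ω y] at h1
      exact h1)
    (fun a ha => by
      obtain ⟨c, hc, hac⟩ := h.section_κ.exists_norm_sub_lt (a : Ω) ha
      exact ⟨⟨c, hκD c hc⟩, hac⟩)
    (fun n _ hn d => by
      obtain ⟨g, hg, h1⟩ := h.exists_norm_eq_of_mem_adjoin hK d.2
      obtain ⟨e, he, h2⟩ := h.exists_root_norm hK hn hg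
      exact ⟨⟨e, D.algebraMap_mem ⟨e, he⟩⟩, h1.trans h2⟩)
    (fun n hpn hn => by
      have h1 : (n : Ω) ≠ 0 := by
        rcases ‹ExpChar Ω p› with _ | ⟨hp⟩
        · exact_mod_cast hn
        · rw [Ne, CharP.cast_eq_zero_iff Ω p]
          exact (hp.coprime_iff_not_dvd).mp hpn
      exact h.section_κ.norm_natCast h1)
    ⟨⟨x, hxL⟩, by
      rintro ⟨d, hd⟩
      have h1 : (d : Ω) = x := congr_arg Subtype.val hd
      exact hx (h1 ▸ d.2)⟩
  have : Fact p.Prime := ⟨hp⟩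
  have : CharP Ω p := by
    rcases ‹ExpChar Ω p› with _ | _
    · exact absurd hp Nat.not_prime_one
    · assumption
  refine ha ⟨⟨a, h.mem_adjoin_of_artinSchreier' hK ?_⟩, rfl⟩
  rw [← show (d : Ω) = (a : Ω) ^ p - a from congr_arg Subtype.val hd]
  exact d.2

end

section

/-- A field `K` in a valued field `C`, with a field `κ` representing the residue classes of `C`,
linked to `K` by means of averages of automorphisms of `C` over `K`. -/
structure IsSplitting {C : Type*} [NormedField C] (p : ℕ) (κ K Ω : Subfield C) : Prop where
  section_κ : IsResidueSection κ
  κ_le : κ ≤ Ω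
  le : K ≤ Ω
  isAlgClosed_κ : IsAlgClosed κ
  isAlgClosed : IsAlgClosed Ω
  isAlgebraic : ∀ x ∈ κ, IsAlgebraic (K ⊓ κ : Subfield C) x
  root_mem : ∀ x, x ^ p ∈ K → x ∈ K
  averaging : ∀ W : Set C, W.Finite → W ⊆ Ω → ∃ (n : ℕ) (s : Fin (n + 1) → C ≃+* C)
    (E : Subfield C), E ≤ κ ∧ (∀ i x, ‖s i x‖ = ‖x‖) ∧ (∀ i, ∀ x ∈ K, s i x = x) ∧
    (∀ b ∈ E, ∀ w ∈ W, ∑ i, s i (b * w) ∈ K) ∧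
    ∀ c : Fin (n + 1) → C, (∀ i, c i ∈ κ) → c ≠ 0 → ∃ b ∈ E, ∑ i, s i b * c i ≠ 0

theorem isAlgClosed_of_denseRange {Ω C : Type*} [Field Ω] [NontriviallyNormedField C]
    [CompleteSpace C] [IsUltrametricDist C] [Algebra Ω C] (hd : DenseRange (algebraMap Ω C))
    [IsAlgClosed Ω] : IsAlgClosed C := by
  apply of_exists_root
  intro f fmon firr
  have hf0 : f.natDegree ≠ 0 := (Irreducible.natDegree_pos firr).ne'
  let F := f.SplittingField
  let : NormedField F := spectralNorm.normedField C F
  let : NormedAlgebra C F := spectralNorm.normedAlgebra C F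
  have hfd : (f.map (algebraMap C F)).degree ≠ 0 := by
    simpa using degree_ne_of_natDegree_ne hf0
  let a := rootOfSplits (SplittingField.splits f) hfd
  have fa0 : f.aeval a = 0 := by
    rw [← eval_map_algebraMap]
    exact eval_rootOfSplits (SplittingField.splits f) hfd
  have hcl : IsClosed (Set.range (algebraMap C F)) :=
    (algebraMap_isometry C F).isClosedEmbedding.isClosed_range
  have ha : a ∈ closure (Set.range (algebraMap C F)) := by
    rw [Metric.mem_closure_iff]
    intro δ hδ
    have hε : (δ / (max ‖a‖ 1)) ^ f.natDegree / (f.natDegree + 1) > 0 := by positivity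
    obtain ⟨g, gmon, gdeg, gcoeff⟩ :=
      exists_monic_and_natDegree_eq_and_norm_map_algebraMap_coeff_sub_lt hd fmon hε
    obtain ⟨b, hb, hab⟩ := exists_aroots_norm_sub_lt_of_norm_coeff_sub_lt
      hε fa0 fmon (gmon.map _) (gdeg ▸ (g.natDegree_map _)) gcoeff
      (by simpa [Polynomial.map_map] using (IsAlgClosed.splits g).map ((algebraMap C F).comp _))
    have hab : ‖a - b‖ < δ := by
      rw [← Real.rpow_natCast, ← mul_comm_div, div_self, one_mul,
          ← Real.rpow_mul (div_pos hδ (by positivity)).le, mul_inv_cancel₀] at hab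
      · simpa [mul_assoc, div_mul_cancel₀ _ (by positivity : (max ‖a‖ 1) > 0).ne'] using hab
      · simp [hf0]
      · positivity
    rw [Polynomial.aroots_def, Splits.roots_map ((IsAlgClosed.splits g).map _),
        Multiset.mem_map] at hb
    obtain ⟨b', _, hb'⟩ := hb
    exact ⟨b, ⟨b', hb'⟩, by rwa [dist_eq_norm]⟩
  obtain ⟨b, hb⟩ := hcl.closure_eq ▸ ha
  refine ⟨b, ?_⟩
  have h1 : algebraMap C F (f.eval b) = 0 := by
    rw [← aeval_algebraMap_apply_eq_algebraMap_eval, hb, fa0]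
  exact (map_eq_zero _).mp h1

variable {Ω : Type u} [NormedField Ω]

theorem isUltrametricDist_completion [IsUltrametricDist Ω] :
    IsUltrametricDist (Completion Ω) := by
  refine ⟨fun x y z => ?_⟩
  induction x, y, z using Completion.induction_on₃ with
  | hp => apply isClosed_le <;> fun_prop
  | ih x y z => simpa using dist_triangle_max x y z

theorem IsResidueSection.map {K C : Type*} [NormedField K] [NormedField C] [IsUltrametricDist C]
    {k : Subfield K} (hk : IsResidueSection k) (ι : K →+* C) (hι : ∀ x, ‖ι x‖ = ‖x‖)
    (hd : DenseRange ι) : IsResidueSection (k.map ι) := by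
  constructor
  · rintro _ ⟨c, hc, rfl⟩ hc0
    rw [hι]
    exact hk.norm_eq_one c hc (by rintro rfl; exact hc0 (map_zero ι))
  · intro a ha
    obtain ⟨_, ⟨w, rfl⟩, hw⟩ := Metric.mem_closure_iff.mp (hd a) 1 one_pos
    rw [dist_eq_norm] at hw
    have hw1 : ‖w‖ ≤ 1 := by
      rw [← hι, ← sub_sub_cancel a (ι w)]
      exact norm_sub_le ha hw.le
    obtain ⟨c, hc, hwc⟩ := hk.exists_norm_sub_lt w hw1
    refine ⟨ι c, ⟨c, hc, rfl⟩, ?_⟩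
    rw [← sub_add_sub_cancel a (ι w), ← map_sub]
    exact norm_add_lt hw (by rwa [hι])

variable {p : ℕ} {F₀ k κ K : Subfield Ω}

theorem IsFrame.isSplitting [IsUltrametricDist Ω] [IsAlgClosed Ω] [ExpChar Ω p]
    (h : IsFrame p F₀ k κ)
    (hK : IsComplement F₀ k κ K) {C : Type u} [NormedField C] [IsUltrametricDist C] (ι : Ω →+* C)
    (hι : ∀ x, ‖ι x‖ = ‖x‖) (hd : DenseRange ι)
    (hlift : ∀ σ : Ω ≃+* Ω, (∀ x, ‖σ x‖ = ‖x‖) → ∃ τ : C ≃+* C, (∀ x, ‖τ x‖ = ‖x‖) ∧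
      ∀ x, τ (ι x) = ι (σ x)) :
    IsSplitting p (κ.map ι) (K.map ι) ι.fieldRange where
  section_κ := h.section_κ.map ι hι hd
  κ_le := by
    rintro _ ⟨x, -, rfl⟩
    exact ⟨x, rfl⟩
  le := by
    rintro _ ⟨x, -, rfl⟩
    exact ⟨x, rfl⟩
  isAlgClosed_κ := by
    have : IsAlgClosed κ := by
      refine of_exists_root κ fun q hq hirr => ?_
      obtain ⟨x, hx⟩ := exists_aeval_eq_zero Ω q hirr.degree_pos.ne'
      have hxκ := h.mem_κ_of_isAlgebraic ⟨q, hq.ne_zero, hx⟩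
      refine ⟨⟨x, hxκ⟩, (algebraMap κ Ω).injective ?_⟩
      rw [← aeval_algebraMap_apply_eq_algebraMap_eval, map_zero]
      exact hx
    exact IsAlgClosed.of_ringEquiv κ _ (κ.toSubring.equivMapOfInjective ι ι.injective)
  isAlgClosed := IsAlgClosed.of_ringEquiv Ω _
    (RingEquiv.ofBijective ι.rangeRestrictField ι.rangeRestrictField_bijective)
  isAlgebraic := by
    rintro _ ⟨x, hx, rfl⟩
    obtain ⟨q, hq, hqx⟩ := (h.mem_iff x).mp hx
    let f : k →+* (K.map ι ⊓ κ.map ι : Subfield C) := (ι.comp k.subtype).codRestrict _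
      fun y => ⟨⟨y, hK.le (h.le y.2), rfl⟩, ⟨y, h.le_κ y.2, rfl⟩⟩
    refine ⟨q.map f, (Polynomial.map_ne_zero_iff f.injective).mpr hq, ?_⟩
    rw [aeval_def, eval₂_map]
    have : (algebraMap (K.map ι ⊓ κ.map ι : Subfield C) C).comp f = ι.comp (algebraMap k Ω) := rfl
    rw [this, ← hom_eval₂, ← aeval_def, hqx, map_zero]
  root_mem := by
    rintro x ⟨y, hy, hyx⟩
    have : ExpChar C p := expChar_of_injective_ringHom ι.injective p
    obtain ⟨z, hz⟩ := exists_pow_nat_eq y (expChar_pos Ω p)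
    refine ⟨z, h.root_mem hK (hz ▸ hy), frobenius_inj C p ?_⟩
    rw [frobenius_def, frobenius_def, ← hyx, ← hz, map_pow]
  averaging := by
    intro W hW hWΩ
    obtain ⟨n, s, E, hEκ, hsE, hE⟩ := h.exists_averaging hK (W := ι ⁻¹' W)
      (hW.preimage ι.injective.injOn) (fun w _ => by simp [h.adjoin_eq_top hK])
    choose τ hτ hτι using fun i => hlift (s i).toRingEquiv (h.norm_map hK (s i))
    refine ⟨n, τ, E.map ι, ?_, hτ, ?_, ?_, ?_⟩
    · rintro _ ⟨x, hx, rfl⟩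
      exact ⟨x, hEκ hx, rfl⟩
    · rintro i _ ⟨x, hx, rfl⟩
      rw [hτι]
      exact congr_arg ι ((s i).commutes ⟨x, hx⟩)
    · rintro _ ⟨b, hb, rfl⟩ w hw
      obtain ⟨w, rfl⟩ := hWΩ hw
      refine ⟨_, hsE b hb w hw, ?_⟩
      rw [map_sum]
      refine sum_congr rfl fun i _ => ?_
      rw [← map_mul, hτι]; rfl
    · intro c hc hc0
      choose c' hc'κ hc' using hc
      obtain ⟨b, hb, hbc⟩ := hE c' fun h0 => hc0 <| funext fun i => by
        rw [← hc', h0]; simp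
      refine ⟨ι b, ⟨b, hb, rfl⟩, fun h0 => hbc (ι.injective ?_)⟩
      rw [map_sum, map_zero, ← h0]
      refine sum_congr rfl fun i _ => ?_
      rw [map_mul, hτι, hc']; rfl

end

section

variable {F Ω : Type*} [NontriviallyNormedField F] [IsUltrametricDist F] [CompleteSpace F]
  [NormedField Ω] [IsUltrametricDist Ω] [NormedAlgebra F Ω] [Algebra.IsAlgebraic F Ω]
  [IsAlgClosed Ω]

omit [IsAlgClosed Ω] in
theorem norm_le_one_of_isAlgebraic {k : Subfield Ω} (hk : ∀ c ∈ k, c ≠ 0 → ‖c‖ = 1) {x : Ω}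
    (hx : IsAlgebraic k x) : ‖x‖ ≤ 1 := by
  by_contra! h1
  obtain ⟨q, hq, hqx⟩ := isAlgebraic_iff_isIntegral.mp hx
  have h2 : ‖∑ i ∈ range q.natDegree, (q.coeff i : Ω) * x ^ i‖ < ‖x‖ ^ q.natDegree := by
    refine norm_sum_lt _ _ (by positivity) fun i hi => ?_
    rw [norm_mul, norm_pow]
    have h3 : ‖(q.coeff i : Ω)‖ ≤ 1 := by
      rcases eq_or_ne (q.coeff i : Ω) 0 with h0 | h0
      · simp [h0]
      · exact (hk _ (q.coeff i).2 h0).le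
    calc ‖(q.coeff i : Ω)‖ * ‖x‖ ^ i ≤ 1 * ‖x‖ ^ i := by gcongr
      _ < ‖x‖ ^ q.natDegree := by
        rw [one_mul]; exact pow_lt_pow_right₀ h1 (mem_range.mp hi)
  rw [← aeval_def, aeval_eq_sum_range, sum_range_succ, hq.coeff_natDegree, one_smul] at hqx
  rw [← norm_pow, ← norm_neg (x ^ _), ← eq_neg_of_add_eq_zero_left hqx] at h2
  exact h2.ne rfl

omit [IsUltrametricDist Ω] [IsAlgClosed Ω] in
theorem one_le_norm_prod {a : Ω} {s : Multiset Ω} (hs : ∀ r ∈ s, 1 ≤ ‖a - r‖) :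
    1 ≤ ‖(s.map fun r => a - r).prod‖ := by
  induction s using Multiset.induction_on with
  | empty => simp
  | cons r s ih =>
    rw [Multiset.map_cons, Multiset.prod_cons, norm_mul]
    exact one_le_mul_of_one_le_of_one_le (hs r (Multiset.mem_cons_self r s))
      (ih fun r hr => hs r (Multiset.mem_cons_of_mem hr))

theorem isFrame_algebraicClosure (p : ℕ) {k : Subfield F} (hk : IsResidueSection k)
    (hperf : ∀ x ∈ k, ∃ y ∈ k, y ^ p = x) :
    IsFrame p (algebraMap F Ω).fieldRange (k.map (algebraMap F Ω))
      (algebraicClosure (k.map (algebraMap F Ω)) Ω).toSubfield := by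
  have hk' : ∀ c ∈ k.map (algebraMap F Ω), c ≠ 0 → ‖c‖ = 1 := by
    rintro _ ⟨c, hc, rfl⟩ hc0
    rw [norm_algebraMap']
    exact hk.norm_eq_one c hc (by rintro rfl; exact hc0 (map_zero _))
  have hmem : ∀ x : Ω, x ∈ (algebraicClosure (k.map (algebraMap F Ω)) Ω).toSubfield ↔
      IsAlgebraic (k.map (algebraMap F Ω)) x := fun x => mem_algebraicClosure_iff
  have hnorm : ∀ x ∈ (algebraicClosure (k.map (algebraMap F Ω)) Ω).toSubfield, x ≠ 0 →
      ‖x‖ = 1 := by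
    intro x hx hx0
    refine le_antisymm (norm_le_one_of_isAlgebraic hk' ((hmem x).mp hx)) ?_
    have h1 := norm_le_one_of_isAlgebraic hk' ((hmem x⁻¹).mp (inv_mem hx))
    rwa [norm_inv, inv_le_one₀ (norm_pos_iff.mpr hx0)] at h1
  have hle : k.map (algebraMap F Ω) ≤
      (algebraicClosure (k.map (algebraMap F Ω)) Ω).toSubfield := fun x hx =>
    (hmem x).mpr (isAlgebraic_algebraMap (⟨x, hx⟩ : k.map (algebraMap F Ω)))
  exact {
    isAlgebraic := fun x => by
      obtain ⟨q, hq, hqx⟩ := Algebra.IsAlgebraic.isAlgebraic (R := F) x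
      refine ⟨q.map (algebraMap F Ω).rangeRestrictField,
        (Polynomial.map_ne_zero_iff (RingHom.injective _)).mpr hq, ?_⟩
      rw [aeval_def, eval₂_map]
      exact hqx
    norm_ringEquiv := fun σ hσ x => by
      let σ' : Ω ≃ₐ[F] Ω := AlgEquiv.ofRingEquiv (f := σ) fun r => hσ _ ⟨r, rfl⟩
      rw [NormedAlgebra.norm_eq_spectralNorm F, NormedAlgebra.norm_eq_spectralNorm F]
      exact (spectralNorm_eq_of_equiv σ' x).symm
    section_κ := by
      refine ⟨hnorm, fun a ha => ?_⟩
      have ha1 := ha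
      rw [NormedAlgebra.norm_eq_spectralNorm F, spectralNorm] at ha
      have hint : IsIntegral F a := (Algebra.IsAlgebraic.isAlgebraic a).isIntegral
      rw [spectralValue_le_one_iff (minpoly.monic hint)] at ha
      choose c hck hc using fun i => hk.exists_norm_sub_lt _ (ha i)
      set n := (minpoly F a).natDegree with hn
      have hn0 : n ≠ 0 := (minpoly.natDegree_pos hint).ne'
      let k' := k.map (algebraMap F Ω)
      have hinj := (algebraMap k' Ω).injective
      let q : Polynomial k' := X ^ n +
        ∑ i ∈ range n, Polynomial.C (⟨algebraMap F Ω (c i), c i, hck i, rfl⟩ : k') * X ^ i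
      have hqm : q.Monic := monic_X_pow_add (mem_degreeLT.mp (sum_mem fun i hi =>
        mem_degreeLT.mpr ((degree_C_mul_X_pow_le _ _).trans_lt
          (by exact_mod_cast mem_range.mp hi))))
      have hqe : ∀ x : Ω, aeval x q = x ^ n +
          ∑ i ∈ range n, algebraMap F Ω (c i) * x ^ i := by
        intro x
        simp only [q, map_add, map_pow, aeval_X, map_sum, map_mul, aeval_C]
        rfl
      have hqa : ‖aeval a q‖ < 1 := by
        have h1 := minpoly.aeval F a
        rw [aeval_eq_sum_range, sum_range_succ,
          (minpoly.monic hint).coeff_natDegree, one_smul, ← hn] at h1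
        have h2 : aeval a q = ∑ i ∈ range n,
            algebraMap F Ω (c i - (minpoly F a).coeff i) * a ^ i := by
          rw [hqe, eq_neg_of_add_eq_zero_right h1, neg_add_eq_sub, ← sum_sub_distrib]
          refine sum_congr rfl fun i _ => ?_
          rw [map_sub, Algebra.smul_def]
          ring
        rw [h2]
        refine norm_sum_lt _ _ one_pos fun i _ => ?_
        rw [norm_mul, norm_algebraMap', norm_pow, norm_sub_rev]
        exact mul_lt_one_of_nonneg_of_lt_one_left (norm_nonneg _) (hc i)
          (pow_le_one₀ (norm_nonneg _) ha1)
      rw [← eval_map_algebraMap,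
        (IsAlgClosed.splits _).eval_eq_prod_roots_of_monic (hqm.map _)] at hqa
      by_contra! hfar
      refine hqa.not_ge (one_le_norm_prod fun r hr => hfar r ((hmem r).mpr ⟨q, hqm.ne_zero, ?_⟩))
      rw [← eval_map_algebraMap]
      exact (mem_roots'.mp hr).2
    mem_iff := hmem
    le := by
      rintro _ ⟨x, -, rfl⟩
      exact ⟨x, rfl⟩
    inter_le := by
      rintro _ ⟨x, rfl⟩ hx
      have hx1 : ‖x‖ ≤ 1 := by
        rw [← norm_algebraMap' Ω]
        exact norm_le_one_of_isAlgebraic hk' ((hmem _).mp hx)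
      obtain ⟨c, hc, hxc⟩ := hk.exists_norm_sub_lt x hx1
      refine ⟨c, hc, ?_⟩
      by_contra hne
      have := hnorm (algebraMap F Ω x - algebraMap F Ω c)
        (sub_mem hx (hle ⟨c, hc, rfl⟩)) (sub_ne_zero.mpr (Ne.symm hne))
      rw [← map_sub, norm_algebraMap'] at this
      exact hxc.ne this
    perfect := by
      rintro _ ⟨x, hx, rfl⟩
      obtain ⟨y, hy, rfl⟩ := hperf x hx
      exact ⟨_, ⟨y, hy, rfl⟩, by simp⟩ }

end

theorem exists_lift_completion {Ω : Type*} [NormedField Ω] (σ : Ω ≃+* Ω) (hσ : ∀ x, ‖σ x‖ = ‖x‖) :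
    ∃ τ : Completion Ω ≃+* Completion Ω, (∀ x, ‖τ x‖ = ‖x‖) ∧
      ∀ x : Ω, τ (Completion.coeRingHom x) =
        Completion.coeRingHom (σ x) := by
  have h1 : Continuous σ := (AddMonoidHomClass.isometry_of_norm σ hσ).continuous
  have h2 : Continuous σ.symm := (AddMonoidHomClass.isometry_of_norm σ.symm fun x => by
    rw [← hσ, σ.apply_symm_apply]).continuous
  have h3 : ∀ x : Ω, Completion.mapRingEquiv σ h1 h2 (x : Completion Ω) =
      (σ x : Ω) := fun x => Completion.mapRingHom_coe (f := (σ : Ω →+* Ω)) h1 x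
  refine ⟨Completion.mapRingEquiv σ h1 h2, fun x => ?_, h3⟩
  have h4 : Continuous (Completion.mapRingEquiv σ h1 h2) :=
    Completion.continuous_map
  induction x using Completion.induction_on with
  | hp => exact isClosed_eq h4.norm continuous_norm
  | ih x => rw [h3, Completion.norm_coe, Completion.norm_coe, hσ]

theorem exists_isSplitting_of_algebraicClosure {F Ω : Type u} [NontriviallyNormedField F]
    [IsUltrametricDist F] [CompleteSpace F] [NormedField Ω] [IsUltrametricDist Ω]
    [NormedAlgebra F Ω] [Algebra.IsAlgebraic F Ω] [IsAlgClosed Ω] (p : ℕ) [ExpChar F p]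
    {k : Subfield F} (hk : IsResidueSection k) (hperf : ∀ x ∈ k, ∃ y ∈ k, y ^ p = x) :
    ∃ (C : Type u) (_ : NormedField C) (_ : IsUltrametricDist C) (_ : CompleteSpace C)
      (_ : IsAlgClosed C) (ι : F →+* C) (κ K Ω : Subfield C), (∀ x, ‖ι x‖ = ‖x‖) ∧
      IsSplitting p κ K Ω ∧ (∀ x, ι x ∈ K) ∧ K ⊓ κ = k.map ι := by
  let C := Completion Ω
  have : IsUltrametricDist C := isUltrametricDist_completion
  let ι : Ω →+* C := Completion.coeRingHom
  have hι : ∀ x : Ω, ‖ι x‖ = ‖x‖ := Completion.norm_coe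
  have hd : DenseRange ι := Completion.denseRange_coe
  let : NontriviallyNormedField C :=
    { (inferInstance : NormedField C) with
      non_trivial := by
        obtain ⟨x, hx⟩ := NontriviallyNormedField.non_trivial (α := F)
        exact ⟨ι (algebraMap F Ω x), by rwa [hι, norm_algebraMap']⟩ }
  have : IsAlgClosed C := by
    let : Algebra Ω C := ι.toAlgebra
    exact isAlgClosed_of_denseRange (Ω := Ω) hd
  have : ExpChar Ω p := expChar_of_injective_ringHom (algebraMap F Ω).injective p
  have hfr := isFrame_algebraicClosure (Ω := Ω) p hk hperf
  obtain ⟨K, hK⟩ := hfr.exists_isComplement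
  have hsp := hfr.isSplitting hK ι hι hd fun σ hσ => exists_lift_completion σ hσ
  refine ⟨C, inferInstance, inferInstance, inferInstance, inferInstance,
    ι.comp (algebraMap F Ω), _, _, _, fun x => ?_, hsp, fun x => ?_, ?_⟩
  · rw [RingHom.comp_apply, hι, norm_algebraMap']
  · exact ⟨_, hK.le ⟨_, rfl⟩, rfl⟩
  · ext x
    constructor
    · rintro ⟨⟨y, hy, rfl⟩, z, hz, hzy⟩
      obtain rfl : z = y := ι.injective hzy
      obtain ⟨c, hc, rfl⟩ := hK.inter_le _ hy hz
      exact ⟨c, hc, rfl⟩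
    · rintro ⟨c, hc, rfl⟩
      have h1 : algebraMap F Ω c ∈ k.map (algebraMap F Ω) := ⟨_, hc, rfl⟩
      exact ⟨⟨_, hK.le (hfr.le h1), rfl⟩, ⟨_, hfr.le_κ h1, rfl⟩⟩

theorem exists_isSplitting {K₁ : Type u} [NontriviallyNormedField K₁] [IsUltrametricDist K₁]
    (p : ℕ) [ExpChar K₁ p] {k : Subfield K₁} (hk : IsResidueSection k)
    (hperf : ∀ x ∈ k, ∃ y ∈ k, y ^ p = x) :
    ∃ (C : Type u) (_ : NormedField C) (_ : IsUltrametricDist C) (_ : CompleteSpace C)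
      (_ : IsAlgClosed C) (ι : K₁ →+* C) (κ K Ω : Subfield C), (∀ x, ‖ι x‖ = ‖x‖) ∧
      IsSplitting p κ K Ω ∧ (∀ x, ι x ∈ K) ∧ K ⊓ κ = k.map ι := by
  let F := Completion K₁
  have : IsUltrametricDist F := isUltrametricDist_completion
  let j : K₁ →+* F := Completion.coeRingHom
  have hj : ∀ x : K₁, ‖j x‖ = ‖x‖ := Completion.norm_coe
  let : NontriviallyNormedField F :=
    { (inferInstance : NormedField F) with
      non_trivial := by
        obtain ⟨x, hx⟩ := NontriviallyNormedField.non_trivial (α := K₁)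
        exact ⟨j x, by rwa [hj]⟩ }
  let : NormedField (AlgebraicClosure F) := spectralNorm.normedField F _
  let : NormedAlgebra F (AlgebraicClosure F) := spectralNorm.normedAlgebra F _
  have : IsUltrametricDist (AlgebraicClosure F) :=
    IsUltrametricDist.isUltrametricDist_of_isNonarchimedean_norm isNonarchimedean_spectralNorm
  have : ExpChar F p := expChar_of_injective_ringHom j.injective p
  obtain ⟨C, i1, i2, i3, i4, ι, κ, K, Ω, hι, hsp, hιK, hκ⟩ :=
    exists_isSplitting_of_algebraicClosure (Ω := AlgebraicClosure F) p
    (hk.map j hj Completion.denseRange_coe) (by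
      rintro _ ⟨x, hx, rfl⟩
      obtain ⟨y, hy, rfl⟩ := hperf x hx
      exact ⟨_, ⟨y, hy, rfl⟩, by simp⟩)
  exact ⟨C, i1, i2, i3, i4, ι.comp j, κ, K, Ω, fun x => (hι _).trans (hj x), hsp,
    fun x => hιK _, by rw [hκ, Subfield.map_map]⟩

section

variable {C : Type*} [NormedField C]

/-- The algebraic closure of a subfield in the ambient field. -/
def acl (M : Subfield C) : Subfield C := (algebraicClosure M C).toSubfield

theorem mem_acl {M : Subfield C} {x : C} : x ∈ acl M ↔ IsAlgebraic M x := mem_algebraicClosure_iff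

theorem le_acl (M : Subfield C) : M ≤ acl M := fun x hx =>
  mem_acl.mpr (isAlgebraic_algebraMap (⟨x, hx⟩ : M))

theorem acl_mono {M N : Subfield C} (h : M ≤ N) : acl M ≤ acl N := fun x hx => by
  rw [mem_acl] at hx ⊢
  let := (Subfield.inclusion h).toAlgebra
  have : IsScalarTower M N C := IsScalarTower.of_algebraMap_eq fun _ => rfl
  exact hx.tower_top N

theorem acl_acl {M : Subfield C} {x : C} (hx : IsAlgebraic (acl M) x) : x ∈ acl M :=
  mem_acl.mpr <| by
    let := (Subfield.inclusion (le_acl M)).toAlgebra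
    have : IsScalarTower M (acl M) C := IsScalarTower.of_algebraMap_eq fun _ => rfl
    have : Algebra.IsAlgebraic M (acl M) :=
      ⟨fun x => (isAlgebraic_algebraMap_iff (algebraMap (acl M) C).injective).mp (mem_acl.mp x.2)⟩
    exact hx.restrictScalars M

theorem isAlgClosed_acl [IsAlgClosed C] (M : Subfield C) : IsAlgClosed (acl M) := by
  refine of_exists_root _ fun q hq hirr => ?_
  obtain ⟨x, hx⟩ := exists_aeval_eq_zero C q hirr.degree_pos.ne'
  have hxκ : x ∈ acl M := acl_acl ⟨q, hq.ne_zero, hx⟩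
  refine ⟨⟨x, hxκ⟩, (algebraMap (acl M) C).injective ?_⟩
  rw [← aeval_algebraMap_apply_eq_algebraMap_eval, map_zero]
  exact hx

theorem map_mem_acl {M : Subfield C} (σ : C ≃+* C) (hσ : ∀ x ∈ M, σ x = x) {x : C}
    (hx : x ∈ acl M) : σ x ∈ acl M := by
  rw [mem_acl] at hx ⊢
  let f : C →ₐ[M] C := { (σ : C →+* C) with commutes' := fun r => hσ r r.2 }
  exact hx.algHom f

theorem acl_le {M Ω : Subfield C} [IsAlgClosed Ω] (h : M ≤ Ω) : acl M ≤ Ω := fun _ hx =>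
  mem_of_isIntegral (isAlgebraic_iff_isIntegral.mp (mem_acl.mp (acl_mono h hx)))

/-- A relatively algebraically closed subfield `M` of `K` containing the residue section of `K`. -/
structure IsStage (p : ℕ) (κ K Ω M : Subfield C) : Prop extends IsSplitting p κ K Ω where
  M_le : M ≤ K
  mem_of_isAlgebraic : ∀ x ∈ K, IsAlgebraic M x → x ∈ M
  inf_le : K ⊓ κ ≤ M

variable {p : ℕ} {κ K Ω M : Subfield C}

theorem IsSplitting.κ_le_acl (h : IsSplitting p κ K Ω) : κ ≤ acl (K ⊓ κ) := fun x hx =>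
  mem_acl.mpr (h.isAlgebraic x hx)

theorem IsSplitting.acl_inf_le (h : IsSplitting p κ K Ω) : acl (K ⊓ κ) ≤ κ := by
  have := h.isAlgClosed_κ
  exact acl_le inf_le_right

theorem IsSplitting.map_mem (h : IsSplitting p κ K Ω) (σ : C ≃+* C) (hσ : ∀ x ∈ K, σ x = x) {x : C}
    (hx : x ∈ κ) : σ x ∈ κ :=
  h.acl_inf_le (map_mem_acl σ (fun x hx => hσ x (Subfield.mem_inf.mp hx).1) (h.κ_le_acl hx))

theorem IsSplitting.norm_le_one (h : IsSplitting p κ K Ω) {c : C} (hc : c ∈ κ) : ‖c‖ ≤ 1 := by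
  rcases eq_or_ne c 0 with rfl | h0
  · simp
  · exact (h.section_κ.norm_eq_one c hc h0).le

theorem IsSplitting.exists_mul_mem (h : IsSplitting p κ K Ω) {t : C} {n : ℕ} (ht : t ∈ Ω)
    (ht0 : t ≠ 0) (hn : n ≠ 0) (htn : t ^ n ∈ K) : ∃ γ ∈ κ, γ ≠ 0 ∧ γ * t ∈ K := by
  obtain ⟨m, s, E, hEκ, hs, hsK, hsE, hE⟩ := h.averaging {t} (Set.finite_singleton t) (by simpa)
  have := h.isAlgClosed_κ
  have hζ : ∀ i, s i t / t ∈ κ := fun i => by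
    refine mem_of_pow_mem (Nat.pos_of_ne_zero hn) ?_
    rw [div_pow, ← map_pow, hsK i _ htn, div_self (pow_ne_zero n ht0)]
    exact one_mem κ
  obtain ⟨b, hb, hb0⟩ := hE (fun i => s i t / t) hζ fun h0 => by
    have := congr_fun h0 0
    simp [ht0] at this
  refine ⟨_, sum_mem fun i _ => mul_mem (h.map_mem (s i) (hsK i) (hEκ hb)) (hζ i), hb0, ?_⟩
  convert! hsE b hb t rfl using 1
  rw [sum_mul]
  refine sum_congr rfl fun i _ => ?_
  rw [map_mul, mul_assoc, div_mul_cancel₀ _ ht0]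

theorem IsSplitting.mem_of_forall_fixed (h : IsSplitting p κ K Ω) {x : C} (hx : x ∈ Ω)
    (hfix : ∀ σ : C ≃+* C, (∀ x, ‖σ x‖ = ‖x‖) → (∀ y ∈ K, σ y = y) → σ x = x) : x ∈ K := by
  obtain ⟨m, s, E, hEκ, hs, hsK, hsE, hE⟩ := h.averaging {x, 1} (by simp) (by
    rintro _ (rfl | rfl)
    exacts [hx, one_mem Ω])
  obtain ⟨b, hb, hb0⟩ := hE 1 (fun i => one_mem κ) one_ne_zero
  have h1 := hsE b hb x (by simp)
  have h2 := hsE b hb 1 (by simp)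
  simp only [Pi.one_apply, mul_one] at hb0 h2
  have h3 : ∑ i, s i (b * x) = (∑ i, s i b) * x := by
    rw [sum_mul]
    exact sum_congr rfl fun i _ => by rw [map_mul, hfix (s i) (hs i) (hsK i)]
  rw [h3] at h1
  exact (div_mem h1 h2 : _ / _ ∈ K) |> fun h4 => by rwa [mul_div_cancel_left₀ _ hb0] at h4

namespace IsStage

variable (h : IsStage p κ K Ω M)
include h

theorem κ_le_acl : κ ≤ acl M := h.toIsSplitting.κ_le_acl.trans (acl_mono h.inf_le)

theorem acl_le_Ω : acl M ≤ Ω := by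
  have := h.isAlgClosed
  exact acl_le (h.M_le.trans h.le)

theorem mem_of_mem_acl {x : C} (hx : x ∈ acl M) (hxK : x ∈ K) : x ∈ M :=
  h.mem_of_isAlgebraic x hxK (mem_acl.mp hx)

theorem map_mem_acl {σ : C ≃+* C} (hσ : ∀ x ∈ K, σ x = x) {x : C} (hx : x ∈ acl M) :
    σ x ∈ acl M := Ultra.map_mem_acl σ (fun x hx => hσ x (h.M_le hx)) hx

theorem perfectField [ExpChar C p] [IsAlgClosed C] : PerfectField M := by
  have : ExpChar M p := ((algebraMap M C).expChar_iff (algebraMap M C).injective p).mpr ‹_›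
  have : PerfectRing M p := PerfectRing.ofSurjective M p fun x => by
    obtain ⟨y, hy⟩ := exists_pow_nat_eq (x : C) (expChar_pos C p)
    have hyK : y ∈ K := h.root_mem y (hy ▸ h.M_le x.2)
    have hyM : y ∈ M := h.mem_of_isAlgebraic y hyK
      (IsAlgebraic.of_pow (expChar_pos C p) (hy ▸ isAlgebraic_algebraMap x))
    exact ⟨⟨y, hyM⟩, Subtype.ext hy⟩
  exact PerfectRing.toPerfectField M p

variable [IsUltrametricDist C]

theorem exists_average {ι : Type*} (S : Finset ι) (β T : ι → C) (hβ : ∀ i ∈ S, β i ∈ acl M)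
    (hT : ∀ i ∈ S, T i ∈ K) {z : C} (hz : z ∈ K) :
    ∃ g : ι → C, (∀ i ∈ S, g i ∈ M) ∧
      ‖z - ∑ i ∈ S, g i * T i‖ ≤ ‖z - ∑ i ∈ S, β i * T i‖ := by
  classical
  obtain ⟨m, s, E, hEκ, hs, hsK, hsE, hE⟩ := h.averaging (insert 1 (β '' S))
    ((S.finite_toSet.image β).insert 1) (by
      rintro _ (rfl | ⟨i, hi, rfl⟩)
      exacts [one_mem Ω, h.acl_le_Ω (hβ i hi)])
  obtain ⟨b, hb, hb0⟩ := hE 1 (fun i => one_mem κ) one_ne_zero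
  have h2 := hsE b hb 1 (by simp)
  simp only [Pi.one_apply, mul_one] at hb0 h2
  have hsκ : ∀ i, s i b ∈ κ := fun i => h.map_mem (s i) (hsK i) (hEκ hb)
  set u := ∑ i, s i b with hu
  have huκ : u ∈ κ := sum_mem fun i _ => hsκ i
  have hu1 : ‖u‖ = 1 := h.section_κ.norm_eq_one u huκ hb0
  have huM : u ∈ M := h.inf_le ⟨h2, huκ⟩
  refine ⟨fun j => (∑ i, s i (b * β j)) / u, fun j hj => ?_, ?_⟩
  · refine div_mem (h.mem_of_mem_acl (sum_mem fun i _ => ?_)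
      (hsE b hb (β j) (by simp only [Set.mem_insert_iff]; exact Or.inr ⟨j, hj, rfl⟩))) huM
    rw [map_mul]
    exact mul_mem (h.κ_le_acl (hsκ i)) (h.map_mem_acl (hsK i) (hβ j hj))
  · have h3 : z - ∑ j ∈ S, (∑ i, s i (b * β j)) / u * T j =
        u⁻¹ * ∑ i, s i (b * (z - ∑ j ∈ S, β j * T j)) := by
      have h4 : ∀ i, s i (b * (z - ∑ j ∈ S, β j * T j)) =
          s i b * z - ∑ j ∈ S, s i (b * β j) * T j := by
        intro i
        rw [mul_sub, map_sub, map_mul, hsK i z hz, mul_sum, map_sum]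
        congr 1
        refine sum_congr rfl fun j hj => ?_
        rw [← mul_assoc, map_mul, hsK i (T j) (hT j hj)]
      rw [sum_congr rfl fun i _ => h4 i, sum_sub_distrib, ← sum_mul,
        ← hu, mul_sub, inv_mul_cancel_left₀ hb0, Finset.sum_comm, mul_sum]
      congr 1
      refine sum_congr rfl fun j _ => ?_
      rw [← sum_mul]
      ring
    rw [h3, norm_mul, norm_inv, hu1, inv_one, one_mul]
    refine norm_sum_le _ _ (norm_nonneg _) fun i _ => ?_
    rw [map_mul, norm_mul, hs i (z - _)]
    exact mul_le_of_le_one_left (norm_nonneg _) (h.toIsSplitting.norm_le_one (hsκ i))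

theorem exists_norm_sub_le {z β : C} (hz : z ∈ K) (hβ : β ∈ acl M) :
    ∃ g ∈ M, ‖z - g‖ ≤ ‖z - β‖ := by
  obtain ⟨g, hg, hzg⟩ := h.exists_average {()} (fun _ => β) (fun _ => 1) (fun _ _ => hβ)
    (fun _ _ => one_mem K) hz
  exact ⟨g (), hg () (by simp), by simpa using hzg⟩

theorem trichotomy {t : C} (ht : t ∈ K) :
    TypeI (acl M) t ∨ (∃ α ∈ M, TypeII (acl M) (t - α)) ∨ t ∈ M := by
  by_contra! hcon
  obtain ⟨h1, h2, h3⟩ := hcon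
  rw [TypeI] at h1
  push Not at h1
  obtain ⟨α, hα⟩ := h1
  obtain ⟨g, hg, hgα⟩ := h.exists_norm_sub_le ht α.2
  have h4 := h2 g hg
  rw [TypeII] at h4
  push Not at h4
  obtain ⟨b, hb⟩ := h4
  obtain ⟨c, hc, -, hlt⟩ := h.section_κ.exists_ratio
    (sub_ne_zero.mpr fun h0 : t = g => h3 (by rw [h0]; exact hg)) hb
  have h5 := hα (⟨g, le_acl M hg⟩ + ⟨c, h.κ_le_acl hc⟩ * b)
  push_cast at h5
  rw [← sub_sub] at h5
  exact (h5.trans_lt hlt).not_ge hgα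

end IsStage

end

section

variable {C : Type*} [NormedField C]

theorem map_mem_hull {B : Subfield C} {σ : C ≃+* C} (hσ : ∀ x, ‖σ x‖ = ‖x‖)
    (hσB : ∀ x ∈ B, σ x ∈ B) {T x : C} (hx : x ∈ hull B T) : σ x ∈ hull B (σ T) := by
  have hE := isGood_hull B (σ T)
  have hiso : Isometry σ := AddMonoidHomClass.isometry_of_norm σ hσ
  refine hull_le (E := (hull B (σ T)).comap (σ : C →+* C)) ⟨?_, fun x hx => hE.le (hσB x hx), ?_⟩
    (mem_hull B (σ T)) hx
  · exact hE.isClosed.preimage hiso.continuous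
  · intro n hn c hc
    refine hE.tame n hn (σ c) ?_
    rw [← map_pow]
    exact hc

theorem map_mem_adjoin {D : Subfield C} {σ : C ≃+* C} (hσD : ∀ x ∈ D, σ x ∈ D) {R : Set C}
    (hR : ∀ r ∈ R, σ r ∈ R) {x : C} (hx : x ∈ adjoin D R) :
    σ x ∈ adjoin D R := by
  induction hx using adjoin_induction with
  | mem x hx => exact subset_adjoin D R (hR x hx)
  | algebraMap x => exact IntermediateField.algebraMap_mem _ (⟨σ x, hσD x x.2⟩ : D)
  | add x y _ _ hx hy => rw [map_add]; exact add_mem hx hy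
  | inv x _ hx => rw [map_inv₀]; exact inv_mem hx
  | mul x y _ _ hx hy => rw [map_mul]; exact mul_mem hx hy

theorem TypeI.map {B : Subfield C} {σ : C ≃+* C} (hσ : ∀ x, ‖σ x‖ = ‖x‖)
    (hσB : ∀ x ∈ B, σ x ∈ B) (hσB' : ∀ x ∈ B, σ.symm x ∈ B) {T : C} (hT : TypeI B T) :
    TypeI B (σ T) := fun α => by
  obtain ⟨β, hβ⟩ := hT ⟨σ.symm α, hσB' α α.2⟩
  refine ⟨⟨σ β, hσB β β.2⟩, ?_⟩
  have h1 : (α : C) = σ (σ.symm α) := by simp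
  rw [h1, ← map_sub, ← map_sub, hσ, hσ]
  exact hβ

variable [IsUltrametricDist C] [IsAlgClosed C] [CompleteSpace C]

theorem hull_le_closure {κ B : Subfield C} [IsAlgClosed B] (hκ : IsResidueSection κ) (hκB : κ ≤ B)
    {T x : C} (hT : T ∈ closure (B : Set C)) (hx : x ∈ hull B T) : x ∈ closure (B : Set C) := by
  obtain ⟨E, hE, hEc⟩ := exists_isGood_closure hκ hκB B.toSubring (fun b hb => hb)
    fun x hx hx0 => ⟨x, hx, hx0, by simpa using hx0, B.inv_mem hx, fun n hn => by
      have hn0 : n ≠ 0 := by rintro rfl; simp at hn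
      obtain ⟨r, hr⟩ := exists_pow_nat_eq (⟨x, hx⟩ : B) (Nat.pos_of_ne_zero hn0)
      exact ⟨r, r.2, congrArg Subtype.val hr⟩⟩
  have h1 : (E : Set C) = closure (B : Set C) := hEc
  rw [← h1] at hT ⊢
  exact hull_le hE hT hx

variable {p : ℕ} [ExpChar C p] {κ K Ω M : Subfield C}

namespace IsStage

variable (h : IsStage p κ K Ω M)
include h

omit [IsAlgClosed C] [CompleteSpace C] [ExpChar C p] in
theorem hull_param {T : C} (hT : T ∈ K) (hTM : T ∉ M) :
    ∃ T' ∈ K, Param (acl M) T' ∧ hull (acl M) T ≤ hull (acl M) T' ∧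
      (∀ N : Subfield C, M ≤ N → T' ∈ N → T ∈ N) := by
  rcases h.trichotomy hT with h1 | ⟨α, hα, h1⟩ | h1
  · exact ⟨T, hT, Or.inl h1, le_rfl, fun _ _ h => h⟩
  · have hN : ∀ N : Subfield C, M ≤ N → T - α ∈ N → T ∈ N := fun N hN hN' => by
      simpa using add_mem hN' (hN hα)
    exact ⟨T - α, sub_mem hT (h.M_le hα), Or.inr h1, hull_le (isGood_hull _ _)
      (hN _ ((le_acl M).trans (isGood_hull _ _).le) (mem_hull _ _)), hN⟩
  · exact absurd h1 hTM

omit [ExpChar C p] in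
theorem exists_descend {T : C} (hT : Param (acl M) T) (hTΩ : T ∈ Ω)
    (hs : ∀ σ : C ≃+* C, (∀ x, ‖σ x‖ = ‖x‖) → (∀ x ∈ K, σ x = x) → σ T ∈ hull (acl M) T) :
    T ∈ closure (acl M : Set C) ∨ ∃ T' ∈ K, T ∈ hull (acl M) T' := by
  have := isAlgClosed_acl M
  obtain ⟨m, s, E, hEκ, hsn, hsK, hsE, hE⟩ := h.averaging {T} (Set.finite_singleton T) (by simpa)
  have hsn' : ∀ i x, ‖(s i).symm x‖ = ‖x‖ := fun i x => by rw [← hsn i, RingEquiv.apply_symm_apply]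
  have hsK' : ∀ i, ∀ x ∈ K, (s i).symm x = x := fun i x hx => by
    rw [RingEquiv.symm_apply_eq, hsK i x hx]
  have hsB : ∀ i, ∀ x ∈ acl M, s i x ∈ acl M := fun i x hx => h.map_mem_acl (hsK i) hx
  have hsB' : ∀ i, ∀ x ∈ acl M, (s i).symm x ∈ acl M := fun i x hx => h.map_mem_acl (hsK' i) hx
  have hS : ∀ i, s i T ∈ hull (acl M) T := fun i => hs (s i) (hsn i) (hsK i)
  have hTS : ∀ i, T ∈ hull (acl M) (s i T) := fun i => by
    have h1 := map_mem_hull (hsn i) (hsB i) (hs (s i).symm (hsn' i) (hsK' i))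
    simpa using h1
  have hsum : ∀ b ∈ E, ∑ i, s i b * s i T ∈ K := fun b hb => by
    simpa only [map_mul] using hsE b hb T rfl
  have h𝒮κ : ∀ b ∈ (fun b : C => fun i => s i b) '' (E : Set C), ∀ i, b i ∈ κ := by
    rintro _ ⟨b, hb, rfl⟩ i
    exact h.map_mem (s i) (hsK i) (hEκ hb)
  have h𝒮 : ∀ c : Fin (m + 1) → C, (∀ i, c i ∈ κ) → c ≠ 0 →
      ∃ b ∈ (fun b : C => fun i => s i b) '' (E : Set C), ∑ i, b i * c i ≠ 0 := fun c hc hc0 => by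
    obtain ⟨b, hb, hbc⟩ := hE c hc hc0
    exact ⟨_, ⟨b, hb, rfl⟩, hbc⟩
  rcases hT with hT | hT
  · set ρ := ⨅ α : acl M, ‖T - α‖ with hρ
    have hbdd : BddBelow (Set.range fun α : acl M => ‖T - α‖) :=
      ⟨0, by rintro _ ⟨α, rfl⟩; exact norm_nonneg _⟩
    have hρT : ∀ α : acl M, ρ ≤ ‖T - α‖ := fun α => ciInf_le hbdd α
    have hρT' : ∀ η > ρ, ∃ α : acl M, ‖T - α‖ < η := fun η hη => exists_lt_of_ciInf_lt hη
    have hρ0 : 0 ≤ ρ := le_ciInf fun α => norm_nonneg _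
    rcases hρ0.eq_or_lt with h0 | h0
    · left
      rw [Metric.mem_closure_iff]
      intro ε hε
      obtain ⟨α, hα⟩ := hρT' ε (h0 ▸ hε)
      exact ⟨α, α.2, by rwa [dist_eq_norm]⟩
    · obtain ⟨_, ⟨b, hb, rfl⟩, hTb⟩ := hT.exists_pull_down h.section_κ h.κ_le_acl h0 hρT hρT' hS hTS
        (fun i => hT.map (hsn i) (hsB i) (hsB' i)) (fun i α => by
          have h1 := hρT ⟨(s i).symm α, hsB' i α α.2⟩
          rwa [← hsn i, map_sub, RingEquiv.apply_symm_apply] at h1) h𝒮κ h𝒮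
      exact Or.inr ⟨_, hsum b hb, hTb⟩
  · obtain ⟨_, ⟨b, hb, rfl⟩, hTb⟩ := hT.exists_pull_down h.section_κ h.κ_le_acl hS
      (fun i => hsn i T) h𝒮κ h𝒮
    exact Or.inr ⟨_, hsum b hb, hTb⟩

/-- A function field of transcendence degree one inside `K` lies in the hull of an element of `K`
in standard position. -/
theorem exists_param {z y : C} (hz : z ∈ K)
    (hyz : IsSeparable (adjoin M {z}) y) :
    (z ∈ closure (acl M : Set C) ∧ y ∈ closure (acl M : Set C)) ∨
      ∃ T ∈ K, Param (acl M) T ∧ z ∈ hull (acl M) T ∧ y ∈ hull (acl M) T := by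
  classical
  have := isAlgClosed_acl M
  have tower : ∀ N : Subfield C, M ≤ N → z ∈ N → IsSeparable N y ∧ ∃ f : Polynomial N,
      f.Separable ∧ y ∈ f.rootSet C ∧ ∀ σ : C ≃+* C, (∀ x ∈ K, σ x = x) →
        ∀ r ∈ f.rootSet C, σ r ∈ f.rootSet C := by
    intro N hMN hzN
    let M' : IntermediateField M C := adjoin M {z}
    have adj : ∀ N : Subfield C, M ≤ N → z ∈ N → M'.toSubfield ≤ N := by
      intro N hMN hzN x hx
      induction (hx : x ∈ M') using adjoin_induction with
      | mem x hx => rw [hx]; exact hzN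
      | algebraMap x => exact hMN x.2
      | add x y hx hy hx' hy' => exact add_mem hx' hy'
      | inv x hx hx' => exact inv_mem hx'
      | mul x y hx hy hx' hy' => exact mul_mem hx' hy'
    let : Algebra M' N := (Subfield.inclusion (adj N hMN hzN)).toAlgebra
    have : IsScalarTower M' N C := IsScalarTower.of_algebraMap_eq fun _ => rfl
    refine ⟨hyz.tower_top N, (minpoly M' y).map (algebraMap M' N), Separable.map hyz, ?_, ?_⟩
    · rw [mem_rootSet]
      refine ⟨(Polynomial.map_ne_zero (minpoly.ne_zero hyz.isIntegral)), ?_⟩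
      rw [aeval_map_algebraMap, minpoly.aeval]
    · intro σ hσ r hr
      let τ : C →ₐ[M'] C := { (σ : C →+* C) with
        commutes' := fun x => hσ x (adj K h.M_le hz x.2) }
      rw [mem_rootSet, aeval_map_algebraMap] at hr ⊢
      refine ⟨hr.1, ?_⟩
      change aeval (τ r) _ = 0
      rw [aeval_algHom_apply, hr.2, map_zero]
  by_cases hzM : z ∈ M
  · have hyM := acl_acl (tower (acl M) (le_acl M) (le_acl M hzM)).1.isIntegral.isAlgebraic
    exact Or.inl ⟨subset_closure (le_acl M hzM), subset_closure hyM⟩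
  obtain ⟨z', hz'K, hz', hzz', hN⟩ := h.hull_param hz hzM
  have hMD : M ≤ hull (acl M) z' := (le_acl M).trans (isGood_hull _ _).le
  obtain ⟨-, f, hf, hyf, hfσ⟩ := tower (hull (acl M) z') hMD (hN _ hMD (mem_hull _ _))
  let W := adjoin (hull (acl M) z') (f.rootSet C)
  have hsplit : f.IsSplittingField (hull (acl M) z') W :=
    IntermediateField.adjoin_rootSet_isSplittingField (IsAlgClosed.splits _)
  have hgal : IsGalois (hull (acl M) z') W := IsGalois.of_separable_splitting_field hf
  have hfin : FiniteDimensional (hull (acl M) z') W := IsSplittingField.finiteDimensional W f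
  obtain ⟨T, hT, hTΩ, hzT, hTW⟩ := hz'.exists_hull_eq (W := W) h.section_κ h.κ_le_acl p h.isAlgClosed
    h.acl_le_Ω (h.le hz'K)
  have hyT : y ∈ hull (acl M) T := by
    rw [hTW]
    exact subset_adjoin _ _ hyf
  have hzT' : z ∈ hull (acl M) T := hull_le (isGood_hull _ _) hzT (hzz' (mem_hull _ _))
  have key : ∀ {T' : C}, T ∈ hull (acl M) T' → ∀ {x : C}, x ∈ hull (acl M) T →
      x ∈ hull (acl M) T' := fun h1 _ h2 => hull_le (isGood_hull _ _) h1 h2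
  rcases h.exists_descend hT hTΩ (fun σ hσ hσK => by
    have h1 := mem_hull (acl M) T
    rw [hTW] at h1 ⊢
    refine map_mem_adjoin (fun x hx => ?_) (hfσ σ hσK) h1
    have h2 := map_mem_hull hσ (fun x hx => h.map_mem_acl hσK hx) hx
    rwa [hσK z' hz'K] at h2) with h1 | ⟨T', hT'K, hTT'⟩
  · exact Or.inl ⟨hull_le_closure h.section_κ h.κ_le_acl h1 hzT',
      hull_le_closure h.section_κ h.κ_le_acl h1 hyT⟩
  · by_cases hT'M : T' ∈ M
    · have h1 : T' ∈ closure (acl M : Set C) := subset_closure (le_acl M hT'M)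
      exact Or.inl ⟨hull_le_closure h.section_κ h.κ_le_acl h1 (key hTT' hzT'),
        hull_le_closure h.section_κ h.κ_le_acl h1 (key hTT' hyT)⟩
    · obtain ⟨T'', hT''K, hT'', hle, -⟩ := h.hull_param hT'K hT'M
      exact Or.inr ⟨T'', hT''K, hT'', hle (key hTT' hzT'), hle (key hTT' hyT)⟩

end IsStage

end

section

variable {M L : Type*} [Field M] [CommRing L] [Algebra M L]

/-- Evaluation of bivariate polynomials. -/
noncomputable def ev (z y : L) : (M[X])[X] →ₐ[M] L :=
  { eval₂RingHom (aeval z : M[X] →ₐ[M] L) y with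
    commutes' := fun r => by
      change eval₂ ((aeval z : M[X] →ₐ[M] L) : M[X] →+* L) y (C (C r)) = _
      rw [eval₂_C]
      exact aeval_C z r }

theorem ev_apply (z y : L) (P : (M[X])[X]) : ev z y P = eval₂ ((aeval z : M[X] →ₐ[M] L) : M[X] →+* L) y P := rfl

@[simp]
theorem ev_C (z y : L) (p : M[X]) : ev z y (C p) = aeval z p := by
  rw [ev_apply, eval₂_C]; rfl

@[simp]
theorem ev_X (z y : L) : ev (M := M) z y X = y := by rw [ev_apply, eval₂_X]

theorem algHom_eq_ev (f : (M[X])[X] →ₐ[M] L) : f = ev (f (C X)) (f X) := by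
  ext
  · simp
  · simp

theorem comp_ev {L' : Type*} [CommRing L'] [Algebra M L'] (f : L →ₐ[M] L') (z y : L) :
    f.comp (ev z y) = ev (f z) (f y) := by
  ext
  · simp
  · simp

end

section

variable {M C : Type*} [Field M] [Field C] [Algebra M C]

theorem exists_bivariate {z y : C} (hz : Transcendental M z)
    (hy : IsSeparable (adjoin M {z}) y)
    (hyint : ((aeval z : M[X] →ₐ[M] C) : M[X] →+* C).IsIntegralElem y) :
    ∃ P : (M[X])[X], ev z y P = 0 ∧ ev z y (derivative P) ≠ 0 ∧
      ∀ Q : (M[X])[X], ev z y Q = 0 → P ∣ Q := by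
  let N := adjoin M {z}
  let : Algebra M[X] C := ((aeval z : M[X] →ₐ[M] C) : M[X] →+* C).toAlgebra
  let g : N := ⟨z, mem_adjoin_simple_self M z⟩
  let : Algebra M[X] N := ((aeval g : M[X] →ₐ[M] N) : M[X] →+* N).toAlgebra
  have htower : IsScalarTower M[X] N C := IsScalarTower.of_algebraMap_eq fun p =>
    aeval_algebraMap_apply C g p
  have hinj : Function.Injective (algebraMap M[X] C) := transcendental_iff_injective.mp hz
  have hfaith : FaithfulSMul M[X] C := (faithfulSMul_iff_algebraMap_injective _ _).mpr hinj
  have hfaith' : FaithfulSMul M[X] N := (faithfulSMul_iff_algebraMap_injective _ _).mpr <| by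
    have h1 := hinj
    rw [IsScalarTower.algebraMap_eq M[X] N C, RingHom.coe_comp] at h1
    exact Function.Injective.of_comp h1
  have hfrac : IsFractionRing M[X] N := IsFractionRing.of_field M[X] N fun x => by
    obtain ⟨r, s, hrs⟩ := (mem_adjoin_simple_iff M (x : C)).mp x.2
    refine ⟨r, s, Subtype.ext ?_⟩
    rw [hrs]
    push_cast
    congr 1
    · exact aeval_algebraMap_apply C g r
    · exact aeval_algebraMap_apply C g s
  have hint : IsIntegral M[X] y := hyint
  refine ⟨minpoly M[X] y, minpoly.aeval M[X] y, ?_, fun Q hQ =>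
    minpoly.isIntegrallyClosed_dvd hint hQ⟩
  have h1 : aeval y (derivative (minpoly N y)) ≠ 0 :=
    Separable.aeval_derivative_ne_zero hy (minpoly.aeval N y)
  rw [minpoly.isIntegrallyClosed_eq_field_fractions' N hint, derivative_map,
    aeval_map_algebraMap] at h1
  exact h1

theorem mem_range_ev {z y x : C} (hx : x ∈ adjoin M {z, y}) :
    ∃ P Q : (M[X])[X], ev z y Q ≠ 0 ∧ x = ev z y P / ev z y Q := by
  have key : ∀ r ∈ Algebra.adjoin M {z, y}, ∃ P : (M[X])[X], ev z y P = r := by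
    intro r hr
    have h1 : Algebra.adjoin M {z, y} ≤ (ev z y : (M[X])[X] →ₐ[M] C).range := by
      rw [Algebra.adjoin_le_iff]
      rintro _ (rfl | rfl)
      · exact ⟨Polynomial.C X, by simp⟩
      · exact ⟨X, by simp⟩
    exact h1 hr
  obtain ⟨r, hr, s, hs, rfl⟩ := (IntermediateField.mem_adjoin_iff_div).mp hx
  obtain ⟨P, rfl⟩ := key r hr
  obtain ⟨Q, rfl⟩ := key s hs
  by_cases h0 : ev z y Q = 0
  · exact ⟨0, 1, by simp, by simp [h0]⟩
  · exact ⟨P, Q, h0, rfl⟩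

theorem isAlgebraic_adjoin_of_adjoin_simple {x y : C}
    (hy : IsAlgebraic (adjoin M {x}) y) :
    IsAlgebraic (Algebra.adjoin M {x}) y := by
  open scoped IntermediateField.algebraAdjoinAdjoin in
  exact (IsFractionRing.isAlgebraic_iff (Algebra.adjoin M {x})
    (adjoin M {x}) C).mpr hy

theorem trdeg_adjoin_le_one {x : C} {s : Set C}
    (hs : ∀ y ∈ s, IsAlgebraic (adjoin M {x}) y) :
    Algebra.trdeg M (adjoin M s) ≤ 1 := by
  let A := Subalgebra.algebraicClosure (Algebra.adjoin M {x}) C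
  have hx : x ∈ Algebra.adjoin M {x} := Algebra.self_mem_adjoin_singleton M x
  let gx : A := algebraMap (Algebra.adjoin M {x}) A ⟨x, hx⟩
  have hrange : ∀ r : Algebra.adjoin M {x},
      algebraMap (Algebra.adjoin M {x}) A r ∈ Algebra.adjoin M {gx} := by
    rintro ⟨r, hr⟩
    obtain ⟨P, rfl⟩ := (Algebra.adjoin_singleton_eq_range_aeval M x ▸ hr : r ∈ (aeval x).range)
    have h1 : algebraMap (Algebra.adjoin M {x}) A ⟨aeval x P, hr⟩ = aeval gx P :=
      Subtype.ext (aeval_algebraMap_apply C gx P)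
    exact h1 ▸ aeval_mem_adjoin_singleton M gx
  have : Algebra.IsAlgebraic (Algebra.adjoin M {gx}) A := ⟨fun w => by
    obtain ⟨P, hP0, hP⟩ : IsAlgebraic (Algebra.adjoin M {x}) w :=
      (isAlgebraic_algebraMap_iff Subtype.val_injective).mp w.2
    let φ := (algebraMap (Algebra.adjoin M {x}) A).codRestrict (Algebra.adjoin M {gx}) hrange
    have hφ : (algebraMap (Algebra.adjoin M {gx}) A).comp φ =
      algebraMap (Algebra.adjoin M {x}) A := rfl
    have hφi : Function.Injective φ := fun a b hab => Subtype.ext <|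
      congrArg (fun u : Algebra.adjoin M {gx} => ((u : A) : C)) hab
    refine ⟨P.map φ, (Polynomial.map_ne_zero_iff hφi).mpr hP0, ?_⟩
    rw [aeval_def, eval₂_map, hφ, ← aeval_def, hP]⟩
  have hA : ∀ y ∈ adjoin M s, y ∈ A := fun y hy => by
    refine isAlgebraic_adjoin_of_adjoin_simple (adjoin_induction M
      (p := fun y _ => IsAlgebraic (adjoin M {x}) y) (fun y h => hs y h)
      (fun r => ?_) (fun _ _ _ _ => IsAlgebraic.add) (fun _ _ => IsAlgebraic.inv)
      (fun _ _ _ _ => IsAlgebraic.mul) hy)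
    exact isAlgebraic_algebraMap (algebraMap M (adjoin M {x}) r)
  let j : adjoin M s →ₐ[M] A :=
    { (algebraMap (adjoin M s) C).codRestrict A (fun y => hA y y.2) with
      commutes' := fun _ => rfl }
  calc Algebra.trdeg M (adjoin M s) ≤ Algebra.trdeg M A :=
        trdeg_le_of_injective j j.toRingHom.injective
    _ ≤ Cardinal.mk ({gx} : Set A) := Algebra.IsAlgebraic.trdeg_le_cardinalMk M {gx}
    _ = 1 := Cardinal.mk_singleton gx

theorem exists_integral_pair {F : IntermediateField M C} (g y : F)
    (hsep : IsSeparable (adjoin M {g}) y)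
    (hy : adjoin (adjoin M {g}) {y} = ⊤) :
    ∃ y' ∈ F, IsSeparable (adjoin M {(g : C)}) y' ∧
      ((aeval (g : C) : M[X] →ₐ[M] C) : M[X] →+* C).IsIntegralElem y' ∧
      ∀ a ∈ F, a ∈ adjoin M {(g : C), y'} := by
  let N := adjoin M {g}
  let N' := adjoin M {(g : C)}
  have hNN' : ∀ n : N, ((n : F) : C) ∈ N' := fun n => by
    have h1 : ((n : F) : C) ∈ N.map F.val := ⟨n, n.2, rfl⟩
    rwa [adjoin_map, Set.image_singleton] at h1
  let φ : N →+* N' := ((algebraMap F C).comp (algebraMap N F)).codRestrict N' hNN'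
  have hφ : (algebraMap N' C).comp φ = (algebraMap F C).comp (algebraMap N F) := rfl
  have hsep' : IsSeparable N' (y : C) := by
    refine (Separable.map (f := φ) hsep).of_dvd (minpoly.dvd _ _ ?_)
    rw [aeval_def, eval₂_map, hφ, ← IntermediateField.algebraMap_apply, ← hom_eval₂, ← aeval_def,
      minpoly.aeval, map_zero]
  have hRN : ∀ r ∈ Algebra.adjoin M {(g : C)}, r ∈ N' := fun r hr =>
    IntermediateField.algebra_adjoin_le_adjoin _ _ hr
  obtain ⟨c, hc0, hc⟩ :=
    (isAlgebraic_adjoin_of_adjoin_simple hsep'.isIntegral.isAlgebraic).exists_integral_multiple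
  have hcF : ∀ r ∈ N', r ∈ F := fun r hr =>
    (adjoin_le_iff.mpr (Set.singleton_subset_iff.mpr g.2) : N' ≤ F) hr
  have hc0' : (c : C) ≠ 0 := fun h => hc0 (Subtype.ext h)
  refine ⟨c * y, F.mul_mem (hcF c (hRN c c.2)) y.2, ?_, ?_, fun a ha => ?_⟩
  · exact Field.isSeparable_mul (isSeparable_algebraMap (K := C) (⟨c, hRN c c.2⟩ : N')) hsep'
  · obtain ⟨P, hP, hP0⟩ := hc
    have hl : P ∈ lifts ((aeval (⟨g, Algebra.self_mem_adjoin_singleton M (g : C)⟩ :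
        Algebra.adjoin M {(g : C)}) : M[X] →ₐ[M] _) : M[X] →+* _) := by
      refine (lifts_iff_coeff_lifts _).mpr fun n => ?_
      have h1 := (P.coeff n).2
      simp only [Algebra.adjoin_singleton_eq_range_aeval M (g : C)] at h1
      obtain ⟨Q, hQ⟩ := h1
      exact ⟨Q, Subtype.ext ((aeval_algebraMap_apply C
        (⟨g, Algebra.self_mem_adjoin_singleton M (g : C)⟩ : Algebra.adjoin M {(g : C)}) Q).symm.trans hQ)⟩
    obtain ⟨Q, hQ, -, hQm⟩ := lifts_and_natDegree_eq_and_monic hl hP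
    refine ⟨Q, hQm, ?_⟩
    rw [← hP0, ← hQ, eval₂_map]
    congr 1
    ext Q
    · simp
    · simp
  · let E := (adjoin M {(g : C), (c : C) * y}).comap F.val
    have hN'E : ∀ r ∈ N', r ∈ adjoin M {(g : C), (c : C) * y} := fun r hr =>
      adjoin.mono M _ _ (by simp) hr
    change (⟨a, ha⟩ : F) ∈ E
    generalize (⟨a, ha⟩ : F) = w
    have h1 : w ∈ adjoin N {y} := hy ▸ IntermediateField.mem_top
    induction h1 using adjoin_induction with
    | mem w hw =>
      obtain rfl := hw
      change (w : C) ∈ adjoin M {(g : C), (c : C) * w}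
      have h2 : (w : C) = (c : C)⁻¹ * (c * w) := (inv_mul_cancel_left₀ hc0' (w : C)).symm
      have h3 : (c : C) * w ∈ adjoin M {(g : C), (c : C) * w} :=
        subset_adjoin M _ (by simp)
      have h4 := mul_mem (inv_mem (hN'E c (hRN c c.2))) h3
      rwa [← h2] at h4
    | algebraMap n => exact hN'E _ (hNN' n)
    | add _ _ _ _ h1 h2 => exact add_mem h1 h2
    | inv _ _ h => exact inv_mem h
    | mul _ _ _ _ h1 h2 => exact mul_mem h1 h2

theorem exists_separating_pair [PerfectField M] (x : C) {ι : Type*} [Finite ι] (a : ι → C)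
    (ha : ∀ i, IsAlgebraic (adjoin M {x}) (a i)) {i₀ : ι}
    (hi₀ : Transcendental M (a i₀)) :
    ∃ z ∈ adjoin M (Set.range a), ∃ y ∈ adjoin M (Set.range a),
      Transcendental M z ∧ IsSeparable (adjoin M {z}) y ∧
      ((aeval z : M[X] →ₐ[M] C) : M[X] →+* C).IsIntegralElem y ∧
      ∀ i, a i ∈ adjoin M {z, y} := by
  let F := adjoin M (Set.range a)
  have hfg : F.FG := fg_adjoin_of_finite (Set.finite_range a)
  have : Algebra.EssFiniteType M F := essFiniteType_iff.mpr hfg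
  obtain ⟨s, hs, hsep⟩ := exists_isTranscendenceBasis_and_isSeparable_of_perfectField M F
  have htr : Algebra.trdeg M F ≤ 1 := trdeg_adjoin_le_one (by rintro _ ⟨i, rfl⟩; exact ha i)
  have hscard := hs.cardinalMk_eq_trdeg
  have haF : ∀ i, a i ∈ F := fun i => subset_adjoin M _ ⟨i, rfl⟩
  have hsne : s.Nonempty := by
    by_contra hne
    rw [Finset.not_nonempty_iff_eq_empty] at hne
    subst hne
    have h0 : Algebra.trdeg M F = 0 := by rw [← hscard]; simp
    have h1 := trdeg_eq_zero_iff.mp h0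
    exact hi₀ ((isAlgebraic_algebraMap_iff (algebraMap F C).injective).mpr
      (h1.isAlgebraic (⟨a i₀, haF i₀⟩ : F)))
  have hs1 : s.card = 1 := by
    rw [← hscard, Cardinal.mk_coe_finset] at htr
    exact le_antisymm (by exact_mod_cast htr) hsne.card_pos
  obtain ⟨g, rfl⟩ := Finset.card_eq_one.mp hs1
  rw [Finset.coe_singleton] at hsep
  have : Algebra.IsSeparable (adjoin M {g}) F := hsep
  have : Algebra.EssFiniteType (adjoin M {g}) F :=
    Algebra.EssFiniteType.of_comp M _ F
  have : Module.Finite (adjoin M {g}) F :=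
    Algebra.finite_of_essFiniteType_of_isAlgebraic
  obtain ⟨y, hy⟩ := Field.exists_primitive_element (adjoin M {g}) F
  have hgt : Transcendental M g := hs.1.transcendental ⟨g, Finset.mem_singleton_self g⟩
  obtain ⟨y', hy'F, hy'sep, hy'int, hy'⟩ :=
    exists_integral_pair g y (Algebra.IsSeparable.isSeparable _ y) hy
  exact ⟨g, g.2, y', hy'F, (transcendental_algebraMap_iff (algebraMap F C).injective).mpr hgt,
    hy'sep, hy'int, fun i => hy' _ (haF i)⟩

end

section

/-- The family `b` is a specialization over `k` of the family `a`. -/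
def SpecOver (k : Type*) {K L ι : Type*} [Field k] [CommRing K] [CommRing L] [Algebra k K]
    [Algebra k L] (a : ι → K) (b : ι → L) : Prop :=
  ∀ P : MvPolynomial ι k, MvPolynomial.aeval a P = 0 → MvPolynomial.aeval b P = 0

variable {k K L : Type*} [Field k] [Field K] [Field L] [Algebra k K] [Algebra k L]

theorem SpecOver.refl {ι : Type*} (a : ι → K) : SpecOver k a a := fun _ h => h

theorem SpecOver.trans {ι F : Type*} [Field F] [Algebra k F] {a : ι → K} {b : ι → L} {c : ι → F}
    (h : SpecOver k a b) (h' : SpecOver k b c) : SpecOver k a c := fun P hP => h' P (h P hP)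

theorem SpecOver.comp {ι ι' : Type*} {a : ι → K} {b : ι → L} (h : SpecOver k a b) (e : ι' → ι) :
    SpecOver k (a ∘ e) (b ∘ e) := fun P hP => by
  have h1 := h (MvPolynomial.rename e P)
  rw [MvPolynomial.aeval_rename, MvPolynomial.aeval_rename] at h1
  exact h1 hP

theorem SpecOver.of_algHom {ι R : Type*} [CommRing R] [Algebra k R] (f : R →ₐ[k] K) (g : R →ₐ[k] L)
    (hfg : ∀ r, f r = 0 → g r = 0) (p q : ι → R) (hf : ∀ i, f (q i) ≠ 0) (hg : ∀ i, g (q i) ≠ 0) :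
    SpecOver k (fun i => f (p i) / f (q i)) (fun i => g (p i) / g (q i)) := fun P hP => by
  suffices h : ∃ n d : R, f d ≠ 0 ∧ g d ≠ 0 ∧
      MvPolynomial.aeval (fun i => f (p i) / f (q i)) P * f d = f n ∧
      MvPolynomial.aeval (fun i => g (p i) / g (q i)) P * g d = g n by
    obtain ⟨n, d, -, hd, h1, h2⟩ := h
    rw [hP, zero_mul] at h1
    rw [hfg n h1.symm] at h2
    exact (mul_eq_zero.mp h2).resolve_right hd
  clear hP
  induction P using MvPolynomial.induction_on with
  | C r => exact ⟨algebraMap k R r, 1, by simp, by simp, by simp, by simp⟩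
  | add P Q hP hQ =>
    obtain ⟨n, d, hd, hd', h1, h2⟩ := hP
    obtain ⟨m, e, he, he', h3, h4⟩ := hQ
    refine ⟨n * e + m * d, d * e, ?_, ?_, ?_, ?_⟩
    · rw [map_mul]; exact mul_ne_zero hd he
    · rw [map_mul]; exact mul_ne_zero hd' he'
    · simp only [map_add, map_mul, ← h1, ← h3]; ring
    · simp only [map_add, map_mul, ← h2, ← h4]; ring
  | mul_X P i hP =>
    obtain ⟨n, d, hd, hd', h1, h2⟩ := hP
    have h3 := hf i
    have h4 := hg i
    refine ⟨n * p i, d * q i, ?_, ?_, ?_, ?_⟩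
    · rw [map_mul]; exact mul_ne_zero hd (hf i)
    · rw [map_mul]; exact mul_ne_zero hd' (hg i)
    · simp only [map_mul, MvPolynomial.aeval_X, ← h1]; field_simp
    · simp only [map_mul, MvPolynomial.aeval_X, ← h2]; field_simp

theorem SpecOver.of_map {ι F : Type*} [Field F] [Algebra k F] {a : ι → K} {b : ι → L} (f : F →ₐ[k] K)
    {a' : ι → F} (ha : ∀ i, f (a' i) = a i) (h : SpecOver k a' b) : SpecOver k a b := fun P hP => by
  obtain rfl : (fun i => f (a' i)) = a := funext ha
  refine h P (f.toRingHom.injective ?_)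
  rw [map_zero]
  rwa [← MvPolynomial.comp_aeval_apply] at hP

end

section

variable {K : Type*} [Field K]

/-- Hensel's lemma for a valuation ring, formulated in its fraction field. -/
def VHens (O : ValuationSubring K) : Prop :=
  ∀ f : K[X], (∀ n, f.coeff n ∈ O) → O.valuation (f.coeff 0) < 1 → O.valuation (f.coeff 1) = 1 →
    ∃ b, O.valuation b < 1 ∧ f.eval b = 0

variable {O : ValuationSubring K}

theorem valuation_natCast_le (n : ℕ) : O.valuation (n : K) ≤ 1 :=
  (O.valuation_le_one_iff _).mpr (natCast_mem O n)

theorem valuation_taylor_one_coeff_lt {g : K[X]} (hg : ∀ n, O.valuation (g.coeff n) < 1) (n : ℕ) :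
    O.valuation ((taylor 1 g).coeff n) < 1 := by
  rw [taylor_coeff, eval_eq_sum_range]
  refine Valuation.map_sum_lt _ one_ne_zero fun i _ => ?_
  rw [one_pow, mul_one, hasseDeriv_coeff, map_mul]
  exact (mul_le_of_le_one_left' (valuation_natCast_le _)).trans_lt (hg _)

theorem VHens.exists_root (hO : VHens O) {f : K[X]} (h1 : f.coeff 1 ≠ 0)
    (hf : ∀ i, 2 ≤ i → O.valuation (f.coeff 0 ^ (i - 1) * f.coeff i) <
      O.valuation (f.coeff 1 ^ i)) :
    ∃ e, O.valuation e < 1 ∧ f.eval (-(f.coeff 0 / f.coeff 1) * (1 + e)) = 0 := by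
  rcases eq_or_ne (f.coeff 0) 0 with h0 | h0
  · exact ⟨0, by simp, by rw [h0, zero_div, neg_zero, zero_mul, ← coeff_zero_eq_eval_zero, h0]⟩
  set u := -(f.coeff 0 / f.coeff 1) with hu
  let g : K[X] := C (f.coeff 0)⁻¹ * f.comp (C u * X)
  have hgc : ∀ n, g.coeff n = (f.coeff 0)⁻¹ * (f.coeff n * u ^ n) := fun n => by
    rw [coeff_C_mul, comp_C_mul_X_coeff]
  let r : K[X] := g - 1 + X
  have hr : ∀ n, O.valuation (r.coeff n) < 1 := fun n => by
    rcases n with _ | _ | n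
    · have : r.coeff 0 = 0 := by simp [r, hgc, h0]
      simp [this]
    · have : r.coeff 1 = 0 := by
        simp only [r, coeff_add, coeff_sub, hgc, coeff_X_one, coeff_one, hu]
        field_simp
        simp
      simp [this]
    · have h2 : r.coeff (n + 2) = (-1) ^ n * ((f.coeff 0 ^ (n + 1) * f.coeff (n + 2)) /
          f.coeff 1 ^ (n + 2)) := by
        have hu' : u = -1 * (f.coeff 0 / f.coeff 1) := by rw [hu, neg_one_mul]
        simp only [r, coeff_add, coeff_sub, hgc, coeff_one, coeff_X, hu', mul_pow, div_pow]
        simp only [show ¬ n + 2 = 0 by omega, show ¬ 1 = n + 2 by omega, if_false]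
        field_simp
        ring
      have h3 := hf (n + 2) (by omega)
      rw [show n + 1 + 1 = n + 2 from rfl, h2, map_mul, map_pow, Valuation.map_neg, map_one, one_pow,
        one_mul, map_div₀]
      exact (div_lt_one₀ (lt_of_le_of_lt zero_le h3)).mpr h3
  let q : K[X] := taylor 1 r - X
  have hq : q = taylor 1 g := by
    simp only [q, r, map_add, map_sub, taylor_one, taylor_X]
    simp
  have hqc : ∀ n, n ≠ 1 → q.coeff n = (taylor 1 r).coeff n := fun n hn => by
    simp only [q, coeff_sub, coeff_X_of_ne_one hn, sub_zero]
  have hq1 : O.valuation (q.coeff 1) = 1 := by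
    simp only [q, coeff_sub, coeff_X_one]
    rw [Valuation.map_sub_eq_of_lt_right _ (by
      rw [map_one]; exact valuation_taylor_one_coeff_lt hr 1), map_one]
  obtain ⟨e, he, hqe⟩ := hO q (fun n => by
    rw [← O.valuation_le_one_iff]
    rcases eq_or_ne n 1 with rfl | hn
    · exact hq1.le
    · rw [hqc n hn]; exact (valuation_taylor_one_coeff_lt hr n).le)
    (by rw [hqc 0 zero_ne_one]; exact valuation_taylor_one_coeff_lt hr 0) hq1
  refine ⟨e, he, ?_⟩
  rw [hq, taylor_eval] at hqe
  simp only [g, eval_mul, eval_C, eval_comp, eval_X] at hqe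
  rw [add_comm]
  exact (mul_eq_zero.mp hqe).resolve_left (inv_ne_zero h0)

theorem VHens.exists_root_near (hO : VHens O) {f : K[X]} {η : K}
    (h1 : (derivative f).eval η ≠ 0)
    (hf : ∀ j, 2 ≤ j → O.valuation (f.eval η ^ (j - 1) * (hasseDeriv j f).eval η) <
      O.valuation ((derivative f).eval η ^ j)) :
    ∃ x, f.eval x = 0 ∧ ∀ g : K[X], g.eval η ≠ 0 →
      (∀ j, 1 ≤ j → O.valuation ((hasseDeriv j g).eval η * f.eval η ^ j) <
        O.valuation (g.eval η * (derivative f).eval η ^ j)) →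
      O.valuation (g.eval x) = O.valuation (g.eval η) := by
  have hc0 : (taylor η f).coeff 0 = f.eval η := by rw [taylor_coeff_zero]
  have hc1 : (taylor η f).coeff 1 = (derivative f).eval η := by rw [taylor_coeff_one]
  obtain ⟨e, he, hroot⟩ := hO.exists_root (f := taylor η f) (by rwa [hc1]) (fun i hi => by
    rw [hc0, hc1, taylor_coeff]; exact hf i hi)
  rw [hc0, hc1] at hroot
  set δ := -(f.eval η / (derivative f).eval η) * (1 + e) with hδ
  have h1e : O.valuation (1 + e) = 1 := by
    rw [Valuation.map_add_eq_of_lt_left _ (by rwa [map_one]), map_one]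
  have hvδ : O.valuation δ = O.valuation (f.eval η) / O.valuation ((derivative f).eval η) := by
    rw [hδ, map_mul, h1e, mul_one, Valuation.map_neg, map_div₀]
  refine ⟨δ + η, by rwa [taylor_eval] at hroot, fun g hg hgj => ?_⟩
  have h2 : g.eval (δ + η) = g.eval η +
      ∑ j ∈ range g.natDegree, (hasseDeriv (j + 1) g).eval η * δ ^ (j + 1) := by
    rw [← taylor_eval, eval_eq_sum_range, natDegree_taylor, sum_range_succ', add_comm]
    simp only [taylor_coeff, hasseDeriv_zero', pow_zero, mul_one]
  rw [h2, Valuation.map_add_eq_of_lt_left]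
  refine Valuation.map_sum_lt _ ((Valuation.ne_zero_iff _).mpr hg) fun j _ => ?_
  have h3 := hgj (j + 1) (by omega)
  rw [map_mul, map_mul, map_pow, map_pow] at h3
  rw [map_mul, map_pow, hvδ, div_pow, ← mul_div_assoc]
  have h4 : 0 < O.valuation ((derivative f).eval η) ^ (j + 1) :=
    pow_pos (zero_lt_iff.mpr ((Valuation.ne_zero_iff _).mpr h1)) _
  rwa [div_lt_iff₀ h4]

end

theorem map_hasseDeriv {R S : Type*} [CommSemiring R] [CommSemiring S] (φ : R →+* S) (j : ℕ)
    (p : R[X]) : (hasseDeriv j p).map φ = hasseDeriv j (p.map φ) := by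
  ext n
  simp [hasseDeriv_coeff]

section

variable {M C L : Type*} [Field M] [NormedField C] [Field L] [Algebra M C] [Algebra M L]

/-- A point `e` of `A` in a normed field is generic for `O` if finitely many strict norm
inequalities at `e` can be realised at a point with values in the fraction field of `O`. -/
def IsGeneric {A : Type*} [CommRing A] [Algebra M A] (O : ValuationSubring L) (e : A →ₐ[M] C) :
    Prop :=
  ∀ S : Finset (A × A), (∀ q ∈ S, ‖e q.1‖ < ‖e q.2‖) →
    ∃ e' : A →ₐ[M] L, ∀ q ∈ S, O.valuation (e' q.1) < O.valuation (e' q.2)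

variable {O : ValuationSubring L}

theorem continuous_ev (P : (M[X])[X]) : Continuous fun w : C × C => ev w.1 w.2 P := by
  have h : ∀ p : M[X], Continuous fun w : C × C => aeval w.1 p := fun p => by
    simp only [aeval_eq_sum_range, Algebra.smul_def]
    fun_prop
  simp only [ev_apply, eval₂_eq_sum_range, RingHom.coe_coe]
  exact continuous_finsetSum _ fun i _ => (h _).mul (continuous_snd.pow i)

theorem isGeneric_ev_of_approx {z y : C} (h : ∀ ε : ℝ, 0 < ε → ∃ (A : Type u) (_ : CommRing A)
    (_ : Algebra M A) (e : A →ₐ[M] C) (z₀ y₀ : A), IsGeneric O e ∧ ‖z - e z₀‖ < ε ∧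
      ‖y - e y₀‖ < ε) : IsGeneric O (ev (M := M) z y) := by
  classical
  intro S hS
  have h1 : ∀ᶠ w : C × C in nhds (z, y), ∀ q ∈ S, ‖ev w.1 w.2 q.1‖ < ‖ev w.1 w.2 q.2‖ :=
    (Filter.eventually_all_finset S).mpr fun q hq =>
      (continuous_ev q.1).norm.continuousAt.eventually_lt (continuous_ev q.2).norm.continuousAt
        (hS q hq)
  obtain ⟨ε, hε, hball⟩ := Metric.eventually_nhds_iff.mp h1
  obtain ⟨A, _, _, e, z₀, y₀, he, hz, hy⟩ := h ε hε
  have h2 := hball (y := (e z₀, e y₀)) (by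
    rw [Prod.dist_eq, max_lt_iff, dist_comm, dist_eq_norm, dist_comm, dist_eq_norm]
    exact ⟨hz, hy⟩)
  obtain ⟨e', he'⟩ := he (S.image fun q => (ev z₀ y₀ q.1, ev z₀ y₀ q.2)) <| by
    simp only [mem_image]
    rintro _ ⟨q, hq, rfl⟩
    have h3 := h2 q hq
    rw [← comp_ev] at h3
    exact h3
  exact ⟨e'.comp (ev z₀ y₀), fun q hq => he' _ (mem_image_of_mem _ hq)⟩

theorem map_aeval_eval (ζ η : L) (P : (M[X])[X]) :
    (P.map ((aeval ζ : M[X] →ₐ[M] L) : M[X] →+* L)).eval η = ev ζ η P := by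
  rw [ev_apply, eval_map]

theorem map_aeval_hasseDeriv_eval (ζ η : L) (P : (M[X])[X]) (j : ℕ) :
    (hasseDeriv j (P.map ((aeval ζ : M[X] →ₐ[M] L) : M[X] →+* L))).eval η =
      ev ζ η (hasseDeriv j P) := by
  rw [← map_hasseDeriv, map_aeval_eval]

theorem IsGeneric.exists_specOver {z y : C} (hgen : IsGeneric O (ev (M := M) z y)) (hO : VHens O)
    {P : (M[X])[X]} (hP : ev z y P = 0) (hP' : ev z y (derivative P) ≠ 0)
    (hdvd : ∀ Q : (M[X])[X], ev z y Q = 0 → P ∣ Q) {ι : Type*} [Finite ι] {a : ι → C}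
    (ha : ∀ i, ∃ R H : (M[X])[X], ev z y H ≠ 0 ∧ a i = ev z y R / ev z y H) :
    ∃ b : ι → L, SpecOver M a b ∧ ∀ i, 1 < ‖a i‖ → b i ∉ O := by
  classical
  have := Fintype.ofFinite ι
  choose R H hH haRH using ha
  let polar : Finset ι := univ.filter fun i => 1 < ‖a i‖
  let G : Finset (M[X])[X] := univ.image H ∪ polar.image R
  have hpolar : ∀ i ∈ polar, ‖ev z y (H i)‖ < ‖ev z y (R i)‖ := fun i hi => by
    have h1 := (mem_filter.mp hi).2
    rwa [haRH, norm_div, one_lt_div (norm_pos_iff.mpr (hH i))] at h1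
  have hG : ∀ g ∈ G, ev z y g ≠ 0 := fun g hg => by
    rcases mem_union.mp hg with hg | hg
    · obtain ⟨i, -, rfl⟩ := mem_image.mp hg
      exact hH i
    · obtain ⟨i, hi, rfl⟩ := mem_image.mp hg
      exact norm_pos_iff.mp ((norm_nonneg _).trans_lt (hpolar i hi))
  let N := P.natDegree + G.sup natDegree
  let S : Finset ((M[X])[X] × (M[X])[X]) := {(0, derivative P)} ∪
    (Finset.Icc 2 N).image (fun j => (P ^ (j - 1) * hasseDeriv j P, derivative P ^ j)) ∪
    G.image (fun g => (0, g)) ∪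
    (G ×ˢ Finset.Icc 1 N).image
      (fun w => (hasseDeriv w.2 w.1 * P ^ w.2, w.1 * derivative P ^ w.2)) ∪
    polar.image (fun i => (H i, R i))
  obtain ⟨e', he'⟩ := hgen S <| by
    simp only [S, mem_union, mem_singleton, mem_image, mem_product,
      mem_Icc]
    rintro _ ((((rfl | ⟨j, hj, rfl⟩) | ⟨g, hg, rfl⟩) | ⟨⟨g, j⟩, ⟨hg, hj⟩, rfl⟩) | ⟨i, hi, rfl⟩)
    · simpa using hP'
    · simp only [map_mul, map_pow, hP]
      rw [zero_pow (by omega), zero_mul, norm_zero]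
      exact norm_pos_iff.mpr (pow_ne_zero _ hP')
    · simpa using hG g hg
    · simp only [map_mul, map_pow, hP]
      rw [zero_pow (by omega), mul_zero, norm_zero]
      exact norm_pos_iff.mpr (mul_ne_zero (hG g hg) (pow_ne_zero _ hP'))
    · exact hpolar i hi
  simp only [S, mem_union, mem_singleton, mem_image, mem_product,
    mem_Icc] at he'
  rw [algHom_eq_ev e'] at he'
  set ζ := e' (Polynomial.C X)
  set η := e' X
  let ψ : M[X] →+* L := ((aeval ζ : M[X] →ₐ[M] L) : M[X] →+* L)
  have hne : ∀ {x : L}, O.valuation (0 : L) < O.valuation x → x ≠ 0 := fun {x} hx => by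
    rw [map_zero] at hx
    exact (Valuation.ne_zero_iff _).mp (zero_lt_iff.mp hx)
  have hD : ev ζ η (derivative P) ≠ 0 := by
    have := he' _ (Or.inl (Or.inl (Or.inl (Or.inl rfl))))
    rw [map_zero] at this
    exact hne this
  have hg0 : ∀ g ∈ G, ev ζ η g ≠ 0 := fun g hg => by
    have := he' _ (Or.inl (Or.inl (Or.inr ⟨g, hg, rfl⟩)))
    rw [map_zero] at this
    exact hne this
  have hderiv : (derivative (P.map ψ)).eval η = ev ζ η (derivative P) := by
    rw [derivative_map, map_aeval_eval]
  have hlarge : ∀ (Q : (M[X])[X]) (j : ℕ), Q.natDegree < j → ev ζ η (hasseDeriv j Q) = 0 :=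
    fun Q j hj => by rw [hasseDeriv_eq_zero_of_lt_natDegree _ _ hj, map_zero]
  have hpos : ∀ {x : L}, x ≠ 0 → O.valuation (0 : L) < O.valuation x := fun {x} hx => by
    rw [map_zero]
    exact zero_lt_iff.mpr ((Valuation.ne_zero_iff _).mpr hx)
  obtain ⟨x, hx, hxg⟩ := hO.exists_root_near (f := P.map ψ) (η := η) (by rwa [hderiv])
    (fun j hj => by
      rw [hderiv, map_aeval_eval, map_aeval_hasseDeriv_eval]
      rcases le_or_gt j N with hjN | hjN
      · have := he' _ (Or.inl (Or.inl (Or.inl (Or.inr ⟨j, ⟨hj, hjN⟩, rfl⟩))))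
        simpa only [map_mul, map_pow] using this
      · rw [hlarge P j (by omega), mul_zero]
        exact hpos (pow_ne_zero _ hD))
  rw [map_aeval_eval] at hx
  have hval : ∀ g ∈ G, O.valuation (ev ζ x g) = O.valuation (ev ζ η g) := fun g hg => by
    have := hxg (g.map ψ) (by rw [map_aeval_eval]; exact hg0 g hg) (fun j hj => by
      rw [hderiv, map_aeval_eval, map_aeval_eval, map_aeval_hasseDeriv_eval]
      rcases le_or_gt j N with hjN | hjN
      · have := he' _ (Or.inl (Or.inr ⟨(g, j), ⟨hg, hj, hjN⟩, rfl⟩))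
        simpa only [map_mul, map_pow] using this
      · have hle : g.natDegree ≤ G.sup natDegree := le_sup (f := natDegree) hg
        rw [hlarge g j (by omega), zero_mul]
        exact hpos (mul_ne_zero (hg0 g hg) (pow_ne_zero _ hD)))
    rwa [map_aeval_eval, map_aeval_eval] at this
  have hgx : ∀ g ∈ G, ev ζ x g ≠ 0 := fun g hg => by
    rw [← Valuation.ne_zero_iff O.valuation, hval g hg]
    exact (Valuation.ne_zero_iff _).mpr (hg0 g hg)
  have hHG : ∀ i, H i ∈ G := fun i =>
    Finset.mem_union_left _ (mem_image_of_mem _ (mem_univ i))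
  obtain rfl : a = fun i => ev z y (R i) / ev z y (H i) := funext haRH
  refine ⟨fun i => ev ζ x (R i) / ev ζ x (H i), SpecOver.of_algHom _ _ (fun Q hQ => ?_) R H hH
    fun i => hgx _ (hHG i), fun i hi hbi => ?_⟩
  · obtain ⟨Q', rfl⟩ := hdvd Q hQ
    rw [map_mul, hx, zero_mul]
  · have hip : i ∈ polar := mem_filter.mpr ⟨mem_univ i, hi⟩
    have hRG : R i ∈ G := Finset.mem_union_right _ (mem_image_of_mem _ hip)
    have h1 := he' _ (Or.inr ⟨i, hip, rfl⟩)
    simp only at h1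
    rw [← hval _ (hHG i), ← hval _ hRG] at h1
    rw [← O.valuation_le_one_iff, map_div₀, div_le_one₀ (zero_lt_iff.mpr
      ((Valuation.ne_zero_iff _).mpr (hgx _ (hHG i))))] at hbi
    exact absurd h1 hbi.not_gt

end

section

section

variable {M R : Type*} [Field M] [CommRing R] [Algebra M R]

/-- Evaluation of Laurent polynomials at a unit. -/
noncomputable def laurentHom (t : Rˣ) : AddMonoidAlgebra M ℤ →ₐ[M] R :=
  AddMonoidAlgebra.lift M R ℤ ((Units.coeHom R).comp (zpowersHom Rˣ t))

theorem laurentHom_apply (t : Rˣ) (f : AddMonoidAlgebra M ℤ) :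
    laurentHom t f = ∑ i ∈ f.coeff.support, algebraMap M R (f.coeff i) * ((t ^ i : Rˣ) : R) := by
  rw [laurentHom, AddMonoidAlgebra.lift_apply, Finsupp.sum]
  refine sum_congr rfl fun i _ => ?_
  rw [Algebra.smul_def]
  rfl

theorem laurentHom_single (t : Rˣ) (i : ℤ) (c : M) :
    laurentHom t (AddMonoidAlgebra.single i c) = algebraMap M R c * ((t ^ i : Rˣ) : R) := by
  rw [laurentHom, AddMonoidAlgebra.lift_single, Algebra.smul_def]
  rfl

end

variable {C : Type u} [NormedField C] [IsUltrametricDist C]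

theorem isGeneric_laurentHom {M : Subfield C} [IsAlgClosed (acl M)] {L : Type*} [Field L]
    [Algebra M L] {O : ValuationSubring L} {t : Cˣ} (ht : TypeII (acl M) (t : C))
    (hL : ∀ W : Finset ((M × ℤ) × (M × ℤ)),
      (∀ w ∈ W, ‖(w.1.1 : C) * t ^ w.1.2‖ < ‖(w.2.1 : C) * t ^ w.2.2‖) →
      ∃ τ : Lˣ, ∀ w ∈ W, O.valuation (algebraMap M L w.1.1 * τ ^ w.1.2) <
        O.valuation (algebraMap M L w.2.1 * τ ^ w.2.2)) :
    IsGeneric O (laurentHom (M := M) t) := by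
  classical
  have happ : ∀ f : AddMonoidAlgebra M ℤ,
      laurentHom t f = ∑ i ∈ f.coeff.support, (f.coeff i : C) * (t : C) ^ i := fun f => by
    rw [laurentHom_apply]
    simp only [Units.val_zpow_eq_zpow_val]
    rfl
  have happL : ∀ (τ : Lˣ) (f : AddMonoidAlgebra M ℤ),
      laurentHom τ f = ∑ i ∈ f.coeff.support, algebraMap M L (f.coeff i) * (τ : L) ^ i :=
    fun τ f => by
      rw [laurentHom_apply]
      simp only [Units.val_zpow_eq_zpow_val]
  have hdom : ∀ f : AddMonoidAlgebra M ℤ, f ≠ 0 → ∃ j ∈ f.coeff.support,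
      (∀ i ∈ f.coeff.support, i ≠ j →
        ‖(f.coeff i : C) * (t : C) ^ i‖ < ‖(f.coeff j : C) * (t : C) ^ j‖) ∧
      ‖laurentHom t f‖ = ‖(f.coeff j : C) * (t : C) ^ j‖ := fun f hf => by
    let g : ℤ →₀ acl M := f.coeff.mapRange (Subfield.inclusion (le_acl M)) (map_zero _)
    have hsupp : g.support = f.coeff.support :=
      Finsupp.support_mapRange_of_injective _ _ (Subfield.inclusion (le_acl M)).injective
    have hg : g ≠ 0 := by
      rw [← Finsupp.support_nonempty_iff, hsupp, Finsupp.support_nonempty_iff]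
      intro h0
      exact hf (AddMonoidAlgebra.coeff_eq_zero.mp h0)
    obtain ⟨j, hj, hlt⟩ := ht.exists_dominant hg
    rw [hsupp] at hj hlt
    refine ⟨j, hj, hlt, ?_⟩
    rw [happ]
    exact (norm_sum_eq_of_dominant (f := fun i => (f.coeff i : C) * (t : C) ^ i) hj
      (mul_ne_zero (fun h0 => Finsupp.mem_support_iff.mp hj (Subtype.ext h0))
        (zpow_ne_zero _ t.ne_zero)) hlt).1
  intro S hS
  have hex : ∀ q ∈ S, ∃ j ∈ q.2.coeff.support,
      (∀ i ∈ q.2.coeff.support, i ≠ j →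
        ‖(q.2.coeff i : C) * (t : C) ^ i‖ < ‖(q.2.coeff j : C) * (t : C) ^ j‖) ∧
      ∀ i ∈ q.1.coeff.support,
        ‖(q.1.coeff i : C) * (t : C) ^ i‖ < ‖(q.2.coeff j : C) * (t : C) ^ j‖ := fun q hq => by
    have hq2 : q.2 ≠ 0 := by
      intro h0
      have := hS q hq
      rw [h0, map_zero, norm_zero] at this
      exact absurd this (norm_nonneg _).not_gt
    obtain ⟨j, hj, h1, h2⟩ := hdom q.2 hq2
    refine ⟨j, hj, h1, fun i hi => ?_⟩
    have hq1 : q.1 ≠ 0 := by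
      intro h0
      rw [h0] at hi
      simp at hi
    obtain ⟨j', hj', h3, h4⟩ := hdom q.1 hq1
    rw [← h2]
    refine lt_of_le_of_lt ?_ (hS q hq)
    rw [h4]
    rcases eq_or_ne i j' with rfl | hij
    · exact le_rfl
    · exact (h3 i hi hij).le
  choose! J hJ h1 h2 using hex
  obtain ⟨τ, hτ⟩ := hL (S.biUnion fun q =>
    (q.2.coeff.support.erase (J q)).image
      (fun i => ((q.2.coeff i, i), (q.2.coeff (J q), J q))) ∪
    q.1.coeff.support.image (fun i => ((q.1.coeff i, i), (q.2.coeff (J q), J q)))) <| by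
      simp only [mem_biUnion, mem_union, mem_image, mem_erase]
      rintro _ ⟨q, hq, ⟨i, ⟨hij, hi⟩, rfl⟩ | ⟨i, hi, rfl⟩⟩
      · exact h1 q hq i hi hij
      · exact h2 q hq i hi
  simp only [mem_biUnion, mem_union, mem_image, mem_erase] at hτ
  refine ⟨laurentHom τ, fun q hq => ?_⟩
  have h3 : O.valuation (laurentHom τ q.2) =
      O.valuation (algebraMap M L (q.2.coeff (J q)) * (τ : L) ^ J q) := by
    rw [happL, ← add_sum_erase _ _ (hJ q hq), Valuation.map_add_eq_of_lt_left]
    refine Valuation.map_sum_lt _ ?_ fun i hi => ?_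
    · rw [Valuation.ne_zero_iff]
      refine mul_ne_zero ?_ (zpow_ne_zero _ τ.ne_zero)
      rw [Ne, map_eq_zero]
      exact Finsupp.mem_support_iff.mp (hJ q hq)
    · exact hτ _ ⟨q, hq, Or.inl ⟨i, mem_erase.mp hi, rfl⟩⟩
  rw [h3, happL]
  refine Valuation.map_sum_lt _ ?_ fun i hi => hτ _ ⟨q, hq, Or.inr ⟨i, hi, rfl⟩⟩
  rw [Valuation.ne_zero_iff]
  refine mul_ne_zero ?_ (zpow_ne_zero _ τ.ne_zero)
  rw [Ne, map_eq_zero]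
  exact Finsupp.mem_support_iff.mp (hJ q hq)

end

section

variable {C : Type u} [NormedField C] [IsUltrametricDist C] [IsAlgClosed C] [CompleteSpace C]
  {p : ℕ} [ExpChar C p] {κ K Ω M : Subfield C}

/-- The three kinds of elementary generic points over `M`. -/
structure HasGenerics (K M : Subfield C) {L : Type*} [Field L] [Algebra M L]
    (O : ValuationSubring L) : Prop where
  const : IsGeneric O (Algebra.ofId M C)
  typeI : ∀ T ∈ K, TypeI (acl M) T → IsGeneric O (aeval T : M[X] →ₐ[M] C)
  typeII : ∀ T : Cˣ, (T : C) ∈ K → TypeII (acl M) (T : C) → IsGeneric O (laurentHom (M := M) T)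

namespace IsStage

variable (h : IsStage p κ K Ω M)
include h

omit [CompleteSpace C] [IsAlgClosed C] [ExpChar C p] in
theorem exists_laurent_near {t : Cˣ} (ht : (t : C) ∈ K) {z w : C} (hz : z ∈ K)
    (hw : w ∈ laurent (acl M) (t : C)) :
    ∃ f : AddMonoidAlgebra M ℤ, ‖z - laurentHom t f‖ ≤ ‖z - w‖ := by
  obtain ⟨f, rfl⟩ := Finsupp.mem_span_range_iff_exists_finsupp.mp hw
  obtain ⟨g, hg, hle⟩ := h.exists_average f.support (fun i => (f i : C)) (fun i => (t : C) ^ i)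
    (fun i _ => (f i).2) (fun i _ => zpow_mem ht i) hz
  let g' : ℤ → M := fun i => if hi : i ∈ f.support then ⟨g i, hg i hi⟩ else 0
  refine ⟨∑ i ∈ f.support, AddMonoidAlgebra.single i (g' i), ?_⟩
  have h1 : laurentHom t (∑ i ∈ f.support, AddMonoidAlgebra.single i (g' i)) =
      ∑ i ∈ f.support, g i * (t : C) ^ i := by
    rw [map_sum]
    refine sum_congr rfl fun i hi => ?_
    rw [laurentHom_single, Units.val_zpow_eq_zpow_val]
    congr 1
    simp only [g', dif_pos hi]
    rfl
  rw [h1]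
  exact hle

omit [CompleteSpace C] [IsAlgClosed C] [ExpChar C p] in
theorem exists_aeval_near {t : C} (ht : t ∈ K) {z : C} (hz : z ∈ K) (q : (acl M)[X]) :
    ∃ f : M[X], ‖z - aeval t f‖ ≤ ‖z - aeval t q‖ := by
  obtain ⟨g, hg, hle⟩ := h.exists_average q.support (fun i => (q.coeff i : C)) (fun i => t ^ i)
    (fun i _ => (q.coeff i).2) (fun i _ => pow_mem ht i) hz
  let g' : ℕ → M := fun i => if hi : i ∈ q.support then ⟨g i, hg i hi⟩ else 0
  refine ⟨∑ i ∈ q.support, monomial i (g' i), ?_⟩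
  have h1 : aeval t (∑ i ∈ q.support, monomial i (g' i)) = ∑ i ∈ q.support, g i * t ^ i := by
    rw [map_sum]
    refine sum_congr rfl fun i hi => ?_
    rw [aeval_monomial]
    congr 1
    simp only [g', dif_pos hi]
    rfl
  have h2 : aeval t q = ∑ i ∈ q.support, (q.coeff i : C) * t ^ i := by
    rw [aeval_def, eval₂_eq_sum, Polynomial.sum]
    rfl
  rw [h1, h2]
  exact hle

variable {L : Type*} [Field L] [Algebra M L] {O : ValuationSubring L}

theorem isGeneric_ev (hgen : HasGenerics K M O) {z y : C} (hz : z ∈ K) (hy : y ∈ K)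
    (hyz : IsSeparable (adjoin M {z}) y) : IsGeneric O (ev (M := M) z y) := by
  have := isAlgClosed_acl M
  refine isGeneric_ev_of_approx fun ε hε => ?_
  rcases h.exists_param hz hyz with ⟨hz', hy'⟩ | ⟨T, hT, hp | hp, hz', hy'⟩
  · obtain ⟨β, hβ, hzβ⟩ := Metric.mem_closure_iff.mp hz' ε hε
    obtain ⟨β', hβ', hyβ⟩ := Metric.mem_closure_iff.mp hy' ε hε
    rw [dist_eq_norm] at hzβ hyβ
    obtain ⟨g, hg, hzg⟩ := h.exists_norm_sub_le hz hβ
    obtain ⟨g', hg', hyg⟩ := h.exists_norm_sub_le hy hβ'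
    exact ⟨M, inferInstance, inferInstance, Algebra.ofId M C, ⟨g, hg⟩, ⟨g', hg'⟩, hgen.const,
      hzg.trans_lt hzβ, hyg.trans_lt hyβ⟩
  · obtain ⟨q, hq⟩ := hp.hull_approx h.section_κ h.κ_le_acl hz' hε
    obtain ⟨q', hq'⟩ := hp.hull_approx h.section_κ h.κ_le_acl hy' hε
    obtain ⟨f, hf⟩ := h.exists_aeval_near hT hz q
    obtain ⟨f', hf'⟩ := h.exists_aeval_near hT hy q'
    exact ⟨M[X], inferInstance, inferInstance, aeval T, f, f', hgen.typeI T hT hp,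
      hf.trans_lt hq, hf'.trans_lt hq'⟩
  · obtain ⟨t₁, n₁, hn₁, ht₁, w₁, hw₁, hzw⟩ := hp.hull_approx h.section_κ h.κ_le_acl hz' hε
    obtain ⟨t₂, n₂, hn₂, ht₂, w₂, hw₂, hyw⟩ := hp.hull_approx h.section_κ h.κ_le_acl hy' hε
    obtain ⟨t, ht, hl₁, hl₂⟩ := exists_common_root (B := acl M) hp.ne_zero hn₁ hn₂ ht₁ ht₂
    have hn : n₁ * n₂ ≠ 0 := by
      rw [Nat.mul_ne_zero_iff]
      exact ⟨fun h0 => hn₁ (by rw [h0, Nat.cast_zero]), fun h0 => hn₂ (by rw [h0, Nat.cast_zero])⟩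
    have ht0 : t ≠ 0 := by
      rintro rfl
      rw [zero_pow hn] at ht
      exact hp.ne_zero ht.symm
    have := h.isAlgClosed
    have htΩ : t ∈ Ω := mem_of_pow_mem (Nat.pos_of_ne_zero hn) (ht ▸ h.le hT)
    obtain ⟨γ, hγ, hγ0, hγt⟩ := h.exists_mul_mem htΩ ht0 hn (ht ▸ hT)
    let τ : Cˣ := Units.mk0 (γ * t) (mul_ne_zero hγ0 ht0)
    have hτII : TypeII (acl M) (τ : C) := fun b => by
      have h1 : TypeII (acl M) t := TypeII.of_pow (n := n₁ * n₂) (ht ▸ hp)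
      change ‖γ * t‖ ≠ _
      rw [norm_mul, h.section_κ.norm_eq_one γ hγ hγ0, one_mul]
      exact h1 b
    have hle : laurent (acl M) t ≤ laurent (acl M) (τ : C) :=
      laurent_le_of (inv_mem (h.κ_le_acl hγ)) (n := 1) (by
        rw [zpow_one]; exact (inv_mul_cancel_left₀ hγ0 t).symm)
    obtain ⟨f, hf⟩ := h.exists_laurent_near (t := τ) hγt hz (hle (hl₁ hw₁))
    obtain ⟨f', hf'⟩ := h.exists_laurent_near (t := τ) hγt hy (hle (hl₂ hw₂))
    exact ⟨AddMonoidAlgebra M ℤ, inferInstance, inferInstance, laurentHom τ, f, f',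
      hgen.typeII τ hγt hτII, hf.trans_lt hzw, hf'.trans_lt hyw⟩

theorem exists_specOver (hgen : HasGenerics K M O) (hO : VHens O) {ι : Type*} [Finite ι] (x : C)
    (a : ι → C) (haK : ∀ i, a i ∈ K) (ha : ∀ i, IsAlgebraic (adjoin M {x}) (a i)) :
    ∃ b : ι → L, SpecOver M a b ∧ ∀ i, 1 < ‖a i‖ → b i ∉ O := by
  by_cases halg : ∀ i, IsAlgebraic M (a i)
  · have haM : ∀ i, a i ∈ M := fun i => h.mem_of_isAlgebraic _ (haK i) (halg i)
    let a' : ι → M := fun i => ⟨a i, haM i⟩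
    refine ⟨fun i => algebraMap M L (a' i), ?_, fun i hi hb => ?_⟩
    · refine SpecOver.of_map (Algebra.ofId M C) (a' := a') (fun i => rfl) fun P hP => ?_
      have h1 : MvPolynomial.aeval (fun i => algebraMap M L (a' i)) P =
          algebraMap M L (MvPolynomial.aeval a' P) := by
        rw [← MvPolynomial.aeval_algebraMap_apply]; rfl
      rw [h1, hP, map_zero]
    · obtain ⟨e', he'⟩ := hgen.const {(1, a' i)} (by
        intro q hq
        obtain rfl := mem_singleton.mp hq
        rw [map_one, norm_one]
        exact hi)
      have h1 := he' (1, a' i) (Finset.mem_singleton_self _)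
      have h2 : e' (a' i) = algebraMap M L (a' i) := e'.commutes (a' i)
      rw [map_one, map_one, h2] at h1
      exact absurd ((O.valuation_le_one_iff _).mpr hb) h1.not_ge
  · push Not at halg
    obtain ⟨i₀, hi₀⟩ := halg
    have := h.perfectField
    obtain ⟨z, hz, y, hy, hzt, hyz, hyint, hay⟩ := exists_separating_pair x a ha hi₀
    let K' : IntermediateField M C := { K with algebraMap_mem' := fun r => h.M_le r.2 }
    have hK' : adjoin M (Set.range a) ≤ K' :=
      adjoin_le_iff.mpr (by rintro _ ⟨i, rfl⟩; exact haK i)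
    obtain ⟨P, hP, hP', hdvd⟩ := exists_bivariate hzt hyz hyint
    exact (h.isGeneric_ev hgen (hK' hz) (hK' hy) hyz).exists_specOver hO hP hP' hdvd
      fun i => by
        obtain ⟨R, H, hH, hRH⟩ := mem_range_ev (hay i)
        exact ⟨R, H, hH, hRH⟩

end IsStage

end

section

section

variable {C : Type u} [NormedField C] [IsUltrametricDist C]

/-- The elements of norm at most one in a subfield. -/
def unitBall (M : Subfield C) : ValuationSubring M where
  carrier := {x | ‖(x : C)‖ ≤ 1}
  mul_mem' {a b} ha hb := by
    change ‖((a : C) * b)‖ ≤ 1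
    rw [norm_mul]
    exact mul_le_one₀ ha (norm_nonneg _) hb
  one_mem' := by simp
  add_mem' {a b} ha hb := norm_add_le ha hb
  zero_mem' := by simp
  neg_mem' {a} ha := by
    change ‖-(a : C)‖ ≤ 1
    rwa [norm_neg]
  mem_or_inv_mem' a := by
    change ‖(a : C)‖ ≤ 1 ∨ ‖((a⁻¹ : M) : C)‖ ≤ 1
    rw [Subfield.coe_inv, norm_inv]
    rcases le_total ‖(a : C)‖ 1 with h | h
    exacts [Or.inl h, Or.inr (inv_le_one_of_one_le₀ h)]

variable {M : Subfield C}

theorem mem_unitBall {x : M} : x ∈ unitBall M ↔ ‖(x : C)‖ ≤ 1 := Iff.rfl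

theorem unitBall_valuation_le {x y : M} :
    (unitBall M).valuation x ≤ (unitBall M).valuation y ↔ ‖(x : C)‖ ≤ ‖(y : C)‖ := by
  rcases eq_or_ne y 0 with rfl | hy
  · rw [map_zero, le_zero_iff, map_eq_zero]
    simp
  · rw [← div_le_one₀ (zero_lt_iff.mpr ((Valuation.ne_zero_iff _).mpr hy)), ← map_div₀,
      ValuationSubring.valuation_le_one_iff, mem_unitBall, Subfield.coe_div, norm_div,
      div_le_one₀ (norm_pos_iff.mpr (by simpa using hy))]

theorem unitBall_valuation_lt {x y : M} :
    (unitBall M).valuation x < (unitBall M).valuation y ↔ ‖(x : C)‖ < ‖(y : C)‖ := by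
  rw [← not_le, unitBall_valuation_le, not_le]

theorem unitBall_valuation_lt_one {x : M} : (unitBall M).valuation x < 1 ↔ ‖(x : C)‖ < 1 := by
  rw [← map_one (unitBall M).valuation, unitBall_valuation_lt]
  simp

theorem unitBall_valuation_eq_one {x : M} : (unitBall M).valuation x = 1 ↔ ‖(x : C)‖ = 1 := by
  rw [le_antisymm_iff, le_antisymm_iff, ← map_one (unitBall M).valuation, unitBall_valuation_le,
    unitBall_valuation_le]
  simp

end

section

variable {C : Type u} [NormedField C] [IsUltrametricDist C]

/-- Two roots of a Hensel polynomial in the open unit disc agree. -/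
theorem eq_of_roots_of_norm_lt_one {f : C[X]} (hf : ∀ n, ‖f.coeff n‖ ≤ 1) (h1 : ‖f.coeff 1‖ = 1)
    {a b : C} (ha : ‖a‖ < 1) (hb : ‖b‖ < 1) (hfa : f.eval a = 0) (hfb : f.eval b = 0) : a = b := by
  classical
  by_contra hne
  have hab : 0 < ‖a - b‖ := norm_pos_iff.mpr (sub_ne_zero.mpr hne)
  have hpow : ∀ i, 2 ≤ i → ‖a ^ i - b ^ i‖ < ‖a - b‖ := fun i hi => by
    obtain ⟨n, rfl⟩ := Nat.exists_eq_add_of_le' (show 1 ≤ i by omega)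
    have h : a ^ (n + 1) - b ^ (n + 1) = a * (a ^ n - b ^ n) + (a - b) * b ^ n := by ring
    rw [h]
    refine norm_add_lt ?_ ?_
    · rw [norm_mul]
      exact (mul_le_mul_of_nonneg_left (norm_pow_sub_pow_le ha.le hb.le n) (norm_nonneg _)).trans_lt
        (mul_lt_of_lt_one_left hab ha)
    · rw [norm_mul, norm_pow]
      exact mul_lt_of_lt_one_right hab (pow_lt_one₀ (norm_nonneg _) hb (by omega))
  have hsum : f.eval a - f.eval b =
      ∑ i ∈ range (f.natDegree + 1), f.coeff i * (a ^ i - b ^ i) := by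
    rw [eval_eq_sum_range, eval_eq_sum_range, ← sum_sub_distrib]
    exact sum_congr rfl fun i _ => by ring
  have hmem : 1 ∈ range (f.natDegree + 1) := by
    have : 1 ≤ f.natDegree := le_natDegree_of_ne_zero (norm_pos_iff.mp (by rw [h1]; norm_num))
    simp only [mem_range]
    omega
  have hnorm : ‖f.coeff 1 * (a ^ 1 - b ^ 1)‖ = ‖a - b‖ := by
    rw [norm_mul, h1, one_mul, pow_one, pow_one]
  have h2 := (norm_sum_eq_of_dominant hmem (f := fun i => f.coeff i * (a ^ i - b ^ i))
    (norm_pos_iff.mp (by rw [hnorm]; exact hab)) fun i _ hi => by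
      rw [hnorm]
      rcases Nat.lt_or_ge i 2 with hi2 | hi2
      · obtain rfl : i = 0 := by omega
        simpa using hab
      · rw [norm_mul]
        exact (mul_le_of_le_one_left (norm_nonneg _) (hf i)).trans_lt (hpow i hi2)).1
  rw [← hsum, hfa, hfb, sub_zero, norm_zero, hnorm] at h2
  exact hab.ne h2

/-- A Hensel polynomial over an algebraically closed subfield has a root in the unit disc. -/
theorem exists_root_of_norm_lt_one {B : Subfield C} [IsAlgClosed B] {f : B[X]}
    (h0 : ‖((f.coeff 0 : B) : C)‖ < 1) (h1 : ‖((f.coeff 1 : B) : C)‖ = 1) :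
    ∃ b : B, ‖(b : C)‖ < 1 ∧ f.eval b = 0 := by
  rcases eq_or_ne (f.coeff 0) 0 with hc | hc
  · exact ⟨0, by simp, by rw [← coeff_zero_eq_eval_zero, hc]⟩
  have hf0 : f ≠ 0 := by
    rintro rfl
    exact hc (coeff_zero 0)
  by_contra! hcon
  have hpos : 0 < ‖((f.coeff 0 : B) : C)‖ := norm_pos_iff.mpr (by simpa using hc)
  have h2 := constDominant_of_roots hf0 (α := 0) hpos fun r hr => by
    have h3 : 1 ≤ ‖(r : C)‖ := not_lt.mp fun hlt => hcon r hlt (isRoot_of_mem_roots hr)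
    simp only [ZeroMemClass.coe_zero, zero_sub, norm_neg]
    exact h0.trans_le h3
  have h3 := h2 1 one_ne_zero
  rw [taylor_zero, coeff_map, coeff_map, pow_one] at h3
  change ‖((f.coeff 1 : B) : C)‖ * _ < ‖((f.coeff 0 : B) : C)‖ at h3
  rw [h1, one_mul] at h3
  exact lt_irrefl _ h3

end

variable {C : Type u} [NormedField C] [IsUltrametricDist C] [IsAlgClosed C]
  {p : ℕ} {κ K Ω M : Subfield C}

namespace IsStage

variable (h : IsStage p κ K Ω M)
include h

theorem vHens_unitBall : VHens (unitBall M) := by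
  intro f hf h0 h1
  have := isAlgClosed_acl M
  rw [unitBall_valuation_lt_one] at h0
  rw [unitBall_valuation_eq_one] at h1
  let j : M →+* acl M := Subfield.inclusion (le_acl M)
  obtain ⟨b, hb, hfb⟩ := exists_root_of_norm_lt_one (f := f.map j) (by rw [coeff_map]; exact h0)
    (by rw [coeff_map]; exact h1)
  have hev : ∀ x : C, (f.map (algebraMap M C)).eval x = aeval x f := fun x => by
    rw [eval_map, aeval_def]
  have hbC : aeval (b : C) f = 0 := by
    have h2 := congr_arg (algebraMap (acl M) C) hfb
    rw [eval_map, hom_eval₂, map_zero] at h2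
    exact h2
  have hbK : (b : C) ∈ K := h.mem_of_forall_fixed (h.acl_le_Ω b.2) fun σ hσ hσK => by
    refine eq_of_roots_of_norm_lt_one (f := f.map (algebraMap M C)) (fun n => ?_) ?_
      ((hσ b).trans_lt hb) hb ?_ ((hev _).trans hbC)
    · rw [coeff_map]
      exact hf n
    · rw [coeff_map]
      exact h1
    · have h2 := congr_arg σ hbC
      rw [map_zero, aeval_def, ← RingEquiv.coe_toRingHom, hom_eval₂] at h2
      rw [eval_map]
      have h3 : (σ : C →+* C).comp (algebraMap M C) = algebraMap M C :=
        RingHom.ext fun m => hσK m (h.M_le m.2)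
      rwa [h3] at h2
  have hbM := h.mem_of_mem_acl b.2 hbK
  refine ⟨⟨b, hbM⟩, unitBall_valuation_lt_one.mpr hb, Subtype.ext ?_⟩
  rw [← coe_aeval_eq_eval]
  have h2 := aeval_algebraMap_apply C (⟨b, hbM⟩ : M) f
  exact h2.symm.trans hbC

theorem isGeneric_aeval {T : C} (hT : T ∈ K) (hI : TypeI (acl M) T) :
    IsGeneric (unitBall M) (aeval T : M[X] →ₐ[M] C) := by
  classical
  intro S hS
  have := isAlgClosed_acl M
  let j : M →+* acl M := Subfield.inclusion (le_acl M)
  have hnear : ∀ q : M[X], ∃ α₀ : acl M, ∀ α : acl M, ‖T - α‖ ≤ ‖T - α₀‖ →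
      ‖aeval T q‖ = ‖(((q.map j).eval α : acl M) : C)‖ := fun q => by
    rcases eq_or_ne q 0 with rfl | hq
    · exact ⟨0, by simp⟩
    · obtain ⟨α₀, hα⟩ := hI.exists_norm_sub_eval_lt ((Polynomial.map_ne_zero_iff j.injective).mpr hq)
      refine ⟨α₀, fun α h' => ?_⟩
      have h2 := hα α h'
      rw [norm_sub_rev] at h2
      have h3 := norm_eq_of_sub_lt h2
      rw [← h3, aeval_def, aeval_def, eval₂_map]
      rfl
  choose A hA using hnear
  obtain ⟨α, hα⟩ := hI.exists_forall_lt (S.image (fun q => A q.1) ∪ S.image fun q => A q.2)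
  obtain ⟨g, hg, hTg⟩ := h.exists_norm_sub_le hT α.2
  have hev : ∀ q : M[X], ‖T - g‖ ≤ ‖T - A q‖ → ‖aeval T q‖ = ‖((q.eval ⟨g, hg⟩ : M) : C)‖ :=
    fun q hq => by
      rw [hA q (j ⟨g, hg⟩) hq, eval_map_apply]
      rfl
  refine ⟨aeval ⟨g, hg⟩, fun q hq => ?_⟩
  rw [unitBall_valuation_lt, coe_aeval_eq_eval, ← hev, ← hev]
  · exact hS q hq
  · exact hTg.trans (hα _ (Finset.mem_union_right _ (mem_image_of_mem _ hq))).le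
  · exact hTg.trans (hα _ (Finset.mem_union_left _ (mem_image_of_mem _ hq))).le

omit [IsUltrametricDist C] in
theorem exists_norm_mem_Ioo {π : C} (hπ : π ∈ M) (hπ1 : 1 < ‖π‖) {l r : ℝ} (hl : 0 < l)
    (hlr : l < r) : ∃ c ∈ M, c ≠ 0 ∧ l < ‖c‖ ∧ ‖c‖ < r := by
  have hB := isAlgClosed_acl M
  obtain ⟨n, hn⟩ := exists_nat_gt (Real.log ‖π‖ / (Real.log r - Real.log l))
  have hd : 0 < Real.log r - Real.log l := sub_pos.mpr (Real.log_lt_log hl hlr)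
  have hlog : 0 < Real.log ‖π‖ := Real.log_pos hπ1
  have hn0 : 0 < (n : ℝ) := (div_pos hlog hd).trans hn
  have hn1 : n ≠ 0 := by
    rintro rfl
    simp at hn0
  rw [div_lt_iff₀ hd] at hn
  obtain ⟨ρ, hρ⟩ := exists_pow_nat_eq (⟨π, le_acl M hπ⟩ : acl M) (Nat.pos_of_ne_zero hn1)
  have hρ' : (ρ : C) ^ n = π := congr_arg Subtype.val hρ
  have hρ0 : (ρ : C) ≠ 0 := by
    rintro h0
    rw [h0, zero_pow hn1] at hρ'
    rw [← hρ', norm_zero] at hπ1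
    linarith
  have hρlog : n * Real.log ‖(ρ : C)‖ = Real.log ‖π‖ := by
    rw [← Real.log_pow, ← norm_pow, hρ']
  have hρpos : 0 < Real.log ‖(ρ : C)‖ := by
    by_contra! hc
    nlinarith
  have hρlt : Real.log ‖(ρ : C)‖ < Real.log r - Real.log l := by
    by_contra! hc
    nlinarith
  obtain ⟨m, hm, -⟩ := existsUnique_add_zsmul_mem_Ioc hρpos 0 (Real.log l)
  rw [zero_add, zsmul_eq_mul, Set.mem_Ioc] at hm
  have htpos : 0 < ‖(ρ : C) ^ m‖ := norm_pos_iff.mpr (zpow_ne_zero m hρ0)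
  have htlog : Real.log ‖(ρ : C) ^ m‖ = m * Real.log ‖(ρ : C)‖ := by rw [norm_zpow, Real.log_zpow]
  obtain ⟨γ, hγ, hγ0, hγt⟩ := h.exists_mul_mem (zpow_mem (h.acl_le_Ω ρ.2) m) (zpow_ne_zero m hρ0)
    hn1 (by
      rw [← zpow_natCast, zpow_comm, zpow_natCast, hρ']
      exact zpow_mem (h.M_le hπ) m)
  have hnorm : ‖γ * (ρ : C) ^ m‖ = ‖(ρ : C) ^ m‖ := by
    rw [norm_mul, h.section_κ.norm_eq_one γ hγ hγ0, one_mul]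
  refine ⟨γ * (ρ : C) ^ m, h.mem_of_mem_acl (mul_mem (h.κ_le_acl hγ) (zpow_mem ρ.2 m)) hγt,
    mul_ne_zero hγ0 (zpow_ne_zero m hρ0), ?_, ?_⟩
  · rw [hnorm, ← Real.log_lt_log_iff hl htpos, htlog]
    exact hm.1
  · rw [hnorm, ← Real.log_lt_log_iff htpos (hl.trans hlr), htlog]
    linarith [hm.2]

theorem isGeneric_laurentHom {π : C} (hπ : π ∈ M) (hπ1 : 1 < ‖π‖) {T : Cˣ}
    (hII : TypeII (acl M) (T : C)) : IsGeneric (unitBall M) (laurentHom (M := M) T) := by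
  have := isAlgClosed_acl M
  refine Ultra.isGeneric_laurentHom hII fun W hW => ?_
  have hT : 0 < ‖(T : C)‖ := norm_pos_iff.mpr T.ne_zero
  have hev : ∀ᶠ r in nhds ‖(T : C)‖, ∀ w ∈ W,
      ‖(w.1.1 : C)‖ * r ^ w.1.2 < ‖(w.2.1 : C)‖ * r ^ w.2.2 := by
    refine (Filter.eventually_all_finset W).mpr fun w hw => ?_
    have hc : ∀ n : ℤ, ContinuousAt (fun r : ℝ => r ^ n) ‖(T : C)‖ := fun n =>
      continuousAt_zpow₀ _ n (Or.inl hT.ne')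
    refine ((hc w.1.2).const_mul _).eventually_lt ((hc w.2.2).const_mul _) ?_
    simpa only [norm_mul, norm_zpow] using hW w hw
  obtain ⟨l, r, ⟨hl, hr⟩, hlr⟩ := mem_nhds_iff_exists_Ioo_subset.mp (hev.and (lt_mem_nhds hT))
  obtain ⟨c, hcM, hc0, hc1, hc2⟩ := h.exists_norm_mem_Ioo hπ hπ1 hT hr
  have hc := (hlr ⟨hl.trans hc1, hc2⟩).1
  refine ⟨Units.mk0 ⟨c, hcM⟩ (fun h0 => hc0 (congr_arg Subtype.val h0)), fun w hw => ?_⟩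
  rw [unitBall_valuation_lt]
  have hz : ∀ n : ℤ, ((((⟨c, hcM⟩ : M) ^ n : M)) : C) = c ^ n := fun n =>
    map_zpow₀ M.subtype _ n
  simpa [hz, norm_zpow] using hc w hw

theorem hasGenerics_unitBall {π : C} (hπ : π ∈ M) (hπ1 : 1 < ‖π‖) :
    HasGenerics K M (unitBall M) where
  const _ hS := ⟨AlgHom.id M M, fun q hq => unitBall_valuation_lt.mpr (hS q hq)⟩
  typeI _ hT hI := h.isGeneric_aeval hT hI
  typeII _ _ hII := h.isGeneric_laurentHom hπ hπ1 hII

end IsStage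

section

variable {L : Type*} [Field L] {O : ValuationSubring L}

theorem exists_one_lt_valuation (hO : O ≠ ⊤) : ∃ τ : Lˣ, 1 < O.valuation (τ : L) := by
  obtain ⟨x, -, hx⟩ := SetLike.exists_of_lt (lt_top_iff_ne_top.mpr hO)
  have hx0 : x ≠ 0 := by
    rintro rfl
    exact hx O.zero_mem
  exact ⟨Units.mk0 x hx0, not_le.mp fun hle => hx ((O.valuation_le_one_iff x).mp hle)⟩

theorem exists_valuation_lt (hO : O ≠ ⊤) (s : Finset L) :
    ∃ τ : Lˣ, 1 < O.valuation (τ : L) ∧ ∀ c ∈ s, O.valuation c < O.valuation (τ : L) := by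
  classical
  induction s using Finset.induction_on with
  | empty =>
    obtain ⟨τ, hτ⟩ := exists_one_lt_valuation hO
    exact ⟨τ, hτ, by simp⟩
  | insert c s _ ih =>
    obtain ⟨τ, hτ, hs⟩ := ih
    rcases lt_or_ge (O.valuation c) (O.valuation (τ : L)) with hc | hc
    · refine ⟨τ, hτ, fun d hd => ?_⟩
      rcases mem_insert.mp hd with rfl | hd
      exacts [hc, hs d hd]
    · have hc1 := hτ.trans_le hc
      have hlt : O.valuation c < O.valuation (c ^ 2) := by
        rw [map_pow]
        exact lt_self_pow₀ hc1 one_lt_two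
      have hc0 : c ^ 2 ≠ 0 := fun h0 => by
        rw [h0, map_zero] at hlt
        exact not_lt_zero hlt
      refine ⟨Units.mk0 (c ^ 2) hc0, hc1.trans hlt, fun d hd => ?_⟩
      rcases mem_insert.mp hd with rfl | hd
      exacts [hlt, ((hs d hd).trans_le hc).trans hlt]

variable (h : IsSplitting p κ K Ω)
include h

omit [IsUltrametricDist C] [IsAlgClosed C] in
theorem IsSplitting.isStage : IsStage p κ K Ω (K ⊓ κ) where
  toIsSplitting := h
  M_le := inf_le_left
  mem_of_isAlgebraic _ hx ha := Subfield.mem_inf.mpr ⟨hx, h.acl_inf_le (mem_acl.mpr ha)⟩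
  inf_le := le_rfl

omit [IsUltrametricDist C] [IsAlgClosed C] in
theorem IsSplitting.norm_eq_one (c : (K ⊓ κ : Subfield C)) (hc : c ≠ 0) : ‖(c : C)‖ = 1 :=
  h.section_κ.norm_eq_one c (Subfield.mem_inf.mp c.2).2 (by simpa using hc)

theorem IsSplitting.hasGenerics [Algebra (K ⊓ κ : Subfield C) L] (hO : O ≠ ⊤) :
    HasGenerics K (K ⊓ κ) O where
  const S hS := ⟨Algebra.ofId _ L, fun q hq => by
    have h1 := hS q hq
    change ‖(q.1 : C)‖ < ‖(q.2 : C)‖ at h1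
    have h2 : q.2 ≠ 0 := fun h0 => by
      rw [h0, ZeroMemClass.coe_zero, norm_zero] at h1
      exact (norm_nonneg _).not_gt h1
    have h3 : q.1 = 0 := by
      by_contra h0
      rw [h.norm_eq_one _ h0, h.norm_eq_one _ h2] at h1
      exact lt_irrefl _ h1
    change O.valuation (algebraMap _ L q.1) < O.valuation (algebraMap _ L q.2)
    rw [h3, map_zero, map_zero]
    exact zero_lt_iff.mpr ((Valuation.ne_zero_iff _).mpr (by simpa using h2))⟩
  typeI T _ hI := by
    exfalso
    obtain ⟨α, hα⟩ := hI 0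
    obtain ⟨β, hβ⟩ := hI α
    obtain ⟨γ, hγ⟩ := hI β
    have h2 : ∀ a b : acl (K ⊓ κ), ‖T - b‖ < ‖T - a‖ → ‖T - a‖ = 1 := fun a b hab => by
      have h1 : (b : C) - a ≠ 0 := fun h0 => by
        rw [sub_eq_zero.mp h0] at hab
        exact lt_irrefl _ hab
      rw [← h.section_κ.norm_eq_one _ (h.acl_inf_le (sub_mem b.2 a.2)) h1,
        show (b : C) - a = (T - a) - (T - b) by ring, norm_sub_eq_left hab]
    rw [h2 _ _ hβ, h2 _ _ hγ] at hβ
    exact lt_irrefl _ hβ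
  typeII T _ hII := by
    classical
    have := isAlgClosed_acl (K ⊓ κ)
    have hT1 : ‖(T : C)‖ ≠ 1 := by simpa using hII 1
    have hT0 : 0 < ‖(T : C)‖ := norm_pos_iff.mpr T.ne_zero
    refine Ultra.isGeneric_laurentHom hII fun W hW => ?_
    have key : ∀ w ∈ W, w.2.1 ≠ 0 ∧ (w.1.1 = 0 ∨ ‖(T : C)‖ ^ w.1.2 < ‖(T : C)‖ ^ w.2.2) :=
      fun w hw => by
        have h1 := hW w hw
        have h2 : w.2.1 ≠ 0 := fun h0 => by
          rw [h0, ZeroMemClass.coe_zero, zero_mul, norm_zero] at h1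
          exact (norm_nonneg _).not_gt h1
        refine ⟨h2, or_iff_not_imp_left.mpr fun h0 => ?_⟩
        rwa [norm_mul, norm_mul, h.norm_eq_one _ h0, h.norm_eq_one _ h2, one_mul, one_mul,
          norm_zpow, norm_zpow] at h1
    let r : (((K ⊓ κ : Subfield C) × ℤ) × ((K ⊓ κ : Subfield C) × ℤ)) → L := fun w =>
      algebraMap _ L w.1.1 / algebraMap _ L w.2.1
    obtain ⟨τ, hτ1, hτ⟩ := exists_valuation_lt hO (W.image r)
    have fin : ∀ w ∈ W, ∀ n : ℤ, 0 < n →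
        O.valuation (algebraMap _ L w.1.1) < O.valuation (algebraMap _ L w.2.1 * (τ : L) ^ n) := by
      intro w hw n hn
      obtain ⟨m, rfl⟩ : ∃ m : ℕ, n = m := ⟨n.toNat, (Int.toNat_of_nonneg hn.le).symm⟩
      have h1 := hτ _ (mem_image_of_mem r hw)
      have h2 : O.valuation (algebraMap _ L w.2.1) ≠ 0 :=
        (Valuation.ne_zero_iff _).mpr (by simpa using (key w hw).1)
      rw [map_div₀, div_lt_iff₀' (zero_lt_iff.mpr h2), ← map_mul] at h1
      refine h1.trans_le ?_
      rw [map_mul, map_mul, zpow_natCast, map_pow]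
      exact mul_le_mul_right (le_self_pow hτ1.le (by omega)) _
    have hpos : ∀ w ∈ W, ∀ (σ : Lˣ) (n : ℤ), 0 < O.valuation (algebraMap _ L w.2.1 * (σ : L) ^ n) :=
      fun w hw σ n => zero_lt_iff.mpr ((Valuation.ne_zero_iff _).mpr
        (mul_ne_zero (by simpa using (key w hw).1) (zpow_ne_zero _ σ.ne_zero)))
    have fin' : ∀ σ : Lˣ, (∀ i j : ℤ, ‖(T : C)‖ ^ i < ‖(T : C)‖ ^ j →
        ∃ n : ℤ, 0 < n ∧ (σ : L) ^ (j - i) = (τ : L) ^ n) → ∀ w ∈ W,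
        O.valuation (algebraMap _ L w.1.1 * σ ^ w.1.2) <
          O.valuation (algebraMap _ L w.2.1 * σ ^ w.2.2) := fun σ hσ w hw => by
      rcases (key w hw).2 with h0 | h3
      · rw [h0, map_zero, zero_mul, map_zero]
        exact hpos w hw σ _
      · obtain ⟨n, hn, hσn⟩ := hσ _ _ h3
        have h4 := fin w hw n hn
        rw [← hσn, zpow_sub₀ σ.ne_zero, mul_div, map_div₀,
          lt_div_iff₀ (zero_lt_iff.mpr ((Valuation.ne_zero_iff _).mpr (zpow_ne_zero _ σ.ne_zero))),
          ← map_mul] at h4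
        exact h4
    rcases lt_or_gt_of_ne hT1 with h1 | h1
    · refine ⟨τ⁻¹, fin' τ⁻¹ fun i j hij => ⟨i - j, ?_, ?_⟩⟩
      · rw [zpow_lt_zpow_iff_right_of_lt_one₀ hT0 h1] at hij
        exact sub_pos.mpr hij
      · rw [Units.val_inv_eq_inv_val, inv_zpow', neg_sub]
    · refine ⟨τ, fin' τ fun i j hij => ⟨j - i, ?_, rfl⟩⟩
      rw [zpow_lt_zpow_iff_right₀ h1] at hij
      exact sub_pos.mpr hij

end

end

section

theorem SpecOver.restrict {C : Type*} [Field C] {M N : Subfield C} (hMN : M ≤ N) {ι : Type*}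
    {a b : ι → C} (h : SpecOver N a b) : SpecOver M a b := fun P hP => by
  let j : M →+* N := Subfield.inclusion hMN
  have h1 : ∀ c : ι → C, MvPolynomial.aeval c (P.map j) = MvPolynomial.aeval c P := fun c => by
    rw [MvPolynomial.aeval_def, MvPolynomial.aeval_def, MvPolynomial.eval₂_map]
    rfl
  rw [← h1]
  exact h _ ((h1 a).trans hP)

theorem SpecOver.apply_eq {k K L ι : Type*} [Field k] [CommRing K] [CommRing L] [Algebra k K]
    [Algebra k L] {a : ι → K} {b : ι → L} (h : SpecOver k a b) {i : ι} {c : k}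
    (hi : a i = algebraMap k K c) : b i = algebraMap k L c := by
  have h1 := h (MvPolynomial.X i - MvPolynomial.C c) (by simp [hi])
  simpa [sub_eq_zero] using h1

variable {C : Type u} [NormedField C]

/-- The subfield generated over `M` by `S`. -/
def gen (M : Subfield C) (S : Set C) : Subfield C := Subfield.closure (M ∪ S)

theorem le_gen (M : Subfield C) (S : Set C) : M ≤ gen M S := fun _ hx =>
  Subfield.subset_closure (Or.inl hx)

theorem mem_gen {M : Subfield C} {S : Set C} {x : C} (hx : x ∈ S) : x ∈ gen M S :=
  Subfield.subset_closure (Or.inr hx)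

theorem gen_le {M N : Subfield C} {S : Set C} (hM : M ≤ N) (hS : S ⊆ N) : gen M S ≤ N :=
  Subfield.closure_le.mpr (Set.union_subset hM hS)

theorem isAlgebraic_adjoin {M : Subfield C} {S : Set C} {x : C} (hx : x ∈ acl (gen M S)) :
    IsAlgebraic (adjoin M S) x := by
  have h1 : gen M S ≤ (adjoin M S).toSubfield :=
    gen_le (fun y hy => (adjoin M S).algebraMap_mem ⟨y, hy⟩)
      (subset_adjoin M S)
  exact mem_acl.mp (acl_mono h1 hx)

variable [IsUltrametricDist C] [IsAlgClosed C] {p : ℕ} {κ K Ω M : Subfield C}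

omit [IsUltrametricDist C] [IsAlgClosed C] in
theorem IsStage.extend (h : IsStage p κ K Ω M) {N : Subfield C} (hN : M ≤ N) :
    IsStage p κ K Ω (K ⊓ acl N) where
  toIsSplitting := h.toIsSplitting
  M_le := inf_le_left
  mem_of_isAlgebraic _ hx ha := Subfield.mem_inf.mpr ⟨hx, acl_acl (mem_acl.mp
    (acl_mono inf_le_right (mem_acl.mpr ha)))⟩
  inf_le := le_inf inf_le_left ((h.inf_le.trans hN).trans (le_acl N))

theorem IsStage.exists_specOver_self [CompleteSpace C] [ExpChar C p] (h : IsStage p κ K Ω M) {π : C}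
    (hπ : π ∈ M) (hπ1 : 1 < ‖π‖) {ι : Type*} [Finite ι] (s : Finset C) (hs : ∀ y ∈ s, y ∈ K)
    (a : ι → C) (haK : ∀ i, a i ∈ K) (ha : ∀ i, a i ∈ acl (gen M s)) :
    ∃ b : ι → C, (∀ i, b i ∈ M) ∧ SpecOver M a b := by
  classical
  induction s using Finset.induction_on generalizing M with
  | empty =>
    refine ⟨a, fun i => h.mem_of_mem_acl (acl_mono (gen_le le_rfl ?_) (ha i)) (haK i), SpecOver.refl a⟩
    simp
  | insert y s _ ih =>
    have h₁ := h.extend (le_gen M {y})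
    have hM : M ≤ K ⊓ acl (gen M {y}) :=
      le_inf h.M_le ((le_gen M {y}).trans (le_acl _))
    have hy : y ∈ K ⊓ acl (gen M {y}) :=
      Subfield.mem_inf.mpr ⟨hs y (Finset.mem_insert_self y s), le_acl _ (mem_gen rfl)⟩
    obtain ⟨b, hb, hab⟩ := ih h₁ (hM hπ) (fun z hz => hs z (Finset.mem_insert_of_mem hz))
      fun i => acl_mono (gen_le (hM.trans (le_gen _ _)) (by
        rw [Finset.coe_insert]
        exact Set.insert_subset (le_gen _ _ hy) fun z hz => mem_gen hz)) (ha i)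
    obtain ⟨c, hbc, -⟩ := h.exists_specOver (h.hasGenerics_unitBall hπ hπ1) h.vHens_unitBall y b
      (fun i => (Subfield.mem_inf.mp (hb i)).1)
      fun i => isAlgebraic_adjoin (Subfield.mem_inf.mp (hb i)).2
    refine ⟨fun i => c i, fun i => (c i).2, (hab.restrict hM).trans (hbc.trans ?_)⟩
    exact SpecOver.of_map (AlgHom.id M M) (a' := c) (fun i => rfl) fun P hP => by
      have h2 := MvPolynomial.aeval_algebraMap_apply C c P
      rw [hP, map_zero] at h2
      exact h2

/-- A field with an ultrametric norm and a perfect residue section `k` specialises over `k` into any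
henselian valued extension of `k`. -/
theorem exists_specOver_of_one_lt_norm {F : Type u} [NontriviallyNormedField F]
    [IsUltrametricDist F] (p : ℕ) [ExpChar F p] {k : Subfield F} (hk : IsResidueSection k)
    (hperf : ∀ x ∈ k, ∃ y ∈ k, y ^ p = x) {L : Type*} [Field L] [Algebra k L]
    {O : ValuationSubring L} (hO : O ≠ ⊤) (hH : VHens O)
    {ι : Type*} [Finite ι] (a : ι → F) {i₀ : ι} (ha : 1 < ‖a i₀‖) :
    ∃ b : ι → L, SpecOver k a b ∧ b i₀ ∉ O := by
  classical
  have := Fintype.ofFinite ι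
  obtain ⟨C, _, _, _, _, f, κ, K, Ω, hf, h, hfK, hinf⟩ := exists_isSplitting p hk hperf
  have : ExpChar C p := expChar_of_injective_ringHom f.injective p
  let e₀ : k →+* (K ⊓ κ : Subfield C) := (f.comp k.subtype).codRestrict _ fun x => by
    rw [hinf]
    exact Subfield.mem_map.mpr ⟨x, x.2, rfl⟩
  let e : k ≃+* (K ⊓ κ : Subfield C) := RingEquiv.ofBijective e₀ ⟨e₀.injective, fun y => by
    obtain ⟨x, hx, hxy⟩ := Subfield.mem_map.mp (hinf.le y.2)
    exact ⟨⟨x, hx⟩, Subtype.ext hxy⟩⟩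
  let _ : Algebra (K ⊓ κ : Subfield C) L := ((algebraMap k L).comp e.symm.toRingHom).toAlgebra
  have hst := h.isStage
  let x := f (a i₀)
  have hxK : x ∈ K := hfK _
  have hx : 1 < ‖x‖ := (hf _).symm ▸ ha
  have hst₁ := hst.extend (le_gen (K ⊓ κ) {x})
  have hxM : x ∈ K ⊓ acl (gen (K ⊓ κ) {x}) :=
    Subfield.mem_inf.mpr ⟨hxK, le_acl _ (mem_gen rfl)⟩
  have hM : K ⊓ κ ≤ K ⊓ acl (gen (K ⊓ κ) {x}) :=
    le_inf inf_le_left ((le_gen (K ⊓ κ) {x}).trans (le_acl _))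
  obtain ⟨b, hb, hab⟩ := hst₁.exists_specOver_self hxM hx (univ.image fun i => f (a i))
    (fun y hy => by
      obtain ⟨i, -, rfl⟩ := mem_image.mp hy
      exact hfK _) (fun i => f (a i)) (fun i => hfK _)
    fun i => le_acl _ (mem_gen (mem_image_of_mem _ (mem_univ i)))
  have hbx : b i₀ = x := hab.apply_eq (c := ⟨x, hxM⟩) rfl
  obtain ⟨c, hbc, hc⟩ := hst.exists_specOver (h.hasGenerics hO) hH x b
    (fun i => (Subfield.mem_inf.mp (hb i)).1)
    fun i => isAlgebraic_adjoin (Subfield.mem_inf.mp (hb i)).2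
  refine ⟨c, fun P hP => ?_, hc i₀ (by rw [hbx]; exact hx)⟩
  have h1 : MvPolynomial.aeval (fun i => f (a i)) (P.map e.toRingHom) = 0 := by
    have h2 := congr_arg f hP
    rw [map_zero, MvPolynomial.aeval_def, MvPolynomial.hom_eval₂] at h2
    rw [MvPolynomial.aeval_def, MvPolynomial.eval₂_map]
    exact h2
  have h3 := ((hab.restrict hM).trans hbc) _ h1
  rw [MvPolynomial.aeval_def, MvPolynomial.eval₂_map] at h3
  rw [MvPolynomial.aeval_def, ← h3]
  congr 1
  ext y
  change _ = algebraMap k L (e.symm (e y))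
  rw [e.symm_apply_apply]

end

section

variable {K : Type*} [Field K] {O O' : ValuationSubring K}

theorem valuation_lt_one_iff {x : K} : O.valuation x < 1 ↔ x = 0 ∨ x⁻¹ ∉ O := by
  rcases eq_or_ne x 0 with rfl | hx
  · simp
  · have h : O.valuation x ≠ 0 := (Valuation.ne_zero_iff _).mpr hx
    rw [← O.valuation_le_one_iff, map_inv₀, inv_le_one₀ (zero_lt_iff.mpr h), not_le]
    simp [hx]

theorem valuation_lt_one_of_le (h : O ≤ O') {x : K} (hx : O'.valuation x < 1) :
    O.valuation x < 1 := by
  rw [valuation_lt_one_iff] at hx ⊢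
  exact hx.imp_right fun h1 h2 => h1 (h h2)

theorem mem_of_valuation_lt_one {x : K} (hx : O.valuation x < 1) : x ∈ O :=
  (O.valuation_le_one_iff x).mp hx.le

theorem valuation_eq_one_iff {x : K} : O.valuation x = 1 ↔ x ∈ O ∧ ¬ O.valuation x < 1 := by
  rw [← O.valuation_le_one_iff, not_lt]
  exact le_antisymm_iff

theorem valuation_lt_iff {x y : K} (hy : y ≠ 0) :
    O.valuation x < O.valuation y ↔ O.valuation (x / y) < 1 := by
  rw [map_div₀, div_lt_one₀ (zero_lt_iff.mpr ((Valuation.ne_zero_iff _).mpr hy))]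

theorem VHens.of_le (hO : VHens O) (h : O ≤ O') : VHens O' := by
  intro f hf h0 h1
  have hc1 : f.coeff 1 ≠ 0 := fun h => by
    rw [h, map_zero] at h1
    exact zero_ne_one h1
  obtain ⟨e, he, hr⟩ := hO.exists_root hc1 fun i hi => by
    rw [valuation_lt_iff (pow_ne_zero i hc1)]
    refine valuation_lt_one_of_le h ?_
    rw [map_div₀, map_mul, map_pow, map_pow, h1, one_pow, div_one]
    exact (mul_le_of_le_one_right' ((O'.valuation_le_one_iff _).mpr (hf i))).trans_lt
      (pow_lt_one₀ zero_le h0 (by omega))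
  refine ⟨_, ?_, hr⟩
  rw [map_mul, Valuation.map_neg, map_div₀, h1, div_one]
  exact (mul_le_of_le_one_right' ((O'.valuation_le_one_iff _).mpr
    (h (add_mem O.one_mem (mem_of_valuation_lt_one he))))).trans_lt h0

theorem valuation_comap_lt_one {F : Type*} [Field F] (i : F →+* K) {x : F} :
    (O.comap i).valuation x < 1 ↔ O.valuation (i x) < 1 := by
  rw [valuation_lt_one_iff, valuation_lt_one_iff, map_eq_zero, ValuationSubring.mem_comap, map_inv₀]

theorem valuation_comap_eq_one {F : Type*} [Field F] (i : F →+* K) {x : F} :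
    (O.comap i).valuation x = 1 ↔ O.valuation (i x) = 1 := by
  rw [valuation_eq_one_iff, valuation_eq_one_iff, valuation_comap_lt_one,
    ValuationSubring.mem_comap]

theorem VHens.comap (hO : VHens O) {F : Type*} [Field F] [Algebra F K]
    (h : ∀ x : K, IsAlgebraic F x → x ∈ (algebraMap F K).range) :
    VHens (O.comap (algebraMap F K)) := by
  intro f hf h0 h1
  rw [valuation_comap_lt_one] at h0
  rw [valuation_comap_eq_one] at h1
  obtain ⟨b, hb, hr⟩ := hO (f.map (algebraMap F K)) (fun n => by rw [coeff_map]; exact hf n)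
    (by rwa [coeff_map]) (by rwa [coeff_map])
  have hf0 : f ≠ 0 := by
    rintro rfl
    rw [coeff_zero, map_zero, map_zero] at h1
    exact zero_ne_one h1
  obtain ⟨c, rfl⟩ := h b ⟨f, hf0, by rwa [aeval_def, ← eval_map]⟩
  refine ⟨c, (valuation_comap_lt_one _).mpr hb, (algebraMap F K).injective ?_⟩
  rwa [map_zero, ← eval_map_apply]

theorem eval_mem {f : K[X]} (hf : ∀ n, f.coeff n ∈ O) {a : K} (ha : a ∈ O) : f.eval a ∈ O := by
  rw [eval_eq_sum_range]
  exact sum_mem fun i _ => mul_mem (hf i) (pow_mem ha i)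

theorem taylor_coeff_mem {f : K[X]} (hf : ∀ n, f.coeff n ∈ O) {a : K} (ha : a ∈ O) (n : ℕ) :
    (taylor a f).coeff n ∈ O := by
  rw [taylor_coeff]
  refine eval_mem (fun m => ?_) ha
  rw [hasseDeriv_coeff]
  exact mul_mem (natCast_mem O _) (hf _)

theorem VHens.exists_root_sub (hO : VHens O) {f : K[X]} (hf : ∀ n, f.coeff n ∈ O) {a : K}
    (ha : a ∈ O) (h0 : O.valuation (f.eval a) < 1) (h1 : O.valuation ((derivative f).eval a) = 1) :
    ∃ b, O.valuation (b - a) < 1 ∧ f.eval b = 0 := by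
  obtain ⟨b, hb, hr⟩ := hO (taylor a f) (taylor_coeff_mem hf ha) (by rwa [taylor_coeff_zero])
    (by rwa [taylor_coeff_one])
  exact ⟨b + a, by rwa [add_sub_cancel_right], by rwa [taylor_eval] at hr⟩

theorem mem_of_isIntegral_subring {A : Subring K} (hA : A ≤ O.toSubring) {x : K}
    (hx : IsIntegral A x) : x ∈ O := by
  let j : A →+* O := Subring.inclusion hA
  obtain ⟨f, hf, hfx⟩ := hx
  have h1 : IsIntegral O x := ⟨f.map j, hf.map j, by rw [eval₂_map]; exact hfx⟩
  obtain ⟨y, rfl⟩ := IsIntegrallyClosed.isIntegral_iff.mp h1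
  exact y.2

/-- Monic polynomials with simple residual roots have roots. -/
def SHens (O : ValuationSubring K) : Prop :=
  ∀ f : K[X], f.Monic → (∀ n, f.coeff n ∈ O) → ∀ a ∈ O, O.valuation (f.eval a) < 1 →
    O.valuation ((derivative f).eval a) = 1 → ∃ b, O.valuation (b - a) < 1 ∧ f.eval b = 0

theorem SHens.vHens (hO : SHens O) : VHens O := by
  intro f hf h0 h1
  have hdeg : 1 ≤ f.natDegree := le_natDegree_of_ne_zero fun h => by
    rw [h, map_zero] at h1
    exact zero_ne_one h1
  obtain ⟨m, hm⟩ := Nat.exists_eq_add_of_le' hdeg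
  let h : K[X] := ∑ i ∈ range m, monomial (m - 1 - i) (f.coeff (i + 2) * f.coeff 0 ^ i)
  have hhO : ∀ n, h.coeff n ∈ O := fun n => by
    rw [finsetSum_coeff]
    refine sum_mem fun i _ => ?_
    rw [coeff_monomial]
    split_ifs
    exacts [mul_mem (hf _) (pow_mem (hf 0) _), O.zero_mem]
  have hhdeg : (Polynomial.C (f.coeff 0) * h).degree < (m + 1 : ℕ) := by
    rw [← smul_eq_C_mul]
    refine (degree_smul_le _ _).trans_lt ?_
    refine (degree_sum_le _ _).trans_lt ((sup_lt_iff (WithBot.bot_lt_coe _)).mpr fun i _ => ?_)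
    exact (degree_monomial_le _ _).trans_lt (WithBot.coe_lt_coe.mpr (Nat.lt_succ_of_le
      ((Nat.sub_le _ _).trans (Nat.sub_le _ _))))
  let q : K[X] := X ^ m * (X + Polynomial.C (f.coeff 1))
  have hq : q.Monic := (monic_X_pow m).mul (monic_X_add_C _)
  have hqdeg : q.degree = (m + 1 : ℕ) := by
    rw [degree_eq_natDegree hq.ne_zero, (monic_X_pow m).natDegree_mul (monic_X_add_C _),
      natDegree_X_pow, natDegree_X_add_C]
  have ha : -f.coeff 1 ∈ O := neg_mem (hf 1)
  have hhd : ∀ n, (derivative h).coeff n ∈ O := fun n => by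
    rw [coeff_derivative]
    exact mul_mem (hhO _) (add_mem (natCast_mem O _) O.one_mem)
  have hsmall : ∀ z ∈ O, O.valuation (f.coeff 0 * z) < 1 := fun z hz => by
    rw [map_mul]
    exact (mul_le_of_le_one_right' ((O.valuation_le_one_iff z).mpr hz)).trans_lt h0
  have hpow : O.valuation ((-f.coeff 1) ^ m) = 1 := by rw [map_pow, Valuation.map_neg, h1, one_pow]
  obtain ⟨y, hy, hroot⟩ := hO (q + Polynomial.C (f.coeff 0) * h)
    (hq.add_of_left (hqdeg ▸ hhdeg))
    (fun n => by
      rw [coeff_add, coeff_C_mul]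
      refine add_mem ?_ (mul_mem (hf 0) (hhO n))
      rw [coeff_X_pow_mul']
      split_ifs
      · rw [coeff_add, coeff_X, coeff_C]
        refine add_mem ?_ ?_ <;> split_ifs
        exacts [O.one_mem, O.zero_mem, hf 1, O.zero_mem]
      · exact O.zero_mem) _ ha
    (by
      rw [eval_add, eval_mul, eval_mul, eval_add, eval_X, eval_C, neg_add_cancel, mul_zero, zero_add,
        eval_C]
      exact hsmall _ (eval_mem hhO ha))
    (by
      have h2 : (derivative (q + Polynomial.C (f.coeff 0) * h)).eval (-f.coeff 1) =
          (-f.coeff 1) ^ m + f.coeff 0 * (derivative h).eval (-f.coeff 1) := by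
        simp [q]
      rw [h2, Valuation.map_add_eq_of_lt_left, hpow]
      rw [hpow]
      exact hsmall _ (eval_mem hhd ha))
  rw [sub_neg_eq_add] at hy
  have hy1 : O.valuation y = 1 := by
    have h2 : y = (y + f.coeff 1) - f.coeff 1 := by ring
    rw [h2, Valuation.map_sub_eq_of_lt_right, h1]
    rwa [h1]
  have hy0 : y ≠ 0 := by
    rintro rfl
    rw [map_zero] at hy1
    exact zero_ne_one hy1
  refine ⟨f.coeff 0 / y, by rwa [map_div₀, hy1, div_one], ?_⟩
  have h3 : f.eval (f.coeff 0 / y) * y ^ (m + 1) =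
      f.coeff 0 * (q + Polynomial.C (f.coeff 0) * h).eval y := by
    rw [eval_eq_sum_range, hm, sum_range_succ', sum_range_succ']
    simp only [q, h, eval_add, eval_mul, eval_pow, eval_X, eval_C, eval_finsetSum]
    rw [mul_add, add_mul, add_mul, sum_mul, ← mul_assoc (f.coeff 0) (f.coeff 0),
      mul_sum, add_assoc, add_comm]
    congr 1
    · simp only [zero_add, pow_one, pow_zero]
      field_simp
      ring
    · refine sum_congr rfl fun i hi => ?_
      have hi := mem_range.mp hi
      obtain ⟨l, rfl⟩ : ∃ l, m = l + 1 + i := ⟨m - 1 - i, by omega⟩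
      have hyi := pow_ne_zero (i + 2) hy0
      rw [eval_monomial, show l + 1 + i - 1 - i = l by omega, div_pow,
        show l + 1 + i + 1 = i + 2 + l by omega, pow_add y (i + 2) l]
      generalize y ^ (i + 2) = Y at hyi
      field_simp
      ring
  rw [hroot, mul_zero] at h3
  exact (mul_eq_zero.mp h3).resolve_right (pow_ne_zero _ hy0)

theorem sHens_of_henselianLocalRing (h : HenselianLocalRing O) : SHens O := by
  intro f hf hfO a ha h0 h1
  obtain ⟨g, hgf, -, hg⟩ := lifts_and_natDegree_eq_and_monic
    ((lifts_iff_coeff_lifts (f := O.subtype) f).mpr fun n => ⟨⟨_, hfO n⟩, rfl⟩) hf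
  have hev : ∀ (q : O[X]) (x : O), ((q.eval x : O) : K) = (q.map O.subtype).eval (x : K) :=
    fun q x => by
      rw [eval_map]
      exact hom_eval₂ q (RingHom.id O) O.subtype x
  obtain ⟨b, hb, hba⟩ := h.is_henselian g hg ⟨a, ha⟩
    ((O.valuation_lt_one_iff _).mpr (by rw [hev, hgf]; exact h0))
    (by
      by_contra hu
      have h2 := (O.valuation_lt_one_iff _).mp ((mem_maximalIdeal _).mpr hu)
      rw [hev, ← derivative_map, hgf] at h2
      exact h2.ne h1)
  refine ⟨b, (O.valuation_lt_one_iff _).mp hba, ?_⟩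
  rw [← hgf, ← hev, hb.eq_zero]
  rfl

theorem sHens_of_isAlgClosed [IsAlgClosed K] (O : ValuationSubring K) : SHens O := by
  intro f hf hfO a ha h0 h1
  have hs := IsAlgClosed.splits f
  have hroots : ∀ r ∈ f.roots, r ∈ O := fun r hr =>
    mem_of_isIntegral_subring (le_refl O.toSubring) (by
      obtain ⟨g, hgf, -, hg⟩ := lifts_and_natDegree_eq_and_monic
        ((lifts_iff_coeff_lifts (f := O.toSubring.subtype) f).mpr fun n => ⟨⟨_, hfO n⟩, rfl⟩) hf
      refine ⟨g, hg, ?_⟩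
      have h2 := (mem_roots'.mp hr).2
      rw [← hgf, IsRoot, eval_map] at h2
      exact h2)
  by_contra! hcon
  have h2 : f.eval a = (f.roots.map fun r => a - r).prod := by
    conv_lhs => rw [hs.eq_prod_roots_of_monic hf]
    rw [eval_multiset_prod, Multiset.map_map]
    simp
  have h3 : O.valuation (f.eval a) = 1 := by
    rw [h2, map_multiset_prod, Multiset.map_map]
    refine Multiset.prod_eq_one fun x hx => ?_
    obtain ⟨r, hr, rfl⟩ := Multiset.mem_map.mp hx
    refine valuation_eq_one_iff.mpr ⟨sub_mem ha (hroots r hr), fun h4 => ?_⟩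
    rw [Valuation.map_sub_swap] at h4
    exact hcon r h4 (mem_roots'.mp hr).2
  exact h0.ne h3

end

section

variable {k K : Type*} [Field k] [Field K] [Algebra k K] {O : ValuationSubring K}

/-- `k` maps isomorphically onto the residue field of `O`. -/
structure IsCoef (k : Type*) {K : Type*} [Field k] [Field K] [Algebra k K]
    (O : ValuationSubring K) : Prop where
  mem (c : k) : algebraMap k K c ∈ O
  exists_sub (a : K) (ha : a ∈ O) : ∃ c : k, O.valuation (a - algebraMap k K c) < 1

theorem mem_of_isAlgebraic (h : ∀ c : k, algebraMap k K c ∈ O) {x : K} (hx : IsAlgebraic k x) :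
    x ∈ O := by
  obtain ⟨f, hf, hfx⟩ := hx.isIntegral
  let j : k →+* O := (algebraMap k K).codRestrict O h
  have h1 : IsIntegral O x := ⟨f.map j, hf.map j, by rw [eval₂_map]; exact hfx⟩
  obtain ⟨y, rfl⟩ := IsIntegrallyClosed.isIntegral_iff.mp h1
  exact y.2

theorem eq_zero_of_isAlgebraic (h : ∀ c : k, algebraMap k K c ∈ O) {x : K} (hx : IsAlgebraic k x)
    (hx1 : O.valuation x < 1) : x = 0 :=
  (valuation_lt_one_iff.mp hx1).resolve_right (not_not.mpr (mem_of_isAlgebraic h hx.inv))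

theorem IsCoef.mem_range (h : IsCoef k O) {x : K} (hx : IsAlgebraic k x) :
    x ∈ (algebraMap k K).range := by
  obtain ⟨c, hc⟩ := h.exists_sub x (mem_of_isAlgebraic h.mem hx)
  exact ⟨c, (sub_eq_zero.mp (eq_zero_of_isAlgebraic h.mem (hx.sub (isAlgebraic_algebraMap c)) hc)).symm⟩

theorem IsCoef.perfectRing (h : IsCoef k O) (p : ℕ) [ExpChar k p] [ExpChar K p] [PerfectRing K p] :
    PerfectRing k p := by
  refine PerfectRing.ofSurjective k p fun c => ?_
  obtain ⟨y, hy⟩ := surjective_frobenius K p (algebraMap k K c)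
  have hy : y ^ p = algebraMap k K c := hy
  obtain ⟨d, rfl⟩ := h.mem_range (x := y) (IsAlgebraic.of_pow (expChar_pos K p)
    (by rw [hy]; exact isAlgebraic_algebraMap (A := K) c))
  exact ⟨d, (algebraMap k K).injective (by rw [← hy]; exact map_pow (algebraMap k K) d p)⟩

theorem valuation_algebraMap (h : ∀ c : k, algebraMap k K c ∈ O) {c : k} (hc : c ≠ 0) :
    O.valuation (algebraMap k K c) = 1 := by
  refine valuation_eq_one_iff.mpr ⟨h c, fun h1 => ?_⟩
  rcases valuation_lt_one_iff.mp h1 with h2 | h2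
  · exact hc ((map_eq_zero _).mp h2)
  · exact h2 (by rw [← map_inv₀]; exact h _)

theorem exists_irreducible_of_valuation_lt_one (h : ∀ c : k, algebraMap k K c ∈ O) {a : K}
    (ha : a ∈ O) (f : k[X]) : f ≠ 0 → O.valuation (aeval a f) < 1 →
    ∃ g : k[X], Irreducible g ∧ O.valuation (aeval a g) < 1 := by
  have hmem : ∀ g : k[X], aeval a g ∈ O := fun g => by
    rw [aeval_def, ← eval_map]
    exact eval_mem (fun n => by rw [coeff_map]; exact h _) ha
  refine WfDvdMonoid.induction_on_irreducible f (fun h => absurd rfl h) (fun u hu _ h1 => ?_)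
    fun q i hq hi ih _ h1 => ?_
  · obtain ⟨c, hc, rfl⟩ := isUnit_iff.mp hu
    rw [aeval_C, valuation_algebraMap h hc.ne_zero] at h1
    exact absurd h1 (lt_irrefl _)
  · by_cases h2 : O.valuation (aeval a i) < 1
    · exact ⟨i, hi, h2⟩
    · refine ih hq ?_
      rwa [map_mul, map_mul, valuation_eq_one_iff.mpr ⟨hmem i, h2⟩, one_mul] at h1

/-- A henselian valuation ring of a perfect field containing a subfield `k` has a field of
representatives containing `k`. -/
theorem VHens.exists_isCoef (hO : VHens O) (p : ℕ) [ExpChar K p] [PerfectRing K p]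
    (k₀ : Subfield K) (hk : ∀ x ∈ k₀, x ∈ O) : ∃ M : Subfield K, k₀ ≤ M ∧ IsCoef M O := by
  obtain ⟨M, hkM, hM⟩ := zorn_le_nonempty₀ {M : Subfield K | ∀ x ∈ M, x ∈ O} (fun c hc hchain y hy =>
    ⟨sSup c, fun x hx => by
      obtain ⟨N, hN, hxN⟩ := (Subfield.mem_sSup_of_directedOn ⟨y, hy⟩ hchain.directedOn).mp hx
      exact hc hN x hxN, fun z hz => le_sSup hz⟩) k₀ hk
  have hMO : ∀ c : M, algebraMap M K c ∈ O := fun c => hM.prop c c.2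
  have hmax : ∀ a : K, (∀ y ∈ adjoin M {a}, y ∈ O) → a ∈ M := fun a ha =>
    hM.le_of_ge (y := (adjoin M {a}).toSubfield) ha
      (fun x hx => (adjoin M {a}).algebraMap_mem ⟨x, hx⟩)
      (mem_adjoin_simple_self M a)
  have hcl : ∀ x : K, IsAlgebraic M x → x ∈ M := fun x hx => by
    have := IntermediateField.isAlgebraic_adjoin_simple hx.isIntegral
    refine hmax x fun y hy => mem_of_isAlgebraic hMO ?_
    exact (Algebra.IsAlgebraic.isAlgebraic (R := M) (⟨y, hy⟩ : adjoin M {x})).algebraMap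
      (A := K)
  refine ⟨M, hkM, hMO, fun a ha => ?_⟩
  by_cases hex : ∃ f : M[X], f ≠ 0 ∧ O.valuation (aeval a f) < 1
  · obtain ⟨f, hf, hfa⟩ := hex
    obtain ⟨g, hg, hga⟩ := exists_irreducible_of_valuation_lt_one hMO ha f hf hfa
    have hp : ExpChar M p := (M.subtype.expChar_iff M.subtype.injective p).mpr ‹_›
    have : PerfectRing M p := PerfectRing.ofSurjective M p fun c => by
      obtain ⟨y, hy⟩ := surjective_frobenius K p (c : K)
      have hy : y ^ p = (c : K) := hy
      exact ⟨⟨y, hcl y (IsAlgebraic.of_pow (expChar_pos K p)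
        (by rw [hy]; exact isAlgebraic_algebraMap (A := K) c))⟩, Subtype.ext hy⟩
    have := PerfectRing.toPerfectField M p
    obtain ⟨u, w, huw⟩ := PerfectField.separable_of_irreducible hg
    have hmem : ∀ g : M[X], aeval a g ∈ O := fun g => by
      rw [aeval_def, ← eval_map]
      exact eval_mem (fun n => by rw [coeff_map]; exact hMO _) ha
    have hd : O.valuation (aeval a (derivative g)) = 1 := by
      refine valuation_eq_one_iff.mpr ⟨hmem _, fun h1 => ?_⟩
      have h2 := congrArg (fun f => O.valuation (aeval a f)) huw
      simp only [map_add, map_mul, map_one] at h2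
      refine h2.not_lt (Valuation.map_add_lt _ ?_ ?_) <;> rw [map_mul]
      · exact (mul_le_of_le_one_left' ((O.valuation_le_one_iff _).mpr (hmem u))).trans_lt hga
      · exact (mul_le_of_le_one_left' ((O.valuation_le_one_iff _).mpr (hmem w))).trans_lt h1
    obtain ⟨b, hb, hr⟩ := hO.exists_root_sub (f := g.map (algebraMap M K))
      (fun n => by rw [coeff_map]; exact hMO _) ha (by rwa [eval_map_algebraMap])
      (by rwa [derivative_map, eval_map_algebraMap])
    refine ⟨⟨b, hcl b ⟨g, hg.ne_zero, by rwa [← eval_map_algebraMap]⟩⟩, ?_⟩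
    rw [Valuation.map_sub_swap]
    exact hb
  · push Not at hex
    refine ⟨⟨a, hmax a fun y hy => ?_⟩, ?_⟩
    · obtain ⟨r, s, rfl⟩ := (mem_adjoin_simple_iff M y).mp hy
      rcases eq_or_ne s 0 with rfl | hs
      · rw [map_zero, div_zero]
        exact O.zero_mem
      rw [← O.valuation_le_one_iff, map_div₀]
      have hmem : aeval a r ∈ O := by
        rw [aeval_def, ← eval_map]
        exact eval_mem (fun n => by rw [coeff_map]; exact hMO _) ha
      exact div_le_one_of_le₀ (((O.valuation_le_one_iff _).mpr hmem).trans (hex s hs)) zero_le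
    · change O.valuation (a - a) < 1
      rw [sub_self, map_zero]
      exact zero_lt_one

end

section

variable {K : Type*} [Field K] (O : ValuationSubring K)

/-- The smallest coarsening in which `s` becomes a unit. -/
def above {s : K} (hs : s ∈ O) : ValuationSubring K :=
  ValuationSubring.ofLE O
    { carrier := {a | ∃ n : ℕ, s ^ n * a ∈ O}
      mul_mem' := by
        rintro a b ⟨n, hn⟩ ⟨m, hm⟩
        refine ⟨n + m, ?_⟩
        rw [pow_add, mul_mul_mul_comm]
        exact mul_mem hn hm
      one_mem' := ⟨0, by simp⟩
      add_mem' := by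
        rintro a b ⟨n, hn⟩ ⟨m, hm⟩
        refine ⟨n + m, ?_⟩
        rw [mul_add]
        refine add_mem ?_ ?_
        · rw [pow_add, mul_comm (s ^ n), mul_assoc]
          exact mul_mem (pow_mem hs m) hn
        · rw [pow_add, mul_assoc]
          exact mul_mem (pow_mem hs n) hm
      zero_mem' := ⟨0, by simp⟩
      neg_mem' := by
        rintro a ⟨n, hn⟩
        exact ⟨n, by rw [mul_neg]; exact neg_mem hn⟩ }
    (fun a ha => ⟨0, by simpa using ha⟩)

variable {O}

theorem mem_above {s : K} {hs : s ∈ O} {a : K} : a ∈ above O hs ↔ ∃ n : ℕ, s ^ n * a ∈ O := Iff.rfl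

theorem le_above {s : K} (hs : s ∈ O) : O ≤ above O hs := fun a ha => ⟨0, by simpa using ha⟩

theorem inv_mem_above {s : K} (hs : s ∈ O) : s⁻¹ ∈ above O hs := by
  refine ⟨1, ?_⟩
  rcases eq_or_ne s 0 with rfl | h
  · simp
  · rw [pow_one, mul_inv_cancel₀ h]
    exact O.one_mem

variable (O) in
/-- The largest coarsening in which `s` is not a unit. -/
def below {s : K} (hs : O.valuation s < 1) : ValuationSubring K :=
  ValuationSubring.ofLE O
    { carrier := {a | ∀ n : ℕ, O.valuation (a ^ n * s) < 1}
      mul_mem' := by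
        intro a b ha hb n
        rw [map_mul, map_pow, map_mul]
        rcases le_total (O.valuation a) (O.valuation b) with h | h
        · refine (mul_le_mul_left (pow_le_pow_left' (mul_le_mul_left h _) n) _).trans_lt ?_
          have := hb (2 * n)
          rwa [map_mul, map_pow, pow_mul, sq] at this
        · refine (mul_le_mul_left (pow_le_pow_left' (mul_le_mul_right h _) n) _).trans_lt ?_
          have := ha (2 * n)
          rwa [map_mul, map_pow, pow_mul, sq] at this
      one_mem' := fun n => by simpa using hs
      add_mem' := by
        intro a b ha hb n
        rw [map_mul, map_pow]
        rcases le_max_iff.mp (O.valuation.map_add a b) with h | h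
        · refine (mul_le_mul_left (pow_le_pow_left' h n) _).trans_lt ?_
          simpa using ha n
        · refine (mul_le_mul_left (pow_le_pow_left' h n) _).trans_lt ?_
          simpa using hb n
      zero_mem' := fun n => by
        rw [map_mul, map_pow, map_zero]
        exact (mul_le_of_le_one_left' (pow_le_one₀ zero_le zero_le)).trans_lt hs
      neg_mem' := by
        intro a ha n
        rw [map_mul, map_pow, Valuation.map_neg]
        simpa using ha n }
    (fun a ha n => by
      rw [map_mul, map_pow]
      exact (mul_le_of_le_one_left' (pow_le_one' ((O.valuation_le_one_iff a).mpr ha) n)).trans_lt hs)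

theorem mem_below {s : K} {hs : O.valuation s < 1} {a : K} :
    a ∈ below O hs ↔ ∀ n : ℕ, O.valuation (a ^ n * s) < 1 := Iff.rfl

theorem le_below {s : K} (hs : O.valuation s < 1) : O ≤ below O hs := fun a ha n => by
  rw [map_mul, map_pow]
  exact (mul_le_of_le_one_left' (pow_le_one' ((O.valuation_le_one_iff a).mpr ha) n)).trans_lt hs

theorem inv_notMem_below {s : K} (hs : O.valuation s < 1) (h0 : s ≠ 0) : s⁻¹ ∉ below O hs :=
  fun h => (h 1).ne (by rw [pow_one, inv_mul_cancel₀ h0, map_one])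

theorem exists_valuation_le_pow {s : K} (hs : O.valuation s < 1) (h0 : s ≠ 0) {x y : K}
    (hx : x ∉ below O hs) (hy : y ∈ above O (mem_of_valuation_lt_one hs)) :
    ∃ n : ℕ, O.valuation y ≤ O.valuation x ^ n := by
  rw [mem_below] at hx
  push Not at hx
  obtain ⟨n, hn⟩ := hx
  obtain ⟨m, hm⟩ := hy
  have hv : 0 < O.valuation s := zero_lt_iff.mpr ((Valuation.ne_zero_iff _).mpr h0)
  rw [map_mul, map_pow] at hn
  rw [← O.valuation_le_one_iff, map_mul, map_pow] at hm
  refine ⟨n * m, ?_⟩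
  have h2 : O.valuation s ^ m * O.valuation y ≤ O.valuation s ^ m * O.valuation x ^ (n * m) := by
    refine hm.trans ?_
    rw [pow_mul, ← mul_pow, mul_comm]
    exact one_le_pow₀ hn
  exact le_of_mul_le_mul_left h2 (pow_pos hv m)

end

section

theorem valuation_eval_sub_lt_one {K : Type*} [Field K] {O : ValuationSubring K} {f : K[X]}
    (hf : ∀ n, f.coeff n ∈ O) {b : K} (hb : O.valuation b < 1) :
    O.valuation (f.eval b - f.coeff 0) < 1 := by
  conv_lhs => rw [← divX_mul_X_add f]
  rw [eval_add, eval_mul, eval_X, eval_C, coeff_add, coeff_mul_X_zero, coeff_C_zero, zero_add,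
    add_sub_cancel_right, map_mul]
  refine (mul_le_of_le_one_left' ((O.valuation_le_one_iff _).mpr
    (eval_mem (fun n => ?_) (mem_of_valuation_lt_one hb)))).trans_lt hb
  rw [coeff_divX]
  exact hf _

variable {K : Type*} [Field K] (O : ValuationSubring K)

variable {O} in
theorem residue_eq_zero_iff {x : O} : residue O x = 0 ↔ O.valuation (x : K) < 1 :=
  (IsLocalRing.residue_eq_zero_iff x).trans (O.valuation_lt_one_iff x)

variable
  (O' : ValuationSubring (ResidueField O))

/-- The composite of a valuation ring with a valuation ring of its residue field. -/
def composite : ValuationSubring K :=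
  { (O'.toSubring.comap (residue O)).map O.subtype with
    mem_or_inv_mem' := by
      have key : ∀ x ∈ O, x ∈ (O'.toSubring.comap (residue O)).map O.subtype ∨
          x⁻¹ ∈ (O'.toSubring.comap (residue O)).map O.subtype := fun x hx => by
        by_cases h : x⁻¹ ∈ O
        · rcases eq_or_ne x 0 with rfl | h0
          · exact Or.inl (zero_mem _)
          have h1 : residue O ⟨x⁻¹, h⟩ = (residue O ⟨x, hx⟩)⁻¹ := by
            refine eq_inv_of_mul_eq_one_left ?_
            rw [← map_mul, ← map_one (residue O)]
            exact congrArg _ (Subtype.ext (inv_mul_cancel₀ h0))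
          exact (O'.mem_or_inv_mem (residue O ⟨x, hx⟩)).imp (fun h2 => ⟨⟨x, hx⟩, h2, rfl⟩)
            fun h2 => ⟨⟨x⁻¹, h⟩, by rw [← h1] at h2; exact h2, rfl⟩
        · refine Or.inl ⟨⟨x, hx⟩, ?_, rfl⟩
          have h1 : residue O ⟨x, hx⟩ = 0 := by
            rw [residue_eq_zero_iff]
            exact valuation_lt_one_iff.mpr (Or.inr h)
          change residue O ⟨x, hx⟩ ∈ O'
          rw [h1]
          exact O'.zero_mem
      intro x
      rcases O.mem_or_inv_mem x with h | h
      · exact key x h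
      · have := key x⁻¹ h
        rw [inv_inv] at this
        exact this.symm }

variable {O O'}

theorem mem_composite {x : O} : (x : K) ∈ composite O O' ↔ residue O x ∈ O' := by
  constructor
  · rintro ⟨y, hy, h⟩
    obtain rfl : y = x := Subtype.ext h
    exact hy
  · exact fun h => ⟨x, h, rfl⟩

theorem composite_le : composite O O' ≤ O := by
  rintro _ ⟨y, -, rfl⟩
  exact y.2

theorem valuation_composite_lt_one {x : O} :
    (composite O O').valuation (x : K) < 1 ↔ O'.valuation (residue O x) < 1 := by
  rw [valuation_lt_one_iff, valuation_lt_one_iff]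
  by_cases h : O.valuation (x : K) < 1
  · have h1 : residue O x = 0 := by
      rwa [residue_eq_zero_iff]
    exact ⟨fun _ => Or.inl h1, fun _ => (valuation_lt_one_iff.mp h).imp_right
      fun h2 h3 => h2 (composite_le h3)⟩
  · have h1 := h
    rw [valuation_lt_one_iff, not_or, not_not] at h1
    have h2 : residue O x ≠ 0 := by
      rwa [Ne, residue_eq_zero_iff]
    have h3 : residue O ⟨(x : K)⁻¹, h1.2⟩ = (residue O x)⁻¹ := by
      refine eq_inv_of_mul_eq_one_left ?_
      rw [← map_mul, ← map_one (residue O)]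
      exact congrArg _ (Subtype.ext (inv_mul_cancel₀ h1.1))
    refine or_congr ⟨fun h => absurd h h1.1, fun h => absurd h h2⟩ (not_congr ?_)
    rw [← h3]
    exact mem_composite (x := ⟨(x : K)⁻¹, h1.2⟩)

theorem composite_ne (h : O' ≠ ⊤) : composite O O' ≠ O := fun h1 => h <| by
  refine eq_top_iff.mpr fun x _ => ?_
  obtain ⟨y, rfl⟩ := residue_surjective x
  exact mem_composite.mp (h1.symm.le y.2)

theorem VHens.composite (hO : VHens O) (hO' : VHens O') : VHens (composite O O') := by
  intro f hf h0 h1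
  obtain ⟨g, rfl⟩ := (lifts_iff_coeff_lifts (f := O.subtype) f).mpr
    fun n => ⟨⟨_, composite_le (hf n)⟩, rfl⟩
  simp only [coe_mapRingHom, coeff_map] at hf h0 h1
  obtain ⟨b, hb, hr⟩ := hO' (g.map (residue O)) (fun n => by
      rw [coeff_map]
      exact mem_composite.mp (hf n))
    (by rw [coeff_map]; exact valuation_composite_lt_one.mp h0)
    (by
      rw [coeff_map]
      rw [valuation_eq_one_iff] at h1 ⊢
      exact ⟨mem_composite.mp h1.1, fun h => h1.2 (valuation_composite_lt_one.mpr h)⟩)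
  obtain ⟨b, rfl⟩ := residue_surjective b
  rw [eval_map_apply] at hr
  have hev : ∀ q : O[X], (q.map O.subtype).eval (b : K) = ((q.eval b : O) : K) := fun q =>
    eval_map_apply O.subtype b
  obtain ⟨e, he, her⟩ := hO.exists_root_sub (f := g.map O.subtype) (a := b)
    (fun n => by rw [coeff_map]; exact (g.coeff n).2) b.2
    (by rwa [hev, ← residue_eq_zero_iff])
    (by
      rw [derivative_map, hev, valuation_eq_one_iff, ← residue_eq_zero_iff]
      refine ⟨SetLike.coe_mem _, fun h => ?_⟩
      have h2 := valuation_eval_sub_lt_one (O := O') (f := derivative (g.map (residue O)))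
        (fun n => by
          rw [coeff_derivative, coeff_map]
          exact mul_mem (mem_composite.mp (hf _)) (add_mem (natCast_mem O' _) O'.one_mem)) hb
      rw [derivative_map, eval_map_apply, h, zero_sub, Valuation.map_neg, coeff_map, coeff_derivative,
        Nat.cast_zero, zero_add, zero_add, mul_one] at h2
      exact (valuation_composite_lt_one.mpr h2).ne h1)
  have heO : e ∈ O := by
    have := add_mem (mem_of_valuation_lt_one he) b.2
    rwa [sub_add_cancel] at this
  refine ⟨e, ?_, her⟩
  have hres : residue O ⟨e, heO⟩ = residue O b := by
    rw [← sub_eq_zero, ← map_sub, residue_eq_zero_iff]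
    exact he
  exact (valuation_composite_lt_one (x := ⟨e, heO⟩)).mpr (by rwa [hres])

end

section

variable {K L : Type*} [Field K] [Field L] [Algebra K L] (p : ℕ) [ExpChar L p]

/-- The valuation ring of a purely inseparable extension lying over `O`. -/
def perfection (hL : ∀ x : L, ∃ (n : ℕ) (y : K), algebraMap K L y = x ^ p ^ n)
    (O : ValuationSubring K) : ValuationSubring L where
  carrier := {x | ∃ (n : ℕ) (y : K), y ∈ O ∧ algebraMap K L y = x ^ p ^ n}
  mul_mem' := by
    rintro a b ⟨n, y, hy, hyn⟩ ⟨m, z, hz, hzm⟩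
    refine ⟨n + m, y ^ p ^ m * z ^ p ^ n, mul_mem (pow_mem hy _) (pow_mem hz _), ?_⟩
    rw [map_mul, map_pow, map_pow, hyn, hzm]
    ring
  one_mem' := ⟨0, 1, O.one_mem, by simp⟩
  add_mem' := by
    rintro a b ⟨n, y, hy, hyn⟩ ⟨m, z, hz, hzm⟩
    refine ⟨n + m, y ^ p ^ m + z ^ p ^ n, add_mem (pow_mem hy _) (pow_mem hz _), ?_⟩
    rw [map_add, map_pow, map_pow, hyn, hzm, add_pow_expChar_pow]
    ring
  zero_mem' := ⟨0, 0, O.zero_mem, by simp⟩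
  neg_mem' := by
    rintro a ⟨n, y, hy, hyn⟩
    refine ⟨n, (-1) ^ p ^ n * y, mul_mem (pow_mem (neg_mem O.one_mem) _) hy, ?_⟩
    rw [map_mul, hyn, neg_pow a]
    simp
  mem_or_inv_mem' := fun x => by
    obtain ⟨n, y, hy⟩ := hL x
    refine (O.mem_or_inv_mem y).imp (fun h => ⟨n, y, h, hy⟩) fun h => ⟨n, y⁻¹, h, ?_⟩
    rw [map_inv₀, hy, inv_pow]

variable {p} {hL : ∀ x : L, ∃ (n : ℕ) (y : K), algebraMap K L y = x ^ p ^ n}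
  {O : ValuationSubring K}

theorem mem_valuationSubring_of_pow_mem {x : K} {n : ℕ} (hn : n ≠ 0) (h : x ^ n ∈ O) : x ∈ O := by
  rw [← O.valuation_le_one_iff] at h ⊢
  rw [map_pow] at h
  exact (pow_le_one_iff hn).mp h

theorem mem_perfection_iff {x : L} {y : K} {n : ℕ} (h : algebraMap K L y = x ^ p ^ n) :
    x ∈ perfection p hL O ↔ y ∈ O := by
  refine ⟨?_, fun hy => ⟨n, y, hy, h⟩⟩
  rintro ⟨m, z, hz, hzm⟩
  refine mem_valuationSubring_of_pow_mem (n := p ^ m) (pow_pos (expChar_pos L p) m).ne' ?_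
  have : y ^ p ^ m = z ^ p ^ n := (algebraMap K L).injective <| by
    rw [map_pow, map_pow, h, hzm]
    ring
  rw [this]
  exact pow_mem hz _

theorem algebraMap_mem_perfection {y : K} : algebraMap K L y ∈ perfection p hL O ↔ y ∈ O :=
  mem_perfection_iff (n := 0) (by simp)

theorem valuation_perfection_lt_one {x : L} {y : K} {n : ℕ} (h : algebraMap K L y = x ^ p ^ n) :
    (perfection p hL O).valuation x < 1 ↔ O.valuation y < 1 := by
  rw [valuation_lt_one_iff, valuation_lt_one_iff, mem_perfection_iff (n := n) (y := y⁻¹)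
    (by rw [map_inv₀, h, inv_pow])]
  refine or_congr_left ?_
  rw [← map_eq_zero (algebraMap K L), h, pow_eq_zero_iff (pow_pos (expChar_pos L p) n).ne']

theorem VHens.perfection (hO : VHens O) [PerfectRing L p] : VHens (perfection p hL O) := by
  intro f hf h0 h1
  have hL1 := hL
  choose N y hy using hL1
  let n := ∑ i ∈ f.support, N (f.coeff i)
  let c : ℕ → K := fun i => y (f.coeff i) ^ p ^ (n - N (f.coeff i))
  have hc : ∀ i ∈ f.support, algebraMap K L (c i) = f.coeff i ^ p ^ n := fun i hi => by
    have hle : N (f.coeff i) ≤ n := Finset.single_le_sum (f := fun i => N (f.coeff i))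
      (fun _ _ => Nat.zero_le _) hi
    rw [map_pow, hy, ← pow_mul, ← pow_add, Nat.add_sub_cancel' hle]
  let g : K[X] := ∑ i ∈ f.support, monomial i (c i)
  have hg : g.map (algebraMap K L) = f.map (iterateFrobenius L p n) := by
    conv_rhs => rw [f.as_sum_support]
    rw [Polynomial.map_sum, Polynomial.map_sum]
    refine sum_congr rfl fun i hi => ?_
    rw [map_monomial, map_monomial, hc i hi, iterateFrobenius_def]
  have hgc : ∀ i, algebraMap K L (g.coeff i) = f.coeff i ^ p ^ n := fun i => by
    rw [← coeff_map, hg, coeff_map, iterateFrobenius_def]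
  obtain ⟨b, hb, hr⟩ := hO g (fun i => (mem_perfection_iff (hgc i)).mp (hf i))
    ((valuation_perfection_lt_one (hgc 0)).mp h0) (by
      rw [valuation_eq_one_iff] at h1 ⊢
      exact ⟨(mem_perfection_iff (hgc 1)).mp h1.1,
        fun h => h1.2 ((valuation_perfection_lt_one (hgc 1)).mpr h)⟩)
  obtain ⟨d, hd⟩ := (bijective_iterateFrobenius L p n).2 (algebraMap K L b)
  refine ⟨d, (valuation_perfection_lt_one (n := n)
    (by rw [← hd, iterateFrobenius_def])).mpr hb, ?_⟩
  refine (iterateFrobenius L p n).injective ?_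
  rw [map_zero, ← eval_map_apply, hd, ← hg, eval_map_apply, hr, map_zero]

end

section

theorem exists_specOver_of_archimedean {F : Type u} [Field F] (p : ℕ) [ExpChar F p] {k : Subfield F}
    {U : ValuationSubring F} (hk : IsCoef k U) (hperf : ∀ x ∈ k, ∃ y ∈ k, y ^ p = x)
    (harch : ∀ x y : F, x ∉ U → ∃ n : ℕ, U.valuation y ≤ U.valuation x ^ n)
    {L : Type*} [Field L] [Algebra k L] {O : ValuationSubring L} (hO : O ≠ ⊤) (hH : VHens O)
    {ι : Type*} [Finite ι] (a : ι → F) {i₀ : ι} (ha : a i₀ ∉ U) :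
    ∃ b : ι → L, SpecOver k a b ∧ b i₀ ∉ O := by
  have h1 : MulArchimedean U.ValueGroup := ⟨fun γ δ hδ => by
    obtain ⟨x, rfl⟩ := U.valuation_surjective δ
    obtain ⟨y, rfl⟩ := U.valuation_surjective γ
    exact harch x y fun h => hδ.not_ge ((U.valuation_le_one_iff x).mpr h)⟩
  have ha1 : 1 < U.valuation (a i₀) := not_le.mp fun h => ha ((U.valuation_le_one_iff _).mp h)
  have h2 : U.valuation.IsNontrivial := ⟨a i₀, (zero_lt_one.trans ha1).ne', ha1.ne'⟩
  have h3 : MulArchimedean (MonoidWithZeroHom.ValueGroup₀ (.ofClass U.valuation)) :=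
    MulArchimedean.comap MonoidWithZeroHom.ValueGroup₀.embedding.toMonoidHom
      MonoidWithZeroHom.ValueGroup₀.embedding_strictMono
  obtain ⟨hr⟩ := Valuation.nonempty_rankOne_iff_mulArchimedean.mpr h3
  let _ : Valued F U.ValueGroup := Valued.mk' U.valuation
  let _ : Valuation.RankOne (Valued.v (R := F) (Γ₀ := U.ValueGroup)) := hr
  let _ : NontriviallyNormedField F := Valued.toNontriviallyNormedField F U.ValueGroup
  have : IsUltrametricDist F := Valued.instIsUltrametricDist F U.ValueGroup
  have hle : ∀ x : F, ‖x‖ ≤ 1 ↔ U.valuation x ≤ 1 := fun x =>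
    Valued.toNormedField.norm_le_one_iff (Γ₀ := U.ValueGroup)
  have hlt : ∀ x : F, ‖x‖ < 1 ↔ U.valuation x < 1 := fun x =>
    Valued.toNormedField.norm_lt_one_iff (Γ₀ := U.ValueGroup)
  have hk' : IsResidueSection k := by
    refine ⟨fun c hc hc0 => ?_, fun x hx => ?_⟩
    · have h4 : U.valuation c = 1 :=
        valuation_algebraMap hk.mem (c := ⟨c, hc⟩) fun h => hc0 (congrArg Subtype.val h)
      exact le_antisymm ((hle c).mpr h4.le) (not_lt.mp fun h => ((hlt c).mp h).ne h4)
    · obtain ⟨c, hc⟩ := hk.exists_sub x ((U.valuation_le_one_iff x).mp ((hle x).mp hx))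
      exact ⟨c, c.2, (hlt _).mpr hc⟩
  exact exists_specOver_of_one_lt_norm p hk' hperf hO hH a
    (not_le.mp fun h => ha1.not_ge ((hle _).mp h))

end

section

variable {k K : Type*} [Field k] [Field K] [Algebra k K] {O : ValuationSubring K}

theorem inv_aeval_mem_above (h : ∀ c : k, algebraMap k K c ∈ O) {s : K} (hs : O.valuation s < 1)
    {q : k[X]} (hq : q ≠ 0) : (aeval s q)⁻¹ ∈ above O (mem_of_valuation_lt_one hs) := by
  obtain ⟨r, hr, hdvd⟩ := exists_eq_pow_rootMultiplicity_mul_and_not_dvd q hq 0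
  rw [hr, map_mul, mul_inv, map_pow, map_zero, sub_zero, aeval_X, ← inv_pow]
  refine mul_mem (pow_mem (inv_mem_above _) _) (le_above _ ?_)
  have h1 : r.coeff 0 ≠ 0 := by
    rwa [dvd_iff_isRoot, IsRoot, ← coeff_zero_eq_eval_zero] at hdvd
  have h2 := valuation_eval_sub_lt_one (f := r.map (algebraMap k K))
    (fun n => by rw [coeff_map]; exact h _) hs
  rw [coeff_map, eval_map_algebraMap] at h2
  have h3 := valuation_algebraMap h h1
  rw [← O.valuation_le_one_iff, map_inv₀, ← sub_add_cancel (aeval s r) (algebraMap k K (r.coeff 0)),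
    Valuation.map_add_eq_of_lt_right _ (by rwa [h3]), h3, inv_one]

theorem mem_above_of_mem_adjoin (h : ∀ c : k, algebraMap k K c ∈ O) {s : K}
    (hs : O.valuation s < 1) {y : K} (hy : y ∈ adjoin k {s}) :
    y ∈ above O (mem_of_valuation_lt_one hs) := by
  obtain ⟨r, q, rfl⟩ := (mem_adjoin_simple_iff k y).mp hy
  rcases eq_or_ne q 0 with rfl | hq
  · rw [map_zero, div_zero]
    exact zero_mem _
  · rw [div_eq_mul_inv]
    refine mul_mem (le_above _ ?_) (inv_aeval_mem_above h hs hq)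
    rw [← eval_map_algebraMap]
    exact eval_mem (fun n => by rw [coeff_map]; exact h _) (mem_of_valuation_lt_one hs)

theorem exists_specOver_of_isCoef {F : Type u} [Field F] (p : ℕ) [ExpChar F p] [PerfectRing F p]
    {O : ValuationSubring F} {s : F} (hs : O.valuation s < 1) (h0 : s ≠ 0) {N : Subfield F}
    (hN : IsCoef N (above O (mem_of_valuation_lt_one hs))) {M : Subfield N}
    (hM : IsCoef M ((below O hs).comap (algebraMap N F))) {L : Type*} [Field L] [Algebra M L]
    {U : ValuationSubring L} (hU : U ≠ ⊤) (hH : VHens U) {ι : Type*} [Finite ι] (a : ι → N) {i₀ : ι}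
    (ha : (a i₀ : F) ∉ below O hs) : ∃ b : ι → L, SpecOver M a b ∧ b i₀ ∉ U := by
  have : ExpChar N p := (N.subtype.expChar_iff N.subtype.injective p).mpr ‹_›
  have : ExpChar M p := (M.subtype.expChar_iff M.subtype.injective p).mpr ‹_›
  have : PerfectRing N p := hN.perfectRing p
  have : PerfectRing M p := hM.perfectRing p
  refine exists_specOver_of_archimedean p hM (fun x hx => ?_) (fun x y hx => ?_) hU hH a ha
  · obtain ⟨y, hy⟩ := surjective_frobenius M p ⟨x, hx⟩
    exact ⟨y, y.2, congrArg Subtype.val hy⟩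
  · obtain ⟨n, hn⟩ := exists_valuation_le_pow hs h0 hx (hN.mem y)
    have hx0 : x ≠ 0 := fun h => hx (h ▸ zero_mem _)
    refine ⟨n, ?_⟩
    rw [← map_pow, ← div_le_one₀ (zero_lt_iff.mpr ((Valuation.ne_zero_iff _).mpr (pow_ne_zero n hx0))),
      ← map_div₀, ValuationSubring.valuation_le_one_iff]
    refine le_below hs ?_
    rw [← O.valuation_le_one_iff, map_div₀, map_pow, map_div₀, map_pow]
    refine div_le_one_of_le₀ hn zero_le

/-- Every finite family of elements of `K` specializes over `k` into `k`. -/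
def SpecializesTo (k K : Type*) [Field k] [Field K] [Algebra k K] : Prop :=
  ∀ (ι : Type) [Finite ι] (a : ι → K), ∃ b : ι → k, SpecOver k a b

theorem SpecOver.restrictScalars {k M K L ι : Type*} [Field k] [Field M] [Field K] [Field L]
    [Algebra k M] [Algebra k K] [Algebra M K] [IsScalarTower k M K] [Algebra k L] [Algebra M L]
    [IsScalarTower k M L] {a : ι → K} {b : ι → L} (h : SpecOver M a b) : SpecOver k a b :=
  fun P hP => by
  have h1 := h (P.map (algebraMap k M))
  rw [MvPolynomial.aeval_map_algebraMap, MvPolynomial.aeval_map_algebraMap] at h1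
  exact h1 hP

theorem IsCoef.comap (h : IsCoef k O) {F : Type*} [Field F] [Algebra k F] [Algebra F K]
    [IsScalarTower k F K] : IsCoef k (O.comap (algebraMap F K)) := by
  refine ⟨fun c => ?_, fun a ha => ?_⟩
  · rw [ValuationSubring.mem_comap, ← IsScalarTower.algebraMap_apply]
    exact h.mem c
  · obtain ⟨c, hc⟩ := h.exists_sub _ ha
    refine ⟨c, ?_⟩
    rwa [valuation_comap_lt_one, map_sub, ← IsScalarTower.algebraMap_apply]

theorem IsCoef.surjective_of_eq_top (h : IsCoef k O) (hO : O = ⊤) :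
    Function.Surjective (algebraMap k K) := fun x => by
  obtain ⟨c, hc⟩ := h.exists_sub x (hO ▸ trivial)
  refine ⟨c, (sub_eq_zero.mp ((valuation_lt_one_iff.mp hc).resolve_right fun h => h ?_)).symm⟩
  rw [hO]
  trivial

theorem exists_ne_zero_valuation_lt_one (hO : O ≠ ⊤) : ∃ s : K, s ≠ 0 ∧ O.valuation s < 1 := by
  obtain ⟨x, hx⟩ : ∃ x, x ∉ O := by
    by_contra! h
    exact hO (eq_top_iff.mpr fun x _ => h x)
  have hx0 : x ≠ 0 := fun h => hx (h ▸ O.zero_mem)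
  exact ⟨x⁻¹, inv_ne_zero hx0, valuation_lt_one_iff.mpr (Or.inr (by rwa [inv_inv]))⟩

theorem SpecializesTo.of_surjective (h : Function.Surjective (algebraMap k K)) :
    SpecializesTo k K := fun ι _ a => by
  choose b hb using fun i => h (a i)
  refine ⟨b, fun P hP => (algebraMap k K).injective ?_⟩
  obtain rfl : (fun i => algebraMap k K (b i)) = a := funext hb
  rw [map_zero, ← hP]
  exact (MvPolynomial.aeval_algebraMap_apply K b P).symm

open Cardinal in
theorem trdeg_le_of_transcendental {n : ℕ} {M L : Type u} {k : Type u} [Field k] [Field M] [Field L]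
    [Algebra k M] [Algebra k L] [Algebra M L] [IsScalarTower k M L]
    (h : Algebra.trdeg k L ≤ (n + 1 : ℕ)) :
    ((∃ x : M, ¬ IsAlgebraic k x) → Algebra.trdeg M L ≤ n) ∧
    ((∃ x : L, ¬ IsAlgebraic M x) → Algebra.trdeg k M ≤ n) := by
  rw [← trdeg_add_eq k M] at h
  obtain ⟨i, hi⟩ := Cardinal.lt_aleph0.mp ((self_le_add_right _ _).trans_lt
    (h.trans_lt (natCast_lt_aleph0)))
  obtain ⟨j, hj⟩ := Cardinal.lt_aleph0.mp ((self_le_add_left _ _).trans_lt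
    (h.trans_lt (natCast_lt_aleph0)))
  rw [hi, hj] at h ⊢
  norm_cast at h ⊢
  constructor
  · rintro ⟨x, hx⟩
    have : i ≠ 0 := fun h0 => by
      rw [h0, Nat.cast_zero, trdeg_eq_zero_iff] at hi
      exact hx (hi.isAlgebraic x)
    omega
  · rintro ⟨x, hx⟩
    have : j ≠ 0 := fun h0 => by
      rw [h0, Nat.cast_zero, trdeg_eq_zero_iff] at hj
      exact hx (hj.isAlgebraic x)
    omega

end

/-- The field `k` carries a nontrivial henselian valuation. -/
def Large (k : Type*) [Field k] : Prop := ∃ B : ValuationSubring k, B ≠ ⊤ ∧ VHens B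

theorem comap_ne_top {F K : Type*} [Field F] [Field K] [Algebra F K] {O : ValuationSubring K}
    {x : F} (hx : algebraMap F K x ∉ O) : O.comap (algebraMap F K) ≠ ⊤ := fun h =>
  hx (show x ∈ O.comap (algebraMap F K) from h ▸ trivial)

theorem Large.of_surjective {k M : Type*} [Field k] [Field M] (hk : Large k) (f : k →+* M)
    (hf : Function.Surjective f) : Large M := by
  obtain ⟨B, hB, hV⟩ := hk
  let e : k ≃+* M := RingEquiv.ofBijective f ⟨f.injective, hf⟩
  let _ : Algebra M k := e.symm.toRingHom.toAlgebra
  have he : ∀ x : k, algebraMap M k (e x) = x := e.symm_apply_apply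
  obtain ⟨x, hx⟩ : ∃ x, x ∉ B := by
    by_contra! h
    exact hB (eq_top_iff.mpr fun x _ => h x)
  exact ⟨B.comap (algebraMap M k), comap_ne_top (x := e x) (by rwa [he]),
    hV.comap fun x _ => ⟨e x, he x⟩⟩

theorem VHens.comap_of_isCoef {k K : Type*} [Field k] [Field K] [Algebra k K]
    {O O' : ValuationSubring K} (hO : VHens O) (h : IsCoef k O') :
    VHens (O.comap (algebraMap k K)) := hO.comap fun _ hx => h.mem_range hx

theorem specializesTo_of_trdeg_le (p n : ℕ) : ∀ {k K : Type u} [Field k] [Field K] [Algebra k K]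
    [ExpChar K p] [PerfectRing K p] {O : ValuationSubring K}, VHens O → IsCoef k O → Large k →
    Algebra.trdeg k K ≤ n → SpecializesTo k K := by
  induction n with
  | zero =>
    intro k K _ _ _ _ _ O hO hk _ htr
    have h := trdeg_eq_zero_iff.mp (nonpos_iff_eq_zero.mp (by simpa using htr))
    exact .of_surjective fun x => hk.mem_range (h.isAlgebraic x)
  | succ n ih =>
    intro k K _ _ _ _ _ O hO hk hL htr
    by_cases hO' : O = ⊤
    · exact .of_surjective (hk.surjective_of_eq_top hO')
    obtain ⟨s, h0, hs⟩ := exists_ne_zero_valuation_lt_one hO'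
    obtain ⟨N, hkN, hN⟩ := (hO.of_le (le_above (mem_of_valuation_lt_one hs))).exists_isCoef p
      (adjoin k {s}).toSubfield fun x hx => mem_above_of_mem_adjoin hk.mem hs hx
    have hsN : s ∈ N := hkN (mem_adjoin_simple_self k s)
    have : ExpChar N p := (N.subtype.expChar_iff N.subtype.injective p).mpr ‹_›
    have : PerfectRing N p := hN.perfectRing p
    let _ : Algebra k N := ((algebraMap k K).codRestrict N fun c =>
      hkN ((adjoin k {s}).algebraMap_mem c)).toAlgebra
    have : IsScalarTower k N K := .of_algebraMap_eq fun _ => rfl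
    have hON : VHens (O.comap (algebraMap N K)) := hO.comap_of_isCoef hN
    have hkN' : IsCoef k (O.comap (algebraMap N K)) := hk.comap
    obtain ⟨M, hkM, hM⟩ := ((hO.of_le (le_below hs)).comap_of_isCoef hN).exists_isCoef p
      (algebraMap k N).fieldRange (by
        rintro _ ⟨c, rfl⟩
        exact le_below hs (hk.mem c))
    have : ExpChar M p := (M.subtype.expChar_iff M.subtype.injective p).mpr ‹_›
    have : PerfectRing M p := hM.perfectRing p
    let _ : Algebra k M := ((algebraMap k N).codRestrict M fun c => hkM ⟨c, rfl⟩).toAlgebra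
    have : IsScalarTower k M N := .of_algebraMap_eq fun _ => rfl
    have hOM : VHens ((O.comap (algebraMap N K)).comap (algebraMap M N)) := hON.comap_of_isCoef hM
    have hkM' : IsCoef k ((O.comap (algebraMap N K)).comap (algebraMap M N)) := hkN'.comap
    have hLM : Large M := by
      by_cases h : (O.comap (algebraMap N K)).comap (algebraMap M N) = ⊤
      · exact hL.of_surjective _ (hkM'.surjective_of_eq_top h)
      · exact ⟨_, h, hOM⟩
    have hs' : s⁻¹ ∉ O := (valuation_lt_one_iff.mp hs).resolve_left h0
    have hLN : Large N := ⟨_, comap_ne_top (x := (⟨s, hsN⟩⁻¹ : N)) hs', hON⟩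
    have h1 : SpecializesTo N K :=
      ih (hO.of_le (le_above (mem_of_valuation_lt_one hs))) hN hLN
        ((trdeg_le_of_transcendental htr).1 ⟨⟨s, hsN⟩, fun h =>
          h0 (eq_zero_of_isAlgebraic hk.mem (h.algebraMap (A := K)) hs)⟩)
    have htr' : Algebra.trdeg k N ≤ (n + 1 : ℕ) := by
      rw [← trdeg_add_eq k N] at htr
      exact (self_le_add_right _ _).trans htr
    have h2 : SpecializesTo k M := by
      refine ih hOM hkM' hL ((trdeg_le_of_transcendental htr').2 ⟨⟨s, hsN⟩, fun h => ?_⟩)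
      refine h0 (congrArg Subtype.val (eq_zero_of_isAlgebraic hM.mem h ?_))
      rw [valuation_lt_one_iff]
      exact Or.inr (inv_notMem_below hs h0)
    intro ι _ a
    obtain ⟨b, hb⟩ := h1 ι a
    obtain ⟨B, hB, hVB⟩ := hLM
    obtain ⟨c, hc, -⟩ := exists_specOver_of_isCoef p hs h0 hN hM hB hVB
      (fun i : Option ι => i.elim (⟨s, hsN⟩⁻¹ : N) b) (i₀ := none) (inv_notMem_below hs h0)
    obtain ⟨d, hd⟩ := h2 ι fun i => c (some i)
    exact ⟨d, (hb.restrictScalars.trans (hc.comp some).restrictScalars).trans hd⟩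

theorem VHens.specializesTo (p : ℕ) {k K : Type u} [Field k] [Field K] [Algebra k K]
    [ExpChar K p] [PerfectRing K p] {O : ValuationSubring K} (hO : VHens O) (hk : IsCoef k O)
    (hL : Large k) : SpecializesTo k K := fun ι _ a => by
  let E := adjoin k (Set.range a)
  have : FinTrdeg k E := by
    have := essFiniteType_iff.mpr
      (fg_adjoin_of_finite (F := k) (Set.finite_range a))
    infer_instance
  let F := algebraicClosure E K
  have : FinTrdeg k F := .trans k E F
  obtain ⟨n, hn⟩ := Cardinal.lt_aleph0.mp (trdeg_lt_aleph0 k F)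
  have : IsScalarTower k F K := .of_algebraMap_eq fun _ => rfl
  have hF : ∀ x : K, IsAlgebraic F x → x ∈ (algebraMap F K).range := fun x hx => by
    have : IsAlgebraic E x := hx.restrictScalars E
    exact ⟨⟨x, mem_algebraicClosure_iff.mpr this⟩, rfl⟩
  have : ExpChar F p := ((algebraMap F K).expChar_iff (algebraMap F K).injective p).mpr ‹_›
  have : PerfectRing F p := .ofSurjective F p fun x => by
    obtain ⟨y, hy⟩ := surjective_frobenius K p (algebraMap F K x)
    obtain ⟨z, hz⟩ := hF y (.of_pow (expChar_pos K p) (by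
      rw [frobenius_def] at hy
      rw [hy]
      exact isAlgebraic_algebraMap x))
    refine ⟨z, (algebraMap F K).injective ?_⟩
    rw [RingHom.map_frobenius, hz, hy]
  obtain ⟨b, hb⟩ := specializesTo_of_trdeg_le p n (hO.comap hF) hk.comap hL hn.le ι fun i =>
    (⟨a i, mem_algebraicClosure_iff.mpr (isAlgebraic_algebraMap (A := K)
      (⟨a i, subset_adjoin k _ ⟨i, rfl⟩⟩ : E))⟩ : F)
  exact ⟨b, .of_map (IsScalarTower.toAlgHom k F K) (fun _ => rfl) hb⟩

end Ultra

namespace Ultra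

section

open MvPolynomial

theorem exists_realize_eq_aeval (K : Type*) [Field K] [Ring.CompatibleRing K] {σ : Type*}
    (t : Language.ring.Term σ) : ∃ P : MvPolynomial σ ℤ, ∀ a : σ → K, t.realize a = aeval a P := by
  induction t with
  | var i => exact ⟨X i, fun a => by simp⟩
  | func f ts ih =>
    choose P hP using ih
    cases f with
    | add => exact ⟨P 0 + P 1, fun a => by
        rw [map_add, ← hP, ← hP]; exact Ring.CompatibleRing.funMap_add _⟩
    | mul => exact ⟨P 0 * P 1, fun a => by
        rw [map_mul, ← hP, ← hP]; exact Ring.CompatibleRing.funMap_mul _⟩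
    | neg => exact ⟨- P 0, fun a => by
        rw [map_neg, ← hP]; exact Ring.CompatibleRing.funMap_neg _⟩
    | zero => exact ⟨0, fun a => by rw [map_zero]; exact Ring.CompatibleRing.funMap_zero _⟩
    | one => exact ⟨1, fun a => by rw [map_one]; exact Ring.CompatibleRing.funMap_one _⟩

theorem exists_realize_iff_pattern (K : Type*) [Field K] [Ring.CompatibleRing K] {α : Type*} {n : ℕ}
    {φ : Language.ring.BoundedFormula α n} (hφ : φ.IsQF) :
    ∃ (A : Set (MvPolynomial (α ⊕ Fin n) ℤ)) (D : Set (Set (MvPolynomial (α ⊕ Fin n) ℤ))),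
      A.Finite ∧ ∀ (v : α → K) (w : Fin n → K),
        φ.Realize v w ↔ {P ∈ A | aeval (Sum.elim v w) P = 0} ∈ D := by
  induction hφ with
  | falsum => exact ⟨∅, ∅, Set.finite_empty, fun v w => by simp [Language.BoundedFormula.Realize]⟩
  | of_isAtomic h =>
    cases h with
    | equal t₁ t₂ =>
      obtain ⟨P, hP⟩ := exists_realize_eq_aeval K t₁
      obtain ⟨Q, hQ⟩ := exists_realize_eq_aeval K t₂
      refine ⟨{P - Q}, {{P - Q}}, Set.finite_singleton _, fun v w => ?_⟩
      rw [Language.BoundedFormula.realize_bdEqual, hP, hQ, ← sub_eq_zero, ← map_sub,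
        Set.mem_singleton_iff, Set.ext_iff]
      simp
    | rel R ts => exact R.elim
  | imp _ _ h₁ h₂ =>
    obtain ⟨A₁, D₁, hA₁, h₁⟩ := h₁
    obtain ⟨A₂, D₂, hA₂, h₂⟩ := h₂
    refine ⟨A₁ ∪ A₂, {X | X ∩ A₁ ∈ D₁ → X ∩ A₂ ∈ D₂}, hA₁.union hA₂, fun v w => ?_⟩
    rw [Language.BoundedFormula.realize_imp, h₁, h₂, Set.mem_ofPred_eq]
    have e : ∀ {A B : Set (MvPolynomial _ ℤ)}, B ⊆ A →
        {P ∈ A | aeval (Sum.elim v w) P = 0} ∩ B = {P ∈ B | aeval (Sum.elim v w) P = 0} :=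
      fun h => Set.ext fun P => ⟨fun ⟨h1, h2⟩ => ⟨h2, h1.2⟩, fun ⟨h1, h2⟩ => ⟨⟨h h1, h2⟩, h1⟩⟩
    rw [e Set.subset_union_left, e Set.subset_union_right]

/-- Existential definability of `S`, the quantifier-free part being a condition on which of
finitely many integral polynomials vanish. -/
def PatternDef (K : Type*) [Field K] (S : Set K) : Prop :=
  ∃ (ι : Type) (_ : Finite ι) (i₀ : ι) (A : Set (MvPolynomial ι ℤ))
    (D : Set (Set (MvPolynomial ι ℤ))), A.Finite ∧
      ∀ x : K, x ∈ S ↔ ∃ a : ι → K, a i₀ = x ∧ {P ∈ A | aeval a P = 0} ∈ D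

theorem _root_.ExistentiallyDef0.patternDef {K : Type*} [Field K] {S : Set K}
    (h : ExistentiallyDef0 K S) : PatternDef K S := by
  let _ := Ring.compatibleRingOfRing K
  obtain ⟨n, φ, hφ, h⟩ := h
  obtain ⟨A, D, hA, hD⟩ := exists_realize_iff_pattern K hφ
  refine ⟨Fin 1 ⊕ Fin n, inferInstance, Sum.inl 0, A, D, hA, fun x => (h x).trans ⟨?_, ?_⟩⟩
  · rintro ⟨w, hw⟩
    exact ⟨Sum.elim (fun _ => x) w, rfl, (hD _ _).mp hw⟩
  · rintro ⟨a, rfl, ha⟩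
    refine ⟨fun i => a (Sum.inr i), (hD _ _).mpr ?_⟩
    convert ha using 6 with P
    congr 1
    exact funext fun i => i.rec (fun i => by rw [Subsingleton.elim i 0]; rfl) fun _ => rfl

theorem PatternDef.exists_family {K : Type*} [Field K] {S : Set K} (h : PatternDef K S) {x : K}
    (hx : x ∈ S) : ∃ (κ : Type) (_ : Finite κ) (j : κ) (a : κ → K), a j = x ∧ ∀ b : κ → K,
      (∀ P : MvPolynomial κ ℤ, aeval a P = 0 → aeval b P = 0) → b j ∈ S := by
  obtain ⟨ι, _, i₀, A, D, hA, h⟩ := h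
  obtain ⟨a, ha, hD⟩ := (h x).mp hx
  have := hA.to_subtype
  refine ⟨ι ⊕ A, inferInstance, Sum.inl i₀, Sum.elim a fun P => (aeval a (P : MvPolynomial ι ℤ))⁻¹,
    ha, fun b hb => (h _).mpr ⟨fun i => b (Sum.inl i), rfl, ?_⟩⟩
  have e : ∀ P ∈ A, aeval (fun i => b (Sum.inl i)) P = 0 ↔ aeval a P = 0 := fun P hP => by
    refine ⟨fun h0 => ?_, fun h0 => ?_⟩
    · by_contra h1
      have := hb (rename Sum.inl P * X (Sum.inr ⟨P, hP⟩) - 1) (by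
        rw [map_sub, map_mul, aeval_rename, aeval_X, map_one]
        exact sub_eq_zero.mpr (mul_inv_cancel₀ h1))
      rw [map_sub, map_mul, aeval_rename, map_one] at this
      erw [h0] at this
      simp at this
    · have := hb (rename Sum.inl P) (by rw [aeval_rename]; exact h0)
      rwa [aeval_rename] at this
  convert hD using 1
  exact Set.ext fun P => and_congr_right (e P)

end

section

open MvPolynomial

/-- Every integral polynomial relation satisfied by the family `a` is satisfied by `b`. -/
def IntSpec {κ K L : Type*} [Field K] [Field L] (a : κ → K) (b : κ → L) : Prop :=
  ∀ P : MvPolynomial κ ℤ, aeval a P = 0 → aeval b P = 0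

theorem IntSpec.trans {κ K L M : Type*} [Field K] [Field L] [Field M] {a : κ → K} {b : κ → L}
    {c : κ → M} (h : IntSpec a b) (h' : IntSpec b c) : IntSpec a c := fun P hP => h' P (h P hP)

theorem SpecOver.intSpec {κ k K L : Type*} [Field k] [Field K] [Field L] [Algebra k K] [Algebra k L]
    {a : κ → K} {b : κ → L} (h : SpecOver k a b) : IntSpec a b := fun P hP => by
  have := h (P.map (Int.castRingHom k))
  simp only [aeval_def, eval₂_map] at this hP ⊢
  rw [RingHom.ext_int ((algebraMap k K).comp _) (algebraMap ℤ K),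
    RingHom.ext_int ((algebraMap k L).comp _) (algebraMap ℤ L)] at this
  exact this hP

theorem aeval_map_int {κ K L : Type*} [CommRing K] [CommRing L] (f : K →+* L) (a : κ → K)
    (P : MvPolynomial κ ℤ) : aeval (fun i => f (a i)) P = f (aeval a P) := by
  rw [aeval_def, aeval_def, eval₂_comp_left, RingHom.ext_int (f.comp (algebraMap ℤ K))]
  rfl

theorem intSpec_map {κ K L : Type*} [Field K] [Field L] (f : K →+* L) (a : κ → K) :
    IntSpec a fun i => f (a i) := fun P hP => by rw [aeval_map_int, hP, map_zero]

theorem intSpec_of_map {κ K L : Type*} [Field K] [Field L] (f : K →+* L) (a : κ → K) :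
    IntSpec (fun i => f (a i)) a := fun P hP => by
  rw [aeval_map_int] at hP
  exact f.injective (by rw [hP, map_zero])

/-- Each element of `S` belongs to a finite family, all of whose specializations keep that
element in `S`. -/
def SpecStable {K : Type*} [Field K] (S : Set K) : Prop :=
  ∀ x ∈ S, ∃ (κ : Type) (_ : Finite κ) (j : κ) (a : κ → K), a j = x ∧
    ∀ b : κ → K, IntSpec a b → b j ∈ S

theorem PatternDef.specStable {K : Type*} [Field K] {S : Set K} (h : PatternDef K S) :
    SpecStable S := fun _ hx => h.exists_family hx

theorem SpecStable.perfection {K L : Type*} [Field K] [Field L] [Algebra K L] (p : ℕ) [ExpChar L p]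
    [PerfectRing L p] (hL : ∀ x : L, ∃ (n : ℕ) (y : K), algebraMap K L y = x ^ p ^ n)
    {O : ValuationSubring K} (h : SpecStable (O : Set K)) :
    SpecStable (perfection p hL O : Set L) := fun x hx => by
  obtain ⟨n, y, hy⟩ := hL x
  obtain ⟨κ, _, j, a, haj, ha⟩ := h y ((mem_perfection_iff hy).mp hx)
  choose r hr using fun i => (bijective_iterateFrobenius L p n).2 (algebraMap K L (a i))
  refine ⟨κ, ‹_›, j, r, (bijective_iterateFrobenius L p n).1 ?_, fun b hb => ?_⟩
  · rw [hr, haj, hy, iterateFrobenius_def]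
  · choose m z hz using fun i => hL (b i)
    obtain ⟨N, hN⟩ : ∃ N, ∀ i, m i ≤ N := by
      obtain ⟨N, hN⟩ := (Set.finite_range m).bddAbove
      exact ⟨N, fun i => hN ⟨i, rfl⟩⟩
    have hN' : ∀ i, algebraMap K L (z i ^ p ^ (N - m i + n)) = iterateFrobenius L p (N + n) (b i) :=
      fun i => by
      rw [map_pow, hz, ← pow_mul, ← pow_add, iterateFrobenius_def]
      congr 2
      have := hN i
      omega
    have h1 : IntSpec a fun i => z i ^ p ^ (N - m i + n) := by
      refine ((intSpec_map (algebraMap K L) a).trans ?_).trans (intSpec_of_map (algebraMap K L) _)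
      rw [funext hN', funext fun i => (hr i).symm]
      exact ((intSpec_of_map _ r).trans hb).trans (intSpec_map _ b)
    refine (mem_perfection_iff (n := N + n) ?_).mpr (ha _ h1)
    rw [hN' j, iterateFrobenius_def]

/-- The nonzero integers are units of `O`. -/
def Equi {K : Type*} [Field K] (O : ValuationSubring K) : Prop :=
  ∀ n : ℕ, (n : K)⁻¹ ∈ O

theorem Equi.of_le {K : Type*} [Field K] {O O' : ValuationSubring K} (h : Equi O) (hO : O ≤ O') :
    Equi O' := fun n => hO (h n)

theorem Equi.comap {F K : Type*} [Field F] [Field K] [Algebra F K] {O : ValuationSubring K}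
    (h : Equi O) : Equi (O.comap (algebraMap F K)) := fun n => by
  rw [ValuationSubring.mem_comap, map_inv₀, map_natCast]
  exact h n

theorem Equi.mem_of_mem_bot {K : Type*} [Field K] {O : ValuationSubring K} (h : Equi O) {x : K}
    (hx : x ∈ (⊥ : Subfield K)) : x ∈ O := by
  rw [← Subfield.closure_empty, Subfield.mem_closure_iff, Subring.closure_empty] at hx
  obtain ⟨_, hy, _, hz, rfl⟩ := hx
  obtain ⟨m, rfl⟩ := Subring.mem_bot.mp hy
  obtain ⟨n, rfl⟩ := Subring.mem_bot.mp hz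
  rw [div_eq_mul_inv]
  refine mul_mem (intCast_mem O m) ?_
  obtain ⟨n, rfl | rfl⟩ := n.eq_nat_or_neg
  · rw [Int.cast_natCast]
    exact h n
  · rw [Int.cast_neg, Int.cast_natCast, inv_neg]
    exact neg_mem (h n)

theorem SpecStable.false_of_lt {L : Type u} [Field L] (p : ℕ) [ExpChar L p] [PerfectRing L p]
    {O W : ValuationSubring L} (h : SpecStable (O : Set L)) (hO : VHens O) (hW : VHens W)
    (hlt : W < O) (htop : O ≠ ⊤) (hE : Equi W) : False := by
  obtain ⟨M₀, -, hM₀⟩ := hO.exists_isCoef p ⊥ fun x hx => hlt.le (hE.mem_of_mem_bot hx)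
  have : ExpChar M₀ p := (M₀.subtype.expChar_iff M₀.subtype.injective p).mpr ‹_›
  have : PerfectRing M₀ p := hM₀.perfectRing p
  set U := W.comap (algebraMap M₀ L) with hUdef
  have hU : VHens U := hW.comap_of_isCoef hM₀
  have hUE : Equi U := hE.comap
  have hUt : U ≠ ⊤ := by
    obtain ⟨y, hy, hyW⟩ := Set.exists_of_ssubset hlt
    obtain ⟨c, hc⟩ := hM₀.exists_sub y hy
    refine comap_ne_top (x := c) fun hcW => hyW ?_
    rw [← sub_add_cancel y (algebraMap M₀ L c)]
    exact add_mem (mem_of_valuation_lt_one (valuation_lt_one_of_le hlt.le hc)) hcW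
  obtain ⟨s, h0, hs⟩ := exists_ne_zero_valuation_lt_one hUt
  obtain ⟨κ, _, j, a, haj, ha⟩ := h _ (hM₀.mem s⁻¹)
  obtain ⟨b, hb⟩ := hO.specializesTo p hM₀ ⟨U, hUt, hU⟩ κ a
  have hbj : b j = s⁻¹ := hb.apply_eq haj
  have hmem : ∀ c : (⊥ : Subfield M₀), algebraMap (⊥ : Subfield M₀) M₀ c ∈ U :=
    fun c => hUE.mem_of_mem_bot c.2
  obtain ⟨N, hkN, hN⟩ := (hU.of_le (le_above (mem_of_valuation_lt_one hs))).exists_isCoef p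
    (adjoin (⊥ : Subfield M₀) {s}).toSubfield
    fun x hx => mem_above_of_mem_adjoin hmem hs hx
  have hsN : s ∈ N := hkN (mem_adjoin_simple_self _ s)
  have : ExpChar N p := (N.subtype.expChar_iff N.subtype.injective p).mpr ‹_›
  have : PerfectRing N p := hN.perfectRing p
  have hs' : s⁻¹ ∉ U := (valuation_lt_one_iff.mp hs).resolve_left h0
  obtain ⟨c, hc⟩ := (hU.of_le (le_above (mem_of_valuation_lt_one hs))).specializesTo p hN
    ⟨_, comap_ne_top (x := (⟨s, hsN⟩⁻¹ : N)) hs', hU.comap_of_isCoef hN⟩ κ b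
  have hcj : c j = (⟨s, hsN⟩⁻¹ : N) := hc.apply_eq hbj
  obtain ⟨M, -, hM⟩ := ((hU.of_le (le_below hs)).comap_of_isCoef hN).exists_isCoef p ⊥
    fun x hx => (hUE.of_le (le_below hs)).comap.mem_of_mem_bot hx
  obtain ⟨d, hd, hdj⟩ := exists_specOver_of_isCoef p hs h0 hN hM htop hO c (i₀ := j) (by
    rw [hcj]
    exact inv_notMem_below hs h0)
  exact hdj (ha d ((hb.intSpec.trans hc.intSpec).trans hd.intSpec))

end

end Ultra

namespace Ultra

open Polynomial

theorem exists_perfect_extension (K : Type u) [Field K] (p : ℕ) [ExpChar K p] :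
    ∃ (L : Type u) (_ : Field L) (_ : Algebra K L) (_ : ExpChar L p) (_ : PerfectRing L p),
      ∀ x : L, ∃ (n : ℕ) (y : K), algebraMap K L y = x ^ p ^ n := by
  have h : ExpChar (perfectClosure K (AlgebraicClosure K)) p := expChar_of_injective_algebraMap
    (algebraMap K (perfectClosure K (AlgebraicClosure K))).injective p
  have : ExpChar (AlgebraicClosure K) p := expChar_of_injective_algebraMap
    (algebraMap K (AlgebraicClosure K)).injective p
  refine ⟨perfectClosure K (AlgebraicClosure K), inferInstance, inferInstance, h,
    inferInstance, fun x => ?_⟩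
  obtain ⟨n, y, hy⟩ := (mem_perfectClosure_iff_pow_mem p).mp x.2
  exact ⟨n, y, Subtype.ext hy⟩

section

variable {K L : Type*} [Field K] [Field L] [Algebra K L] {p : ℕ} [ExpChar L p]
  {hL : ∀ x : L, ∃ (n : ℕ) (y : K), algebraMap K L y = x ^ p ^ n} {O W : ValuationSubring K}

theorem perfection_mono (h : W ≤ O) : perfection p hL W ≤ perfection p hL O := fun x hx => by
  obtain ⟨n, y, hy⟩ := hL x
  exact (mem_perfection_iff hy).mpr (h ((mem_perfection_iff hy).mp hx))

theorem perfection_le_iff : perfection p hL W ≤ perfection p hL O ↔ W ≤ O :=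
  ⟨fun h _ hx => algebraMap_mem_perfection.mp (h (algebraMap_mem_perfection.mpr hx)),
    perfection_mono⟩

theorem perfection_ne_top (h : O ≠ ⊤) : perfection p hL O ≠ ⊤ := fun h' =>
  h (eq_top_iff.mpr fun _ _ => algebraMap_mem_perfection.mp
    (h' ▸ ValuationSubring.mem_top _ : _ ∈ perfection p hL O))

theorem Equi.perfection (h : Equi O) : Equi (perfection p hL O) := fun n => by
  rw [← map_natCast (algebraMap K L), ← map_inv₀]
  exact algebraMap_mem_perfection.mpr (h n)

end

theorem SpecStable.not_lt_of_equi {K : Type u} [Field K] {O W : ValuationSubring K}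
    (h : SpecStable (O : Set K)) (hO : VHens O) (hW : VHens W) (htop : O ≠ ⊤) (hE : Equi W) :
    ¬ W < O := fun hlt => by
  obtain ⟨p, _⟩ := ExpChar.exists K
  obtain ⟨L, _, _, _, _, hL⟩ := exists_perfect_extension K p
  refine (h.perfection p hL).false_of_lt p (hO.perfection (hL := hL)) (hW.perfection (hL := hL)) ?_
    (perfection_ne_top htop) hE.perfection
  exact lt_of_le_not_ge (perfection_mono hlt.le) fun h' => hlt.not_ge (perfection_le_iff.mp h')

section

open Filter

/-- The ultrapower of `K` over the hyperfilter of `ℕ`. -/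
abbrev UPow (K : Type u) : Type u := Germ (hyperfilter ℕ : Filter ℕ) K

section

variable {K : Type u} [Field K]

/-- The class of a sequence in the ultrapower. -/
noncomputable def toUPow (K : Type u) [Field K] : (ℕ → K) →+* UPow K := Germ.coeRingHom _

theorem toUPow_surjective : Function.Surjective (toUPow K) := Quotient.mk_surjective

theorem toUPow_eq_iff {c d : ℕ → K} :
    toUPow K c = toUPow K d ↔ ∀ᶠ i in (hyperfilter ℕ : Filter ℕ), c i = d i := Germ.coe_eq

theorem toUPow_eq_zero_iff {c : ℕ → K} :
    toUPow K c = 0 ↔ ∀ᶠ i in (hyperfilter ℕ : Filter ℕ), c i = 0 := by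
  rw [← map_zero (toUPow K)]
  exact toUPow_eq_iff

theorem toUPow_inv (c : ℕ → K) : (toUPow K c)⁻¹ = toUPow K c⁻¹ := rfl

/-- The ultrapower of a valuation subring. -/
noncomputable def uVal (O : ValuationSubring K) : ValuationSubring (UPow K) where
  carrier := {x | Germ.LiftPred (· ∈ O) x}
  mul_mem' {x y} hx hy := by
    obtain ⟨c, rfl⟩ := toUPow_surjective x
    obtain ⟨d, rfl⟩ := toUPow_surjective y
    exact Eventually.mp hx (Eventually.mono hy fun i h h' => mul_mem h' h)
  one_mem' := Eventually.of_forall fun _ => O.one_mem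
  add_mem' {x y} hx hy := by
    obtain ⟨c, rfl⟩ := toUPow_surjective x
    obtain ⟨d, rfl⟩ := toUPow_surjective y
    exact Eventually.mp hx (Eventually.mono hy fun i h h' => add_mem h' h)
  zero_mem' := Eventually.of_forall fun _ => O.zero_mem
  neg_mem' {x} hx := by
    obtain ⟨c, rfl⟩ := toUPow_surjective x
    exact Eventually.mono hx fun i h => neg_mem h
  mem_or_inv_mem' x := by
    obtain ⟨c, rfl⟩ := toUPow_surjective x
    exact Ultrafilter.eventually_or.mp (Eventually.of_forall fun i => O.mem_or_inv_mem (c i))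

theorem toUPow_mem_uVal {O : ValuationSubring K} {c : ℕ → K} :
    toUPow K c ∈ uVal O ↔ ∀ᶠ i in (hyperfilter ℕ : Filter ℕ), c i ∈ O := Iff.rfl

theorem valuation_toUPow_lt_one {O : ValuationSubring K} {c : ℕ → K} :
    (uVal O).valuation (toUPow K c) < 1 ↔
      ∀ᶠ i in (hyperfilter ℕ : Filter ℕ), O.valuation (c i) < 1 := by
  simp only [valuation_lt_one_iff, Ultrafilter.eventually_or, Ultrafilter.eventually_not]
  rw [toUPow_eq_zero_iff, toUPow_inv, toUPow_mem_uVal]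
  rfl

open Polynomial in
theorem VHens.uPow {O : ValuationSubring K} (hO : VHens O) : VHens (uVal O) := by
  intro f hf h0 h1
  obtain ⟨g, rfl⟩ := map_surjective (toUPow K) toUPow_surjective f
  rw [coeff_map] at h0 h1
  rw [valuation_eq_one_iff] at h1
  have hg : ∀ᶠ i in (hyperfilter ℕ : Filter ℕ), ∀ n, g.coeff n i ∈ O := by
    have : ∀ᶠ i in (hyperfilter ℕ : Filter ℕ), ∀ n ∈ g.support, g.coeff n i ∈ O :=
      (eventually_all_finset _).mpr fun n _ => by
        have := hf n
        rwa [coeff_map] at this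
    refine this.mono fun i hi n => ?_
    by_cases hn : n ∈ g.support
    · exact hi n hn
    · rw [notMem_support_iff.mp hn]
      exact O.zero_mem
  have h1' : ∀ᶠ i in (hyperfilter ℕ : Filter ℕ), ¬ O.valuation (g.coeff 1 i) < 1 :=
    Ultrafilter.eventually_not.mpr fun h => h1.2 (valuation_toUPow_lt_one.mpr h)
  have key : ∀ᶠ i in (hyperfilter ℕ : Filter ℕ), ∃ b : K, O.valuation b < 1 ∧
      (g.map (Pi.evalRingHom (fun _ => K) i)).eval b = 0 := by
    filter_upwards [hg, h1', valuation_toUPow_lt_one.mp h0] with i hgi h1i h0i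
    refine hO _ (fun n => by rw [coeff_map]; exact hgi n) (by rw [coeff_map]; exact h0i) ?_
    rw [coeff_map]
    exact valuation_eq_one_iff.mpr ⟨hgi 1, h1i⟩
  obtain ⟨b, hb⟩ := key.choice
  refine ⟨toUPow K b, valuation_toUPow_lt_one.mpr (hb.mono fun i h => h.1), ?_⟩
  rw [eval_map_apply, toUPow_eq_zero_iff]
  refine hb.mono fun i h => ?_
  rw [← h.2]
  exact (eval_map_apply (f := Pi.evalRingHom (fun _ => K) i) (p := g) b).symm

open MvPolynomial in
theorem PatternDef.uPow {O : ValuationSubring K} (h : PatternDef K (O : Set K)) :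
    PatternDef (UPow K) (uVal O : Set (UPow K)) := by
  obtain ⟨ι, _, i₀, A, D, hA, h⟩ := h
  refine ⟨ι, ‹_›, i₀, A, D, hA, fun x => ?_⟩
  have key : ∀ a : ι → ℕ → K, ∀ᶠ i in (hyperfilter ℕ : Filter ℕ),
      {P ∈ A | aeval (fun j => a j i) P = 0} = {P ∈ A | aeval (fun j => toUPow K (a j)) P = 0} := by
    intro a
    have : ∀ᶠ i in (hyperfilter ℕ : Filter ℕ), ∀ P ∈ A,
        (aeval (fun j => a j i) P = 0 ↔ aeval (fun j => toUPow K (a j)) P = 0) := by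
      refine hA.eventually_all.mpr fun P _ => ?_
      have e : ∀ i, aeval (fun j => a j i) P = (aeval a P : ℕ → K) i := fun i =>
        aeval_map_int (Pi.evalRingHom (fun _ => K) i) a P
      have e' : aeval (fun j => toUPow K (a j)) P = toUPow K (aeval a P) := aeval_map_int _ a P
      simp_rw [e]
      rw [e', toUPow_eq_zero_iff]
      by_cases h : ∀ᶠ i in (hyperfilter ℕ : Filter ℕ), (aeval a P : ℕ → K) i = 0
      · exact h.mono fun i hi => iff_of_true hi h
      · exact (Ultrafilter.eventually_not.mpr h).mono fun i hi => iff_of_false hi h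
    exact this.mono fun i hi => Set.ext fun P => and_congr_right (hi P)
  obtain ⟨c, rfl⟩ := toUPow_surjective x
  constructor
  · intro hx
    obtain ⟨a, ha⟩ := ((toUPow_mem_uVal.mp hx).mono fun i hi => (h _).mp hi).choice
    refine ⟨fun j => toUPow K fun i => a i j, toUPow_eq_iff.mpr (ha.mono fun i h => h.1), ?_⟩
    obtain ⟨i, hi, hi'⟩ := (ha.and (key fun j i => a i j)).exists
    rw [← hi']
    exact hi.2
  · rintro ⟨a, hac, ha⟩
    choose b hb using fun j => toUPow_surjective (a j)
    obtain rfl : (fun j => toUPow K (b j)) = a := funext hb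
    refine toUPow_mem_uVal.mpr ?_
    filter_upwards [toUPow_eq_iff.mp hac, key b] with i hi hi'
    exact (h _).mpr ⟨fun j => b j i, hi, hi' ▸ ha⟩

theorem exists_prime_inv_notMem {W : ValuationSubring K} (h : ¬ Equi W) :
    ∃ q : ℕ, q.Prime ∧ (q : K)⁻¹ ∉ W := by
  by_contra! h'
  refine h fun n => ?_
  induction n using Nat.recOnMul with
  | zero => simp
  | one => simp
  | prime q hq => exact h' q hq
  | mul a b ha hb =>
    rw [Nat.cast_mul, mul_inv]
    exact mul_mem ha hb

theorem inv_mem_of_prime_ne {W : ValuationSubring K} {q l : ℕ} (hq : q.Prime) (hl : l.Prime)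
    (hlq : l ≠ q) (h : (q : K)⁻¹ ∉ W) : (l : K)⁻¹ ∈ W := by
  by_contra h'
  have h1 : W.valuation (q : K) < 1 := valuation_lt_one_iff.mpr (.inr h)
  have h2 : W.valuation (l : K) < 1 := valuation_lt_one_iff.mpr (.inr h')
  obtain ⟨u, v, huv⟩ := (Nat.isCoprime_iff_coprime.mpr ((Nat.coprime_primes hl hq).mpr hlq))
  have h3 : W.valuation ((u * l + v * q : ℤ) : K) < 1 := by
    push_cast
    refine Valuation.map_add_lt _ ?_ ?_ <;> rw [map_mul]
    · exact (mul_le_of_le_one_left' ((W.valuation_le_one_iff _).mpr (intCast_mem W u))).trans_lt h2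
    · exact (mul_le_of_le_one_left' ((W.valuation_le_one_iff _).mpr (intCast_mem W v))).trans_lt h1
  rw [huv, Int.cast_one, map_one] at h3
  exact h3.false

theorem PatternDef.not_lt {O W : ValuationSubring K} (h : PatternDef K (O : Set K)) (hO : VHens O)
    (hW : VHens W) (htop : O ≠ ⊤) (hE : Equi O) : ¬ W < O := fun hlt => by
  by_cases hEW : Equi W
  · exact h.specStable.not_lt_of_equi hO hW htop hEW hlt
  obtain ⟨q, hq, hqW⟩ := exists_prime_inv_notMem hEW
  have hq0 : (q : K) ≠ 0 := fun h0 => hqW (by rw [h0, inv_zero]; exact W.zero_mem)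
  have hmem : ((q : ℕ) : UPow K) ∈ uVal W := natCast_mem _ q
  have hinv : ∀ n : ℕ, ((n : UPow K))⁻¹ = toUPow K fun _ => (n : K)⁻¹ := fun n => rfl
  have hE' : Equi (uVal O) := fun n => by
    rw [hinv, toUPow_mem_uVal]
    exact Eventually.of_forall fun _ => hE n
  have htop' : uVal O ≠ ⊤ := fun h => htop (eq_top_iff.mpr fun x _ => by
    have : toUPow K (fun _ => x) ∈ uVal O := h ▸ trivial
    exact (toUPow_mem_uVal.mp this).exists.choose_spec)
  have hWO : uVal W ≤ uVal O := fun x hx => by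
    obtain ⟨c, rfl⟩ := toUPow_surjective x
    exact (toUPow_mem_uVal.mp hx).mono fun i hi => hlt.le hi
  have hle : above (uVal W) hmem ≤ uVal O := fun x ⟨n, hn⟩ => by
    have h0 : (q : UPow K) ^ n ≠ 0 := pow_ne_zero n fun h0 => hq0 (by
      have : toUPow K (fun _ => (q : K)) = 0 := h0
      exact (toUPow_eq_zero_iff.mp this).exists.choose_spec)
    rw [← inv_mul_cancel_left₀ h0 x, ← inv_pow]
    exact mul_mem (pow_mem (hE' q) n) (hWO hn)
  refine h.uPow.specStable.not_lt_of_equi hO.uPow (hW.uPow.of_le (le_above hmem)) htop' (fun n => ?_)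
    (hle.lt_of_not_ge fun hge => ?_)
  · by_contra hn
    obtain ⟨l, hl, hl'⟩ := exists_prime_inv_notMem fun hE => hn (hE n)
    rcases eq_or_ne l q with rfl | hlq
    · exact hl' (inv_mem_above hmem)
    · refine hl' (le_above hmem ?_)
      rw [hinv, toUPow_mem_uVal]
      exact Eventually.of_forall fun _ => inv_mem_of_prime_ne hq hl hlq hqW
  · have h1 : toUPow K (fun i => (q : K)⁻¹ ^ i) ∈ uVal O :=
      toUPow_mem_uVal.mpr (Eventually.of_forall fun i => pow_mem (hE q) i)
    obtain ⟨n, hn⟩ := hge h1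
    have h2 : ∀ᶠ i in (hyperfilter ℕ : Filter ℕ), (q : K) ^ n * (q : K)⁻¹ ^ i ∈ W := hn
    obtain ⟨i, hi, hni⟩ := (h2.and ((eventually_gt_atTop n).filter_mono
      Nat.hyperfilter_le_atTop)).exists
    refine hqW ?_
    obtain ⟨m, rfl⟩ : ∃ m, i = n + 1 + m := ⟨i - (n + 1), by omega⟩
    have h3 := mul_mem hi (pow_mem (natCast_mem W q) m)
    convert h3 using 1
    rw [pow_add, pow_succ, inv_pow, inv_pow]
    field_simp

end

end

theorem nonempty_algHom_of_isAlgClosed (k A L : Type*) [Field k] [CommRing A] [Nontrivial A]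
    [Field L] [Algebra k A] [Algebra k L] [IsAlgClosed L] [Algebra.FiniteType k A] :
    Nonempty (A →ₐ[k] L) := by
  obtain ⟨m, hm⟩ := Ideal.exists_maximal A
  let _ : Field (A ⧸ m) := Ideal.Quotient.field m
  have := finite_of_finite_type_of_isJacobsonRing k (A ⧸ m)
  exact ⟨(IsAlgClosed.lift : (A ⧸ m) →ₐ[k] L).comp (Ideal.Quotient.mkₐ k m)⟩

theorem exists_specOver_of_isAlgClosed {k K L κ : Type*} [Field k] [Field K] [Field L] [Algebra k K]
    [Algebra k L] [IsAlgClosed L] [Finite κ] (a : κ → K) : ∃ b : κ → L, SpecOver k a b := by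
  let φ : MvPolynomial κ k →ₐ[k] K := MvPolynomial.aeval a
  have : Algebra.FiniteType k φ.range :=
    Algebra.FiniteType.of_surjective φ.rangeRestrict φ.rangeRestrict_surjective
  obtain ⟨g⟩ := nonempty_algHom_of_isAlgClosed k φ.range L
  let a' : κ → φ.range := fun i => φ.rangeRestrict (MvPolynomial.X i)
  have ha' : ∀ P, ((MvPolynomial.aeval a' P : φ.range) : K) = MvPolynomial.aeval a P := fun P => by
    have h : MvPolynomial.aeval a' = φ.rangeRestrict :=
      MvPolynomial.algHom_ext fun i => by rw [MvPolynomial.aeval_X]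
    rw [h]
    rfl
  refine ⟨fun i => g (a' i), fun P hP => ?_⟩
  rw [← MvPolynomial.comp_aeval_apply, show MvPolynomial.aeval a' P = 0 from
    Subtype.ext ((ha' P).trans hP), map_zero]

theorem mem_range_of_isAlgebraic_of_isAlgClosed {k F : Type*} [Field k] [Field F] [Algebra k F]
    [IsAlgClosed k] {y : F} (h : IsAlgebraic k y) : y ∈ (algebraMap k F).range :=
  minpoly.mem_range_of_degree_eq_one k y
    (IsAlgClosed.degree_eq_one_of_irreducible k (minpoly.irreducible h.isIntegral))

theorem exists_valuationSubring_notMem {k F : Type*} [Field k] [Field F] [Algebra k F]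
    [IsAlgClosed k] {t : F} (h : Transcendental k t) :
    ∃ V : ValuationSubring F, (∀ c, algebraMap k F c ∈ V) ∧ t ∉ V := by
  have : IsIntegrallyClosedIn (algebraMap k F).range F := by
    refine Subring.isIntegrallyClosedIn_iff.mpr fun {y} ⟨P, hP, hy⟩ => ?_
    obtain ⟨Q, rfl⟩ := Polynomial.map_surjective _ (algebraMap k F).rangeRestrict_surjective P
    refine mem_range_of_isAlgebraic_of_isAlgClosed ⟨Q, fun h0 => hP.ne_zero (by simp [h0]), ?_⟩
    rwa [Polynomial.eval₂_map] at hy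
  obtain ⟨V, hV, ht⟩ := Subring.exists_le_valuationSubring_of_isIntegrallyClosedIn
    (R := (algebraMap k F).range) (x := t) fun ⟨c, hc⟩ => h (hc ▸ isAlgebraic_algebraMap c)
  exact ⟨V, fun c => hV ⟨c, rfl⟩, ht⟩

theorem exists_aeval_div_of_adjoin_simple {k L : Type*} [Field k] [Field L] [Algebra k L] (x : L)
    (c : adjoin k {x}) : ∃ r q : Polynomial k,
      c = Polynomial.aeval (IntermediateField.AdjoinSimple.gen k x) r /
        Polynomial.aeval (IntermediateField.AdjoinSimple.gen k x) q := by
  obtain ⟨r, q, h⟩ := (mem_adjoin_simple_iff k _).mp c.2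
  refine ⟨r, q, Subtype.ext (h.trans ?_)⟩
  have e : ∀ r : Polynomial k, ((Polynomial.aeval (IntermediateField.AdjoinSimple.gen k x) r :
      adjoin k {x}) : L) = Polynomial.aeval x r := fun r =>
    (Polynomial.aeval_algebraMap_apply L (IntermediateField.AdjoinSimple.gen k x) r).symm
  rw [IntermediateField.coe_div, e, e]

theorem trdeg_adjoin_simple_le {k L : Type u} [Field k] [Field L] [Algebra k L] (x : L) :
    Algebra.trdeg k (adjoin k {x}) ≤ 1 := by
  let g := IntermediateField.AdjoinSimple.gen k x
  have : Algebra.IsAlgebraic (Algebra.adjoin k {g}) (adjoin k {x}) := by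
    refine ⟨fun c => ?_⟩
    have e : ∀ r : Polynomial k, IsAlgebraic (Algebra.adjoin k {g}) (Polynomial.aeval g r) :=
      fun r => isAlgebraic_algebraMap
        (⟨_, Polynomial.aeval_mem_adjoin_singleton k g⟩ : Algebra.adjoin k {g})
    obtain ⟨r, q, rfl⟩ := exists_aeval_div_of_adjoin_simple x c
    rw [div_eq_mul_inv]
    exact (e r).mul (e q).inv
  exact (Algebra.IsAlgebraic.trdeg_le_cardinalMk k {g}).trans (by simp)

theorem exists_specOver_notMem_of_isCoef {k F L : Type u} [Field k] [Field F] [Field L] [Algebra k F]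
    [Algebra k L] [IsAlgClosed k] [IsAlgClosed F] {O : ValuationSubring L} (hO : VHens O)
    (htop : O ≠ ⊤) {V : ValuationSubring F} (hkV : ∀ c, algebraMap k F c ∈ V) {s : F}
    (hs : V.valuation s < 1) (h0 : s ≠ 0) {N : Subfield F} [Algebra k N] [IsScalarTower k N F]
    (hN : IsCoef N (above V (mem_of_valuation_lt_one hs))) (hsN : s ∈ N)
    (htr : Algebra.trdeg k N ≤ 1) {κ : Type} [Finite κ] {j : κ} {b : κ → N}
    (hbj : (b j : F) = s⁻¹) : ∃ d : κ → L, IntSpec b d ∧ d j ∉ O := by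
  obtain ⟨p, _⟩ := ExpChar.exists F
  have : PerfectRing F p := inferInstance
  have : ExpChar N p := (N.subtype.expChar_iff N.subtype.injective p).mpr ‹_›
  have : PerfectRing N p := hN.perfectRing p
  have hV : VHens V := (sHens_of_isAlgClosed V).vHens
  obtain ⟨M, hkM, hM⟩ := ((hV.of_le (le_below hs)).comap_of_isCoef hN).exists_isCoef p
      (algebraMap k N).fieldRange (by
        rintro _ ⟨c, rfl⟩
        exact le_below hs ((IsScalarTower.algebraMap_apply k N F c) ▸ hkV c))
  let _ : Algebra k M := ((algebraMap k N).codRestrict M fun c => hkM ⟨c, rfl⟩).toAlgebra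
  have : IsScalarTower k M N := .of_algebraMap_eq fun _ => rfl
  have htrM : Algebra.trdeg k M ≤ (0 : ℕ) := by
    refine (trdeg_le_of_transcendental (n := 0) (htr.trans (by simp))).2 ⟨⟨s, hsN⟩, fun h' => h0 ?_⟩
    refine congrArg Subtype.val (eq_zero_of_isAlgebraic hM.mem h' ?_)
    rw [valuation_lt_one_iff]
    exact Or.inr (inv_notMem_below hs h0)
  have : Algebra.IsAlgebraic k M :=
    trdeg_eq_zero_iff.mp (nonpos_iff_eq_zero.mp (by simpa using htrM))
  let e : k ≃+* M := RingEquiv.ofBijective (algebraMap k M)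
    IsAlgClosed.algebraMap_bijective_of_isIntegral
  let _ : Algebra M L := ((algebraMap k L).comp e.symm.toRingHom).toAlgebra
  obtain ⟨d, hd, hdj⟩ := exists_specOver_of_isCoef p hs h0 hN hM htop hO b (i₀ := j)
    (hbj ▸ inv_notMem_below hs h0)
  exact ⟨d, hd.intSpec, hdj⟩

theorem exists_specOver_notMem_of_above {k F L : Type u} [Field k] [Field F] [Field L] [Algebra k F]
    [Algebra k L] [IsAlgClosed k] [IsAlgClosed F] {O : ValuationSubring L} (hO : VHens O)
    (htop : O ≠ ⊤) {V : ValuationSubring F} (hkV : ∀ c, algebraMap k F c ∈ V) {s : F}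
    (hs : V.valuation s < 1) (h0 : s ≠ 0) (hF : ∀ c, c ∈ above V (mem_of_valuation_lt_one hs))
    (h1 : Algebra.trdeg k F ≤ 1) {κ : Type} [Finite κ] {j : κ} {b : κ → F} (hbj : b j = s⁻¹) :
    ∃ d : κ → L, IntSpec b d ∧ d j ∉ O := by
  obtain ⟨N, hN0⟩ : ∃ N : Subfield F, ∀ y, y ∈ N := ⟨⊤, fun _ => trivial⟩
  have hN : IsCoef N (above V (mem_of_valuation_lt_one hs)) :=
    ⟨fun c => hF c,
      fun y _ => ⟨⟨y, hN0 y⟩, by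
        rw [show algebraMap N F ⟨y, hN0 y⟩ = y from rfl, sub_self, map_zero]
        exact zero_lt_one⟩⟩
  let _ : Algebra k N := ((algebraMap k F).codRestrict N fun _ => hN0 _).toAlgebra
  have : IsScalarTower k N F := .of_algebraMap_eq fun _ => rfl
  have htr : Algebra.trdeg k N ≤ 1 :=
    (trdeg_le_of_injective (IsScalarTower.toAlgHom k N F) N.subtype.injective).trans h1
  obtain ⟨d, hd, hdj⟩ := exists_specOver_notMem_of_isCoef hO htop hkV hs h0 hN (hN0 s) htr
    (b := fun i => ⟨b i, hN0 _⟩) (j := j) hbj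
  have hb : IntSpec b fun i => (⟨b i, hN0 _⟩ : N) :=
    intSpec_of_map N.subtype fun i => (⟨b i, hN0 _⟩ : N)
  exact ⟨d, hb.trans hd, hdj⟩

theorem exists_specOver_notMem_of_transcendental {k E F L : Type u} [Field k] [Field E] [Field F]
    [Field L] [Algebra k E] [Algebra k F] [Algebra k L] [Algebra E F] [IsScalarTower k E F]
    [IsAlgClosed k] [IsAlgClosed F] [Algebra.IsAlgebraic E F] {O : ValuationSubring L}
    (hO : VHens O) (htop : O ≠ ⊤) {g : E}
    (hgen : ∀ c : E, ∃ r q : Polynomial k, c = Polynomial.aeval g r / Polynomial.aeval g q)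
    (hE1 : Algebra.trdeg k E ≤ 1) (hg : Transcendental k g) {κ : Type} [Finite κ] {j : κ}
    {b : κ → F} (hbj : b j = algebraMap E F g) :
    ∃ d : κ → L, IntSpec b d ∧ d j ∉ O := by
  have ht : Transcendental k (algebraMap E F g) := fun h' =>
    hg ((isAlgebraic_algebraMap_iff (algebraMap E F).injective).mp h')
  obtain ⟨V, hkV, htV⟩ := exists_valuationSubring_notMem ht
  set s : F := (algebraMap E F g)⁻¹ with hsdef
  have h0 : s ≠ 0 := inv_ne_zero fun h' => htV (h' ▸ V.zero_mem)
  have hs : V.valuation s < 1 := valuation_lt_one_iff.mpr (.inr (by rwa [hsdef, inv_inv]))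
  have hV : VHens V := (sHens_of_isAlgClosed V).vHens
  have hE : ∀ c : E, algebraMap E F c ∈ above V (mem_of_valuation_lt_one hs) := fun c => by
    refine mem_above_of_mem_adjoin hkV hs ?_
    have e : ∀ r : Polynomial k, algebraMap E F (Polynomial.aeval g r) ∈
        adjoin k {s} := fun r => by
      rw [← Polynomial.aeval_algebraMap_apply]
      have : algebraMap E F g ∈ adjoin k {s} := by
        rw [← inv_inv (algebraMap E F g)]
        exact inv_mem (mem_adjoin_simple_self k s)
      exact Algebra.adjoin_le (S := (adjoin k {s}).toSubalgebra)
        (Set.singleton_subset_iff.mpr this)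
        (Polynomial.aeval_mem_adjoin_singleton k (algebraMap E F g))
    obtain ⟨r, q, rfl⟩ := hgen c
    rw [map_div₀]
    exact div_mem (e r) (e q)
  have h1 : Algebra.trdeg k F ≤ 1 := by
    rw [← trdeg_add_eq k E, trdeg_eq_zero_iff.mpr (inferInstance : Algebra.IsAlgebraic E F),
      add_zero]
    exact hE1
  exact exists_specOver_notMem_of_above hO htop hkV hs h0
    (fun c => mem_of_isAlgebraic hE (Algebra.IsAlgebraic.isAlgebraic c)) h1
    (by rw [hsdef, inv_inv, hbj])

theorem SpecStable.false_of_transcendental {k L : Type u} [Field k] [Field L] [Algebra k L]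
    [IsAlgClosed k] {O : ValuationSubring L} (h : SpecStable (O : Set L)) (hO : VHens O)
    (htop : O ≠ ⊤) {x : L} (hx : x ∈ O) (hxt : Transcendental k x) : False := by
  obtain ⟨κ, _, j, a, haj, ha⟩ := h x hx
  let E := adjoin k {x}
  let g : E := IntermediateField.AdjoinSimple.gen k x
  obtain ⟨b, hb⟩ := exists_specOver_of_isAlgClosed (k := E) (L := AlgebraicClosure E) a
  obtain ⟨d, hd, hdj⟩ := exists_specOver_notMem_of_transcendental hO htop
    (exists_aeval_div_of_adjoin_simple x) (trdeg_adjoin_simple_le x)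
    (fun h' => hxt (h'.algebraMap (A := L))) (hb.apply_eq (c := g) haj)
  exact hdj (ha d (hb.intSpec.trans hd))

theorem isSepClosed_of_surjective {k l : Type*} [Field k] [Field l] [IsSepClosed k] (f : k →+* l)
    (hf : ∀ x, ∃ n ≠ 0, x ^ n ∈ f.range) : IsSepClosed l := by
  let _ : Algebra k l := f.toAlgebra
  have : Algebra.IsAlgebraic k l := ⟨fun x => by
    obtain ⟨n, hn, y, hy⟩ := hf x
    refine IsAlgebraic.of_pow (n := n) (Nat.pos_of_ne_zero hn) ?_
    rw [← hy]
    exact isAlgebraic_algebraMap (A := l) y⟩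
  exact Algebra.IsAlgebraic.isSepClosed (F := k) (E := l)

theorem IsCoef.isSepClosed {k K : Type*} [Field k] [Field K] [Algebra k K] {O : ValuationSubring K}
    (h : IsCoef k O) [IsSepClosed (ResidueField O)] : IsSepClosed k := by
  let i : k →+* O := (algebraMap k K).codRestrict O.toSubring h.mem
  let e : k ≃+* ResidueField O :=
    RingEquiv.ofBijective ((residue O).comp i) ⟨RingHom.injective _, fun y => by
      obtain ⟨y, rfl⟩ := residue_surjective y
      obtain ⟨c, hc⟩ := h.exists_sub y y.2
      refine ⟨c, ?_⟩
      rw [← sub_eq_zero, ← neg_eq_zero, neg_sub, RingHom.comp_apply, ← map_sub, residue_eq_zero_iff]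
      exact hc⟩
  exact isSepClosed_of_surjective e.symm.toRingHom fun x =>
    ⟨1, one_ne_zero, e x, by rw [pow_one]; exact e.symm_apply_apply x⟩

theorem isSepClosed_perfection {K L : Type*} [Field K] [Field L] [Algebra K L] (p : ℕ) [ExpChar L p]
    (hL : ∀ x : L, ∃ (n : ℕ) (y : K), algebraMap K L y = x ^ p ^ n) (O : ValuationSubring K)
    [IsSepClosed (ResidueField O)] :
    IsSepClosed (ResidueField (perfection p hL O)) := by
  let i : O →+* perfection p hL O := ((algebraMap K L).comp O.subtype).codRestrict
    (perfection p hL O).toSubring fun x => algebraMap_mem_perfection.mpr x.2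
  have hi : ∀ x, ((i x : perfection p hL O) : L) = algebraMap K L (x : K) := fun _ => rfl
  have : RingHom.ker ((residue (perfection p hL O)).comp i) =
      IsLocalRing.maximalIdeal O := by
    ext x
    rw [RingHom.mem_ker, RingHom.comp_apply, residue_eq_zero_iff, hi,
      valuation_perfection_lt_one (n := 0) (y := (x : K)) (by simp), ValuationSubring.valuation_lt_one_iff]
  have : IsLocalHom ((residue (perfection p hL O)).comp i) := ⟨fun x hx => by
    by_contra h
    have h1 : x ∈ RingHom.ker ((residue (perfection p hL O)).comp i) := by
      rwa [this, mem_maximalIdeal]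
    rw [(RingHom.mem_ker).mp h1] at hx
    exact not_isUnit_zero hx⟩
  refine isSepClosed_of_surjective
    (ResidueField.lift ((residue (perfection p hL O)).comp i)) fun x => ?_
  obtain ⟨x, rfl⟩ := residue_surjective x
  obtain ⟨n, y, hy⟩ := hL x
  refine ⟨p ^ n, (pow_pos (expChar_pos L p) n).ne',
    residue O ⟨y, (mem_perfection_iff hy).mp x.2⟩, ?_⟩
  rw [ResidueField.lift_residue_apply, RingHom.comp_apply, ← map_pow]
  exact congrArg _ (Subtype.ext hy)

theorem SpecStable.not_isSepClosed {K : Type u} [Field K] {O : ValuationSubring K}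
    (h : SpecStable (O : Set K)) (hO : VHens O) (htop : O ≠ ⊤) (hE : Equi O) :
    ¬ IsSepClosed (ResidueField O) := fun _ => by
  obtain ⟨p, _⟩ := ExpChar.exists K
  obtain ⟨L, _, _, _, _, hL⟩ := exists_perfect_extension K p
  have hW : VHens (Ultra.perfection p hL O) := hO.perfection
  obtain ⟨M, -, hM⟩ := hW.exists_isCoef p ⊥ fun x hx => hE.perfection.mem_of_mem_bot hx
  have : ExpChar M p := (M.subtype.expChar_iff M.subtype.injective p).mpr ‹_›
  have : PerfectRing M p := hM.perfectRing p
  have : PerfectField M := PerfectRing.toPerfectField M p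
  have := isSepClosed_perfection p hL O
  have := hM.isSepClosed
  have : IsAlgClosed M := inferInstance
  obtain ⟨x, h0, hx⟩ := exists_ne_zero_valuation_lt_one (perfection_ne_top (hL := hL) htop)
  exact (h.perfection p hL).false_of_transcendental (k := M) hW (perfection_ne_top htop)
    (mem_of_valuation_lt_one hx) fun h' => h0 (eq_zero_of_isAlgebraic hM.mem h' hx)

section

theorem separable_of_map_residue {R : Type*} [CommRing R] [IsLocalRing R] {f : R[X]} (hf : f.Monic)
    (h : (f.map (residue R)).Separable) : f.Separable := by
  rw [Separable, derivative_map, ← isUnit_resultant_iff_isCoprime (hf.map _)] at h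
  rw [Separable, ← isUnit_resultant_iff_isCoprime hf]
  refine isUnit_of_map_unit (residue R) _ ?_
  rw [← resultant_map_map]
  obtain ⟨k, hk⟩ := Nat.exists_eq_add_of_le
    (natDegree_map_le (f := residue R) (p := derivative f))
  have h1 : (f.map (residue R)).coeff f.natDegree = 1 := by
    rw [coeff_map, hf.coeff_natDegree, map_one]
  rw [hk, resultant_add_right_deg _ _ _ _ _ le_rfl, h1, one_pow, one_mul]
  rwa [hf.natDegree_map] at h

variable {K : Type*} [Field K] {O O' : ValuationSubring K}

theorem mem_of_monic_of_eval_eq_zero {g : O[X]} (hg : g.Monic) {b : K}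
    (hb : (g.map O.subtype).eval b = 0) : b ∈ O :=
  mem_of_isIntegral_subring (A := O.toSubring) le_rfl ⟨g, hg, by rwa [eval_map] at hb⟩

theorem exists_root_map_residue {g : O[X]} (hg : g.Monic) {b : K}
    (hb : (g.map O.subtype).eval b = 0) : ∃ x, (g.map (residue O)).eval x = 0 := by
  refine ⟨residue O ⟨b, mem_of_monic_of_eval_eq_zero hg hb⟩, ?_⟩
  rw [eval_map_apply, (Subtype.ext ((eval_map_apply (f := O.subtype) (p := g)
    ⟨b, mem_of_monic_of_eval_eq_zero hg hb⟩).symm.trans hb) : g.eval _ = 0), map_zero]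

theorem isSepClosed_of_le (hO' : VHens O') (h : O ≤ O')
    [IsSepClosed (ResidueField O')] : IsSepClosed (ResidueField O) := by
  refine IsSepClosed.of_exists_root _ fun q hq hi hs => ?_
  obtain ⟨f, rfl, hd, hf⟩ := lifts_and_natDegree_eq_and_monic (f := residue O) (p := q)
    (by
      obtain ⟨f, hf⟩ := map_surjective _ residue_surjective q
      exact ⟨f, hf⟩) hq
  let i : O →+* O' := Subring.inclusion h
  have hF : ∀ n, (f.map O.subtype).coeff n ∈ O' := fun n => by
    rw [coeff_map]
    exact h (f.coeff n).2
  have hfs : ((f.map i).map (residue O')).Separable :=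
    ((separable_of_map_residue hf hs).map (f := i)).map
  obtain ⟨z, hz⟩ := IsSepClosed.exists_root _ (by
    rw [(hf.map i).degree_map, hf.degree_map i, ← hf.degree_map (residue O)]
    exact hi.degree_pos.ne') hfs
  obtain ⟨z, rfl⟩ := residue_surjective z
  have hev : ∀ g : O[X], (g.map O.subtype).eval (z : K) = (((g.map i).eval z : O') : K) := fun g => by
    rw [show O.subtype = O'.subtype.comp i from rfl, ← Polynomial.map_map]
    exact eval_map_apply (f := O'.subtype) (p := g.map i) z
  have hz' := hfs.eval₂_derivative_ne_zero (RingHom.id _) (by rwa [← eval_map, Polynomial.map_id])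
  rw [← eval_map, Polynomial.map_id, derivative_map, derivative_map, eval_map_apply, Ne,
    residue_eq_zero_iff] at hz'
  obtain ⟨b, -, hb⟩ := hO'.exists_root_sub hF z.2
    (by rwa [hev, ← residue_eq_zero_iff, ← eval_map_apply])
    (by
      rw [derivative_map, hev, valuation_eq_one_iff]
      exact ⟨SetLike.coe_mem _, hz'⟩)
  exact exists_root_map_residue hf hb

theorem exists_sub_lt_one_of_not_le (h : ¬ O ≤ O') (h' : ¬ O' ≤ O) {c : K} (hc : c ∈ O) :
    ∃ e, O.valuation (e - c) < 1 ∧ O'.valuation e < 1 := by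
  obtain ⟨a, ha, ha'⟩ := SetLike.not_le_iff_exists.mp h
  obtain ⟨b, hb', hb⟩ := SetLike.not_le_iff_exists.mp h'
  have hb0 : b ≠ 0 := fun h => hb (h ▸ O.zero_mem)
  have ha0 : a ≠ 0 := fun h => ha' (h ▸ O'.zero_mem)
  have hd : O.valuation (a / b) < 1 := by
    rw [map_div₀, div_eq_mul_inv, ← map_inv₀]
    exact mul_lt_one_of_nonneg_of_lt_one_right ((O.valuation_le_one_iff a).mpr ha) zero_le
      (valuation_lt_one_iff.mpr (.inr (by rwa [inv_inv])))
  have hd' : 1 < O'.valuation (a / b) := by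
    rw [← not_le, O'.valuation_le_one_iff]
    exact fun h => ha' (by simpa [hb0] using mul_mem h hb')
  have key : ∀ t, O.valuation t < 1 → 1 < O'.valuation t → O.valuation ((1 + t)⁻¹ - 1) < 1 ∧
      O'.valuation (1 + t)⁻¹ = (O'.valuation t)⁻¹ := fun t ht ht' => by
    have h1 : O.valuation (1 + t) = 1 := by
      rw [Valuation.map_add_eq_of_lt_left _ (by rwa [map_one]), map_one]
    have h0 : 1 + t ≠ 0 := fun h => by simp [h] at h1
    refine ⟨?_, ?_⟩
    · rw [show (1 + t)⁻¹ - 1 = -t * (1 + t)⁻¹ by field_simp; ring, map_mul, map_inv₀, h1,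
        inv_one, mul_one, Valuation.map_neg]
      exact ht
    · rw [map_inv₀, Valuation.map_add_eq_of_lt_right _ (by rwa [map_one])]
  have hv : O.valuation c ≤ 1 := (O.valuation_le_one_iff c).mpr hc
  rcases le_or_gt (O'.valuation c) 1 with hc' | hc'
  · obtain ⟨h1, h2⟩ := key _ hd hd'
    refine ⟨c * (1 + a / b)⁻¹, ?_, ?_⟩
    · rw [← mul_sub_one, map_mul]
      exact mul_lt_one_of_nonneg_of_lt_one_right hv zero_le h1
    · rw [map_mul, h2]
      exact mul_lt_one_of_nonneg_of_lt_one_right hc' zero_le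
        (inv_lt_one_of_one_lt₀ hd')
  · obtain ⟨h1, h2⟩ := key (a / b * c) (by
        rw [map_mul]
        exact mul_lt_one_of_nonneg_of_lt_one_left zero_le hd hv) (by
        rw [map_mul]
        exact one_lt_mul_of_le_of_lt hd'.le hc')
    have hc0 : O'.valuation c ≠ 0 := (zero_lt_one.trans hc').ne'
    refine ⟨c * (1 + a / b * c)⁻¹, ?_, ?_⟩
    · rw [← mul_sub_one, map_mul]
      exact mul_lt_one_of_nonneg_of_lt_one_right hv zero_le h1
    · rw [map_mul, h2, map_mul (O'.valuation), mul_inv, mul_left_comm, mul_inv_cancel₀ hc0, mul_one]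
      exact inv_lt_one_of_one_lt₀ hd'

theorem valuation_eval_lt_one {f : K[X]} (hf : ∀ n, O.valuation (f.coeff n) < 1) {a : K}
    (ha : a ∈ O) : O.valuation (f.eval a) < 1 := by
  rw [eval_eq_sum_range]
  refine Valuation.map_sum_lt _ one_ne_zero fun n _ => ?_
  rw [map_mul]
  exact mul_lt_one_of_nonneg_of_lt_one_left zero_le (hf n)
    ((O.valuation_le_one_iff _).mpr (pow_mem ha n))

theorem isSepClosed_of_not_le (hO' : VHens O') (h : ¬ O ≤ O') (h' : ¬ O' ≤ O) :
    IsSepClosed (ResidueField O) := by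
  refine IsSepClosed.of_exists_root _ fun q hq hi _ => ?_
  obtain ⟨m, hm⟩ := Nat.exists_eq_succ_of_ne_zero hi.natDegree_pos.ne'
  choose r hr using fun n => residue_surjective (R := O) (q.coeff n)
  obtain ⟨e₁, he₁, he₁'⟩ := exists_sub_lt_one_of_not_le h' h (c := -1) (neg_mem O'.one_mem)
  have hex : ∀ n, ∃ e : O, residue O e = q.coeff n ∧
      O'.valuation (e + if n = m then 1 else 0) < 1 := fun n => by
    obtain ⟨e, he, he'⟩ := exists_sub_lt_one_of_not_le h h' (r n).2
    have hsum : O.valuation ((e + if n = m then e₁ else 0) - r n) < 1 := by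
      rw [add_sub_right_comm]
      refine Valuation.map_add_lt _ he ?_
      split_ifs
      exacts [he₁', by rw [map_zero]; exact zero_lt_one]
    have hmem : (e + if n = m then e₁ else 0) ∈ O := by
      have := add_mem (mem_of_valuation_lt_one hsum) (r n).2
      rwa [sub_add_cancel] at this
    refine ⟨⟨_, hmem⟩, ?_, ?_⟩
    · rw [← hr, ← sub_eq_zero, ← map_sub, residue_eq_zero_iff]
      exact hsum
    · rw [add_assoc]
      refine Valuation.map_add_lt _ he' ?_
      split_ifs
      · rwa [sub_neg_eq_add] at he₁
      · rw [add_zero, map_zero]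
        exact zero_lt_one
  choose e he he' using hex
  let g : O[X] := X ^ (m + 1) + ∑ n ∈ range (m + 1), C (e n) * X ^ n
  have hg : g.Monic := monic_X_pow_add <| (degree_sum_le _ _).trans_lt <|
    (sup_lt_iff (WithBot.bot_lt_coe _)).mpr fun n hn =>
      (degree_C_mul_X_pow_le _ _).trans_lt (Nat.cast_lt.mpr (mem_range.mp hn))
  have hgq : g.map (residue O) = q := by
    rw [hq.as_sum, hm]
    simp [g, Polynomial.map_sum, he]
  let D : K[X] := ∑ n ∈ range (m + 1), C ((e n : K) + if n = m then 1 else 0) * X ^ n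
  have hD : ∀ n, O'.valuation (D.coeff n) < 1 := fun n => by
    simp only [D, finsetSum_coeff, coeff_C_mul_X_pow]
    rw [Finset.sum_ite_eq]
    by_cases h1 : n ∈ range (m + 1)
    · rw [if_pos h1]
      exact he' n
    · rw [if_neg h1, map_zero]
      exact zero_lt_one
  have hgD : g.map O.subtype = X ^ (m + 1) - X ^ m + D := by
    simp [g, D, Polynomial.map_sum, add_mul, sum_add_distrib, ite_mul]
  obtain ⟨b, -, hb⟩ := hO'.exists_root_sub (f := g.map O.subtype) (a := 1) (fun n => by
      rw [hgD, coeff_add, coeff_sub, coeff_X_pow, coeff_X_pow]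
      refine add_mem (sub_mem ?_ ?_) (mem_of_valuation_lt_one (hD n)) <;> split_ifs
      exacts [O'.one_mem, O'.zero_mem, O'.one_mem, O'.zero_mem]) O'.one_mem
    (by
      rw [hgD, eval_add, eval_sub, eval_pow, eval_pow, eval_X, one_pow, one_pow, sub_self, zero_add]
      exact valuation_eval_lt_one hD O'.one_mem)
    (by
      have h1 : eval 1 (derivative (X ^ (m + 1) - X ^ m : K[X])) = 1 := by simp [derivative_X_pow]
      rw [hgD, derivative_add, eval_add, h1, Valuation.map_add_eq_of_lt_left, map_one]
      rw [map_one]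
      refine valuation_eval_lt_one (fun n => ?_) O'.one_mem
      rw [coeff_derivative, map_mul]
      exact mul_lt_one_of_nonneg_of_lt_one_left zero_le (hD _) ((O'.valuation_le_one_iff _).mpr
        (add_mem (natCast_mem O' n) O'.one_mem)))
  exact hgq ▸ exists_root_map_residue hg hb

end

theorem equi_of_ringChar_eq {K : Type*} [Field K] {O : ValuationSubring K}
    (h : ringChar K = ringChar (ResidueField O)) : Equi O := fun n => by
  by_contra hn
  have h1 : residue O (n : O) = 0 := by
    rw [residue_eq_zero_iff, valuation_lt_one_iff]
    exact Or.inr hn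
  rw [map_natCast, ringChar.spec, ← h, ← ringChar.spec] at h1
  rw [h1, inv_zero] at hn
  exact hn O.zero_mem

end Ultra

/-- If a nontrivial equicharacteristic henselian valuation ring `𝒪_v` on `K` is existentially
`∅`-definable, then the residue field is not separably closed and admits no nontrivial henselian
valuation; consequently no henselian valuation on `K` has separably closed residue field, `v` is
the canonical henselian valuation (the finest henselian valuation on `K`), and no proper
henselian coarsening of `v` has existentially `∅`-definable valuation ring. -/
theorem stmt_18 (K : Type*) [Field K] (O : ValuationSubring K) (hnt : O ≠ ⊤)
    (hhens : HenselianLocalRing ↥O)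
    (hequi : ringChar K = ringChar (IsLocalRing.ResidueField ↥O))
    (hdef : ExistentiallyDef0 K (O : Set K)) :
    ¬ IsSepClosed (IsLocalRing.ResidueField ↥O) ∧
    (∀ O' : ValuationSubring (IsLocalRing.ResidueField ↥O),
        O' ≠ ⊤ → ¬ HenselianLocalRing ↥O') ∧
    (∀ O' : ValuationSubring K, HenselianLocalRing ↥O' →
        ¬ IsSepClosed (IsLocalRing.ResidueField ↥O')) ∧
    (∀ O' : ValuationSubring K, HenselianLocalRing ↥O' → O ≤ O') ∧
    (∀ O' : ValuationSubring K, HenselianLocalRing ↥O' → O ≤ O' → O' ≠ O → O' ≠ ⊤ →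
        ¬ ExistentiallyDef0 K (O' : Set K)) := by
  have hP := hdef.patternDef
  have hO : Ultra.VHens O := (Ultra.sHens_of_henselianLocalRing hhens).vHens
  have hE := Ultra.equi_of_ringChar_eq hequi
  have hres := hP.specStable.not_isSepClosed hO hnt hE
  have hle : ∀ O' : ValuationSubring K, HenselianLocalRing ↥O' → O ≤ O' := fun O' h' => by
    have hO' := (Ultra.sHens_of_henselianLocalRing h').vHens
    by_contra hn
    refine hres (Ultra.isSepClosed_of_not_le hO' hn fun h => ?_)
    exact hP.not_lt hO hO' hnt hE (lt_of_le_not_ge h hn)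
  refine ⟨hres, fun O' ht h' => ?_, fun O' h' _ => ?_, hle, fun O' h' hOO' hne ht hd => ?_⟩
  · exact hP.not_lt hO (hO.composite (Ultra.sHens_of_henselianLocalRing h').vHens) hnt hE
      (lt_of_le_of_ne Ultra.composite_le (Ultra.composite_ne ht))
  · exact hres (Ultra.isSepClosed_of_le (Ultra.sHens_of_henselianLocalRing h').vHens (hle O' h'))
  · exact hd.patternDef.not_lt (Ultra.sHens_of_henselianLocalRing h').vHens hO ht (hE.of_le hOO')
      (lt_of_le_of_ne hOO' hne.symm)
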